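/- (Plane case of the ∞-translation-arc corollary.) Let f : ℝ² → ℝ² be an orientation-preserving homeomorphism and U ⊆ ℝ² an open f-invariant set homeomorphic to ℝ² such that ℝ²∖U has more than one point. Suppose f is ∂-nonwandering in U and some extension F of f|_U to c_E(U,ℝ²) has no fixed point in b_E(U,ℝ²) (i.e. ρ(f,U) ≠ 0). Then there is a compact set K ⊆ U such that every ∞-translation arc for f contained in ℝ²∖K is disjoint from ∂U. -/

import Mathlib

open Set Topology Filter

noncomputable section

universe u

variable {X : Type u} [TopologicalSpace X]

/-- A homeomorphism is *orientation preserving* if it is isotopic to the identity. -/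
def IsOrientationPreserving (f : X ≃ₜ X) : Prop :=
  ∃ H : unitInterval × X → X,
    Continuous H ∧ (∀ x, H (0, x) = x) ∧ (∀ x, H (1, x) = f x) ∧
      ∀ t : unitInterval, IsHomeomorph fun x => H (t, x)

/-- `D` is a connected component of `A`. -/
def IsCompOf (A D : Set X) : Prop := ∃ x ∈ A, D = connectedComponentIn A x

/-- `A` has exactly two connected components, the distinct sets `D₁` and `D₂`. -/
def HasTwoComps (A D₁ D₂ : Set X) : Prop :=
  IsCompOf A D₁ ∧ IsCompOf A D₂ ∧ D₁ ≠ D₂ ∧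
    ∀ x ∈ A, connectedComponentIn A x = D₁ ∨ connectedComponentIn A x = D₂

/-- A *cross-cut* of the open set `U`: the image of an arc `g` on `(0,1)`, where `g` is
continuous and injective on `[0,1]`'s interior, runs inside `U`, has endpoints on `∂U`, and
separates `U` into exactly two components, each with a boundary point on `∂U` away from the
closed arc. -/
def IsCrossCut (U γ : Set X) : Prop :=
  ∃ g : ℝ → X,
    ContinuousOn g (Icc 0 1) ∧ InjOn g (Ioo 0 1) ∧ (∀ t ∈ Ioo (0:ℝ) 1, g t ∈ U) ∧
      g 0 ∈ frontier U ∧ g 1 ∈ frontier U ∧ γ = g '' Ioo 0 1 ∧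
      ∃ D₁ D₂ : Set X, HasTwoComps (U \ γ) D₁ D₂ ∧
        (frontier D₁ ∩ (frontier U \ g '' Icc 0 1)).Nonempty ∧
        (frontier D₂ ∩ (frontier U \ g '' Icc 0 1)).Nonempty

/-- A *cross-section* of `U`: a connected component of `U ∖ γ` for a cross-cut `γ`. -/
def IsCrossSection (U D : Set X) : Prop := ∃ γ : Set X, IsCrossCut U γ ∧ IsCompOf (U \ γ) D

/-- The image of a set under the `k`-th integer iterate of a homeomorphism. -/
def iterZ (f : X ≃ₜ X) (k : ℤ) (A : Set X) : Set X := ⇑(f.toEquiv ^ k) '' A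

/-- A cross-section of `U` which is wandering for `f^n`. -/
def IsWanderingSection (f : X ≃ₜ X) (U : Set X) (n : ℕ) (D : Set X) : Prop :=
  IsCrossSection U D ∧ ∀ k : ℤ, k ≠ 0 → iterZ f ((n : ℤ) * k) D ∩ D = ∅

/-- `f` is ∂-nonwandering in `U`. -/
def BdNonwandering (f : X ≃ₜ X) (U : Set X) : Prop :=
  ∀ n : ℕ, 1 ≤ n → ∃ K : Set X, IsCompact K ∧ K ⊆ U ∧
    ∀ D : Set X, IsWanderingSection f U n D →
      (∃ k : ℤ, 0 < k ∧ (iterZ f ((n : ℤ) * k) D ∩ K).Nonempty) ∧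
      (∃ k : ℤ, k < 0 ∧ (iterZ f ((n : ℤ) * k) D ∩ K).Nonempty)

/-- The boundary of `D` inside `U` (for `D` open in `U`). -/
def bdIn (U D : Set X) : Set X := (closure D \ D) ∩ U

/-- A chain of cross-sections of `U`. -/
def IsPEChain (U : Set X) (D : ℕ → Set X) : Prop :=
  (∀ i, IsCrossSection U (D i)) ∧ (∀ i j : ℕ, j ≤ i → D i ⊆ D j) ∧
    ∀ i j : ℕ, i ≠ j → closure (bdIn U (D i)) ∩ closure (bdIn U (D j)) = ∅

/-- The chain `D` divides the cross-section `E`. -/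
def ChainDividesSection (D : ℕ → Set X) (E : Set X) : Prop := ∃ N : ℕ, ∀ i, N ≤ i → D i ⊆ E

/-- The chain `D` divides the chain `D'`. -/
def ChainDivides (D D' : ℕ → Set X) : Prop := ∀ n : ℕ, ∃ m : ℕ, D m ⊆ D' n

/-- A prime chain: a chain dividing every chain that divides it. -/
def IsPrimeChain (U : Set X) (D : ℕ → Set X) : Prop :=
  IsPEChain U D ∧ ∀ D' : ℕ → Set X, IsPEChain U D' → ChainDivides D' D → ChainDivides D D'

/-- The type of prime chains of `U`. -/
def PrimeChain (U : Set X) : Type u := {D : ℕ → Set X // IsPrimeChain U D}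

/-- A prime end of `U`: an equivalence class of prime chains. -/
def PrimeEnd (U : Set X) : Type u :=
  Quot fun C C' : PrimeChain U => ChainDivides C.1 C'.1 ∧ ChainDivides C'.1 C.1

/-- The prime end `p` divides the cross-section `E`. -/
def PrimeEndDivides {U : Set X} (p : PrimeEnd U) (E : Set X) : Prop :=
  ∃ C : PrimeChain U, Quot.mk _ C = p ∧ ChainDividesSection C.1 E

/-- The prime ends compactification of `U` (as a set: `U ⊔ (prime ends)`). -/
def PrimeEndComp (U : Set X) : Type u := ↥U ⊕ PrimeEnd U

/-- A point of `U`, as an element of the prime ends compactification. -/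
def pePt (U : Set X) (x : ↥U) : PrimeEndComp U := Sum.inl x

/-- A prime end, as an element of the prime ends compactification. -/
def peEnd (U : Set X) (p : PrimeEnd U) : PrimeEndComp U := Sum.inr p

/-- The copy of a subset `V ⊆ U` inside the prime ends compactification. -/
def peOpen (U V : Set X) : Set (PrimeEndComp U) := {z | ∃ x : ↥U, z = pePt U x ∧ (x : X) ∈ V}

/-- The basic set `E ∪ i_E(E)` of the prime ends compactification, for a cross-section `E`. -/
def peSection (U E : Set X) : Set (PrimeEndComp U) :=
  peOpen U E ∪ {z | ∃ p : PrimeEnd U, z = peEnd U p ∧ PrimeEndDivides p E}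

/-- The topology of the prime ends compactification. -/
instance primeEndCompTopology (U : Set X) : TopologicalSpace (PrimeEndComp U) :=
  TopologicalSpace.generateFrom
    ({s | ∃ V : Set X, IsOpen V ∧ V ⊆ U ∧ s = peOpen U V} ∪
      {s | ∃ E : Set X, IsCrossSection U E ∧ s = peSection U E})

/-- The circle of prime ends, as a subset of the prime ends compactification. -/
def PrimeEndCircle (U : Set X) : Set (PrimeEndComp U) := Set.range (peEnd U)

/-- `F` is an extension of `f|_U` to the prime ends compactification of `U`. -/
def IsPEExtension (f : X ≃ₜ X) (U : Set X) (F : PrimeEndComp U ≃ₜ PrimeEndComp U) : Prop :=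
  ∀ (x : X) (hx : x ∈ U) (hfx : f x ∈ U), F (pePt U ⟨x, hx⟩) = pePt U ⟨f x, hfx⟩

/-- An end-cut of `U`: an injective arc in `U` defined on `[0,1)` converging in the ambient
space as `t → 1⁻`. -/
def IsEndCut (U : Set X) (γ : ℝ → X) : Prop :=
  ContinuousOn γ (Ico 0 1) ∧ InjOn γ (Ico 0 1) ∧ (∀ t ∈ Ico (0:ℝ) 1, γ t ∈ U) ∧
    ∃ z : X, Tendsto γ (𝓝[<] (1:ℝ)) (𝓝 z)

/-- `z` is an accessible point of `∂U`. -/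
def IsAccessiblePoint (U : Set X) (z : X) : Prop :=
  ∃ γ : ℝ → X, IsEndCut U γ ∧ Tendsto γ (𝓝[<] (1:ℝ)) (𝓝 z)

/-- `p` is an accessible prime end of `U`. -/
def IsAccessiblePrimeEnd (U : Set X) (p : PrimeEnd U) : Prop :=
  ∃ (γ : ℝ → X) (hγ : ∀ t ∈ Ico (0:ℝ) 1, γ t ∈ U), IsEndCut U γ ∧
    Tendsto (fun t : ↥(Ico (0:ℝ) 1) => pePt U ⟨γ ↑t, hγ ↑t t.2⟩)
      (comap Subtype.val (𝓝[<] (1:ℝ))) (𝓝 (peEnd U p))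

/-- A translation arc for `f` based at `x`: a simple arc from `x` to `f x` meeting its image
only as allowed. -/
def IsTranslationArc (f : X ≃ₜ X) (γ : Set X) (x : X) : Prop :=
  f x ≠ x ∧
    ∃ g : ℝ → X, ContinuousOn g (Icc 0 1) ∧ InjOn g (Icc 0 1) ∧
      g 0 = x ∧ g 1 = f x ∧ γ = g '' Icc 0 1 ∧
      ((⇑f '' γ) ∩ γ = {f x} ∨ ((⇑f '' γ) ∩ γ = {x, f x} ∧ f (f x) = x))

/-- An `N`-translation arc for `f` based at `x` (for `N = 1` this is just a translation arc). -/
def IsNTranslationArc (f : X ≃ₜ X) (N : ℕ) (γ : Set X) (x : X) : Prop :=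
  IsTranslationArc f γ x ∧
    (2 ≤ N →
      (∀ k : ℕ, 2 ≤ k → k ≤ N - 1 → (⇑f)^[k] '' γ ∩ γ = ∅) ∧
        ((⇑f)^[N] '' γ ∩ γ = ∅ ∨ ((⇑f)^[N] '' γ ∩ γ = {x} ∧ (⇑f)^[N + 1] x = x)))

/-- An ∞-translation arc: an `N`-translation arc for every `N ≥ 1`. -/
def IsInfTranslationArc (f : X ≃ₜ X) (γ : Set X) (x : X) : Prop :=
  ∀ N : ℕ, 1 ≤ N → IsNTranslationArc f N γ x

/-- A nonwandering homeomorphism. -/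
def IsNonwanderingMap (f : X → X) : Prop :=
  ∀ V : Set X, IsOpen V → V.Nonempty → ∃ n : ℕ, 1 ≤ n ∧ (f^[n] '' V ∩ V).Nonempty

/-- A loop contained in `A` which is not null-homotopic in `V`. -/
def IsEssentialLoopIn (V A : Set X) : Prop :=
  ∃ (z : ↥V) (δ : Path z z), (∀ t : unitInterval, (↑(δ t) : X) ∈ A) ∧
    ¬ δ.Homotopic (Path.refl z)

/-- An annular continuum: a continuum with an open annular neighborhood `V` such that `V ∖ K`
has exactly two components, each essential in `V`. -/
def IsAnnularContinuum (K : Set X) : Prop :=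
  IsCompact K ∧ IsConnected K ∧ K.Nontrivial ∧
    ∃ V : Set X, IsOpen V ∧ K ⊆ V ∧
      Nonempty (↥V ≃ₜ AddCircle (1 : ℝ) × ↥(Ioo (0 : ℝ) 1)) ∧
      ∃ D₁ D₂ : Set X, HasTwoComps (V \ K) D₁ D₂ ∧
        IsEssentialLoopIn V D₁ ∧ IsEssentialLoopIn V D₂

/-- A set contractible in the ambient surface: it has an open neighborhood homeomorphic to the
plane. -/
def ContractibleInSurface (K : Set X) : Prop :=
  ∃ W : Set X, IsOpen W ∧ K ⊆ W ∧ Nonempty (↥W ≃ₜ (ℝ × ℝ))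

/-- `α ∈ ℝ/ℤ` is rational. -/
def IsRationalAC (α : AddCircle (1 : ℝ)) : Prop := ∃ r : ℚ, α = ((r : ℝ) : AddCircle (1 : ℝ))

/-- The constant `q(α,g)`: the smallest positive integer `q` with `‖qα‖ = 0` if `α` is
rational, and `(2g+1)‖qα‖ < ‖α‖` if `α` is irrational. -/
def qConst (α : AddCircle (1 : ℝ)) (g : ℕ) : ℕ :=
  sInf {q : ℕ | 0 < q ∧
    ((IsRationalAC α ∧ ‖q • α‖ = 0) ∨
      (¬IsRationalAC α ∧ ((2 * g + 1 : ℕ) : ℝ) * ‖q • α‖ < ‖α‖))}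

section

theorem exists_continuous_log {T : Type*} [TopologicalSpace T] [SimplyConnectedSpace T]
    [LocallyPathConnectedSpace T] {g : T → ℂ} (hg : Continuous g) (h0 : ∀ x, g x ≠ 0) :
    ∃ L : T → ℂ, Continuous L ∧ ∀ x, Complex.exp (L x) = g x := by
  have hu : IsSimplyConnected (univ : Set T) := by
    unfold IsSimplyConnected
    exact (Homeomorph.Set.univ T).toHomotopyEquiv.simplyConnectedSpace
  obtain ⟨L, hL, hL'⟩ := Complex.exists_continuousOn_eqOn_exp_comp hu isOpen_univ
    hg.continuousOn (by rintro ⟨x, -, hx⟩; exact h0 x hx)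
  exact ⟨L, continuousOn_univ.1 hL, fun x => hL' (mem_univ x)⟩

theorem eq_of_exp_eq_exp {T : Type*} [TopologicalSpace T] [PreconnectedSpace T] {u v : T → ℂ}
    (hu : Continuous u) (hv : Continuous v) (h : ∀ x, Complex.exp (u x) = Complex.exp (v x))
    (x y : T) : u x - u y = v x - v y := by
  have hn : ∀ x, ∃ n : ℤ, u x - v x = n * (2 * Real.pi * Complex.I) := fun x => by
    obtain ⟨n, hn⟩ := Complex.exp_eq_exp_iff_exists_int.1 (h x)
    exact ⟨n, by rw [hn]; ring⟩
  choose n hn using hn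
  have hpi : (2 * Real.pi * Complex.I : ℂ) ≠ 0 := Complex.two_pi_I_ne_zero
  have hc : Continuous fun x => ((n x : ℤ) : ℂ) := by
    have : (fun x => ((n x : ℤ) : ℂ)) = fun x => (u x - v x) / (2 * Real.pi * Complex.I) := by
      ext x; rw [hn]; field_simp
    rw [this]; exact (hu.sub hv).div_const _
  have hr : Continuous fun x => ((n x : ℤ) : ℝ) :=
    (Complex.continuous_re.comp hc).congr (by simp)
  have hz : Continuous n := Int.isClosedEmbedding_coe_real.isInducing.continuous_iff.2 hr
  have := PreconnectedSpace.constant inferInstance hz (x := x) (y := y)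
  have h1 := hn x
  have h2 := hn y
  rw [this] at h1
  linear_combination h1 - h2

theorem tendsto_slope_diag {φ : ℂ → ℂ} {z : ℂ} (h : AnalyticAt ℂ φ z) :
    Tendsto (fun w : ℂ × ℂ => if w.1 = w.2 then deriv φ w.1 else (φ w.1 - φ w.2) / (w.1 - w.2))
      (𝓝 (z, z)) (𝓝 (deriv φ z)) := by
  have h1 := h.hasStrictDerivAt
  rw [Metric.tendsto_nhds]
  intro ε hε
  have h2 := (hasStrictFDerivAt_iff_isLittleO.1 h1.hasStrictFDerivAt).def (half_pos hε)
  have h3 : ∀ᶠ w : ℂ × ℂ in 𝓝 (z, z), dist (deriv φ w.1) (deriv φ z) < ε := by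
    have : Tendsto (fun w : ℂ × ℂ => deriv φ w.1) (𝓝 (z, z)) (𝓝 (deriv φ z)) :=
      h.deriv.continuousAt.tendsto.comp continuous_fst.continuousAt
    exact (Metric.tendsto_nhds.1 this) ε hε
  filter_upwards [h2, h3] with w hw hw'
  split_ifs with he
  · exact hw'
  · have hne : w.1 - w.2 ≠ 0 := sub_ne_zero.2 he
    rw [dist_eq_norm]
    have : (φ w.1 - φ w.2) / (w.1 - w.2) - deriv φ z
        = (φ w.1 - φ w.2 - (w.1 - w.2) * deriv φ z) / (w.1 - w.2) := by
      field_simp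
    rw [this, norm_div, div_lt_iff₀ (norm_pos_iff.2 hne)]
    have h4 : ‖φ w.1 - φ w.2 - (w.1 - w.2) * deriv φ z‖ ≤ ε / 2 * ‖w.1 - w.2‖ := by
      simpa using hw
    have := norm_pos_iff.2 hne
    nlinarith

/-- The principal logarithm of `1 - w` on the closed unit disc minus `1`. -/
theorem one_sub_mem_slitPlane {w : ℂ} (h : ‖w‖ ≤ 1) (h1 : w ≠ 1) : 1 - w ∈ Complex.slitPlane := by
  left
  have h2 : w.re ≤ 1 := (Complex.re_le_norm w).trans h
  rcases h2.lt_or_eq with h3 | h3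
  · simpa using h3
  · exfalso
    apply h1
    have h4 := Complex.sq_norm w
    rw [Complex.normSq_apply, h3] at h4
    have : w.im = 0 := by
      have : w.im * w.im ≤ 0 := by nlinarith [norm_nonneg w]
      nlinarith
    exact Complex.ext h3 this

theorem log_one_sub_exp_im {t : ℝ} (h0 : 0 < t) (h1 : t < 2 * Real.pi) :
    (Complex.log (1 - Complex.exp (t * Complex.I))).im = (t - Real.pi) / 2 := by
  rw [Complex.log_im]
  have hs : 0 < Real.sin (t / 2) := Real.sin_pos_of_pos_of_lt_pi (by linarith) (by linarith)
  have key : 1 - Complex.exp (t * Complex.I) = ((2 * Real.sin (t / 2) : ℝ) : ℂ) *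
      (Complex.cos (((t - Real.pi) / 2 : ℝ)) + Complex.sin (((t - Real.pi) / 2 : ℝ)) * Complex.I) := by
    rw [← Complex.ofReal_cos, ← Complex.ofReal_sin]
    have e1 : Real.cos ((t - Real.pi) / 2) = Real.sin (t / 2) := by
      rw [show (t - Real.pi) / 2 = t / 2 - Real.pi / 2 by ring, Real.cos_sub_pi_div_two]
    have e2 : Real.sin ((t - Real.pi) / 2) = - Real.cos (t / 2) := by
      rw [show (t - Real.pi) / 2 = t / 2 - Real.pi / 2 by ring, Real.sin_sub_pi_div_two]
    rw [e1, e2, Complex.exp_mul_I, ← Complex.ofReal_cos, ← Complex.ofReal_sin]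
    have h2 : Real.cos t = 1 - 2 * Real.sin (t / 2) ^ 2 := by
      rw [show t = 2 * (t / 2) by ring, Real.cos_two_mul, Real.cos_sq']
      ring_nf
    have h3 : Real.sin t = 2 * Real.sin (t / 2) * Real.cos (t / 2) := by
      conv_lhs => rw [show t = 2 * (t / 2) by ring, Real.sin_two_mul]
    rw [h2, h3]
    push_cast
    ring
  rw [key, Complex.arg_real_mul _ (by positivity), Complex.arg_cos_add_sin_mul_I]
  constructor <;> linarith

theorem continuous_log_one_sub_mul {p : ℝ → ℂ} (hp : Continuous p) {b : ℂ} (hb : ‖b‖ = 1)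
    (h1 : ∀ s, ‖p s‖ ≤ 1) (h2 : ∀ s, p s ≠ b) :
    Continuous fun s => Complex.log (1 - p s * (starRingEnd ℂ) b) := by
  refine continuous_iff_continuousAt.2 fun s => ?_
  have hbb : b * (starRingEnd ℂ) b = 1 := by
    rw [Complex.mul_conj, Complex.normSq_eq_norm_sq, hb]; simp
  refine ContinuousAt.clog (by fun_prop) (one_sub_mem_slitPlane ?_ ?_)
  · simpa [hb] using h1 s
  · intro h
    apply h2 s
    have : p s * (starRingEnd ℂ b * b) = b := by rw [← mul_assoc, h, one_mul]
    rw [mul_comm (starRingEnd ℂ b), hbb, mul_one] at this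
    exact this

/-- Along an edge of the square. -/
theorem edge_log {p φp m K : ℝ → ℂ} {b y : ℂ} (hb : ‖b‖ = 1) (hp : Continuous p)
    (h1 : ∀ s, ‖p s‖ ≤ 1) (h2 : ∀ s, p s ≠ b) (hm : Continuous m) (hK : Continuous K)
    (hem : ∀ s, Complex.exp (m s) = φp s - y)
    (heK : ∀ s, Complex.exp (K s) = (φp s - y) / (p s - b)) :
    K 1 - K 0 = m 1 - m 0 - (Complex.log (1 - p 1 * (starRingEnd ℂ) b)
      - Complex.log (1 - p 0 * (starRingEnd ℂ) b)) := by
  have hbb : b * (starRingEnd ℂ) b = 1 := by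
    rw [Complex.mul_conj, Complex.normSq_eq_norm_sq, hb]; simp
  have hb0 : b ≠ 0 := by rintro rfl; simp at hb
  have hc := continuous_log_one_sub_mul hp hb h1 h2
  have key := eq_of_exp_eq_exp (u := fun s => K s + Complex.log (1 - p s * (starRingEnd ℂ) b)
    + Complex.log (-b)) (v := m) (by fun_prop) hm (fun s => by
      have hne : p s - b ≠ 0 := sub_ne_zero.2 (h2 s)
      have e : 1 - p s * (starRingEnd ℂ) b = (p s - b) / (-b) := by
        field_simp
        linear_combination -p s * hbb
      have hne' : 1 - p s * (starRingEnd ℂ) b ≠ 0 := by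
        rw [e]; exact div_ne_zero hne (neg_ne_zero.2 hb0)
      rw [Complex.exp_add, Complex.exp_add, heK, Complex.exp_log hne',
        Complex.exp_log (neg_ne_zero.2 hb0), hem, e]
      field_simp) 1 0
  linear_combination key

structure IsEndPath (φ : ℂ → ℂ) (a c ya yc : ℂ) (p φp : ℝ → ℂ) : Prop where
  cont : Continuous p
  contφ : Continuous φp
  mem : ∀ s, (p s ∈ Metric.ball (0:ℂ) 1 ∧ φp s = φ (p s)) ∨ (p s = a ∧ φp s = ya) ∨
    (p s = c ∧ φp s = yc)
  p0 : p 0 = a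
  p1 : p 1 = c
  φp0 : φp 0 = ya
  φp1 : φp 1 = yc

theorem IsEndPath.norm_le {φ : ℂ → ℂ} {a c ya yc : ℂ} {p φp : ℝ → ℂ}
    (h : IsEndPath φ a c ya yc p φp) (ha : ‖a‖ = 1) (hc : ‖c‖ = 1) (s : ℝ) : ‖p s‖ ≤ 1 := by
  rcases h.mem s with h1 | h1 | h1
  · simpa using (mem_ball_zero_iff.1 h1.1).le
  · rw [h1.1, ha]
  · rw [h1.1, hc]

theorem IsEndPath.ne {φ : ℂ → ℂ} {a c ya yc : ℂ} {p φp : ℝ → ℂ}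
    (h : IsEndPath φ a c ya yc p φp) {b : ℂ} (hb : ‖b‖ = 1) (hab : a ≠ b) (hcb : c ≠ b) (s : ℝ) :
    p s ≠ b := by
  rcases h.mem s with h1 | h1 | h1
  · rintro rfl
    have := mem_ball_zero_iff.1 h1.1
    linarith
  · rw [h1.1]; exact hab
  · rw [h1.1]; exact hcb

theorem reciprocity {φ : ℂ → ℂ} (hφ : DifferentiableOn ℂ φ (Metric.ball 0 1))
    (hinj : InjOn φ (Metric.ball 0 1)) (hd : ∀ z ∈ Metric.ball (0:ℂ) 1, deriv φ z ≠ 0)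
    {a b c d ya yb yc yd : ℂ}
    (ha : ‖a‖ = 1) (hb : ‖b‖ = 1) (hc : ‖c‖ = 1) (hdd : ‖d‖ = 1)
    (hab : a ≠ b) (had : a ≠ d) (hcb : c ≠ b) (hcd : c ≠ d)
    (hya : ya ∉ φ '' Metric.ball 0 1) (hyb : yb ∉ φ '' Metric.ball 0 1)
    (hyc : yc ∉ φ '' Metric.ball 0 1) (hyd : yd ∉ φ '' Metric.ball 0 1)
    {P Q : Set ℂ} (hPQ : Disjoint P Q) {p q : ℝ → ℂ} (hp : Continuous p) (hq : Continuous q)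
    (hpP : ∀ s, p s ∈ P) (hqQ : ∀ s, q s ∈ Q) (hp0 : p 0 = ya) (hp1 : p 1 = yc)
    (hq0 : q 0 = yb) (hq1 : q 1 = yd)
    {pt φp qt φq : ℝ → ℂ} (hpt : IsEndPath φ a c ya yc pt φp) (hqt : IsEndPath φ b d yb yd qt φq)
    (hφpQ : ∀ s, φp s ∉ Q) (hφqP : ∀ s, φq s ∉ P) :
    (Complex.log (1 - c * (starRingEnd ℂ) d)).im - (Complex.log (1 - a * (starRingEnd ℂ) d)).im
      - (Complex.log (1 - c * (starRingEnd ℂ) b)).im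
      + (Complex.log (1 - a * (starRingEnd ℂ) b)).im = 0 := by
  have hpt' := hpt
  have hqt' := hqt
  obtain ⟨cp, cφp, memp, p0, p1, φp0, φp1⟩ := hpt'
  obtain ⟨cq, cφq, memq, q0, q1, φq0, φq1⟩ := hqt'
  have hyaP : ya ∈ P := hp0 ▸ hpP 0
  have hycP : yc ∈ P := hp1 ▸ hpP 1
  have hybQ : yb ∈ Q := hq0 ▸ hqQ 0
  have hydQ : yd ∈ Q := hq1 ▸ hqQ 1
  have hmem : ∀ {x y}, x ∈ P → y ∈ Q → x ≠ y := fun hx hy => hPQ.ne_of_mem hx hy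
  have cE1 : Continuous fun w : ℝ × ℝ => p w.1 - q w.2 := by fun_prop
  have cE2 : Continuous fun w : ℝ × ℝ => φp w.1 - q w.2 := by fun_prop
  have cE3 : Continuous fun w : ℝ × ℝ => p w.1 - φq w.2 := by fun_prop
  obtain ⟨l, cl, el⟩ := exists_continuous_log cE1
    (fun w => sub_ne_zero.2 (hmem (hpP _) (hqQ _)))
  obtain ⟨m, cm, em⟩ := exists_continuous_log cE2
    (fun w => sub_ne_zero.2 (fun h => hφpQ w.1 (h ▸ hqQ w.2)))
  obtain ⟨m', cm', em'⟩ := exists_continuous_log cE3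
    (fun w => sub_ne_zero.2 (fun h => hφqP w.2 (h ▸ hpP w.1)))
  have hdiag : ∀ s t, pt s = qt t → pt s ∈ Metric.ball (0:ℂ) 1 ∧ qt t ∈ Metric.ball (0:ℂ) 1 := by
    intro s t h
    have hne1 := hpt.ne hb hab hcb s
    have hne2 := hpt.ne hdd had hcd s
    have : qt t ∈ Metric.ball (0:ℂ) 1 := by
      rcases memq t with h1 | h1 | h1
      · exact h1.1
      · exact absurd (h.trans h1.1) hne1
      · exact absurd (h.trans h1.1) hne2
    exact ⟨h ▸ this, this⟩
  have hφp : ∀ s, pt s ∈ Metric.ball (0:ℂ) 1 → φp s = φ (pt s) := by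
    intro s hs
    rw [mem_ball_zero_iff] at hs
    rcases memp s with h1 | h1 | h1
    · exact h1.2
    · rw [h1.1] at hs; linarith
    · rw [h1.1] at hs; linarith
  have hφq : ∀ s, qt s ∈ Metric.ball (0:ℂ) 1 → φq s = φ (qt s) := by
    intro s hs
    rw [mem_ball_zero_iff] at hs
    rcases memq s with h1 | h1 | h1
    · exact h1.2
    · rw [h1.1] at hs; linarith
    · rw [h1.1] at hs; linarith
  let E : ℝ × ℝ → ℂ := fun w => if pt w.1 = qt w.2 then deriv φ (pt w.1) else
    (φp w.1 - φq w.2) / (pt w.1 - qt w.2)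
  have hE0 : ∀ w, E w ≠ 0 := by
    intro w
    simp only [E]
    split_ifs with h
    · exact hd _ (hdiag _ _ h).1
    · refine div_ne_zero (sub_ne_zero.2 ?_) (sub_ne_zero.2 h)
      rcases memp w.1 with h1 | h1 | h1 <;> rcases memq w.2 with h2 | h2 | h2
      · rw [h1.2, h2.2]; exact fun h3 => h (hinj h1.1 h2.1 h3)
      · rw [h1.2, h2.2]; rintro rfl; exact hyb (mem_image_of_mem _ h1.1)
      · rw [h1.2, h2.2]; rintro rfl; exact hyd (mem_image_of_mem _ h1.1)
      · rw [h1.2, h2.2]; rintro rfl; exact hya (mem_image_of_mem _ h2.1)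
      · rw [h1.2, h2.2]; exact hmem hyaP hybQ
      · rw [h1.2, h2.2]; exact hmem hyaP hydQ
      · rw [h1.2, h2.2]; rintro rfl; exact hyc (mem_image_of_mem _ h2.1)
      · rw [h1.2, h2.2]; exact hmem hycP hybQ
      · rw [h1.2, h2.2]; exact hmem hycP hydQ
  have cE : Continuous E := by
    refine continuous_iff_continuousAt.2 fun w => ?_
    by_cases h : pt w.1 = qt w.2
    · obtain ⟨h1, h2⟩ := hdiag _ _ h
      have hb1 : ∀ᶠ v : ℝ × ℝ in 𝓝 w, pt v.1 ∈ Metric.ball (0:ℂ) 1 :=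
        (cp.comp continuous_fst).continuousAt.eventually (Metric.isOpen_ball.mem_nhds h1)
      have hb2 : ∀ᶠ v : ℝ × ℝ in 𝓝 w, qt v.2 ∈ Metric.ball (0:ℂ) 1 :=
        (cq.comp continuous_snd).continuousAt.eventually (Metric.isOpen_ball.mem_nhds h2)
      have han : AnalyticAt ℂ φ (pt w.1) := hφ.analyticAt (Metric.isOpen_ball.mem_nhds h1)
      have ht : Tendsto (fun v : ℝ × ℝ => (pt v.1, qt v.2)) (𝓝 w) (𝓝 (pt w.1, pt w.1)) := by
        have : ContinuousAt (fun v : ℝ × ℝ => (pt v.1, qt v.2)) w := by fun_prop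
        rw [ContinuousAt, ← h] at this
        exact this
      have := (tendsto_slope_diag han).comp ht
      have hEw : E w = deriv φ (pt w.1) := by simp only [E]; rw [if_pos h]
      rw [ContinuousAt, hEw]
      refine this.congr' ?_
      filter_upwards [hb1, hb2] with v hv1 hv2
      simp only [E, Function.comp, hφp _ hv1, hφq _ hv2]
    · have hn : ∀ᶠ v : ℝ × ℝ in 𝓝 w, pt v.1 ≠ qt v.2 := by
        have : ContinuousAt (fun v : ℝ × ℝ => pt v.1 - qt v.2) w := by fun_prop
        filter_upwards [this.eventually_ne (sub_ne_zero.2 h)] with v hv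
        exact sub_ne_zero.1 hv
      have : ContinuousAt (fun v : ℝ × ℝ => (φp v.1 - φq v.2) / (pt v.1 - qt v.2)) w :=
        ContinuousAt.div (by fun_prop) (by fun_prop) (sub_ne_zero.2 h)
      refine this.congr ?_
      filter_upwards [hn] with v hv
      simp only [E]; rw [if_neg hv]
  obtain ⟨K, cK, eK⟩ := exists_continuous_log cE hE0
  -- comparison of the double differences
  have e1 := eq_of_exp_eq_exp (u := fun t => l (0, t)) (v := fun t => m (0, t)) (by fun_prop)
    (by fun_prop) (fun t => by simp only [el, em, hp0, φp0]) 1 0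
  have e2 := eq_of_exp_eq_exp (u := fun t => l (1, t)) (v := fun t => m (1, t)) (by fun_prop)
    (by fun_prop) (fun t => by simp only [el, em, hp1, φp1]) 1 0
  have e3 := eq_of_exp_eq_exp (u := fun t => l (t, 0)) (v := fun t => m' (t, 0)) (by fun_prop)
    (by fun_prop) (fun t => by simp only [el, em', hq0, φq0]) 1 0
  have e4 := eq_of_exp_eq_exp (u := fun t => l (t, 1)) (v := fun t => m' (t, 1)) (by fun_prop)
    (by fun_prop) (fun t => by simp only [el, em', hq1, φq1]) 1 0
  have f1 := edge_log (p := pt) (φp := φp) (m := fun s => m (s, 0)) (K := fun s => K (s, 0))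
    (y := yb) hb cp (hpt.norm_le ha hc) (hpt.ne hb hab hcb) (by fun_prop) (by fun_prop)
    (fun s => by simp only [em, hq0]) (fun s => by
      simp only [eK, E, q0, φq0]; rw [if_neg (hpt.ne hb hab hcb s)])
  have f2 := edge_log (p := pt) (φp := φp) (m := fun s => m (s, 1)) (K := fun s => K (s, 1))
    (y := yd) hdd cp (hpt.norm_le ha hc) (hpt.ne hdd had hcd) (by fun_prop) (by fun_prop)
    (fun s => by simp only [em, hq1]) (fun s => by
      simp only [eK, E, q1, φq1]; rw [if_neg (hpt.ne hdd had hcd s)])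
  have hpiI : Complex.exp (Real.pi * Complex.I) = -1 := Complex.exp_pi_mul_I
  have f3 := edge_log (p := qt) (φp := φq) (m := fun s => m' (0, s) + Real.pi * Complex.I)
    (K := fun s => K (0, s))
    (y := ya) ha cq (hqt.norm_le hb hdd) (hqt.ne ha hab.symm had.symm) (by fun_prop) (by fun_prop)
    (fun s => by simp only [Complex.exp_add, em', hp0, hpiI]; ring) (fun s => by
      simp only [eK, E, p0, φp0]; rw [if_neg (hqt.ne ha hab.symm had.symm s).symm,
        ← neg_sub (φq s), ← neg_sub (qt s), neg_div_neg_eq])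
  have f4 := edge_log (p := qt) (φp := φq) (m := fun s => m' (1, s) + Real.pi * Complex.I)
    (K := fun s => K (1, s))
    (y := yc) hc cq (hqt.norm_le hb hdd) (hqt.ne hc hcb.symm hcd.symm) (by fun_prop) (by fun_prop)
    (fun s => by simp only [Complex.exp_add, em', hp1, hpiI]; ring) (fun s => by
      simp only [eK, E, p1, φp1]; rw [if_neg (hqt.ne hc hcb.symm hcd.symm s).symm,
        ← neg_sub (φq s), ← neg_sub (qt s), neg_div_neg_eq])
  have hconj : ∀ {u v : ℂ}, ‖u‖ = 1 → ‖v‖ = 1 → u ≠ v →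
      Complex.log (1 - v * (starRingEnd ℂ) u)
        = (starRingEnd ℂ) (Complex.log (1 - u * (starRingEnd ℂ) v)) := by
    intro u v hu hv huv
    have h1 : u * (starRingEnd ℂ) v ≠ 1 := by
      intro h
      apply huv
      have hvv : v * (starRingEnd ℂ) v = 1 := by
        rw [Complex.mul_conj, Complex.normSq_eq_norm_sq, hv]; simp
      have hv0 : (starRingEnd ℂ) v ≠ 0 := by
        intro h0; rw [h0] at h; simp at h
      exact mul_right_cancel₀ hv0 (h.trans hvv.symm)
    rw [← Complex.log_conj]
    · simp [mul_comm]
    · exact Complex.slitPlane_arg_ne_pi (one_sub_mem_slitPlane (by simp [hu, hv]) h1)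
  simp only [p0, p1] at f1 f2
  simp only [q0, q1] at f3 f4
  rw [hconj ha hb hab, hconj ha hdd had] at f3
  rw [hconj hc hb hcb, hconj hc hdd hcd] at f4
  have key := congrArg Complex.im (show
      Complex.log (1 - c * (starRingEnd ℂ) d) - Complex.log (1 - a * (starRingEnd ℂ) d)
      - Complex.log (1 - c * (starRingEnd ℂ) b) + Complex.log (1 - a * (starRingEnd ℂ) b)
      - ((starRingEnd ℂ) (Complex.log (1 - c * (starRingEnd ℂ) d))
      - (starRingEnd ℂ) (Complex.log (1 - c * (starRingEnd ℂ) b))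
      - ((starRingEnd ℂ) (Complex.log (1 - a * (starRingEnd ℂ) d))
      - (starRingEnd ℂ) (Complex.log (1 - a * (starRingEnd ℂ) b)))) = 0 by
    linear_combination f2 - f1 + f3 - f4 + e1 - e2 - e3 + e4)
  simp only [Complex.sub_im, Complex.add_im, Complex.conj_im, Complex.zero_im] at key
  linarith

/-- The point of the unit circle with angle `t`. -/
noncomputable def circ (t : ℝ) : ℂ := Complex.exp (t * Complex.I)

theorem norm_circ (t : ℝ) : ‖circ t‖ = 1 := Complex.norm_exp_ofReal_mul_I t

theorem circ_mul_conj (s t : ℝ) : circ s * (starRingEnd ℂ) (circ t) = circ (s - t) := by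
  simp only [circ, ← Complex.exp_conj, ← Complex.exp_add]
  congr 1
  simp
  ring

theorem circ_eq_circ {s t : ℝ} : circ s = circ t ↔ ∃ n : ℤ, s = t + n * (2 * Real.pi) := by
  rw [circ, circ, Complex.exp_eq_exp_iff_exists_int]
  refine exists_congr fun n => ?_
  constructor
  · intro h
    have := congrArg Complex.im h
    simpa using this
  · intro h
    rw [h]; push_cast; ring

theorem circ_add_two_pi (t : ℝ) : circ (t + 2 * Real.pi) = circ t :=
  circ_eq_circ.2 ⟨1, by simp⟩

theorem circ_ne {s t : ℝ} (h : t < s) (h' : s < t + 2 * Real.pi) : circ s ≠ circ t := by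
  intro e
  obtain ⟨n, hn⟩ := circ_eq_circ.1 e
  have hpi := Real.pi_pos
  have h1 : (0 : ℝ) < n := by
    by_contra hc
    push Not at hc
    nlinarith
  have h2 : (n : ℝ) < 1 := by
    by_contra hc
    push Not at hc
    nlinarith
  have h3 : (0 : ℤ) < n := by exact_mod_cast h1
  have h4 : n < (1 : ℤ) := by exact_mod_cast h2
  omega

theorem log_circ {t : ℝ} (h0 : 0 < t) (h1 : t < 2 * Real.pi) :
    (Complex.log (1 - circ t)).im = (t - Real.pi) / 2 := log_one_sub_exp_im h0 h1

/-- The graph over which end paths run. -/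
def endGraph (φ : ℂ → ℂ) (Q : Set ℂ) (a ya c yc : ℂ) : Set (ℂ × ℂ) :=
  {w | (w.1 ∈ Metric.ball (0:ℂ) 1 ∧ w.2 = φ w.1 ∧ w.2 ∉ Q) ∨ w = (a, ya) ∨ w = (c, yc)}

theorem reciprocity_joined {φ : ℂ → ℂ} (hφ : DifferentiableOn ℂ φ (Metric.ball 0 1))
    (hinj : InjOn φ (Metric.ball 0 1)) (hd : ∀ z ∈ Metric.ball (0:ℂ) 1, deriv φ z ≠ 0)
    {α β γ δ : ℝ} (h1 : α < β) (h2 : β < γ) (h3 : γ < δ) (h4 : δ < α + 2 * Real.pi)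
    {ya yb yc yd : ℂ}
    (hya : ya ∉ φ '' Metric.ball 0 1) (hyb : yb ∉ φ '' Metric.ball 0 1)
    (hyc : yc ∉ φ '' Metric.ball 0 1) (hyd : yd ∉ φ '' Metric.ball 0 1)
    {P Q : Set ℂ} (hPQ : Disjoint P Q) (hP : JoinedIn P ya yc) (hQ : JoinedIn Q yb yd)
    (hp : JoinedIn (endGraph φ Q (circ α) ya (circ γ) yc) (circ α, ya) (circ γ, yc))
    (hq : JoinedIn (endGraph φ P (circ β) yb (circ δ) yd) (circ β, yb) (circ δ, yd)) :
    False := by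
  obtain ⟨p, hp1⟩ := hP
  obtain ⟨q, hq1⟩ := hQ
  obtain ⟨pp, hpp⟩ := hp
  obtain ⟨qq, hqq⟩ := hq
  have key : ∀ {a c ya yc : ℂ} {Q : Set ℂ} (p : Path (a, ya) (c, yc))
      (_ : ∀ t, p t ∈ endGraph φ Q a ya c yc), IsEndPath φ a c ya yc
      (fun s => (p.extend s).1) (fun s => (p.extend s).2) := by
    intro a c ya yc Q p hp
    have := p.continuous_extend
    refine ⟨by fun_prop, by fun_prop, fun s => ?_, by simp, by simp, by simp, by simp⟩
    rcases hp (projIcc 0 1 zero_le_one s) with h | h | h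
    · exact Or.inl ⟨h.1, h.2.1⟩
    · exact Or.inr (Or.inl (Prod.ext_iff.1 h))
    · exact Or.inr (Or.inr (Prod.ext_iff.1 h))
  have key2 : ∀ {a c ya yc : ℂ} {Q : Set ℂ} (p : Path (a, ya) (c, yc))
      (_ : ∀ t, p t ∈ endGraph φ Q a ya c yc), ya ∉ Q → yc ∉ Q → ∀ s, (p.extend s).2 ∉ Q := by
    intro a c ya yc Q p hp h1 h2 s
    rcases hp (projIcc 0 1 zero_le_one s) with h | h | h
    · exact h.2.2
    · exact (Prod.ext_iff.1 h).2.symm ▸ h1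
    · exact (Prod.ext_iff.1 h).2.symm ▸ h2
  have hp0 : ya ∈ P := p.source ▸ hp1 0
  have hp2 : yc ∈ P := p.target ▸ hp1 1
  have hq0 : yb ∈ Q := q.source ▸ hq1 0
  have hq2 : yd ∈ Q := q.target ▸ hq1 1
  have hpi := Real.pi_pos
  have n1 : circ α ≠ circ β := (circ_ne h1 (by linarith)).symm
  have n2 : circ α ≠ circ δ := (circ_ne (by linarith) h4).symm
  have n3 : circ γ ≠ circ β := circ_ne h2 (by linarith)
  have n4 : circ γ ≠ circ δ := (circ_ne h3 (by linarith)).symm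
  have := reciprocity hφ hinj hd (norm_circ α) (norm_circ β) (norm_circ γ) (norm_circ δ)
    n1 n2 n3 n4 hya hyb hyc hyd hPQ p.continuous_extend q.continuous_extend
    (fun s => hp1 _) (fun s => hq1 _) (by simp) (by simp) (by simp) (by simp)
    (key pp hpp) (key qq hqq)
    (key2 pp hpp (fun h => hPQ.ne_of_mem hp0 h rfl) (fun h => hPQ.ne_of_mem hp2 h rfl))
    (key2 qq hqq (fun h => hPQ.ne_of_mem h hq0 rfl) (fun h => hPQ.ne_of_mem h hq2 rfl))
  simp only [circ_mul_conj] at this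
  rw [log_circ (t := γ - β) (by linarith) (by linarith),
    ← circ_add_two_pi (γ - δ), ← circ_add_two_pi (α - δ), ← circ_add_two_pi (α - β),
    log_circ (by linarith) (by linarith), log_circ (by linarith) (by linarith),
    log_circ (by linarith) (by linarith)] at this
  linarith

/-- Two disjoint path connected subsets of the closed disc, each reaching two points of the circle,
cannot have linked landing points. -/
theorem not_linked_of_disjoint {α β γ δ : ℝ} (h1 : α < β) (h2 : β < γ) (h3 : γ < δ)
    (h4 : δ < α + 2 * Real.pi) {D₁ D₂ : Set ℂ} (hD : Disjoint D₁ D₂)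
    (hp : JoinedIn (D₁ ∩ Metric.ball 0 1 ∪ {circ α, circ γ}) (circ α) (circ γ))
    (hq : JoinedIn (D₂ ∩ Metric.ball 0 1 ∪ {circ β, circ δ}) (circ β) (circ δ)) : False := by
  have hn : ∀ t, circ t ∉ (fun z : ℂ => z) '' Metric.ball 0 1 := by
    rintro t ⟨z, hz, rfl⟩
    have := norm_circ t
    rw [mem_ball_zero_iff] at hz
    linarith
  have hpi := Real.pi_pos
  have n1 : circ α ≠ circ β := (circ_ne h1 (by linarith)).symm
  have n2 : circ α ≠ circ δ := (circ_ne (by linarith) h4).symm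
  have n3 : circ γ ≠ circ β := circ_ne h2 (by linarith)
  have n4 : circ γ ≠ circ δ := (circ_ne h3 (by linarith)).symm
  have hball : ∀ t, circ t ∉ Metric.ball (0:ℂ) 1 := fun t h => hn t ⟨_, h, rfl⟩
  have hdis : Disjoint (D₁ ∩ Metric.ball 0 1 ∪ {circ α, circ γ})
      (D₂ ∩ Metric.ball 0 1 ∪ {circ β, circ δ}) := by
    rw [Set.disjoint_left]
    rintro x (hx | hx) (hy | hy)
    · exact hD.ne_of_mem hx.1 hy.1 rfl
    · rcases hy with rfl | rfl <;> exact hball _ hx.2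
    · rcases hx with rfl | rfl <;> exact hball _ hy.2
    · rcases hx with rfl | rfl <;> rcases hy with h | h <;> simp_all
  refine reciprocity_joined (φ := fun z => z) differentiableOn_id (injOn_id _) (by simp) h1 h2 h3 h4
    (hn _) (hn _) (hn _) (hn _) hdis hp hq ?_ ?_
  · obtain ⟨p, hp⟩ := hp
    refine ⟨p.map (f := fun z => (z, z)) (by fun_prop), fun t => ?_⟩
    rcases hp t with h | h | h
    · left
      exact ⟨h.2, rfl, fun h' => Set.disjoint_left.1 hdis (Or.inl h) h'⟩
    · right; left
      simp [h]
    · right; right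
      rw [Set.mem_singleton_iff] at h
      simp [h]
  · obtain ⟨p, hp⟩ := hq
    refine ⟨p.map (f := fun z => (z, z)) (by fun_prop), fun t => ?_⟩
    rcases hp t with h | h | h
    · left
      exact ⟨h.2, rfl, fun h' => Set.disjoint_left.1 hdis h' (Or.inl h)⟩
    · right; left
      simp [h]
    · right; right
      rw [Set.mem_singleton_iff] at h
      simp [h]

end

section

section Hide
variable {T : Type*} [TopologicalSpace T]

theorem isPreconnected_inter_of_union_eq_univ [SimplyConnectedSpace T] [LocallyPathConnectedSpace T]
    [NormalSpace T] {A B : Set T} (hA : IsClosed A) (hB : IsClosed B) (hA' : IsPreconnected A)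
    (hB' : IsPreconnected B) (hAB : A ∪ B = univ) : IsPreconnected (A ∩ B) := by
  classical
  rw [isPreconnected_closed_iff]
  rintro t t' ht ht' hsub ⟨p, hp, hpt⟩ ⟨q, hq, hqt⟩
  by_contra hne
  rw [Set.not_nonempty_iff_eq_empty] at hne
  have hdis : Disjoint (A ∩ B ∩ t) (A ∩ B ∩ t') := by
    rw [Set.disjoint_left]
    intro x hx hx'
    exact (hne ▸ (⟨hx.1, hx.2, hx'.2⟩ : x ∈ A ∩ B ∩ (t ∩ t')) : x ∈ (∅ : Set T))
  obtain ⟨g, hg0, hg1, -⟩ := exists_continuous_zero_one_of_isClosed ((hA.inter hB).inter ht)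
    ((hA.inter hB).inter ht') hdis
  let θ : T → ℂ := fun x => if x ∈ A then Complex.exp (Real.pi * Complex.I * g x)
    else Complex.exp (-(Real.pi * Complex.I * g x))
  have hθA : ∀ x ∈ A, θ x = Complex.exp (Real.pi * Complex.I * g x) := fun x hx => if_pos hx
  have hθB : ∀ x ∈ B, θ x = Complex.exp (-(Real.pi * Complex.I * g x)) := by
    intro x hx
    by_cases hxA : x ∈ A
    · rw [hθA x hxA]
      rcases hsub ⟨hxA, hx⟩ with h | h
      · simp [show g x = 0 from hg0 ⟨⟨hxA, hx⟩, h⟩]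
      · simp [show g x = 1 from hg1 ⟨⟨hxA, hx⟩, h⟩, Complex.exp_neg]
    · exact if_neg hxA
  have hc : Continuous θ := by
    rw [← continuousOn_univ, ← hAB]
    refine ContinuousOn.union_of_isClosed ?_ ?_ hA hB
    · refine ContinuousOn.congr ?_ hθA
      exact Continuous.continuousOn (by fun_prop)
    · refine ContinuousOn.congr ?_ hθB
      exact Continuous.continuousOn (by fun_prop)
  have hn : ∀ x, θ x ≠ 0 := by
    intro x
    simp only [θ]
    split_ifs <;> exact Complex.exp_ne_zero _
  obtain ⟨L, hL, hL'⟩ := exists_continuous_log hc hn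
  have : PreconnectedSpace A := isPreconnected_iff_preconnectedSpace.1 hA'
  have : PreconnectedSpace B := isPreconnected_iff_preconnectedSpace.1 hB'
  have e1 := eq_of_exp_eq_exp (T := A) (u := fun x => L x)
    (v := fun x => Real.pi * Complex.I * g x) (by fun_prop) (by fun_prop)
    (fun x => by rw [hL', hθA x x.2]) ⟨p, hp.1⟩ ⟨q, hq.1⟩
  have e2 := eq_of_exp_eq_exp (T := B) (u := fun x => L x)
    (v := fun x => -(Real.pi * Complex.I * g x)) (by fun_prop) (by fun_prop)
    (fun x => by rw [hL', hθB x x.2]) ⟨p, hp.2⟩ ⟨q, hq.2⟩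
  have gp : g p = 0 := hg0 ⟨hp, hpt⟩
  have gq : g q = 1 := hg1 ⟨hq, hqt⟩
  simp only [gp, gq] at e1 e2
  rw [e1] at e2
  apply Complex.two_pi_I_ne_zero
  push_cast at e2
  linear_combination -e2

/-- A connected set meeting `D` and its complement meets the frontier of `D`. -/
theorem IsPreconnected.inter_frontier_nonempty' {C D : Set T} (hC : IsPreconnected C)
    (h1 : (C ∩ D).Nonempty) (h2 : (C ∩ Dᶜ).Nonempty) : (C ∩ frontier D).Nonempty := by
  by_contra hne
  rw [Set.not_nonempty_iff_eq_empty] at hne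
  have hx : ∀ x ∈ C, x ∉ frontier D := fun x hx hx' =>
    (hne ▸ (⟨hx, hx'⟩ : x ∈ C ∩ frontier D) : x ∈ (∅ : Set T))
  obtain ⟨x, hxC, hxD⟩ := h1
  obtain ⟨y, hyC, hyD⟩ := h2
  have hi : ∀ x ∈ C, x ∈ D → x ∈ interior D := fun x h h' => by
    by_contra h''
    exact hx x h ⟨subset_closure h', h''⟩
  have hi' : ∀ x ∈ C, x ∉ D → x ∈ (closure D)ᶜ := fun x h h' h'' =>
    hx x h ⟨h'', fun h3 => h' (interior_subset h3)⟩
  obtain ⟨z, hzC, hz1, hz2⟩ := hC (interior D) (closure D)ᶜ isOpen_interior isClosed_closure.isOpen_compl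
    (fun z hz => by
      by_cases h : z ∈ D
      · exact Or.inl (hi z hz h)
      · exact Or.inr (hi' z hz h))
    ⟨x, hxC, hi x hxC hxD⟩ ⟨y, hyC, hi' y hyC hyD⟩
  exact hz2 (subset_closure (interior_subset hz1))

/-- The set hidden from `b` by `F`: the complement of the component of `Fᶜ` containing `b`. -/
def hideSet (b : T) (F : Set T) : Set T := (connectedComponentIn Fᶜ b)ᶜ

theorem subset_hideSet (b : T) (F : Set T) : F ⊆ hideSet b F := fun _ hx h =>
  connectedComponentIn_subset _ _ h hx

theorem base_not_mem_hideSet {b : T} {F : Set T} (hb : b ∉ F) : b ∉ hideSet b F := fun h =>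
  h (mem_connectedComponentIn hb)

theorem isClosed_hideSet [LocallyConnectedSpace T] {b : T} {F : Set T} (hF : IsClosed F) :
    IsClosed (hideSet b F) := hF.isOpen_compl.connectedComponentIn.isClosed_compl

/-- A component of a hidden set. -/
def IsHideComp (b : T) (F D : Set T) : Prop :=
  ∃ y ∈ hideSet b F, D = connectedComponentIn (hideSet b F) y

namespace IsHideComp
variable {b : T} {F D : Set T}

theorem subset (h : IsHideComp b F D) : D ⊆ hideSet b F := by
  obtain ⟨y, -, rfl⟩ := h
  exact connectedComponentIn_subset _ _

theorem isConnected (h : IsHideComp b F D) : IsConnected D := by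
  obtain ⟨y, hy, rfl⟩ := h
  exact isConnected_connectedComponentIn_iff.2 hy

theorem subset_of_isPreconnected (h : IsHideComp b F D) {C : Set T} (hC : IsPreconnected C)
    (hCH : C ⊆ hideSet b F) (hCD : (C ∩ D).Nonempty) : C ⊆ D := by
  obtain ⟨y, hy, rfl⟩ := h
  obtain ⟨x, hxC, hxD⟩ := hCD
  rw [connectedComponentIn_eq hxD]
  exact hC.subset_connectedComponentIn hxC hCH

theorem eq_or_disjoint {D' : Set T} (h : IsHideComp b F D) (h' : IsHideComp b F D') :
    D = D' ∨ Disjoint D D' := by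
  by_cases hne : (D ∩ D').Nonempty
  · left
    exact Subset.antisymm (h'.subset_of_isPreconnected h.isConnected.isPreconnected h.subset hne)
      (h.subset_of_isPreconnected h'.isConnected.isPreconnected h'.subset (inter_comm D D' ▸ hne))
  · right; rwa [Set.disjoint_iff_inter_eq_empty, ← Set.not_nonempty_iff_eq_empty]

theorem base_not_mem (h : IsHideComp b F D) (hb : b ∉ F) : b ∉ D := fun hbD =>
  base_not_mem_hideSet hb (h.subset hbD)

theorem isClosed [LocallyConnectedSpace T] (h : IsHideComp b F D) (hF : IsClosed F) :
    IsClosed D := by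
  have hc := h.isConnected
  refine isClosed_of_closure_subset ?_
  refine h.subset_of_isPreconnected hc.isPreconnected.closure
    (closure_minimal h.subset (isClosed_hideSet hF)) ?_
  obtain ⟨x, hx⟩ := hc.nonempty
  exact ⟨x, subset_closure hx, hx⟩

theorem frontier_subset [LocallyConnectedSpace T] (h : IsHideComp b F D) (hF : IsClosed F) :
    frontier D ⊆ F := by
  intro x hx
  by_contra hxF
  have hxD : x ∈ D := (h.isClosed hF).frontier_subset hx
  have hO : IsOpen (connectedComponentIn Fᶜ x) := hF.isOpen_compl.connectedComponentIn
  have hxO : x ∈ connectedComponentIn Fᶜ x := mem_connectedComponentIn hxF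
  have hOH : connectedComponentIn Fᶜ x ⊆ hideSet b F := by
    intro y hy hyV
    have hxH := h.subset hxD
    apply hxH
    have e1 := connectedComponentIn_eq hy
    have e2 := connectedComponentIn_eq hyV
    rw [e2, ← e1]
    exact hxO
  have hOD := h.subset_of_isPreconnected isPreconnected_connectedComponentIn hOH ⟨x, hxO, hxD⟩
  exact hx.2 (mem_interior.2 ⟨_, hOD, hO, hxO⟩)

theorem frontier_nonempty [ConnectedSpace T] (h : IsHideComp b F D) (hb : b ∉ F) :
    (frontier D).Nonempty := by
  obtain ⟨x, hx⟩ := h.isConnected.nonempty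
  simpa using IsPreconnected.inter_frontier_nonempty' (isPreconnected_univ (α := T))
    (D := D) ⟨x, trivial, hx⟩ ⟨b, trivial, h.base_not_mem hb⟩

theorem inter_closure_nonempty [ConnectedSpace T] [LocallyConnectedSpace T]
    (h : IsHideComp b F D) (hF : IsClosed F) (hb : b ∉ F) :
    (D ∩ closure (hideSet b F)ᶜ).Nonempty := by
  by_contra hne
  rw [Set.not_nonempty_iff_eq_empty, closure_compl, ← Set.sdiff_eq, Set.sdiff_eq_empty] at hne
  obtain ⟨x, hx⟩ := h.frontier_nonempty hb
  have hxD : x ∈ D := (h.isClosed hF).frontier_subset hx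
  have hO : IsOpen (connectedComponentIn (interior (hideSet b F)) x) :=
    isOpen_interior.connectedComponentIn
  have hxO := mem_connectedComponentIn (hne hxD)
  have hOD := h.subset_of_isPreconnected isPreconnected_connectedComponentIn
    ((connectedComponentIn_subset _ _).trans interior_subset) ⟨x, hxO, hxD⟩
  exact hx.2 (mem_interior.2 ⟨_, hOD, hO, hxO⟩)

theorem isPreconnected_compl [ConnectedSpace T] [LocallyConnectedSpace T]
    (h : IsHideComp b F D) (hF : IsClosed F) (hb : b ∉ F) : IsPreconnected Dᶜ := by
  refine isPreconnected_of_forall b fun y hy => ?_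
  have hV : IsPreconnected (hideSet b F)ᶜ := by
    rw [hideSet, compl_compl]; exact isPreconnected_connectedComponentIn
  have hbV : b ∈ (hideSet b F)ᶜ := base_not_mem_hideSet hb
  have hVD : (hideSet b F)ᶜ ⊆ Dᶜ := compl_subset_compl.2 h.subset
  by_cases hyH : y ∈ hideSet b F
  · have hE : IsHideComp b F (connectedComponentIn (hideSet b F) y) := ⟨y, hyH, rfl⟩
    have hyE := mem_connectedComponentIn hyH
    obtain ⟨p, hpE, hpV⟩ := hE.inter_closure_nonempty hF hb
    refine ⟨insert p (hideSet b F)ᶜ ∪ connectedComponentIn (hideSet b F) y, ?_, ?_, ?_, ?_⟩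
    · have hd : Disjoint D (connectedComponentIn (hideSet b F) y) := by
        rcases h.eq_or_disjoint hE with h1 | h1
        · exact absurd (h1 ▸ hyE) hy
        · exact h1
      refine union_subset (insert_subset ?_ hVD) hd.subset_compl_left
      exact hd.subset_compl_left hpE
    · exact Or.inl (Or.inr hbV)
    · exact Or.inr hyE
    · refine IsPreconnected.union p (mem_insert _ _) hpE ?_ hE.isConnected.isPreconnected
      exact hV.subset_closure (subset_insert _ _) (insert_subset hpV subset_closure)
  · exact ⟨_, hVD, hbV, hyH, hV⟩

theorem isPreconnected_frontier [SimplyConnectedSpace T] [LocallyPathConnectedSpace T]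
    [NormalSpace T] (h : IsHideComp b F D) (hF : IsClosed F) (hb : b ∉ F) :
    IsPreconnected (frontier D) := by
  rw [frontier_eq_closure_inter_closure, (h.isClosed hF).closure_eq]
  refine isPreconnected_inter_of_union_eq_univ (h.isClosed hF) isClosed_closure
    h.isConnected.isPreconnected (h.isPreconnected_compl hF hb).closure ?_
  exact eq_univ_of_univ_subset (by
    rw [← union_compl_self D]; exact union_subset_union_right _ subset_closure)

end IsHideComp

theorem not_mem_hideSet_union [SimplyConnectedSpace T] [LocallyPathConnectedSpace T]
    [NormalSpace T] {b y : T} {F₁ F₂ : Set T} (h1 : IsClosed F₁) (h2 : IsClosed F₂)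
    (hd : Disjoint F₁ F₂) (hy1 : y ∉ hideSet b F₁) (hy2 : y ∉ hideSet b F₂) :
    y ∉ hideSet b (F₁ ∪ F₂) := by
  intro hy
  have hb1 : b ∉ F₁ := by
    intro hb
    apply hy1
    rw [hideSet, connectedComponentIn_eq_empty (by simpa using hb)]; simp
  have hb2 : b ∉ F₂ := by
    intro hb
    apply hy2
    rw [hideSet, connectedComponentIn_eq_empty (by simpa using hb)]; simp
  have hb : b ∉ F₁ ∪ F₂ := by simp [hb1, hb2]
  have hD : IsHideComp b (F₁ ∪ F₂) (connectedComponentIn (hideSet b (F₁ ∪ F₂)) y) := ⟨y, hy, rfl⟩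
  have hyD := mem_connectedComponentIn hy
  have hF := h1.union h2
  have hfr := hD.isPreconnected_frontier hF hb
  have key : ∀ {G : Set T}, y ∉ hideSet b G → b ∉ G →
      ¬ frontier (connectedComponentIn (hideSet b (F₁ ∪ F₂)) y) ⊆ G := by
    intro G hyG hbG hfG
    obtain ⟨x, hx, hx'⟩ := IsPreconnected.inter_frontier_nonempty'
      (isPreconnected_connectedComponentIn (F := Gᶜ) (x := b))
      (D := connectedComponentIn (hideSet b (F₁ ∪ F₂)) y) ⟨y, Set.notMem_compl_iff.1 hyG, hyD⟩
      ⟨b, mem_connectedComponentIn hbG, hD.base_not_mem hb⟩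
    exact connectedComponentIn_subset _ _ hx (hfG hx')
  have hsub := hD.frontier_subset hF
  rcases (isPreconnected_closed_iff.1 hfr F₁ F₂ h1 h2 hsub) with h
  by_cases hne1 : (frontier (connectedComponentIn (hideSet b (F₁ ∪ F₂)) y) ∩ F₁).Nonempty
  · by_cases hne2 : (frontier (connectedComponentIn (hideSet b (F₁ ∪ F₂)) y) ∩ F₂).Nonempty
    · obtain ⟨z, -, hz1, hz2⟩ := h hne1 hne2
      exact hd.ne_of_mem hz1 hz2 rfl
    · refine key hy1 hb1 fun x hx => (hsub hx).resolve_right fun h' => hne2 ⟨x, hx, h'⟩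
  · refine key hy2 hb2 fun x hx => (hsub hx).resolve_left fun h' => hne1 ⟨x, hx, h'⟩

end Hide

end

section

/-- The open unit disc, as a space. -/
abbrev Dsk : Type := ↥(Metric.ball (0:ℂ) 1)

instance : LocallyPathConnectedSpace Dsk := Metric.isOpen_ball.locallyPathConnectedSpace

instance : ContractibleSpace Dsk :=
  (convex_ball (0:ℂ) 1).contractibleSpace ⟨0, by simp⟩

/-- Neighbourhoods in the disc of a boundary point. -/
def Nb (x r : ℝ) : Set Dsk := {z | dist (z:ℂ) (circ x) < r}

/-- Circular cross-cuts of the disc around a boundary point. -/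
def Cb (x r : ℝ) : Set Dsk := {z | dist (z:ℂ) (circ x) = r}

theorem Nb_mono {x r r' : ℝ} (h : r ≤ r') : Nb x r ⊆ Nb x r' := fun _ hz => lt_of_lt_of_le hz h

theorem continuous_dist_circ (x : ℝ) : Continuous fun z : Dsk => dist (z:ℂ) (circ x) := by fun_prop

theorem dist_circ_pos (x : ℝ) (z : Dsk) : 0 < dist (z:ℂ) (circ x) := by
  refine dist_pos.2 fun h => ?_
  have := mem_ball_zero_iff.1 z.2
  rw [h, norm_circ] at this
  exact lt_irrefl _ this

/-- The radial point at distance `s` from the boundary. -/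
theorem radial_mem {x s : ℝ} (h0 : 0 < s) (h1 : s ≤ 1) :
    ((1 - s : ℝ) : ℂ) * circ x ∈ Metric.ball (0:ℂ) 1 := by
  rw [mem_ball_zero_iff, norm_mul, norm_circ, Complex.norm_real, Real.norm_eq_abs,
    abs_of_nonneg (by linarith)]
  linarith

theorem radial_dist {x s : ℝ} (h0 : 0 ≤ s) : dist (((1 - s : ℝ) : ℂ) * circ x) (circ x) = s := by
  rw [dist_eq_norm, show ((1 - s : ℝ) : ℂ) * circ x - circ x = -((s : ℝ) : ℂ) * circ x by
    push_cast; ring, norm_mul, norm_circ, norm_neg, Complex.norm_real, Real.norm_eq_abs,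
    abs_of_nonneg h0, mul_one]

theorem Nb_nonempty (x : ℝ) {r : ℝ} (hr : 0 < r) : (Nb x r).Nonempty := by
  refine ⟨⟨((1 - min (r / 2) 1 : ℝ) : ℂ) * circ x, radial_mem (by positivity) (min_le_right _ _)⟩, ?_⟩
  simp only [Nb, mem_ofPred_eq]
  rw [radial_dist (by positivity)]
  exact (min_le_left _ _).trans_lt (by linarith)

theorem subset_Nb_or_disjoint {C : Set Dsk} (hC : IsPreconnected C) {x r : ℝ}
    (hd : Disjoint C (Cb x r)) : C ⊆ Nb x r ∨ Disjoint C (Nb x r) := by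
  by_cases hne : (C ∩ Nb x r).Nonempty
  · left
    by_contra hsub
    obtain ⟨z, hz, hz'⟩ := Set.not_subset.1 hsub
    obtain ⟨y, hy, hy'⟩ := hne
    have := hC.image _ (continuous_dist_circ x).continuousOn
    have hIcc := this.Icc_subset (mem_image_of_mem _ hy) (mem_image_of_mem _ hz)
    obtain ⟨w, hw, hw'⟩ := hIcc (show r ∈ Icc _ _ from ⟨le_of_lt hy', not_lt.1 hz'⟩)
    exact Set.disjoint_left.1 hd hw hw'
  · right
    rwa [Set.disjoint_iff_inter_eq_empty, ← Set.not_nonempty_iff_eq_empty]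

theorem joinedIn_radial {O : Set Dsk} {x r : ℝ} (hr : 0 < r) (hO : Nb x r ⊆ O) :
    ∃ z ∈ Nb x r, JoinedIn (Subtype.val '' O ∪ {circ x}) (circ x) (z : ℂ) := by
  have h0 : 0 < min (r / 2) 1 := by positivity
  have h1 : min (r / 2) 1 ≤ 1 := min_le_right _ _
  have h2 : min (r / 2) 1 < r := (min_le_left _ _).trans_lt (by linarith)
  set s := min (r / 2) 1
  refine ⟨⟨((1 - s : ℝ) : ℂ) * circ x, radial_mem h0 h1⟩, ?_, ?_⟩
  · simp only [Nb, mem_ofPred_eq]; rwa [radial_dist h0.le]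
  · apply JoinedIn.of_segment_subset
    rw [segment_eq_image']
    rintro _ ⟨t, ⟨ht0, ht1⟩, rfl⟩
    have e : circ x + t • (((1 - s : ℝ) : ℂ) * circ x - circ x)
        = ((1 - t * s : ℝ) : ℂ) * circ x := by
      simp only [Complex.real_smul]; push_cast; ring
    rcases ht0.eq_or_lt with h | h
    · right; simp [← h]
    · left
      simp only [e]
      have hts : 0 < t * s := by positivity
      refine ⟨⟨_, radial_mem hts (by nlinarith)⟩, hO ?_, rfl⟩
      simp only [Nb, mem_ofPred_eq]; rw [radial_dist hts.le]; nlinarith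

theorem joinedIn_of_isOpen {O : Set Dsk} (hO : IsOpen O) (hc : IsConnected O) {x y r s : ℝ}
    (hr : 0 < r) (hs : 0 < s) (hx : Nb x r ⊆ O) (hy : Nb y s ⊆ O) :
    JoinedIn (Subtype.val '' O ∪ {circ x, circ y}) (circ x) (circ y) := by
  obtain ⟨z, hz, hxz⟩ := joinedIn_radial hr hx
  obtain ⟨w, hw, hyw⟩ := joinedIn_radial hs hy
  have hzw : JoinedIn O z w := (hO.isConnected_iff_isPathConnected.1 hc).joinedIn z (hx hz) w (hy hw)
  have hzw' : JoinedIn (Subtype.val '' O) (z:ℂ) w := by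
    obtain ⟨p, hp⟩ := hzw
    exact ⟨p.map (f := Subtype.val) (by fun_prop), fun t => ⟨_, hp t, rfl⟩⟩
  refine (hxz.mono ?_).trans ((hzw'.mono subset_union_left).trans (hyw.mono ?_).symm)
  · gcongr; simp
  · gcongr; simp

theorem not_linked_closed {α β γ δ : ℝ} (h1 : α < β) (h2 : β < γ) (h3 : γ < δ)
    (h4 : δ < α + 2 * Real.pi) {D₁ D₂ : Set Dsk} (hD : Disjoint D₁ D₂)
    (hc1 : IsClosed D₁) (hc2 : IsClosed D₂) (hp1 : IsPreconnected D₁) (hp2 : IsPreconnected D₂)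
    (hα : ∃ r > 0, Nb α r ⊆ D₁) (hγ : ∃ r > 0, Nb γ r ⊆ D₁) (hβ : ∃ r > 0, Nb β r ⊆ D₂)
    (hδ : ∃ r > 0, Nb δ r ⊆ D₂) : False := by
  obtain ⟨O₁, O₂, hO1, hO2, hs1, hs2, hdis⟩ := normal_separation hc1 hc2 hD
  have key : ∀ {O D : Set Dsk}, IsOpen O → D ⊆ O → IsPreconnected D → ∀ {x y : ℝ},
      (∃ r > 0, Nb x r ⊆ D) → (∃ r > 0, Nb y r ⊆ D) →
      JoinedIn (Subtype.val '' O ∩ Metric.ball 0 1 ∪ {circ x, circ y}) (circ x) (circ y) := by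
    rintro O D hO hs hp x y ⟨r, hr, hx⟩ ⟨s, hs', hy⟩
    obtain ⟨z, hz⟩ := Nb_nonempty x hr
    have hzO := hs (hx hz)
    have hsub : D ⊆ connectedComponentIn O z := hp.subset_connectedComponentIn (hx hz) hs
    refine (joinedIn_of_isOpen hO.connectedComponentIn
      (isConnected_connectedComponentIn_iff.2 hzO) hr hs' (hx.trans hsub) (hy.trans hsub)).mono ?_
    gcongr
    rintro _ ⟨w, hw, rfl⟩
    exact ⟨⟨w, connectedComponentIn_subset _ _ hw, rfl⟩, w.2⟩
  exact not_linked_of_disjoint h1 h2 h3 h4 (D₁ := Subtype.val '' O₁) (D₂ := Subtype.val '' O₂)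
    ((Set.disjoint_image_iff Subtype.val_injective).2 hdis) (key hO1 hs1 hp1 hα hγ) (key hO2 hs2 hp2 hβ hδ)

/-- The data of a lifted circle homeomorphism extending a homeomorphism of the disc, together with
a closed set `P` and a continuum `K`. -/
structure DiscData (g : Dsk ≃ₜ Dsk) (h : ℝ ≃o ℝ) (P K : Set Dsk) (b : Dsk) : Prop where
  per : ∀ x, h (x + 2 * Real.pi) = h x + 2 * Real.pi
  ext : ∀ x, ∀ r > 0, ∃ r' > 0, g '' Nb x r' ⊆ Nb (h x) r
  ext' : ∀ x, ∀ r > 0, ∃ r' > 0, (g⁻¹ : Dsk ≃ₜ Dsk) '' Nb x r' ⊆ Nb ((h⁻¹ : ℝ ≃o ℝ) x) r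
  closed : IsClosed P
  dis : Disjoint (g '' P) P
  conn : IsPreconnected K
  bK : b ∈ K
  gbK : g b ∈ K
  gbK' : (g⁻¹ : Dsk ≃ₜ Dsk) b ∈ K
  K0 : Disjoint K P
  K1 : Disjoint K (g '' P)
  K2 : Disjoint K ((g⁻¹ : Dsk ≃ₜ Dsk) '' P)
  NW1 : ∀ x r : ℝ, 0 < r → (∀ k : ℤ, k ≠ 0 → Disjoint ((g ^ k : Dsk ≃ₜ Dsk) '' Nb x r) (Nb x r)) →
    (∃ k : ℤ, 0 < k ∧ ((g ^ k : Dsk ≃ₜ Dsk) '' Nb x r ∩ K).Nonempty) ∧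
    (∃ k : ℤ, k < 0 ∧ ((g ^ k : Dsk ≃ₜ Dsk) '' Nb x r ∩ K).Nonempty)
  NW2 : ∀ x r : ℝ, 0 < r →
    (∀ k : ℤ, k ≠ 0 → Disjoint ((g ^ (2 * k) : Dsk ≃ₜ Dsk) '' Nb x r) (Nb x r)) →
    (∃ k : ℤ, 0 < k ∧ ((g ^ (2 * k) : Dsk ≃ₜ Dsk) '' Nb x r ∩ K).Nonempty) ∧
    (∃ k : ℤ, k < 0 ∧ ((g ^ (2 * k) : Dsk ≃ₜ Dsk) '' Nb x r ∩ K).Nonempty)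
  reach : ∀ y ∈ P, ∃ x : ℝ, (∀ R > 0, ∃ r, 0 < r ∧ r < R ∧ ∃ S : Set Dsk, IsPreconnected S ∧
      Disjoint S (g '' P) ∧ y ∈ S ∧ Cb x r ⊆ S) ∧
    (∀ R > 0, ∃ r, 0 < r ∧ r < R ∧ ∃ S : Set Dsk, IsPreconnected S ∧
      Disjoint S ((g⁻¹ : Dsk ≃ₜ Dsk) '' P) ∧ y ∈ S ∧ Cb x r ⊆ S)
  star : P ⊆ hideSet b (g '' P) ∪ hideSet b ((g⁻¹ : Dsk ≃ₜ Dsk) '' P)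
  rot : (∃ x, ∃ m : ℤ, h x = x + m * (2 * Real.pi)) ∨
    (∀ i : ℤ, i ≠ 0 → ∀ x, ∀ m : ℤ, (h ^ i : ℝ ≃o ℝ) x ≠ x + m * (2 * Real.pi))

theorem image_inv_image (g : Dsk ≃ₜ Dsk) (S : Set Dsk) : (g⁻¹ : Dsk ≃ₜ Dsk) '' (g '' S) = S := by
  rw [← image_comp]
  convert image_id S
  simp [← Homeomorph.mul_apply]

theorem image_image_inv (g : Dsk ≃ₜ Dsk) (S : Set Dsk) : g '' ((g⁻¹ : Dsk ≃ₜ Dsk) '' S) = S := by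
  simpa using image_inv_image g⁻¹ S

theorem image_homeo_mul (g g' : Dsk ≃ₜ Dsk) (S : Set Dsk) :
    (g * g' : Dsk ≃ₜ Dsk) '' S = g '' (g' '' S) := by
  rw [← image_comp]; rfl

@[simp]
theorem image_homeo_one (S : Set Dsk) : (1 : Dsk ≃ₜ Dsk) '' S = S := image_id S

theorem DiscData.symm {g : Dsk ≃ₜ Dsk} {h : ℝ ≃o ℝ} {P K : Set Dsk} {b : Dsk}
    (d : DiscData g h P K b) : DiscData g⁻¹ h⁻¹ P K b where
  per x := by
    apply h.injective
    have e : ∀ y, h ((h⁻¹ : ℝ ≃o ℝ) y) = y := fun y => h.apply_symm_apply y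
    rw [d.per, e, e]
  ext := d.ext'
  ext' := by simpa using d.ext
  closed := d.closed
  dis := by
    have := (Set.disjoint_image_iff (g⁻¹ : Dsk ≃ₜ Dsk).injective).2 d.dis
    rw [image_inv_image] at this
    exact this.symm
  conn := d.conn
  bK := d.bK
  gbK := d.gbK'
  gbK' := by simpa using d.gbK
  K0 := d.K0
  K1 := d.K2
  K2 := by simpa using d.K1
  NW1 := by
    intro x r hr hw
    obtain ⟨⟨k, hk, hk'⟩, ⟨l, hl, hl'⟩⟩ := d.NW1 x r hr fun k hk => by
      simpa using hw (-k) (by simpa using hk)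
    exact ⟨⟨-l, by simpa using hl, by simpa using hl'⟩, ⟨-k, by simpa using hk, by simpa using hk'⟩⟩
  NW2 := by
    intro x r hr hw
    obtain ⟨⟨k, hk, hk'⟩, ⟨l, hl, hl'⟩⟩ := d.NW2 x r hr fun k hk => by
      simpa using hw (-k) (by simpa using hk)
    exact ⟨⟨-l, by simpa using hl, by simpa using hl'⟩, ⟨-k, by simpa using hk, by simpa using hk'⟩⟩
  reach := by
    intro y hy
    obtain ⟨x, h1, h2⟩ := d.reach y hy
    exact ⟨x, h2, by simpa using h1⟩
  star := by
    have := d.star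
    rw [union_comm] at this
    simpa using this
  rot := by
    rcases d.rot with ⟨x, m, hx⟩ | hrot
    · left
      refine ⟨h x, -m, ?_⟩
      rw [show (h⁻¹ : ℝ ≃o ℝ) (h x) = x from h.symm_apply_apply x, hx]
      push_cast; ring
    · right
      intro i hi x m
      simpa using hrot (-i) (by simpa using hi) x m

end

section

section
variable {T : Type*} [TopologicalSpace T] {b : T} {F F' D E : Set T}

theorem IsHideComp.subset_of_frontier_subset (h : IsHideComp b F D) (hb : b ∉ F)
    (hE : IsPreconnected Eᶜ) (hbE : b ∉ E) (hfr : frontier D ⊆ E) : D ⊆ E := by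
  by_contra hsub
  obtain ⟨z, hz, hz'⟩ := Set.not_subset.1 hsub
  obtain ⟨w, hw, hw'⟩ := IsPreconnected.inter_frontier_nonempty' hE (D := D) ⟨z, hz', hz⟩
    ⟨b, hbE, h.base_not_mem hb⟩
  exact hw (hfr hw')

theorem IsHideComp.nest [SimplyConnectedSpace T] [LocallyPathConnectedSpace T] [NormalSpace T]
    (h : IsHideComp b F D) (h' : IsHideComp b F' E) (hF : IsClosed F) (hF' : IsClosed F')
    (hb : b ∉ F) (hb' : b ∉ F') (hd : Disjoint F F') (hne : (frontier D ∩ E).Nonempty) : D ⊆ E := by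
  refine h.subset_of_frontier_subset hb (h'.isPreconnected_compl hF' hb') (h'.base_not_mem hb') ?_
  by_contra hsub
  obtain ⟨z, hz, hz'⟩ := Set.not_subset.1 hsub
  obtain ⟨w, hw, hw'⟩ := IsPreconnected.inter_frontier_nonempty' (h.isPreconnected_frontier hF hb)
    hne ⟨z, hz, hz'⟩
  exact hd.ne_of_mem (h.frontier_subset hF hw) (h'.frontier_subset hF' hw') rfl
end

theorem IsHideComp.exists_Nb_subset {b : Dsk} {F E : Set Dsk} (h : IsHideComp b F E)
    (hF : IsClosed F) (hb : b ∉ F) {y : Dsk} (hy : y ∈ E) {x : ℝ}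
    (hx : ∀ R > 0, ∃ r, 0 < r ∧ r < R ∧ ∃ S : Set Dsk, IsPreconnected S ∧
      Disjoint S F ∧ y ∈ S ∧ Cb x r ⊆ S) : ∃ r > 0, Nb x r ⊆ E := by
  obtain ⟨r, hr, hrR, S, hS, hSF, hyS, hCS⟩ := hx _ (dist_circ_pos x b)
  have hSE : S ⊆ E := by
    by_contra hsub
    obtain ⟨z, hz, hz'⟩ := Set.not_subset.1 hsub
    obtain ⟨w, hw, hw'⟩ := IsPreconnected.inter_frontier_nonempty' hS ⟨y, hyS, hy⟩ ⟨z, hz, hz'⟩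
    exact hSF.ne_of_mem hw (h.frontier_subset hF hw') rfl
  refine ⟨r, hr, ?_⟩
  rcases subset_Nb_or_disjoint (h.isPreconnected_compl hF hb)
    (Set.disjoint_left.2 fun z hz hz' => hz (hSE (hCS hz'))) with h1 | h1
  · have : b ∈ Nb x r := h1 (h.base_not_mem hb)
    exact absurd (lt_trans hrR this) (lt_irrefl _)
  · exact fun z hz => by_contra fun hz' => Set.disjoint_left.1 h1 hz' hz

theorem IsHideComp.exists_Nb_disjoint {b : Dsk} {F E : Set Dsk} (h : IsHideComp b F E)
    (hF : IsClosed F) {y : Dsk} (hy : y ∉ E) {x : ℝ}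
    (hx : ∀ R > 0, ∃ r, 0 < r ∧ r < R ∧ ∃ S : Set Dsk, IsPreconnected S ∧
      Disjoint S F ∧ y ∈ S ∧ Cb x r ⊆ S) : ∃ r > 0, Disjoint E (Nb x r) := by
  obtain ⟨e, he⟩ := h.isConnected.nonempty
  obtain ⟨r, hr, hrR, S, hS, hSF, hyS, hCS⟩ := hx _ (dist_circ_pos x e)
  have hSE : Disjoint S E := by
    rw [Set.disjoint_left]
    intro z hz hz'
    obtain ⟨w, hw, hw'⟩ := IsPreconnected.inter_frontier_nonempty' hS ⟨z, hz, hz'⟩ ⟨y, hyS, hy⟩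
    exact hSF.ne_of_mem hw (h.frontier_subset hF hw') rfl
  refine ⟨r, hr, ?_⟩
  rcases subset_Nb_or_disjoint h.isConnected.isPreconnected
    (Set.disjoint_left.2 fun z hz hz' => Set.disjoint_left.1 hSE (hCS hz') hz) with h1 | h1
  · have : e ∈ Nb x r := h1 he
    exact absurd (lt_trans hrR this) (lt_irrefl _)
  · exact h1

namespace DiscData
variable {g : Dsk ≃ₜ Dsk} {h : ℝ ≃o ℝ} {P K : Set Dsk} {b : Dsk}

theorem b0 (d : DiscData g h P K b) : b ∉ P := fun hb => d.K0.ne_of_mem d.bK hb rfl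
theorem b1 (d : DiscData g h P K b) : b ∉ g '' P := fun hb => d.K1.ne_of_mem d.bK hb rfl
theorem c1 (d : DiscData g h P K b) : IsClosed (g '' P) := g.isClosed_image.2 d.closed

theorem disjoint_hideSet (d : DiscData g h P K b) : Disjoint K (hideSet b P) := by
  rw [hideSet, Set.disjoint_compl_right_iff_subset]
  exact d.conn.subset_connectedComponentIn d.bK d.K0.subset_compl_right

theorem hideSet_image (d : DiscData g h P K b) : hideSet b (g '' P) = g '' hideSet b P := by
  have hb : (g⁻¹ : Dsk ≃ₜ Dsk) b ∈ connectedComponentIn Pᶜ b := by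
    have := Set.disjoint_left.1 d.disjoint_hideSet d.gbK'
    rwa [hideSet, Set.notMem_compl_iff] at this
  have hgb : g ((g⁻¹ : Dsk ≃ₜ Dsk) b) = b := g.apply_symm_apply b
  rw [hideSet, hideSet, image_compl_eq g.bijective, connectedComponentIn_eq hb,
    g.image_connectedComponentIn (connectedComponentIn_subset _ _ hb), hgb,
    image_compl_eq g.bijective]

theorem comp_image (d : DiscData g h P K b) {D : Set Dsk} (hD : IsHideComp b P D) :
    IsHideComp b (g '' P) (g '' D) := by
  obtain ⟨y, hy, rfl⟩ := hD
  refine ⟨g y, ?_, ?_⟩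
  · rw [d.hideSet_image]; exact mem_image_of_mem _ hy
  · rw [d.hideSet_image, g.image_connectedComponentIn hy]

theorem comp_image_inv (d : DiscData g h P K b) {E : Set Dsk} (hE : IsHideComp b (g '' P) E) :
    IsHideComp b P ((g⁻¹ : Dsk ≃ₜ Dsk) '' E) := by
  obtain ⟨y, hy, rfl⟩ := hE
  rw [d.hideSet_image] at hy ⊢
  have hy' : (g⁻¹ : Dsk ≃ₜ Dsk) y ∈ hideSet b P := by
    rw [← image_inv_image g (hideSet b P)]; exact mem_image_of_mem _ hy
  refine ⟨_, hy', ?_⟩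
  rw [(g⁻¹ : Dsk ≃ₜ Dsk).image_connectedComponentIn hy, image_inv_image]

/-- Components hidden by the forward image. -/
def Up (g : Dsk ≃ₜ Dsk) (P : Set Dsk) (b : Dsk) (D : Set Dsk) : Prop :=
  IsHideComp b P D ∧ ∃ E, IsHideComp b (g '' P) E ∧ D ⊆ E

theorem up_or_down (d : DiscData g h P K b) {D : Set Dsk} (hD : IsHideComp b P D) :
    Up g P b D ∨ Up g⁻¹ P b D := by
  obtain ⟨y, hy⟩ := hD.frontier_nonempty d.b0
  have hyP := hD.frontier_subset d.closed hy
  rcases d.star hyP with h1 | h1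
  · left
    have hE : IsHideComp b (g '' P) _ := ⟨y, h1, rfl⟩
    exact ⟨hD, _, hE, hD.nest hE d.closed d.c1 d.b0 d.b1 d.dis.symm
      ⟨y, hy, mem_connectedComponentIn h1⟩⟩
  · right
    have hE : IsHideComp b ((g⁻¹ : Dsk ≃ₜ Dsk) '' P) _ := ⟨y, h1, rfl⟩
    exact ⟨hD, _, hE, hD.nest hE d.closed d.symm.c1 d.b0 d.symm.b1 d.symm.dis.symm
      ⟨y, hy, mem_connectedComponentIn h1⟩⟩

theorem image_frontier_subset (d : DiscData g h P K b) {D : Set Dsk} (hD : IsHideComp b P D) :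
    frontier (g '' D) ⊆ g '' P := by
  rw [← g.image_frontier]; exact image_mono (hD.frontier_subset d.closed)

theorem up_next (d : DiscData g h P K b) {D E : Set Dsk} (hD : IsHideComp b P D)
    (hE : IsHideComp b (g '' P) E) (hDE : D ⊆ E) : Up g P b ((g⁻¹ : Dsk ≃ₜ Dsk) '' E) := by
  have hD' := d.comp_image_inv hE
  refine (d.up_or_down hD').resolve_right ?_
  rintro ⟨-, E', hE', hsub⟩
  have h1 := d.symm.comp_image_inv hE'
  rw [inv_inv] at h1
  have h2 : E ⊆ g '' E' := by
    have := image_mono (f := g) hsub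
    rwa [image_image_inv] at this
  have h3 : D = g '' E' := by
    rcases hD.eq_or_disjoint h1 with h4 | h4
    · exact h4
    · obtain ⟨y, hy⟩ := hD.isConnected.nonempty
      exact absurd rfl (h4.ne_of_mem hy (h2 (hDE hy)))
  have h4 : D = E := hDE.antisymm (h3 ▸ h2)
  obtain ⟨y, hy⟩ := hD.frontier_nonempty d.b0
  exact d.dis.ne_of_mem (hE.frontier_subset d.c1 (h4 ▸ hy)) (hD.frontier_subset d.closed hy) rfl

theorem exists_Nb_image (d : DiscData g h P K b) {D : Set Dsk} {x : ℝ} (hx : ∃ r > 0, Nb x r ⊆ D) :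
    ∃ r > 0, Nb (h x) r ⊆ g '' D := by
  obtain ⟨r, hr, hxr⟩ := hx
  obtain ⟨r', hr', h'⟩ := d.symm.ext (h x) r hr
  refine ⟨r', hr', ?_⟩
  rw [show (h⁻¹ : ℝ ≃o ℝ) (h x) = x from h.symm_apply_apply x] at h'
  have := image_mono (f := g) (h'.trans hxr)
  rwa [image_image_inv] at this

end DiscData

end

section

theorem exists_fixed_of_antitone {F : ℝ → ℝ} (hF : Continuous F) {x c : ℝ}
    (h : ∀ k, c ≤ F^[k] x ∧ F^[k + 1] x ≤ F^[k] x) : ∃ y, F y = y := by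
  have hm : Antitone fun k => F^[k] x := antitone_nat_of_succ_le fun k => (h k).2
  have := tendsto_atTop_ciInf hm ⟨c, by rintro _ ⟨k, rfl⟩; exact (h k).1⟩
  exact ⟨_, isFixedPt_of_tendsto_iterate this hF.continuousAt⟩

theorem exists_fixed_of_monotone {F : ℝ → ℝ} (hF : Continuous F) {x c : ℝ}
    (h : ∀ k, F^[k] x ≤ c ∧ F^[k] x ≤ F^[k + 1] x) : ∃ y, F y = y := by
  have hm : Monotone fun k => F^[k] x := monotone_nat_of_le_succ fun k => (h k).2
  have := tendsto_atTop_ciSup hm ⟨c, by rintro _ ⟨k, rfl⟩; exact (h k).1⟩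
  exact ⟨_, isFixedPt_of_tendsto_iterate this hF.continuousAt⟩

theorem no_cross_rotation {A B : ℝ → Prop} {R : ℝ → ℝ} (hR : Continuous R) (hm : StrictMono R)
    (hR1 : ∀ x, x < R x) (hR2 : ∀ x, R x < x + 2 * Real.pi)
    (hA : ∀ x, ∀ m : ℤ, A x → A (x + m * (2 * Real.pi)))
    (hB : ∀ x, ∀ m : ℤ, B x → B (x + m * (2 * Real.pi)))
    (hAR : ∀ x, A x → A (R x)) {y : ℝ} (hy : B y) (hRy : B (R y)) (hAB : ∀ x, A x → B x → False)
    (cross : ∀ α β γ δ, α < β → β < γ → γ < δ → δ < α + 2 * Real.pi → B α → A β → B γ → A δ → False)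
    (hne : ∃ x, A x) : False := by
  have hpi := Real.pi_pos
  have hlt : y < R y ∧ R y < y + 2 * Real.pi := ⟨hR1 y, hR2 y⟩
  obtain ⟨a, ha, hya, hay⟩ : ∃ a, A a ∧ y < a ∧ a < R y := by
    obtain ⟨x, hx⟩ := hne
    obtain ⟨m, hm', -⟩ := existsUnique_add_zsmul_mem_Ico (show 0 < 2 * Real.pi by positivity) x
      (y - 2 * Real.pi)
    have hx' : A (x + m * (2 * Real.pi)) := hA x m hx
    rw [zsmul_eq_mul] at hm'
    have hx1 : x + m * (2 * Real.pi) < y := by linarith [hm'.2]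
    generalize x + m * (2 * Real.pi) = x' at hx' hx1
    have hAk : ∀ k, A (R^[k] x') := fun k => by
      induction k with
      | zero => exact hx'
      | succ k ih => rw [Function.iterate_succ_apply']; exact hAR _ ih
    have hex : ∃ k, y ≤ R^[k] x' := by
      by_contra hc
      push Not at hc
      obtain ⟨z, hz⟩ := exists_fixed_of_monotone hR (x := x') (c := y)
        fun k => ⟨(hc k).le, by rw [Function.iterate_succ_apply']; exact (hR1 _).le⟩
      exact absurd hz (hR1 z).ne'
    classical
    have hk := Nat.find_spec hex
    have hk' := fun j => Nat.find_min hex (m := j)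
    generalize Nat.find hex = k at hk hk'
    cases k with
    | zero => exact absurd hk (not_le.2 hx1)
    | succ k =>
      refine ⟨_, hAk (k + 1), lt_of_le_of_ne hk ?_, ?_⟩
      · intro h
        exact hAB _ (hAk (k + 1)) (h ▸ hy)
      · rw [Function.iterate_succ_apply']
        exact hm (not_le.1 (hk' k (Nat.lt_succ_self k)))
  by_cases hb : ∃ b, A b ∧ R y < b ∧ b < y + 2 * Real.pi
  · obtain ⟨b, hb, h1, h2⟩ := hb
    exact cross y a (R y) b hya hay h1 h2 hy ha hRy hb
  · push Not at hb
    have key : ∀ x, A x ∧ y < x ∧ x < R y →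
        (A (R x - 2 * Real.pi) ∧ y < R x - 2 * Real.pi ∧ R x - 2 * Real.pi < R y) := by
      rintro x ⟨h1, h2, h3⟩
      have h4 := hb (R x) (hAR x h1) (hm h2)
      have h5 : R x ≠ y + 2 * Real.pi := by
        intro h
        have := hB y 1 hy
        rw [Int.cast_one, one_mul, ← h] at this
        exact hAB _ (hAR x h1) this
      have h6 := lt_of_le_of_ne h4 h5.symm
      have h7 := hR2 x
      refine ⟨?_, by linarith, by linarith⟩
      have := hA (R x) (-1) (hAR x h1)
      convert this using 1; push_cast; ring
    have hall : ∀ k, A ((fun x => R x - 2 * Real.pi)^[k] a) ∧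
        y < (fun x => R x - 2 * Real.pi)^[k] a ∧ (fun x => R x - 2 * Real.pi)^[k] a < R y := by
      intro k
      induction k with
      | zero => exact ⟨ha, hya, hay⟩
      | succ k ih => rw [Function.iterate_succ_apply']; exact key _ ih
    obtain ⟨z, hz⟩ := exists_fixed_of_antitone (F := fun x => R x - 2 * Real.pi) (by fun_prop)
      (x := a) (c := y) fun k => ⟨(hall k).2.1.le, by
        rw [Function.iterate_succ_apply']; linarith [hR2 ((fun x => R x - 2 * Real.pi)^[k] a)]⟩
    have := hR2 z
    linarith

theorem no_cross_fixed {A B : ℝ → Prop} {h : ℝ ≃o ℝ} {p : ℝ} (hp : h p = p)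
    (hper : ∀ x, h (x + 2 * Real.pi) = h x + 2 * Real.pi)
    (hA : ∀ x, ∀ m : ℤ, A x → A (x + m * (2 * Real.pi)))
    (hAh : ∀ x, A x → B (h x)) {n : ℕ} (hn : 1 ≤ n) (hAn : ∀ x, A x → A ((h⁻¹ ^ n : ℝ ≃o ℝ) x))
    (hAB : ∀ x, A x → B x → False)
    (cross : ∀ α β γ δ, α < β → β < γ → γ < δ → δ < α + 2 * Real.pi → A α → B β → A γ → B δ → False)
    (cross' : ∀ α β γ δ, α < β → β < γ → γ < δ → δ < α + 2 * Real.pi → B α → A β → B γ → A δ → False)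
    (hne : ∃ x, A x) : False := by
  obtain ⟨x, hx⟩ := hne
  have hpi := Real.pi_pos
  obtain ⟨m, hm', -⟩ := existsUnique_add_zsmul_mem_Ico (show 0 < 2 * Real.pi by positivity) x p
  have hx' : A (x + m * (2 * Real.pi)) := hA x m hx
  rw [zsmul_eq_mul] at hm'
  obtain ⟨hx1, hx2⟩ := hm'
  generalize x + m * (2 * Real.pi) = z at hx' hx1 hx2
  have hpz : p < z := by
    refine lt_of_le_of_ne hx1 ?_
    rintro rfl
    have := hAh _ hx'
    rw [hp] at this
    exact hAB _ hx' this
  have hinv : ∀ y, h ((h⁻¹ : ℝ ≃o ℝ) y) = y := fun y => h.apply_symm_apply y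
  have hinv' : ∀ y, (h⁻¹ : ℝ ≃o ℝ) (h y) = y := fun y => h.symm_apply_apply y
  have hp' : (h⁻¹ : ℝ ≃o ℝ) p = p := by conv_lhs => rw [← hp, hinv']
  have hq : h (p + 2 * Real.pi) = p + 2 * Real.pi := by rw [hper, hp]
  have hq' : (h⁻¹ : ℝ ≃o ℝ) (p + 2 * Real.pi) = p + 2 * Real.pi := by
    conv_lhs => rw [← hq, hinv']
  have hbd : ∀ y, p < y → y < p + 2 * Real.pi → ∀ k : ℕ,
      p < (h⁻¹ ^ k : ℝ ≃o ℝ) y ∧ (h⁻¹ ^ k : ℝ ≃o ℝ) y < p + 2 * Real.pi := by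
    intro y h1 h2 k
    induction k with
    | zero => exact ⟨h1, h2⟩
    | succ k ih =>
      rw [pow_succ', RelIso.mul_apply]
      constructor
      · rw [← hp', (h⁻¹ : ℝ ≃o ℝ).lt_iff_lt]; exact ih.1
      · rw [← hq', (h⁻¹ : ℝ ≃o ℝ).lt_iff_lt]; exact ih.2
  obtain ⟨k, rfl⟩ : ∃ k, n = k + 1 := ⟨n - 1, by omega⟩
  have hyn : h ((h⁻¹ ^ (k + 1) : ℝ ≃o ℝ) z) = (h⁻¹ ^ k : ℝ ≃o ℝ) z := by
    rw [pow_succ', RelIso.mul_apply, hinv]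
  have hAy := hAn z hx'
  have hBy := hAh _ hAy
  have hy := hbd z hpz hx2 (k + 1)
  have hhz : p < h z ∧ h z < p + 2 * Real.pi := by
    constructor
    · rw [← hp, h.lt_iff_lt]; exact hpz
    · rw [← hq, h.lt_iff_lt]; exact hx2
  have hne' : (h⁻¹ ^ k : ℝ ≃o ℝ) z ≠ z := by
    intro he
    rw [hyn, he] at hBy
    exact hAB _ hx' hBy
  have hcomm : (h⁻¹ ^ (k + 1) : ℝ ≃o ℝ) (h z) = h ((h⁻¹ ^ (k + 1) : ℝ ≃o ℝ) z) := by
    rw [hyn, pow_succ, RelIso.mul_apply, hinv']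
  rcases lt_trichotomy z (h z) with hc | hc | hc
  · have hle : ∀ k : ℕ, (h⁻¹ ^ k : ℝ ≃o ℝ) z ≤ z := by
      intro k
      induction k with
      | zero => exact le_refl _
      | succ k ih =>
        rw [pow_succ', RelIso.mul_apply]
        refine ((h⁻¹ : ℝ ≃o ℝ).le_iff_le.2 (ih.trans hc.le)).trans_eq (hinv' z)
    have h1 : (h⁻¹ ^ (k + 1) : ℝ ≃o ℝ) z < h ((h⁻¹ ^ (k + 1) : ℝ ≃o ℝ) z) := by
      rw [← hcomm, OrderIso.lt_iff_lt]; exact hc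
    have h2 : h ((h⁻¹ ^ (k + 1) : ℝ ≃o ℝ) z) < z := by
      rw [hyn]; exact lt_of_le_of_ne (hle k) hne'
    exact cross _ _ _ _ h1 h2 hc (by linarith [hy.1, hhz.2]) hAy hBy hx' (hAh z hx')
  · exact hAB _ hx' (hc.symm ▸ hAh z hx')
  · have hle : ∀ k : ℕ, z ≤ (h⁻¹ ^ k : ℝ ≃o ℝ) z := by
      intro k
      induction k with
      | zero => exact le_refl _
      | succ k ih =>
        rw [pow_succ', RelIso.mul_apply]
        exact (hinv' z).symm.trans_le ((h⁻¹ : ℝ ≃o ℝ).le_iff_le.2 (hc.le.trans ih))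
    have h1 : h ((h⁻¹ ^ (k + 1) : ℝ ≃o ℝ) z) < (h⁻¹ ^ (k + 1) : ℝ ≃o ℝ) z := by
      rw [← hcomm, OrderIso.lt_iff_lt]; exact hc
    have h2 : z < h ((h⁻¹ ^ (k + 1) : ℝ ≃o ℝ) z) := by
      rw [hyn]; exact lt_of_le_of_ne (hle k) hne'.symm
    exact cross' _ _ _ _ hc h2 h1 (by linarith [hy.2, hhz.1]) (hAh z hx') hx' hBy hAy

theorem map_add_int_mul {h : ℝ → ℝ} (hper : ∀ x, h (x + 2 * Real.pi) = h x + 2 * Real.pi) (x : ℝ)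
    (m : ℤ) : h (x + m * (2 * Real.pi)) = h x + m * (2 * Real.pi) := by
  induction m using Int.induction_on with
  | zero => simp
  | succ k ih =>
    have := hper (x + k * (2 * Real.pi))
    push_cast at *
    rw [show x + (k + 1) * (2 * Real.pi) = x + k * (2 * Real.pi) + 2 * Real.pi by ring, this, ih]
    ring
  | pred k ih =>
    have := hper (x + (-k - 1) * (2 * Real.pi))
    rw [show x + (-k - 1) * (2 * Real.pi) + 2 * Real.pi = x + -k * (2 * Real.pi) by ring] at this
    push_cast at *
    linarith

theorem pow_periodic {h : ℝ ≃o ℝ} (hper : ∀ x, h (x + 2 * Real.pi) = h x + 2 * Real.pi) (n : ℕ)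
    (x : ℝ) : (h ^ n : ℝ ≃o ℝ) (x + 2 * Real.pi) = (h ^ n : ℝ ≃o ℝ) x + 2 * Real.pi := by
  induction n with
  | zero => rfl
  | succ n ih => rw [pow_succ', RelIso.mul_apply, RelIso.mul_apply, ih, hper]

/-- A lift of a fixed point free circle homeomorphism can be normalised. -/
theorem exists_normalised {R : ℝ → ℝ} (hR : Continuous R)
    (hne : ∀ x, ∀ m : ℤ, R x ≠ x + m * (2 * Real.pi)) :
    ∃ j : ℤ, ∀ x, x < R x - j * (2 * Real.pi) ∧ R x - j * (2 * Real.pi) < x + 2 * Real.pi := by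
  have hpi := Real.pi_pos
  obtain ⟨m, hm', -⟩ := existsUnique_add_zsmul_mem_Ico (show 0 < 2 * Real.pi by positivity) (R 0) 0
  rw [zsmul_eq_mul] at hm'
  refine ⟨-m, fun x => ?_⟩
  have hc : Continuous fun x => R x - x := by fun_prop
  have hno : ∀ k : ℤ, ∀ x, R x - x ≠ k * (2 * Real.pi) := fun k x h => hne x k (by linarith)
  have h0 : 0 < R 0 - 0 + m * (2 * Real.pi) := by
    refine lt_of_le_of_ne (by linarith [hm'.1]) fun h => hno (-m) 0 ?_
    push_cast; linarith
  have h1 : R 0 - 0 + m * (2 * Real.pi) < 2 * Real.pi := by linarith [hm'.2]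
  push_cast
  constructor
  · by_contra hcon
    push Not at hcon
    obtain ⟨z, hz⟩ := mem_range_of_exists_le_of_exists_ge hc (c := -m * (2 * Real.pi))
      ⟨x, by linarith⟩ ⟨0, by linarith⟩
    exact hno (-m) z (by push_cast; linarith)
  · by_contra hcon
    push Not at hcon
    obtain ⟨z, hz⟩ := mem_range_of_exists_le_of_exists_ge hc (c := (-m + 1) * (2 * Real.pi))
      ⟨0, by linarith⟩ ⟨x, by linarith⟩
    exact hno (-m + 1) z (by push_cast; linarith)

theorem no_cross {A B : ℝ → Prop} {h : ℝ ≃o ℝ}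
    (hper : ∀ x, h (x + 2 * Real.pi) = h x + 2 * Real.pi)
    (hA : ∀ x, ∀ m : ℤ, A x → A (x + m * (2 * Real.pi)))
    (hB : ∀ x, ∀ m : ℤ, B x → B (x + m * (2 * Real.pi)))
    (hAh : ∀ x, A x → B (h x)) {n : ℕ} (hn : 1 ≤ n) (hAn : ∀ x, A x → A ((h⁻¹ ^ n : ℝ ≃o ℝ) x))
    (hAB : ∀ x, A x → B x → False)
    (cross : ∀ α β γ δ, α < β → β < γ → γ < δ → δ < α + 2 * Real.pi → A α → B β → A γ → B δ → False)
    (cross' : ∀ α β γ δ, α < β → β < γ → γ < δ → δ < α + 2 * Real.pi → B α → A β → B γ → A δ → False)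
    (hne : ∃ x, A x)
    (rot : (∃ x, ∃ m : ℤ, h x = x + m * (2 * Real.pi)) ∨
      (∀ i : ℤ, i ≠ 0 → ∀ x, ∀ m : ℤ, (h ^ i : ℝ ≃o ℝ) x ≠ x + m * (2 * Real.pi))) : False := by
  rcases rot with ⟨p, m, hp⟩ | hrot
  · let s : ℝ ≃o ℝ := OrderIso.addRight (-(m * (2 * Real.pi)))
    have hs : ∀ x, s x = x + -(m * (2 * Real.pi)) := fun x => rfl
    have hsi : ∀ x, (s⁻¹ : ℝ ≃o ℝ) x = x + m * (2 * Real.pi) := fun x => by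
      apply s.injective
      have e : s ((s⁻¹ : ℝ ≃o ℝ) x) = x := s.apply_symm_apply x
      rw [e, hs]; ring
    have hcom : Commute s h := by
      ext x
      rw [RelIso.mul_apply, RelIso.mul_apply, hs, hs]
      have := map_add_int_mul hper x (-m)
      push_cast at this
      rw [← neg_mul, this]
    have hspow : ∀ k : ℕ, ∀ x, (s⁻¹ ^ k : ℝ ≃o ℝ) x = x + (k * m : ℤ) * (2 * Real.pi) := by
      intro k
      induction k with
      | zero => intro x; simp
      | succ k ih =>
        intro x
        rw [pow_succ', RelIso.mul_apply, ih, hsi]; push_cast; ring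
    refine no_cross_fixed (h := s * h) (p := p) (A := A) (B := B) ?_ ?_ hA ?_ hn ?_ hAB cross cross' hne
    · rw [RelIso.mul_apply, hs, hp]; ring
    · intro x; rw [RelIso.mul_apply, RelIso.mul_apply, hs, hs, hper]; ring
    · intro x hx
      rw [RelIso.mul_apply, hs]
      have := hB _ (-m) (hAh x hx)
      rwa [Int.cast_neg, neg_mul] at this
    · intro x hx
      rw [mul_inv_rev, hcom.inv_inv.symm.mul_pow]
      rw [← (hcom.inv_inv.pow_pow n n).eq, RelIso.mul_apply, hspow]
      exact hA _ _ (hAn x hx)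
  · have hRne : ∀ x, ∀ m : ℤ, (h⁻¹ ^ n : ℝ ≃o ℝ) x ≠ x + m * (2 * Real.pi) := by
      intro x m
      have := hrot (-(n : ℤ)) (by omega) x m
      rwa [zpow_neg, zpow_natCast, ← inv_pow] at this
    have hRc : Continuous (h⁻¹ ^ n : ℝ ≃o ℝ) := OrderIso.continuous _
    obtain ⟨j, hj⟩ := exists_normalised hRc hRne
    obtain ⟨x, hx⟩ := hne
    have hsub : ∀ y, A y → A ((h⁻¹ ^ n : ℝ ≃o ℝ) y - j * (2 * Real.pi)) := fun y hy => by
      have := hA _ (-j) (hAn y hy)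
      rwa [Int.cast_neg, neg_mul] at this
    refine no_cross_rotation (R := fun x => (h⁻¹ ^ n : ℝ ≃o ℝ) x - j * (2 * Real.pi)) (by fun_prop)
      (fun x y hxy => sub_lt_sub_right ((h⁻¹ ^ n : ℝ ≃o ℝ).strictMono hxy) _) (fun x => (hj x).1)
      (fun x => (hj x).2) hA hB hsub (hAh x hx) ?_ hAB cross' ⟨x, hx⟩
    have e : (h⁻¹ ^ n : ℝ ≃o ℝ) (h x) - j * (2 * Real.pi)
        = h ((h⁻¹ ^ n : ℝ ≃o ℝ) x - j * (2 * Real.pi)) := by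
      have e1 := map_add_int_mul hper ((h⁻¹ ^ n : ℝ ≃o ℝ) x) (-j)
      rw [Int.cast_neg, neg_mul, ← sub_eq_add_neg, ← sub_eq_add_neg] at e1
      rw [e1, ← RelIso.mul_apply, ← RelIso.mul_apply]
      congr 2
      exact ((Commute.refl h).inv_left.pow_left n).eq ▸ rfl
    simp only [e]
    exact hAh _ (hsub x hx)

end

section

theorem Nb_add_int_mul (x : ℝ) (m : ℤ) (r : ℝ) : Nb (x + m * (2 * Real.pi)) r = Nb x r := by
  have : circ (x + m * (2 * Real.pi)) = circ x := (circ_eq_circ).2 ⟨m, rfl⟩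
  simp only [Nb, this]

theorem disjoint_zpow_image {q : Dsk ≃ₜ Dsk} {N : Set Dsk}
    (hN : ∀ j : ℕ, 1 ≤ j → Disjoint ((q⁻¹ ^ j : Dsk ≃ₜ Dsk) '' N) N) (k : ℤ) (hk : k ≠ 0) :
    Disjoint ((q ^ k : Dsk ≃ₜ Dsk) '' N) N := by
  rcases lt_or_gt_of_ne hk with h | h
  · have := hN k.natAbs (by omega)
    rwa [inv_pow, ← zpow_natCast, ← zpow_neg, show -(k.natAbs : ℤ) = k by omega] at this
  · have := hN k.natAbs (by omega)
    have h2 := (Set.disjoint_image_iff (q ^ k : Dsk ≃ₜ Dsk).injective).2 this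
    rw [← image_homeo_mul, inv_pow, ← zpow_natCast, ← zpow_neg, ← zpow_add,
      show k + -(k.natAbs : ℤ) = 0 by omega, zpow_zero] at h2
    simpa only [image_homeo_one] using h2.symm

namespace DiscData
variable {g : Dsk ≃ₜ Dsk} {h : ℝ ≃o ℝ} {P K : Set Dsk} {b : Dsk}

theorem exists_Nb_image_pow (d : DiscData g h P K b) {D : Set Dsk} {x : ℝ}
    (hx : ∃ r > 0, Nb x r ⊆ D) (n : ℕ) :
    ∃ r > 0, Nb ((h ^ n : ℝ ≃o ℝ) x) r ⊆ (g ^ n : Dsk ≃ₜ Dsk) '' D := by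
  induction n with
  | zero => rw [pow_zero, pow_zero, image_homeo_one]; exact hx
  | succ n ih =>
    rw [pow_succ', pow_succ', image_homeo_mul, RelIso.mul_apply]
    exact d.exists_Nb_image ih

theorem not_up_subset (d : DiscData g h P K b) {D : Set Dsk} (hD : IsHideComp b P D)
    (hsub : D ⊆ g '' D) : False := by
  have hi : (g⁻¹ : Dsk ≃ₜ Dsk) '' D ⊆ D := by
    have := image_mono (f := (g⁻¹ : Dsk ≃ₜ Dsk)) hsub
    rwa [image_inv_image] at this
  have hgD := d.comp_image hD
  have hgD' := d.symm.comp_image hD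
  obtain ⟨y, hy⟩ := hD.frontier_nonempty d.b0
  have hyP := hD.frontier_subset d.closed hy
  have hyD : y ∈ D := (hD.isClosed d.closed).frontier_subset hy
  obtain ⟨x, hx, hx'⟩ := d.reach y hyP
  have hyn : y ∉ (g⁻¹ : Dsk ≃ₜ Dsk) '' D := by
    intro hc
    have : y ∈ frontier ((g⁻¹ : Dsk ≃ₜ Dsk) '' D) :=
      ⟨subset_closure hc, fun h => hy.2 (interior_mono hi h)⟩
    exact d.symm.dis.ne_of_mem (d.symm.image_frontier_subset hD this) hyP rfl
  obtain ⟨r, hr, hrs⟩ := hgD.exists_Nb_subset d.c1 d.b1 (hsub hyD) hx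
  obtain ⟨r', hr', hrs'⟩ := hgD'.exists_Nb_disjoint d.symm.c1 hyn hx'
  have hN1 : Nb x (min r r') ⊆ g '' D := (Nb_mono (min_le_left _ _)).trans hrs
  have hN2 : Disjoint ((g⁻¹ : Dsk ≃ₜ Dsk) '' D) (Nb x (min r r')) :=
    hrs'.mono_right (Nb_mono (min_le_right _ _))
  have hpow : ∀ j : ℕ, ((g⁻¹ ^ j : Dsk ≃ₜ Dsk)) '' D ⊆ D := by
    intro j
    induction j with
    | zero => simp only [pow_zero, image_homeo_one]; simp
    | succ j ih => rw [pow_succ, image_homeo_mul]; exact (image_mono hi).trans ih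
  have hsm : ∀ j : ℕ, 1 ≤ j →
      (((g ^ 2)⁻¹ ^ j : Dsk ≃ₜ Dsk)) '' Nb x (min r r') ⊆ (g⁻¹ : Dsk ≃ₜ Dsk) '' D := by
    intro j hj
    refine (image_mono hN1).trans ?_
    rw [← image_homeo_mul, show ((g ^ 2)⁻¹ ^ j * g : Dsk ≃ₜ Dsk) = g⁻¹ * g⁻¹ ^ (2 * j - 2) by
      rw [← inv_pow, ← pow_mul, ← pow_succ', show 2 * j = (2 * j - 2 + 1) + 1 by omega, pow_succ]
      simp, image_homeo_mul]
    exact image_mono (hpow _)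
  have hmul : ∀ k : ℤ, (g ^ (2 * k) : Dsk ≃ₜ Dsk) = (g ^ 2) ^ k := fun k => by
    rw [zpow_mul]; rfl
  obtain ⟨-, k, hk, z, hz, hzK⟩ := d.NW2 x _ (lt_min hr hr') (by
    intro k hk
    rw [hmul]
    exact disjoint_zpow_image (fun j hj => hN2.mono_left (hsm j hj)) k hk)
  have h3 := hsm k.natAbs (by omega)
  rw [inv_pow, ← zpow_natCast, ← zpow_neg, show -(k.natAbs : ℤ) = k by omega, ← hmul] at h3
  exact d.disjoint_hideSet.ne_of_mem hzK (hD.subset (hi (h3 hz))) rfl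

theorem not_up_disjoint (d : DiscData g h P K b) {D : Set Dsk} (hD : IsHideComp b P D)
    (hdis : Disjoint D (g '' D)) {n : ℕ} (hn : 1 ≤ n)
    (hret : (g⁻¹ ^ n : Dsk ≃ₜ Dsk) '' D ⊆ D) (hne : ∃ x, ∃ r > 0, Nb x r ⊆ D) : False := by
  have hc := hD.isClosed d.closed
  have hc' : IsClosed (g '' D) := g.isClosed_image.2 hc
  have hp := hD.isConnected.isPreconnected
  have hp' : IsPreconnected (g '' D) := hp.image _ g.continuous.continuousOn
  refine no_cross (A := fun x => ∃ r > 0, Nb x r ⊆ D) (B := fun x => ∃ r > 0, Nb x r ⊆ g '' D)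
    (h := h) d.per ?_ ?_ (fun x hx => d.exists_Nb_image hx) hn ?_ ?_ ?_ ?_ hne d.rot
  · intro x m hx; simpa only [Nb_add_int_mul] using hx
  · intro x m hx; simpa only [Nb_add_int_mul] using hx
  · intro x hx
    obtain ⟨r, hr, h⟩ := d.symm.exists_Nb_image_pow hx n
    exact ⟨r, hr, h.trans hret⟩
  · rintro x ⟨r, hr, h⟩ ⟨r', hr', h'⟩
    obtain ⟨z, hz⟩ := Nb_nonempty x (lt_min hr hr')
    exact hdis.ne_of_mem (h (Nb_mono (min_le_left _ _) hz)) (h' (Nb_mono (min_le_right _ _) hz)) rfl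
  · intro α β γ δ h1 h2 h3 h4 hα hβ hγ hδ
    exact not_linked_closed h1 h2 h3 h4 hdis hc hc' hp hp' hα hγ hβ hδ
  · intro α β γ δ h1 h2 h3 h4 hα hβ hγ hδ
    exact not_linked_closed h1 h2 h3 h4 hdis.symm hc' hc hp' hp hα hγ hβ hδ

theorem not_up (d : DiscData g h P K b) {D : Set Dsk} (hD : Up g P b D) : False := by
  have hnext : ∀ D : {D // Up g P b D}, ∃ D' : {D // Up g P b D},
      ∃ E, IsHideComp b (g '' P) E ∧ D.1 ⊆ E ∧ D'.1 = (g⁻¹ : Dsk ≃ₜ Dsk) '' E := by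
    rintro ⟨D, hD, E, hE, hDE⟩
    exact ⟨⟨_, d.up_next hD hE hDE⟩, E, hE, hDE, rfl⟩
  choose nxt E hE hDE hnxt using hnext
  set s : ℕ → {D // Up g P b D} := fun k => nxt^[k] ⟨D, hD⟩ with hs
  have hs1 : ∀ k, s (k + 1) = nxt (s k) := fun k => Function.iterate_succ_apply' _ _ _
  have hstep : ∀ k, (g⁻¹ : Dsk ≃ₜ Dsk) '' (s k).1 ⊆ (s (k + 1)).1 := fun k => by
    rw [hs1, hnxt]; exact image_mono (hDE _)
  have hpow : ∀ j k, (g⁻¹ ^ j : Dsk ≃ₜ Dsk) '' (s k).1 ⊆ (s (k + j)).1 := by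
    intro j
    induction j with
    | zero => simp only [pow_zero, image_homeo_one, add_zero]; simp
    | succ j ih =>
      intro k
      rw [pow_succ', image_homeo_mul]
      exact (image_mono (ih k)).trans (hstep _)
  have hNb : ∀ k, ∃ x, ∃ r > 0, Nb x r ⊆ (s (k + 1)).1 := by
    intro k
    have hk := (s k).2.1
    obtain ⟨y, hy⟩ := hk.frontier_nonempty d.b0
    obtain ⟨x, hx, -⟩ := d.reach y (hk.frontier_subset d.closed hy)
    refine ⟨(h⁻¹ : ℝ ≃o ℝ) x, ?_⟩
    rw [hs1, hnxt]
    exact d.symm.exists_Nb_image ((hE (s k)).exists_Nb_subset d.c1 d.b1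
      (hDE _ ((hk.isClosed d.closed).frontier_subset hy)) hx)
  by_cases hinj : Function.Injective s
  · obtain ⟨x, r, hr, hN⟩ := hNb 0
    have hsm : ∀ j : ℕ, (g⁻¹ ^ j : Dsk ≃ₜ Dsk) '' Nb x r ⊆ (s (1 + j)).1 := fun j =>
      (image_mono hN).trans (hpow j 1)
    obtain ⟨-, k, hk, z, hz, hzK⟩ := d.NW1 x r hr (disjoint_zpow_image fun j hj => by
      refine Disjoint.mono (hsm j) hN ?_
      refine ((s (1 + j)).2.1.eq_or_disjoint (s 1).2.1).resolve_left fun he => ?_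
      have := hinj (Subtype.ext he)
      omega)
    have h3 := hsm k.natAbs
    rw [inv_pow, ← zpow_natCast, ← zpow_neg, show -(k.natAbs : ℤ) = k by omega] at h3
    exact d.disjoint_hideSet.ne_of_mem hzK ((s _).2.1.subset (h3 hz)) rfl
  · have : ∃ i j, i < j ∧ s i = s j := by
      simp only [Function.Injective, not_forall] at hinj
      obtain ⟨i, j, hij, hne⟩ := hinj
      rcases lt_or_gt_of_ne hne with h | h
      exacts [⟨i, j, h, hij⟩, ⟨j, i, h, hij.symm⟩]
    obtain ⟨i, j, hij, he⟩ := this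
    have hD' := (s (i + 1)).2.1
    have he' : s (i + 1) = s (j + 1) := by rw [hs1, hs1, he]
    have hret : (g⁻¹ ^ (j - i) : Dsk ≃ₜ Dsk) '' (s (i + 1)).1 ⊆ (s (i + 1)).1 := by
      refine (hpow (j - i) (i + 1)).trans ?_
      rw [show i + 1 + (j - i) = j + 1 by omega, he']
    rcases (hE (s (i + 1))).eq_or_disjoint (d.comp_image hD') with h1 | h1
    · exact d.not_up_subset hD' (h1 ▸ hDE _)
    · exact d.not_up_disjoint hD' (h1.mono_left (hDE _)) (by omega) hret (hNb i)

theorem eq_empty (d : DiscData g h P K b) : P = ∅ := by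
  by_contra hne
  obtain ⟨y, hy⟩ := Set.nonempty_iff_ne_empty.2 hne
  have hD : IsHideComp b P _ := ⟨y, subset_hideSet b P hy, rfl⟩
  rcases d.up_or_down hD with h1 | h1
  exacts [d.not_up h1, d.symm.not_up h1]

end DiscData

end

section

theorem exists_bounded_root {U : Set ℂ} (hUo : IsOpen U) (hUc : IsSimplyConnected U)
    (hU : U ≠ univ) : ∃ (a b ε : ℂ) (ψ : ℂ → ℂ), ε ≠ 0 ∧ DifferentiableOn ℂ ψ U ∧ InjOn ψ U ∧
      (∀ z ∈ U, deriv ψ z ≠ 0) ∧ (∀ z ∈ U, ‖ψ z‖ < 1) ∧ (∀ z ∈ U, ψ z ≠ 0) ∧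
      ∀ z ∈ U, (z - a) * ψ z ^ 2 = (b * ψ z + ε) ^ 2 := by
  obtain ⟨a, ha⟩ := (ne_univ_iff_exists_notMem U).1 hU
  obtain ⟨f, hfc, hf⟩ := Complex.exists_continuousOn_pow_eq hUc hUo
    (g := fun z => z - a) (by fun_prop) (by
      rintro ⟨z, hz, hz'⟩
      rw [sub_eq_zero.1 hz'] at hz; exact ha hz) two_ne_zero
  have hf₀ : ∀ z ∈ U, f z ≠ 0 := by
    intro z hz hfz
    have := hf z
    rw [hfz, zero_pow two_ne_zero] at this
    rw [← sub_eq_zero.1 this.symm] at ha; exact ha hz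
  have hdf : ∀ z ∈ U, HasStrictDerivAt f (2 * f z)⁻¹ z := by
    intro z hz
    refine HasStrictDerivAt.of_local_left_inverse (f := fun w => w ^ 2 + a)
      (hfc.continuousAt (hUo.mem_nhds hz)) ?_ (by simpa using hf₀ z hz)
      (.of_forall fun z => by simp [hf z])
    simpa using (hasStrictDerivAt_pow 2 (f z)).add_const a
  have hinj : Function.Injective f := fun z w h => by
    have := hf z
    rw [h, hf w] at this
    simpa using this.symm
  obtain ⟨x, hx⟩ := hUc.nonempty
  have himg : f '' U ∈ 𝓝 (f x) := by
    rw [← (hdf x hx).map_nhds_eq (by simpa using hf₀ x hx)]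
    exact Filter.image_mem_map (hUo.mem_nhds hx)
  obtain ⟨ε, hε, hball⟩ := Metric.mem_nhds_iff.1 himg
  have hmiss : ∀ z ∈ U, ε ≤ ‖f z + f x‖ := by
    intro z hz
    by_contra hlt
    push Not at hlt
    obtain ⟨y, hy, hyz⟩ := hball (show -f z ∈ Metric.ball (f x) ε by
      rw [Metric.mem_ball, dist_eq_norm, show -f z - f x = -(f z + f x) by ring, norm_neg]
      exact hlt)
    have h2 : y = z := by
      have h1 := hf y
      rw [hyz, neg_sq, hf z] at h1
      simpa using h1.symm
    rw [h2] at hyz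
    refine hf₀ z hz ?_
    linear_combination hyz / 2
  have hne : ∀ z ∈ U, f z + f x ≠ 0 := fun z hz h => by
    have := hmiss z hz
    rw [h, norm_zero] at this
    linarith
  have hd : ∀ z ∈ U, HasDerivAt (fun z => (ε / 2 : ℂ) / (f z + f x))
      (-((ε / 2 : ℂ) * (2 * f z)⁻¹) / (f z + f x) ^ 2) z := fun z hz => by
    simpa using (hasDerivAt_const z (ε / 2 : ℂ)).fun_div
      ((hdf z hz).hasDerivAt.add_const (f x)) (hne z hz)
  have hε' : (ε / 2 : ℂ) ≠ 0 := by
    have : (ε : ℂ) ≠ 0 := by exact_mod_cast hε.ne'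
    simpa using this
  refine ⟨a, -f x, ε / 2, fun z => (ε / 2 : ℂ) / (f z + f x), hε',
    fun z hz => (hd z hz).differentiableAt.differentiableWithinAt, ?_, ?_, ?_, ?_, ?_⟩
  · intro z hz w hw h
    simp only at h
    rw [div_eq_div_iff (hne z hz) (hne w hw)] at h
    have := mul_left_cancel₀ hε' h
    exact hinj (by simpa using this.symm)
  · intro z hz
    rw [(hd z hz).deriv]
    exact div_ne_zero (neg_ne_zero.2 (mul_ne_zero hε' (inv_ne_zero (mul_ne_zero two_ne_zero
      (hf₀ z hz))))) (pow_ne_zero _ (hne z hz))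
  · intro z hz
    have h1 := hmiss z hz
    have h2 : ‖(ε / 2 : ℂ)‖ = ε / 2 := by
      rw [show (ε / 2 : ℂ) = ((ε / 2 : ℝ) : ℂ) by push_cast; ring, Complex.norm_real,
        Real.norm_of_nonneg (by positivity)]
    rw [norm_div, h2, div_lt_one (by linarith)]
    linarith
  · intro z hz
    exact div_ne_zero hε' (hne z hz)
  · intro z hz
    have := hne z hz
    have h2 : z - a = f z ^ 2 := (hf z).symm
    rw [h2]
    field_simp
    ring

/-- A local form of the Hurwitz theorem. -/
theorem ne_zero_of_tendstoLocallyUniformlyOn {ι : Type*} {l : Filter ι} [l.NeBot] {W : Set ℂ}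
    (hW : IsOpen W) {F : ι → ℂ → ℂ} {G : ℂ → ℂ} (hF : ∀ i, DifferentiableOn ℂ (F i) W)
    (hne : ∀ i, ∀ z ∈ W, F i z ≠ 0) (hlim : TendstoLocallyUniformlyOn F G l W) {p : ℂ} (hp : p ∈ W)
    (hG : ¬ ∀ᶠ z in 𝓝 p, G z = 0) : G p ≠ 0 := by
  intro hGp
  have hGd := hlim.differentiableOn (.of_forall hF) hW
  have hGa : AnalyticAt ℂ G p := hGd.analyticAt (hW.mem_nhds hp)
  have hiso := hGa.eventually_eq_zero_or_eventually_ne_zero.resolve_left hG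
  rw [eventually_nhdsWithin_iff] at hiso
  obtain ⟨R, hR, hRW⟩ := Metric.mem_nhds_iff.1 (inter_mem hiso (hW.mem_nhds hp))
  have hr : 0 < R / 2 := by positivity
  have hsub : Metric.closedBall p (R / 2) ⊆ W := fun z hz =>
    (hRW (Metric.closedBall_subset_ball (by linarith) hz)).2
  have hsph : ∀ z ∈ Metric.sphere p (R / 2), G z ≠ 0 := fun z hz =>
    (hRW (Metric.closedBall_subset_ball (by linarith) (Metric.sphere_subset_closedBall hz))).1
      (fun h => by rw [h, Metric.mem_sphere, dist_self] at hz; linarith)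
  obtain ⟨q, hq, hqm⟩ := (isCompact_sphere p (R / 2)).exists_isMinOn
    (NormedSpace.sphere_nonempty.2 hr.le)
    (f := fun z => ‖G z‖) ((hGd.continuousOn.mono (Metric.sphere_subset_closedBall.trans hsub)).norm)
  have hm : 0 < ‖G q‖ := norm_pos_iff.2 (hsph q hq)
  have hunif := (tendstoLocallyUniformlyOn_iff_forall_isCompact hW).1 hlim _ hsub
    (isCompact_closedBall p (R / 2))
  obtain ⟨i, hi⟩ := (Metric.tendstoUniformlyOn_iff.1 hunif (‖G q‖ / 2) (by positivity)).exists
  have hd : DiffContOnCl ℂ (fun z => (F i z)⁻¹) (Metric.ball p (R / 2)) := by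
    refine DifferentiableOn.diffContOnCl ?_
    rw [closure_ball _ hr.ne']
    exact ((hF i).mono hsub).inv fun z hz => hne i z (hsub hz)
  have hb : ‖(F i p)⁻¹‖ ≤ (‖G q‖ / 2)⁻¹ := by
    refine Complex.norm_le_of_forall_mem_frontier_norm_le Metric.isBounded_ball hd ?_
      (subset_closure (Metric.mem_ball_self hr))
    intro z hz
    rw [frontier_ball _ hr.ne'] at hz
    have h1 := hi z (Metric.sphere_subset_closedBall hz)
    have h2 : ‖G q‖ ≤ ‖G z‖ := hqm hz
    rw [norm_inv]
    refine inv_anti₀ (by positivity) ?_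
    rw [dist_eq_norm] at h1
    have := norm_sub_norm_le (G z) (F i z)
    linarith
  have h1 := hi p (Metric.mem_closedBall_self hr.le)
  rw [hGp, dist_zero_left] at h1
  rw [norm_inv] at hb
  have h3 := (inv_le_inv₀ (norm_pos_iff.2 (hne i p hp)) (by positivity)).1 hb
  linarith

/-- Bounded families of holomorphic functions converge along ultrafilters. -/
theorem exists_tendstoLocallyUniformlyOn_of_bounded {ι : Type*} (l : Ultrafilter ι) {W : Set ℂ}
    (hW : IsOpen W) {F : ι → ℂ → ℂ} (hF : ∀ i, DifferentiableOn ℂ (F i) W)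
    (hb : ∀ i, ∀ z ∈ W, ‖F i z‖ ≤ 1) :
    ∃ G : ℂ → ℂ, TendstoLocallyUniformlyOn F G l W ∧
      ∀ z ∈ W, Tendsto (fun i => F i z) l (𝓝 (G z)) := by
  have hpt : ∀ z, ∃ y, z ∈ W → Tendsto (fun i => F i z) l (𝓝 y) := by
    intro z
    by_cases hz : z ∈ W
    · have hc : IsCompact (Metric.closedBall (0 : ℂ) 1) := isCompact_closedBall 0 1
      obtain ⟨y, -, hy⟩ := hc.ultrafilter_le_nhds (l.map fun i => F i z) (by
        refine le_principal_iff.2 (Filter.mem_map.2 (univ_mem' fun i => ?_))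
        simpa using hb i z hz)
      exact ⟨y, fun _ => hy⟩
    · exact ⟨0, fun h => absurd h hz⟩
  choose G hG using hpt
  have lip : ∀ z ∈ W, ∃ R > 0, Metric.ball z R ⊆ W ∧
      ∀ i, ∀ w ∈ Metric.ball z R, ‖F i w - F i z‖ ≤ R⁻¹ * ‖w - z‖ := by
    intro z hz
    obtain ⟨R, hR, hRW⟩ := Metric.mem_nhds_iff.1 (hW.mem_nhds hz)
    refine ⟨R / 3, by positivity, (Metric.ball_subset_ball (by linarith)).trans hRW, ?_⟩
    intro i w hw
    refine (convex_ball z (R / 3)).norm_image_sub_le_of_norm_deriv_le (𝕜 := ℂ) ?_ ?_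
      (Metric.mem_ball_self (by positivity)) hw
    · intro x hx
      exact (hF i).differentiableAt (hW.mem_nhds (hRW (Metric.ball_subset_ball (by linarith) hx)))
    · intro x hx
      have hsub : Metric.closedBall x (R / 3) ⊆ W := fun y hy => hRW (by
        rw [Metric.mem_ball] at *
        rw [Metric.mem_closedBall] at hy
        linarith [dist_triangle y x z])
      have := Complex.norm_deriv_le_of_forall_mem_sphere_norm_le (f := F i) (c := x)
        (C := 1) (show 0 < R / 3 by positivity) (by
          refine DifferentiableOn.diffContOnCl ?_
          rw [closure_ball _ (by positivity)]
          exact (hF i).mono hsub) (fun y hy => hb i y (hsub (Metric.sphere_subset_closedBall hy)))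
      rwa [one_div] at this
  refine ⟨G, ?_, fun z hz => hG z hz⟩
  rw [Metric.tendstoLocallyUniformlyOn_iff]
  intro ε hε z hz
  obtain ⟨R, hR, hRW, hlip⟩ := lip z hz
  refine ⟨Metric.ball z (min R (R * ε / 4)), mem_nhdsWithin_of_mem_nhds
    (Metric.ball_mem_nhds _ (by positivity)), ?_⟩
  have hev : ∀ᶠ i in (l : Filter ι), dist (F i z) (G z) < ε / 4 :=
    Metric.tendsto_nhds.1 (hG z hz) (ε / 4) (by positivity)
  filter_upwards [hev] with i hi w hw
  have hwR : w ∈ Metric.ball z R := Metric.ball_subset_ball (min_le_left _ _) hw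
  have hb1 : R⁻¹ * ‖w - z‖ ≤ ε / 4 := by
    rw [inv_mul_le_iff₀ hR]
    rw [Metric.mem_ball, dist_eq_norm] at hw
    have := hw.le.trans (min_le_right _ _)
    linarith
  have h1 : ‖F i w - F i z‖ ≤ ε / 4 := (hlip i w hwR).trans hb1
  have h2 : ‖G w - G z‖ ≤ ε / 4 := by
    refine le_of_tendsto (((hG w (hRW hwR)).sub (hG z hz)).norm) (.of_forall fun j => ?_)
    exact (hlip j w hwR).trans hb1
  rw [dist_eq_norm] at *
  calc ‖G w - F i w‖ = ‖(G w - G z) - (F i z - G z) - (F i w - F i z)‖ := by congr 1; ring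
    _ ≤ ‖G w - G z‖ + ‖F i z - G z‖ + ‖F i w - F i z‖ := by
      refine (norm_sub_le _ _).trans ?_
      gcongr
      exact norm_sub_le _ _
    _ < ε := by linarith

end

section

/-- Normalised injective maps of a domain to the unit disc. -/
structure UnivalentToDisc (U : Set ℂ) (p : ℂ) (f : ℂ → ℂ) : Prop where
  diff : DifferentiableOn ℂ f U
  inj : InjOn f U
  der : ∀ z ∈ U, deriv f z ≠ 0
  norm_lt : ∀ z ∈ U, ‖f z‖ < 1
  base : f p = 0

theorem one_sub_conj_mul_ne_zero {c w : ℂ} (hc : ‖c‖ < 1) (hw : ‖w‖ < 1) :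
    1 - (starRingEnd ℂ) c * w ≠ 0 := by
  intro h
  have h1 : ‖(starRingEnd ℂ) c * w‖ = 1 := by rw [← sub_eq_zero.1 h, norm_one]
  rw [norm_mul, RCLike.norm_conj] at h1
  have := mul_lt_one_of_nonneg_of_lt_one_left (norm_nonneg c) hc hw.le
  linarith

/-- Moebius transformations of the disc. -/
noncomputable def moebius (c w : ℂ) : ℂ := (w - c) / (1 - (starRingEnd ℂ) c * w)

theorem hasDerivAt_moebius {c w : ℂ} (hc : ‖c‖ < 1) (hw : ‖w‖ < 1) :
    HasDerivAt (moebius c) ((1 - ‖c‖ ^ 2) / (1 - (starRingEnd ℂ) c * w) ^ 2) w := by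
  have h := one_sub_conj_mul_ne_zero hc hw
  have := ((hasDerivAt_id w).sub_const c).fun_div
    (((hasDerivAt_id w).const_mul ((starRingEnd ℂ) c)).const_sub 1) h
  refine this.congr_deriv ?_
  rw [← Complex.conj_mul' c]
  simp only [id]
  ring

theorem deriv_moebius_ne_zero {c w : ℂ} (hc : ‖c‖ < 1) (hw : ‖w‖ < 1) :
    ((1 - ‖c‖ ^ 2) / (1 - (starRingEnd ℂ) c * w) ^ 2 : ℂ) ≠ 0 := by
  refine div_ne_zero ?_ (pow_ne_zero _ (one_sub_conj_mul_ne_zero hc hw))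
  norm_cast
  nlinarith [norm_nonneg c]

theorem norm_moebius_lt_one {c w : ℂ} (hc : ‖c‖ < 1) (hw : ‖w‖ < 1) : ‖moebius c w‖ < 1 := by
  have h := one_sub_conj_mul_ne_zero hc hw
  rw [moebius, norm_div, div_lt_one (norm_pos_iff.2 h)]
  refine lt_of_pow_lt_pow_left₀ 2 (norm_nonneg _) ?_
  rw [← Complex.normSq_eq_norm_sq, ← Complex.normSq_eq_norm_sq]
  have e : Complex.normSq (1 - (starRingEnd ℂ) c * w) - Complex.normSq (w - c)
      = (1 - ‖c‖ ^ 2) * (1 - ‖w‖ ^ 2) := by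
    rw [← Complex.normSq_eq_norm_sq, ← Complex.normSq_eq_norm_sq]
    simp [Complex.normSq_apply]
    ring
  have : 0 < (1 - ‖c‖ ^ 2) * (1 - ‖w‖ ^ 2) := by
    apply mul_pos <;> nlinarith [norm_nonneg c, norm_nonneg w]
  linarith

theorem moebius_injOn {c w w' : ℂ} (hc : ‖c‖ < 1) (hw : ‖w‖ < 1) (hw' : ‖w'‖ < 1)
    (h : moebius c w = moebius c w') : w = w' := by
  rw [moebius, moebius, div_eq_div_iff (one_sub_conj_mul_ne_zero hc hw)
    (one_sub_conj_mul_ne_zero hc hw')] at h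
  have h1 : (1 - ‖c‖ ^ 2 : ℂ) * (w - w') = 0 := by
    rw [← Complex.conj_mul' c]
    linear_combination h
  have h2 : (1 - ‖c‖ ^ 2 : ℂ) ≠ 0 := by
    norm_cast
    nlinarith [norm_nonneg c]
  exact sub_eq_zero.1 ((mul_eq_zero.1 h1).resolve_left h2)

theorem UnivalentToDisc.moebius_comp {U : Set ℂ} (hU : IsOpen U) {p : ℂ} {f : ℂ → ℂ} (hp : p ∈ U)
    (hd : DifferentiableOn ℂ f U) (hi : InjOn f U) (hder : ∀ z ∈ U, deriv f z ≠ 0)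
    (hn : ∀ z ∈ U, ‖f z‖ < 1) : UnivalentToDisc U p (fun z => moebius (f p) (f z)) := by
  have hD : ∀ z ∈ U, HasDerivAt (fun z => moebius (f p) (f z)) _ z := fun z hz =>
    (hasDerivAt_moebius (hn p hp) (hn z hz)).comp z
      ((hd.differentiableAt (hU.mem_nhds hz)).hasDerivAt)
  exact
  { diff := fun z hz => (hD z hz).differentiableAt.differentiableWithinAt
    inj := fun z hz w hw h => hi hz hw (moebius_injOn (hn p hp) (hn z hz) (hn w hw) h)
    der := fun z hz => by
      rw [(hD z hz).deriv]
      exact mul_ne_zero (deriv_moebius_ne_zero (hn p hp) (hn z hz)) (hder z hz)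
    norm_lt := fun z hz => norm_moebius_lt_one (hn p hp) (hn z hz)
    base := by simp [moebius] }

/-- The square root trick. -/
theorem UnivalentToDisc.exists_larger {U : Set ℂ} (hU : IsOpen U) (hUc : IsSimplyConnected U)
    {p : ℂ} (hp : p ∈ U) {f : ℂ → ℂ} (hf : UnivalentToDisc U p f) {w : ℂ} (hw : ‖w‖ < 1)
    (hwf : w ∉ f '' U) : ∃ g, UnivalentToDisc U p g ∧ ‖deriv f p‖ < ‖deriv g p‖ := by
  have hM : ∀ z ∈ U, HasDerivAt (fun z => moebius w (f z)) _ z := fun z hz =>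
    (hasDerivAt_moebius hw (hf.norm_lt z hz)).comp z
      ((hf.diff.differentiableAt (hU.mem_nhds hz)).hasDerivAt)
  have hM0 : ∀ z ∈ U, moebius w (f z) ≠ 0 := fun z hz h => by
    rw [moebius, div_eq_zero_iff] at h
    rcases h with h | h
    · exact hwf ⟨z, hz, sub_eq_zero.1 h⟩
    · exact one_sub_conj_mul_ne_zero hw (hf.norm_lt z hz) h
  obtain ⟨s, hsc, hs⟩ := Complex.exists_continuousOn_pow_eq hUc hU
    (g := fun z => moebius w (f z)) (fun z hz => (hM z hz).continuousAt.continuousWithinAt) (by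
      rintro ⟨z, hz, hz'⟩
      exact hM0 z hz hz') two_ne_zero
  have hs0 : ∀ z ∈ U, s z ≠ 0 := fun z hz h => hM0 z hz (by rw [← hs, h]; simp)
  have hds : ∀ z ∈ U, HasDerivAt s (((1 - ‖w‖ ^ 2) / (1 - (starRingEnd ℂ) w * f z) ^ 2) *
      deriv f z / (2 * s z)) z := by
    intro z hz
    refine HasDerivAt.of_comp_left (f := fun y => y ^ 2) (hsc.continuousAt (hU.mem_nhds hz)) ?_
      (hM z hz) (by simpa using hs0 z hz) (.of_forall fun z => hs z)
    simpa using hasDerivAt_pow 2 (s z)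
  have hsn : ∀ z ∈ U, ‖s z‖ < 1 := fun z hz => by
    have := norm_moebius_lt_one hw (hf.norm_lt z hz)
    rw [← hs, norm_pow] at this
    exact (pow_lt_one_iff_of_nonneg (norm_nonneg _) two_ne_zero).1 this
  have hg := UnivalentToDisc.moebius_comp hU hp
    (fun z hz => (hds z hz).differentiableAt.differentiableWithinAt)
    (fun z hz z' hz' h => hf.inj hz hz' (moebius_injOn hw (hf.norm_lt z hz) (hf.norm_lt z' hz')
      (by rw [← hs, ← hs, h])))
    (fun z hz => by
      rw [(hds z hz).deriv]
      exact div_ne_zero (mul_ne_zero (deriv_moebius_ne_zero hw (hf.norm_lt z hz)) (hf.der z hz))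
        (mul_ne_zero two_ne_zero (hs0 z hz))) hsn
  refine ⟨_, hg, ?_⟩
  have hD : HasDerivAt (fun z => moebius (s p) (s z)) _ p :=
    (hasDerivAt_moebius (hsn p hp) (hsn p hp)).comp p (hds p hp)
  rw [hD.deriv, hf.base, Complex.conj_mul']
  have hsp : ‖s p‖ ^ 2 = ‖w‖ := by
    rw [← norm_pow, hs, moebius, hf.base]; simp
  have ht0 : 0 < ‖s p‖ := norm_pos_iff.2 (hs0 p hp)
  have ht1 := hsn p hp
  have hfp : 0 < ‖deriv f p‖ := norm_pos_iff.2 (hf.der p hp)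
  have e1 : ((1 : ℂ) - ‖s p‖ ^ 2) / (1 - ‖s p‖ ^ 2) ^ 2 * ((1 - ‖w‖ ^ 2) /
      (1 - (starRingEnd ℂ) w * 0) ^ 2 * deriv f p / (2 * s p))
      = (((1 + ‖s p‖ ^ 2 : ℝ)) : ℂ) * deriv f p / (2 * s p) := by
    have h1 : ((1 : ℂ) - ‖s p‖ ^ 2) ≠ 0 := by
      norm_cast
      nlinarith
    rw [← hsp]
    have := hs0 p hp
    push_cast
    field_simp
    ring
  rw [e1, norm_div, norm_mul, norm_mul, Complex.norm_real, Real.norm_of_nonneg (by positivity),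
    Complex.norm_two, lt_div_iff₀ (by positivity)]
  nlinarith [mul_pos hfp (pow_pos (sub_pos.2 ht1) 2)]

theorem exists_riemann_map {U : Set ℂ} (hU : IsOpen U) (hUc : IsSimplyConnected U)
    (hne : U ≠ univ) (p : ℂ) (hp : p ∈ U) :
    ∃ f, UnivalentToDisc U p f ∧ f '' U = Metric.ball 0 1 := by
  obtain ⟨-, -, -, ψ, -, hψd, hψi, hψder, hψn, -⟩ := exists_bounded_root hU hUc hne
  have h0 := UnivalentToDisc.moebius_comp hU hp hψd hψi hψder hψn
  set S : Set ℝ := {x | ∃ f, UnivalentToDisc U p f ∧ ‖deriv f p‖ = x} with hS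
  have hSn : S.Nonempty := ⟨_, _, h0, rfl⟩
  obtain ⟨R, hR, hRU⟩ := Metric.mem_nhds_iff.1 (hU.mem_nhds hp)
  have hSb : BddAbove S := by
    refine ⟨1 / (R / 2), ?_⟩
    rintro _ ⟨f, hf, rfl⟩
    have hsub : Metric.closedBall p (R / 2) ⊆ U :=
      (Metric.closedBall_subset_ball (by linarith)).trans hRU
    refine Complex.norm_deriv_le_of_forall_mem_sphere_norm_le (by positivity) ?_
      (fun z hz => (hf.norm_lt z (hsub (Metric.sphere_subset_closedBall hz))).le)
    refine DifferentiableOn.diffContOnCl ?_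
    rw [closure_ball _ (by positivity)]
    exact hf.diff.mono hsub
  obtain ⟨u, -, hu, huS⟩ := exists_seq_tendsto_sSup hSn hSb
  choose F hF hFu using huS
  obtain ⟨G, hG, hGpt⟩ := exists_tendstoLocallyUniformlyOn_of_bounded (hyperfilter ℕ) hU
    (fun n => (hF n).diff) (fun n z hz => ((hF n).norm_lt z hz).le)
  have hdl := hG.deriv (.of_forall fun n => (hF n).diff) hU
  have hGd : DifferentiableOn ℂ G U := hG.differentiableOn (.of_forall fun n => (hF n).diff) hU
  have hGa : AnalyticOnNhd ℂ G U := hGd.analyticOnNhd hU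
  have hpre : IsPreconnected U := by
    have := hUc.simplyConnectedSpace
    exact isPreconnected_iff_preconnectedSpace.2 inferInstance
  have hmax : ‖deriv G p‖ = sSup S := by
    refine tendsto_nhds_unique (hdl.tendsto_at hp).norm ?_
    refine (hu.mono_left Nat.hyperfilter_le_atTop).congr fun n => ?_
    exact (hFu n).symm
  have hpos : 0 < ‖deriv G p‖ := by
    rw [hmax]
    exact lt_of_lt_of_le (norm_pos_iff.2 (h0.der p hp)) (le_csSup hSb ⟨_, h0, rfl⟩)
  have hGp : G p = 0 := by
    refine tendsto_nhds_unique (hGpt p hp) ?_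
    simp only [(hF _).base]
    exact tendsto_const_nhds
  have hconst : ∀ c : ℂ, ∀ z ∈ U, ¬ ∀ᶠ y in 𝓝 z, G y - c = 0 := by
    intro c z hz hev
    have h1 := (hGa.sub analyticOnNhd_const).eqOn_zero_of_preconnected_of_eventuallyEq_zero hpre hz hev
    have h2 : G =ᶠ[𝓝 p] fun _ => c := by
      filter_upwards [hU.mem_nhds hp] with y hy
      exact sub_eq_zero.1 (h1 hy)
    rw [h2.deriv_eq, deriv_const, norm_zero] at hpos
    exact lt_irrefl _ hpos
  have hGle : ∀ z ∈ U, ‖G z‖ ≤ 1 := fun z hz =>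
    le_of_tendsto (hGpt z hz).norm (.of_forall fun n => ((hF n).norm_lt z hz).le)
  have hGu : UnivalentToDisc U p G :=
  { diff := hGd
    inj := by
      intro x hx y hy hxy
      by_contra hne
      have hW : IsOpen (U \ {y}) := hU.sdiff isClosed_singleton
      refine ne_zero_of_tendstoLocallyUniformlyOn (l := (hyperfilter ℕ : Filter ℕ)) hW
        (F := fun n z => F n z - F n y) (G := fun z => G z - G y) (p := x)
        (fun n => ((hF n).diff.mono sdiff_subset).sub_const _) ?_ ?_ ⟨hx, hne⟩ (hconst _ x hx)
        (sub_eq_zero.2 hxy)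
      · intro n z hz h
        exact hz.2 ((hF n).inj hz.1 hy (sub_eq_zero.1 h))
      · rw [Metric.tendstoLocallyUniformlyOn_iff]
        have hG' := Metric.tendstoLocallyUniformlyOn_iff.1 (hG.mono (sdiff_subset : U \ {y} ⊆ U))
        intro ε hε z hz
        obtain ⟨t, ht, hev⟩ := hG' (ε / 2) (by positivity) z hz
        refine ⟨t, ht, ?_⟩
        have h3 : ∀ᶠ n in (hyperfilter ℕ : Filter ℕ), dist (F n y) (G y) < ε / 2 :=
          Metric.tendsto_nhds.1 (hGpt y hy) _ (by positivity)
        filter_upwards [hev, h3] with n hn h3 w hw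
        have h4 := hn w hw
        have h5 := dist_sub_sub_le (G w) (G y) (F n w) (F n y)
        rw [dist_comm (G y)] at h5
        linarith
    der := by
      intro z hz
      refine ne_zero_of_tendstoLocallyUniformlyOn (l := (hyperfilter ℕ : Filter ℕ)) hU
        (fun n => ((hF n).diff.deriv hU)) (fun n => (hF n).der) hdl hz ?_
      intro hev
      have h1 := hGa.deriv.eqOn_zero_of_preconnected_of_eventuallyEq_zero hpre hz hev
      rw [h1 hp] at hpos
      simp at hpos
    norm_lt := by
      intro z hz
      refine lt_of_le_of_ne (hGle z hz) fun h => ?_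
      have := Complex.eqOn_of_isPreconnected_of_isMaxOn_norm hpre hU hGd hz
        (fun y hy => by simpa [h] using hGle y hy)
      have h2 := this hp
      rw [hGp] at h2
      simp only [Function.const_apply] at h2
      rw [← h2] at h
      simp at h
    base := hGp }
  refine ⟨G, hGu, Subset.antisymm ?_ ?_⟩
  · rintro _ ⟨z, hz, rfl⟩
    simpa using hGu.norm_lt z hz
  · intro w hw
    by_contra hcon
    obtain ⟨g, hg, hlt⟩ := hGu.exists_larger hU hUc hp (by simpa using hw) hcon
    have := le_csSup hSb ⟨g, hg, rfl⟩
    linarith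

end

section
open MeasureTheory

/-- The energy density of a function on an open set, in polar coordinates. -/
noncomputable def polarDensity (W : Set ℂ) (χ : ℂ → ℂ) (r s : ℝ) : ENNReal :=
  ENNReal.ofReal r * W.indicator (fun z => ‖deriv χ z‖ₑ ^ 2) (r * circ s)

theorem measurable_polarDensity {W : Set ℂ} (hW : IsOpen W) (χ : ℂ → ℂ) :
    Measurable fun p : ℝ × ℝ => polarDensity W χ p.1 p.2 := by
  have h1 : Measurable (W.indicator fun z => ‖deriv χ z‖ₑ ^ 2) :=
    ((measurable_deriv χ).enorm.pow_const 2).indicator hW.measurableSet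
  have h2 : Measurable fun p : ℝ × ℝ => (p.1 : ℂ) * circ p.2 := by
    unfold circ
    exact Continuous.measurable (by fun_prop)
  exact (ENNReal.measurable_ofReal.comp measurable_fst).mul (h1.comp h2)

theorem lintegral_polarDensity_lt_top {W : Set ℂ} (hW : IsOpen W) {χ : ℂ → ℂ}
    (hχ : DifferentiableOn ℂ χ W) (hinj : InjOn χ W) (hb : ∀ z ∈ W, ‖χ z‖ < 1) :
    ∫⁻ p in Ioi (0:ℝ) ×ˢ Ioo (-Real.pi) Real.pi, polarDensity W χ p.1 p.2 < ⊤ := by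
  have h1 := Complex.lintegral_comp_polarCoord_symm (W.indicator (fun z => ‖deriv χ z‖ₑ ^ 2))
  rw [polarCoord_target] at h1
  have h2 : ∀ p : ℝ × ℝ, ENNReal.ofReal p.1 • W.indicator (fun z => ‖deriv χ z‖ₑ ^ 2)
      (Complex.polarCoord.symm p) = polarDensity W χ p.1 p.2 := by
    intro p
    rw [Complex.polarCoord_symm_apply, polarDensity, circ, Complex.exp_mul_I, smul_eq_mul]
    push_cast
    rfl
  simp only [h2] at h1
  rw [h1, lintegral_indicator hW.measurableSet]
  have h3 := lintegral_abs_det_fderiv_eq_addHaar_image (volume : Measure ℂ) (s := W) (f := χ)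
    (f' := fun z => (deriv χ z • (1 : ℂ →L[ℂ] ℂ)).restrictScalars ℝ) hW.measurableSet
    (fun z hz => by
      have := (hχ.differentiableAt (hW.mem_nhds hz)).hasDerivAt.hasFDerivAt
      refine ((this.congr_fderiv ?_).restrictScalars ℝ).hasFDerivWithinAt
      ext; simp) hinj
  have h4 : ∀ c : ℂ, ENNReal.ofReal |((c • (1 : ℂ →L[ℂ] ℂ)).restrictScalars ℝ).det| = ‖c‖ₑ ^ 2 := by
    intro c
    have : ((c • (1 : ℂ →L[ℂ] ℂ)).restrictScalars ℝ).det = ‖c‖ ^ 2 := by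
      rw [ContinuousLinearMap.det]
      have := LinearMap.det_restrictScalars (R := ℝ) (S := ℂ) (f := c • (LinearMap.id : ℂ →ₗ[ℂ] ℂ))
      rw [LinearMap.det_smul, LinearMap.det_id, Module.finrank_self, pow_one, mul_one,
        Algebra.norm_complex_apply, Complex.normSq_eq_norm_sq] at this
      exact this
    rw [this, abs_of_nonneg (by positivity), ENNReal.ofReal_pow (norm_nonneg _), ofReal_norm]
  simp only [h4] at h3
  rw [h3]
  refine lt_of_le_of_lt (measure_mono (t := Metric.ball 0 1) ?_) measure_ball_lt_top
  rintro _ ⟨z, hz, rfl⟩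
  simpa using hb z hz

theorem exists_small_of_lintegral_lt_top {J : ℝ → ENNReal} (hJ : ∫⁻ r in Ioi (0:ℝ), J r < ⊤)
    {δ η : ℝ} (hδ : 0 < δ) (hη : 0 < η) :
    ∃ r, 0 < r ∧ r < δ ∧ ENNReal.ofReal r * J r < ENNReal.ofReal η := by
  by_contra! hcon
  have h1 : ∀ r ∈ Ioc (0:ℝ) (δ / 2), ‖η * r⁻¹‖ₑ ≤ J r := by
    intro r hr
    have h2 := hcon r hr.1 (by linarith [hr.2])
    rw [Real.enorm_of_nonneg (mul_nonneg hη.le (inv_nonneg.2 hr.1.le)),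
      ENNReal.ofReal_mul hη.le, ENNReal.ofReal_inv_of_pos hr.1, ← div_eq_mul_inv]
    exact ENNReal.div_le_of_le_mul' h2
  have h3 : ∫⁻ r in Ioc (0:ℝ) (δ / 2), ‖η * r⁻¹‖ₑ < ⊤ :=
    ((setLIntegral_mono' measurableSet_Ioc h1).trans
      (lintegral_mono_set Ioc_subset_Ioi_self)).trans_lt hJ
  have h4 : IntervalIntegrable (fun r : ℝ => η * r⁻¹) volume 0 (δ / 2) := by
    rw [intervalIntegrable_iff_integrableOn_Ioc_of_le (by positivity)]
    exact ⟨(measurable_inv.const_mul η).aestronglyMeasurable, h3⟩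
  have h5 : IntervalIntegrable (fun r : ℝ => r⁻¹) volume 0 (δ / 2) := by
    refine (h4.const_mul η⁻¹).congr fun x _ => ?_
    simp [hη.ne']
  rw [intervalIntegrable_inv_iff] at h5
  rcases h5 with h5 | h5
  · linarith
  · exact h5 left_mem_uIcc

theorem enorm_le_sq_div_add (x : ENNReal) {l : ENNReal} (h0 : l ≠ 0) (h1 : l ≠ ⊤) :
    x ≤ x ^ 2 / l + l := by
  rcases le_total x l with h | h
  · exact h.trans le_add_self
  · refine le_trans ?_ le_self_add
    rw [ENNReal.le_div_iff_mul_le (Or.inl h0) (Or.inl h1), sq]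
    gcongr

theorem enorm_sub_le_lintegral_deriv {F F' : ℝ → ℂ} {s t : ℝ} (hst : s ≤ t)
    (hF : ∀ x ∈ Icc s t, HasDerivAt F (F' x) x) (hF' : ContinuousOn F' (Icc s t)) :
    ‖F t - F s‖ₑ ≤ ∫⁻ x in Icc s t, ‖F' x‖ₑ := by
  rw [← intervalIntegral.integral_eq_sub_of_hasDerivAt (by rwa [uIcc_of_le hst])
    (by rw [← uIcc_of_le hst] at hF'; exact hF'.intervalIntegrable),
    intervalIntegral.integral_of_le hst]
  exact (enorm_integral_le_lintegral_enorm _).trans (lintegral_mono_set Ioc_subset_Icc_self)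

theorem hasDerivAt_circ (t : ℝ) : HasDerivAt circ (Complex.I * circ t) t := by
  have h := ((hasDerivAt_id (t : ℂ)).mul_const Complex.I).cexp.comp_ofReal
  refine (h.congr_deriv ?_)
  simp [circ, mul_comm]

/-- Short circular cross-cuts: images of suitable small circular arcs are short. -/
theorem exists_short_arc {W : Set ℂ} (hW : IsOpen W) {χ : ℂ → ℂ}
    (hχ : DifferentiableOn ℂ χ W) (hinj : InjOn χ W) (hb : ∀ z ∈ W, ‖χ z‖ < 1) {δ η : ℝ}
    (hδ : 0 < δ) (hη : 0 < η) : ∃ r, 0 < r ∧ r < δ ∧ ∀ s t : ℝ, -Real.pi < s → s ≤ t →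
      t < Real.pi → (∀ u ∈ Icc s t, (r : ℂ) * circ u ∈ W) →
      dist (χ (r * circ t)) (χ (r * circ s)) ≤ η := by
  have hfin := lintegral_polarDensity_lt_top hW hχ hinj hb
  have hm := measurable_polarDensity hW χ
  rw [Measure.volume_eq_prod, setLIntegral_prod _ hm.aemeasurable] at hfin
  set l : ℝ := η / (1 + 2 * Real.pi) with hl
  have hl0 : 0 < l := by positivity
  obtain ⟨r, hr0, hrδ, hr⟩ := exists_small_of_lintegral_lt_top hfin hδ (pow_pos hl0 2)
  refine ⟨r, hr0, hrδ, fun s t hs hst ht hu => ?_⟩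
  have hD : ∀ u ∈ Icc s t, HasDerivAt (fun u : ℝ => χ (r * circ u))
      (deriv χ (r * circ u) * (r * (Complex.I * circ u))) u := fun u h =>
    ((hχ.differentiableAt (hW.mem_nhds (hu u h))).hasDerivAt).comp_of_eq u
      ((hasDerivAt_circ u).const_mul (r : ℂ)) rfl
  have hc : Continuous circ := by unfold circ; fun_prop
  have hdc : ContinuousOn (fun u : ℝ => deriv χ (r * circ u) * (r * (Complex.I * circ u))) (Icc s t) := by
    refine ContinuousOn.mul ?_ (by fun_prop)
    exact ((hχ.deriv hW).continuousOn).comp (by fun_prop) hu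
  have h1 := enorm_sub_le_lintegral_deriv hst hD hdc
  have hlt : ENNReal.ofReal l ≠ ⊤ := ENNReal.ofReal_ne_top
  have hl' : ENNReal.ofReal l ≠ 0 := by simpa using hl0
  have h2 : ∫⁻ u in Icc s t, ‖deriv χ (r * circ u) * (r * (Complex.I * circ u))‖ₑ ≤
      ∫⁻ u in Ioo (-Real.pi) Real.pi, (ENNReal.ofReal r * polarDensity W χ r u / ENNReal.ofReal l
        + ENNReal.ofReal l) := by
    refine le_trans (setLIntegral_mono' (g := fun u => ENNReal.ofReal r * polarDensity W χ r u /
      ENNReal.ofReal l + ENNReal.ofReal l) measurableSet_Icc fun u h => ?_)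
      (lintegral_mono_set fun u h => ⟨hs.trans_le h.1, h.2.trans_lt ht⟩)
    refine (enorm_le_sq_div_add _ hl' hlt).trans_eq ?_
    rw [polarDensity, indicator_of_mem (hu u h), enorm_mul, enorm_mul, enorm_mul,
      ← ofReal_norm (circ u), norm_circ, ← ofReal_norm Complex.I, Complex.norm_I, ← ofReal_norm (r:ℂ),
      Complex.norm_real, Real.norm_of_nonneg hr0.le]
    simp only [ENNReal.ofReal_one, mul_one]
    congr 2
    ring
  have h3 : ∫⁻ u in Ioo (-Real.pi) Real.pi, (ENNReal.ofReal r * polarDensity W χ r u / ENNReal.ofReal l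
        + ENNReal.ofReal l) ≤ ENNReal.ofReal η := by
    have hmr : Measurable fun u => polarDensity W χ r u := hm.comp (measurable_const.prodMk measurable_id)
    rw [lintegral_add_right _ measurable_const, setLIntegral_const, Real.volume_Ioo]
    simp only [div_eq_mul_inv]
    rw [lintegral_mul_const _ (hmr.const_mul _), lintegral_const_mul _ hmr]
    calc _ ≤ ENNReal.ofReal (l ^ 2) * (ENNReal.ofReal l)⁻¹ + ENNReal.ofReal l *
          ENNReal.ofReal (Real.pi - -Real.pi) := by gcongr
      _ = ENNReal.ofReal η := by
        rw [← ENNReal.ofReal_inv_of_pos hl0, ← ENNReal.ofReal_mul (by positivity),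
          ← ENNReal.ofReal_mul hl0.le, ← ENNReal.ofReal_add (by positivity)
          (mul_nonneg hl0.le (by linarith [Real.pi_pos]))]
        congr 1
        rw [hl]
        field_simp
        ring
  have h4 := h1.trans (h2.trans h3)
  rw [← ofReal_norm, ENNReal.ofReal_le_ofReal_iff hη.le] at h4
  rwa [dist_eq_norm]

/-- Radial limits exist almost everywhere. -/
theorem ae_exists_radial_limit {χ : ℂ → ℂ} (hχ : DifferentiableOn ℂ χ (Metric.ball 0 1))
    (hinj : InjOn χ (Metric.ball 0 1)) (hb : ∀ z ∈ Metric.ball (0:ℂ) 1, ‖χ z‖ < 1) :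
    ∀ᵐ s ∂(volume.restrict (Ioo (-Real.pi) Real.pi)),
      ∃ u, Tendsto (fun r : ℝ => χ (r * circ s)) (𝓝[<] 1) (𝓝 u) := by
  have hW : IsOpen (Metric.ball (0:ℂ) 1) := Metric.isOpen_ball
  have hfin := lintegral_polarDensity_lt_top hW hχ hinj hb
  have hm := measurable_polarDensity hW χ
  rw [Measure.volume_eq_prod, setLIntegral_prod_symm _ hm.aemeasurable] at hfin
  have hms : Measurable fun s => ∫⁻ r in Ioi (0:ℝ), polarDensity (Metric.ball 0 1) χ r s :=
    Measurable.lintegral_prod_left (f := fun r s => polarDensity (Metric.ball 0 1) χ r s) hm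
  filter_upwards [ae_lt_top hms hfin.ne] with s hs
  have hmem : ∀ r ∈ Ico (1/2:ℝ) 1, (r : ℂ) * circ s ∈ Metric.ball (0:ℂ) 1 := by
    intro r hr
    rw [mem_ball_zero_iff, norm_mul, norm_circ, Complex.norm_real,
      Real.norm_of_nonneg (by linarith [hr.1])]
    linarith [hr.2]
  set F' : ℝ → ℂ := fun r => deriv χ (r * circ s) * circ s with hF'
  have hD : ∀ r ∈ Ico (1/2:ℝ) 1, HasDerivAt (fun r : ℝ => χ (r * circ s)) (F' r) r := by
    intro r hr
    have h := ((hasDerivAt_id (r : ℂ)).mul_const (circ s)).comp_ofReal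
    rw [one_mul] at h
    exact ((hχ.differentiableAt (hW.mem_nhds (hmem r hr))).hasDerivAt).comp_of_eq r h rfl
  have hF'm : Measurable F' := ((measurable_deriv χ).comp
    (Continuous.measurable (by fun_prop))).mul_const _
  have hI : IntervalIntegrable F' volume (1/2) 1 := by
    rw [intervalIntegrable_iff_integrableOn_Ioo_of_le (by norm_num)]
    refine ⟨hF'm.aestronglyMeasurable, ?_⟩
    have h1 : ∫⁻ r in Ioo (1/2:ℝ) 1, ‖F' r‖ₑ ≤ ∫⁻ r in Ioo (1/2:ℝ) 1,
        (2 * polarDensity (Metric.ball 0 1) χ r s + 1) := by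
      refine setLIntegral_mono' measurableSet_Ioo fun r hr => ?_
      refine (enorm_le_sq_div_add _ one_ne_zero ENNReal.one_ne_top).trans ?_
      rw [polarDensity, indicator_of_mem (hmem r ⟨hr.1.le, hr.2⟩), hF']
      simp only [enorm_mul]
      rw [← ofReal_norm (circ s), norm_circ, ENNReal.ofReal_one, mul_one, div_one, ← mul_assoc]
      gcongr
      refine le_mul_of_one_le_left (by positivity) ?_
      rw [← ENNReal.ofReal_ofNat, ← ENNReal.ofReal_mul (by norm_num), ENNReal.one_le_ofReal]
      linarith [hr.1]
    refine h1.trans_lt ?_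
    have hmr : Measurable fun r => polarDensity (Metric.ball 0 1) χ r s :=
      hm.comp (measurable_id.prodMk measurable_const)
    rw [lintegral_add_right _ measurable_const, setLIntegral_const, lintegral_const_mul _ hmr]
    refine ENNReal.add_lt_top.2 ⟨ENNReal.mul_lt_top (by simp) ?_, by simp⟩
    refine (lintegral_mono_set ?_).trans_lt hs
    intro r hr
    exact lt_trans (by norm_num) hr.1
  have hcont := intervalIntegral.continuousOn_primitive_interval (a := 1/2) (b := 1) (f := F')
    (μ := volume) (by
      rw [uIcc_of_le (by norm_num), ← intervalIntegrable_iff_integrableOn_Icc_of_le (by norm_num)]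
      exact hI)
  have h1 : Tendsto (fun r => χ ((1/2 : ℝ) * circ s) + ∫ x in (1/2:ℝ)..r, F' x) (𝓝[<] 1)
      (𝓝 (χ ((1/2 : ℝ) * circ s) + ∫ x in (1/2:ℝ)..1, F' x)) := by
    refine tendsto_const_nhds.add ?_
    have := hcont 1 right_mem_uIcc
    refine this.mono_left (nhdsWithin_le_of_mem ?_)
    filter_upwards [Ioo_mem_nhdsLT (show (1/2:ℝ) < 1 by norm_num)] with r hr
    rw [uIcc_of_le (by norm_num)]
    exact ⟨hr.1.le, hr.2.le⟩
  refine ⟨_, h1.congr' ?_⟩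
  filter_upwards [Ioo_mem_nhdsLT (show (1/2:ℝ) < 1 by norm_num)] with r hr
  have hsub : uIcc (1/2:ℝ) r ⊆ Ico (1/2:ℝ) 1 := by
    rw [uIcc_of_le hr.1.le]
    exact fun x hx => ⟨hx.1, hx.2.trans_lt hr.2⟩
  rw [intervalIntegral.integral_eq_sub_of_hasDerivAt (fun x hx => hD x (hsub hx))
    (hI.mono_set (hsub.trans (by rw [uIcc_of_le (by norm_num)]; exact Ico_subset_Icc_self)))]
  ring

end

section

/-- The filter of sets eventually containing the members of a sequence of sets. -/
def evFilter {α : Type*} (σ : ℕ → Set α) : Filter α where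
  sets := {s | ∀ᶠ k in atTop, σ k ⊆ s}
  univ_sets := by simp
  sets_of_superset := fun {s t} hs hst => Eventually.mono (p := fun k => σ k ⊆ s) hs
    fun _ h => h.trans hst
  inter_sets := fun {s t} hs ht => Eventually.mp (p := fun k => σ k ⊆ s) hs
    (Eventually.mono (p := fun k => σ k ⊆ t) ht fun _ h h' => subset_inter h' h)

theorem mem_evFilter {α : Type*} {σ : ℕ → Set α} {s : Set α} :
    s ∈ evFilter σ ↔ ∀ᶠ k in atTop, σ k ⊆ s := Iff.rfl

theorem evFilter_neBot {α : Type*} {σ : ℕ → Set α} (h : ∀ k, (σ k).Nonempty) :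
    (evFilter σ).NeBot := by
  refine ⟨fun hb => ?_⟩
  have h1 : (∅ : Set α) ∈ evFilter σ := by rw [hb]; trivial
  obtain ⟨k, hk⟩ := (mem_evFilter.1 h1).exists
  exact (h k).ne_empty (subset_empty_iff.1 hk)

theorem evFilter_comp_le {α : Type*} (σ : ℕ → Set α) {j : ℕ → ℕ} (hj : Tendsto j atTop atTop) :
    evFilter (fun k => σ (j k)) ≤ evFilter σ := fun _ hs => hj.eventually hs

theorem tendsto_evFilter {α : Type*} {σ : ℕ → Set α} {z : ℕ → α} (h : ∀ k, z k ∈ σ k) :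
    Tendsto z atTop (evFilter σ) := fun _ hs =>
  (mem_evFilter.1 hs).mono fun k hk => hk (h k)

section
variable {X Y : Type*} [TopologicalSpace X] [TopologicalSpace Y]

/-- The ideal boundary points of a set: points outside of it, and infinity. -/
def IsEnd (U : Set X) (l : Filter X) : Prop := (∃ y, y ∉ U ∧ l = 𝓝 y) ∨ l = cocompact X

theorem IsEnd.eq_or_disjoint [T2Space X] [LocallyCompactSpace X] {U : Set X} {l l' : Filter X}
    (h : IsEnd U l) (h' : IsEnd U l') : l = l' ∨ Disjoint l l' := by
  rcases h with ⟨y, -, rfl⟩ | rfl <;> rcases h' with ⟨y', -, rfl⟩ | rfl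
  · by_cases h : y = y'
    · exact Or.inl (h ▸ rfl)
    · exact Or.inr (disjoint_nhds_nhds.2 h)
  · exact Or.inr (disjoint_nhds_cocompact y)
  · exact Or.inr (disjoint_nhds_cocompact y').symm
  · exact Or.inl rfl

theorem IsEnd.disjoint_nhds [T2Space X] [LocallyCompactSpace X] {U : Set X} {l : Filter X}
    (h : IsEnd U l) {y : X} (hy : y ∈ U) : Disjoint l (𝓝 y) := by
  rcases h with ⟨y', hy', rfl⟩ | rfl
  · exact disjoint_nhds_nhds.2 fun h => hy' (h ▸ hy)
  · exact (disjoint_nhds_cocompact y).symm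

theorem IsEnd.map {U : Set X} {l : Filter X} (h : IsEnd U l) (e : X ≃ₜ Y) :
    IsEnd (e '' U) (Filter.map e l) := by
  rcases h with ⟨y, hy, rfl⟩ | rfl
  · exact Or.inl ⟨e y, by simpa using hy, e.map_nhds_eq y⟩
  · exact Or.inr e.map_cocompact

/-- A parametrisation of a planar domain by the unit disc, with the boundary behaviour of a
conformal map. -/
structure DiscModel (U : Set X) (χ : ℂ → X) : Prop where
  inj : InjOn χ (Metric.ball 0 1)
  img : χ '' Metric.ball 0 1 = U
  nhds : ∀ z ∈ Metric.ball (0:ℂ) 1, map χ (𝓝 z) = 𝓝 (χ z)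
  wolff : ∀ x : ℝ, ∃ r : ℕ → ℝ, (∀ k, 0 < r k) ∧ Tendsto r atTop (𝓝 0) ∧ ∃ l, IsEnd U l ∧
    Tendsto χ (evFilter fun k => Metric.sphere (circ x) (r k) ∩ Metric.ball 0 1) l
  radial : ∀ α β : ℝ, α < β → ∀ S : Set X, S.Finite → ∃ θ ∈ Ioo α β, ∃ y, y ∉ U ∧ y ∉ S ∧
    Tendsto (fun r : ℝ => χ (r * circ θ)) (𝓝[<] 1) (𝓝 y)

theorem DiscModel.comp_homeo {U : Set X} {χ : ℂ → X} (h : DiscModel U χ) (e : X ≃ₜ Y) :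
    DiscModel (e '' U) (fun z => e (χ z)) where
  inj := fun x hx y hy hxy => h.inj hx hy (e.injective hxy)
  img := by rw [← h.img, image_image]
  nhds := fun z hz => by
    rw [← e.map_nhds_eq, ← h.nhds z hz, Filter.map_map]; rfl
  wolff := fun x => by
    obtain ⟨r, h0, h1, l, hl, hl'⟩ := h.wolff x
    exact ⟨r, h0, h1, _, hl.map e, tendsto_map.comp hl'⟩
  radial := fun α β hαβ S hS => by
    obtain ⟨θ, hθ, y, hy, hyS, ht⟩ := h.radial α β hαβ (e ⁻¹' S) (hS.preimage e.injective.injOn)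
    exact ⟨θ, hθ, e y, by simpa using hy, hyS, (e.continuous.tendsto y).comp ht⟩

end

end

section
open MeasureTheory

/-- The radial limit set over a single value is negligible. -/
theorem measure_radial_fibre {ψ : ℂ → ℂ} (hψ : DifferentiableOn ℂ ψ (Metric.ball 0 1))
    (hinj : InjOn ψ (Metric.ball 0 1)) (hder : ∀ z ∈ Metric.ball (0:ℂ) 1, deriv ψ z ≠ 0)
    (hb : ∀ z ∈ Metric.ball (0:ℂ) 1, ‖ψ z‖ < 1) (u : ℂ) :
    ∀ᵐ s ∂(volume.restrict (Ioo (-Real.pi) Real.pi)),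
      ¬ Tendsto (fun r : ℝ => ψ (r * circ s)) (𝓝[<] 1) (𝓝 u) := by
  have hball : ∀ r ∈ Ioo (0:ℝ) 1, ∀ s, (r : ℂ) * circ s ∈ Metric.ball (0:ℂ) 1 := by
    intro r hr s
    rw [mem_ball_zero_iff, norm_mul, norm_circ, Complex.norm_real, Real.norm_of_nonneg hr.1.le]
    linarith [hr.2]
  have hev : ∀ᶠ r : ℝ in 𝓝[<] 1, r ∈ Ioo (0:ℝ) 1 := Ioo_mem_nhdsLT one_pos
  by_cases hu : u ∈ ψ '' Metric.ball 0 1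
  · obtain ⟨z, hz, rfl⟩ := hu
    refine .of_forall fun s ht => ?_
    have hs : HasStrictDerivAt ψ (deriv ψ z) z :=
      (hψ.analyticAt (Metric.isOpen_ball.mem_nhds hz)).hasStrictDerivAt
    have hm := hs.map_nhds_eq (hder z hz)
    have h1 : Tendsto (fun r : ℝ => (r : ℂ) * circ s) (𝓝[<] 1) (𝓝 z) := by
      intro V hV
      have h2 : ψ '' (V ∩ Metric.ball 0 1) ∈ 𝓝 (ψ z) := by
        rw [← hm]
        exact image_mem_map (inter_mem hV (Metric.isOpen_ball.mem_nhds hz))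
      rw [mem_map]
      filter_upwards [ht h2, hev] with r hr hr'
      obtain ⟨w, ⟨hw, hwB⟩, hw'⟩ := hr
      rw [hinj hwB (hball r hr' s) hw'] at hw
      exact hw
    have h2 : Tendsto (fun r : ℝ => (r : ℂ) * circ s) (𝓝[<] 1) (𝓝 (((1:ℝ) : ℂ) * circ s)) :=
      (Continuous.tendsto (by fun_prop) 1).mono_left nhdsWithin_le_nhds
    have h3 := tendsto_nhds_unique h1 h2
    rw [h3] at hz
    simp [norm_circ] at hz
  · set C : ℝ := 2 + ‖u‖ with hC
    set ρ : ℕ → ℝ := fun k => 1 - 1 / ((k:ℝ) + 2) with hρ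
    have hρ1 : ∀ k, ρ k ∈ Ioo (0:ℝ) 1 := by
      intro k
      have h1 : (1:ℝ) / (k + 2) < 1 := by
        rw [div_lt_one (by positivity)]
        linarith [show (0:ℝ) ≤ k from k.cast_nonneg]
      have h2 : (0:ℝ) < 1 / (k + 2) := by positivity
      exact ⟨by simp only [hρ]; linarith, by simp only [hρ]; linarith⟩
    have hρt : Tendsto ρ atTop (𝓝[<] 1) := by
      refine tendsto_nhdsWithin_iff.2 ⟨?_, .of_forall fun k => (hρ1 k).2⟩
      have h1 : Tendsto (fun k : ℕ => (1:ℝ) / ((k:ℝ) + 2)) atTop (𝓝 0) :=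
        tendsto_const_nhds.div_atTop (tendsto_atTop_add_const_right _ _ tendsto_natCast_atTop_atTop)
      have h2 := (tendsto_const_nhds (x := (1:ℝ))).sub h1
      rw [sub_zero] at h2
      exact h2
    have hne : ∀ z ∈ Metric.ball (0:ℂ) 1, ψ z - u ≠ 0 := fun z hz h =>
      hu ⟨z, hz, sub_eq_zero.1 h⟩
    have hle : ∀ z ∈ Metric.ball (0:ℂ) 1, ‖ψ z - u‖ ≤ C := fun z hz => by
      have := norm_sub_le (ψ z) u
      have := hb z hz
      linarith
    set v : ℕ → ℝ → ℝ := fun k s => Real.log C - Real.log ‖ψ (ρ k * circ s) - u‖ with hv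
    have hc : Continuous circ := by unfold circ; fun_prop
    have hvc : ∀ k, Continuous (v k) := by
      intro k
      refine continuous_const.sub (Continuous.log (Continuous.norm (Continuous.sub ?_ continuous_const)) ?_)
      · exact hψ.continuousOn.comp_continuous (by fun_prop) fun s => hball _ (hρ1 k) s
      · exact fun s => norm_ne_zero_iff.2 (hne _ (hball _ (hρ1 k) s))
    have hv0 : ∀ k s, 0 ≤ v k s := fun k s => sub_nonneg.2
      (Real.log_le_log (norm_pos_iff.2 (hne _ (hball _ (hρ1 k) s))) (hle _ (hball _ (hρ1 k) s)))
    have hI : ∀ k, ∫ s in (-Real.pi)..Real.pi, v k s =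
        2 * Real.pi * (Real.log C - Real.log ‖ψ 0 - u‖) := by
      intro k
      have hsub : Metric.closedBall (0:ℂ) |ρ k| ⊆ Metric.ball 0 1 := by
        rw [abs_of_pos (hρ1 k).1]
        exact Metric.closedBall_subset_ball (hρ1 k).2
      have h1 := AnalyticOnNhd.circleAverage_log_norm_of_ne_zero (c := 0) (R := ρ k)
        (g := fun z => ψ z - u)
        (((hψ.analyticOnNhd Metric.isOpen_ball).mono hsub).sub analyticOnNhd_const)
        (fun z hz => hne z (hsub hz))
      rw [Real.circleAverage_def] at h1
      have h2 : ∀ θ, circleMap 0 (ρ k) θ = ρ k * circ θ := by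
        intro θ; simp [circleMap, circ]
      simp only [h2] at h1
      have hper : Function.Periodic (v k) (2 * Real.pi) := fun s => by
        simp only [hv, circ_add_two_pi]
      have h3 := hper.intervalIntegral_add_eq (-Real.pi) 0
      rw [show -Real.pi + 2 * Real.pi = Real.pi by ring, zero_add] at h3
      rw [h3]
      have hci : IntervalIntegrable (fun s => Real.log ‖ψ (ρ k * circ s) - u‖) volume 0
          (2 * Real.pi) := by
        have : (fun s => Real.log ‖ψ (ρ k * circ s) - u‖) = fun s => Real.log C - v k s := by
          funext s; simp [hv]
        rw [this]
        exact (continuous_const.sub (hvc k)).intervalIntegrable _ _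
      simp only [hv]
      rw [intervalIntegral.integral_sub (by simp) hci, intervalIntegral.integral_const]
      rw [smul_eq_mul, inv_mul_eq_iff_eq_mul₀ (by positivity)] at h1
      rw [h1]
      simp only [smul_eq_mul]
      ring
    set w : ℕ → ℝ → ENNReal := fun k s => ENNReal.ofReal (v k s) with hw
    have hwm : ∀ k, Measurable (w k) := fun k => (hvc k).measurable.ennreal_ofReal
    have hwint : ∀ k, ∫⁻ s in Ioo (-Real.pi) Real.pi, w k s =
        ENNReal.ofReal (2 * Real.pi * (Real.log C - Real.log ‖ψ 0 - u‖)) := by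
      intro k
      rw [← hI k, intervalIntegral.integral_of_le (by linarith [Real.pi_pos]),
        integral_Ioc_eq_integral_Ioo, ofReal_integral_eq_lintegral_ofReal]
      · exact ((hvc k).integrableOn_Icc (a := -Real.pi) (b := Real.pi)).mono_set Ioo_subset_Icc_self
      · exact .of_forall fun s => hv0 k s
    have hF : ∫⁻ s in Ioo (-Real.pi) Real.pi, liminf (fun k => w k s) atTop < ⊤ := by
      refine (lintegral_liminf_le (μ := volume.restrict (Ioo (-Real.pi) Real.pi)) (u := atTop)
        hwm).trans_lt ?_
      simp only [hwint, liminf_const]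
      exact ENNReal.ofReal_lt_top
    filter_upwards [ae_lt_top (Measurable.liminf hwm) hF.ne] with s hs ht
    refine hs.ne ?_
    have h1 : Tendsto (fun k => ‖ψ (ρ k * circ s) - u‖) atTop (𝓝[>] 0) := by
      refine tendsto_nhdsWithin_iff.2 ⟨?_, .of_forall fun k =>
        norm_pos_iff.2 (hne _ (hball _ (hρ1 k) s))⟩
      simpa using ((ht.comp hρt).sub_const u).norm
    have h2 : Tendsto (fun k => v k s) atTop atTop := by
      have := tendsto_neg_atBot_atTop.comp (Real.tendsto_log_nhdsGT_zero.comp h1)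
      simpa [hv, sub_eq_add_neg] using tendsto_atTop_add_const_left _ (Real.log C) this
    exact (ENNReal.tendsto_ofReal_atTop.comp h2).liminf_eq

/-- The data attached to a conformal map of the disc: the map `φ` and a bounded univalent `ψ`
algebraically related to it. -/
structure ConfDisc (U : Set ℂ) (φ ψ : ℂ → ℂ) (a b ε : ℂ) : Prop where
  diff : DifferentiableOn ℂ φ (Metric.ball 0 1)
  inj : InjOn φ (Metric.ball 0 1)
  img : φ '' Metric.ball 0 1 = U
  der : ∀ z ∈ Metric.ball (0:ℂ) 1, deriv φ z ≠ 0
  pdiff : DifferentiableOn ℂ ψ (Metric.ball 0 1)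
  pinj : InjOn ψ (Metric.ball 0 1)
  pder : ∀ z ∈ Metric.ball (0:ℂ) 1, deriv ψ z ≠ 0
  plt : ∀ z ∈ Metric.ball (0:ℂ) 1, ‖ψ z‖ < 1
  pne : ∀ z ∈ Metric.ball (0:ℂ) 1, ψ z ≠ 0
  ne : ε ≠ 0
  rel : ∀ z ∈ Metric.ball (0:ℂ) 1, (φ z - a) * ψ z ^ 2 = (b * ψ z + ε) ^ 2

theorem exists_confDisc {U : Set ℂ} (hU : IsOpen U) (hUc : IsSimplyConnected U)
    (hne : U ≠ univ) : ∃ φ ψ a b ε, ConfDisc U φ ψ a b ε := by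
  obtain ⟨a, b, ε, ψ, h0, hd, hi, hder, hlt, hn, hrel⟩ := exists_bounded_root hU hUc hne
  obtain ⟨p, hp⟩ : U.Nonempty := by
    have := hUc.simplyConnectedSpace
    exact nonempty_coe_sort.1 (inferInstance : Nonempty U)
  obtain ⟨F, hF, hFU⟩ := exists_riemann_map hU hUc hne p hp
  set φ := Function.invFunOn F U with hφ
  have h1 : ∀ w ∈ Metric.ball (0:ℂ) 1, φ w ∈ U := fun w hw =>
    Function.invFunOn_mem (by rwa [← hFU] at hw)
  have h2 : ∀ w ∈ Metric.ball (0:ℂ) 1, F (φ w) = w := fun w hw =>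
    Function.invFunOn_eq (by rwa [← hFU] at hw)
  have hD : ∀ w ∈ Metric.ball (0:ℂ) 1, HasDerivAt φ (deriv F (φ w))⁻¹ w := by
    intro w hw
    have hs : HasStrictDerivAt F (deriv F (φ w)) (φ w) :=
      (hF.diff.analyticAt (hU.mem_nhds (h1 w hw))).hasStrictDerivAt
    have hm := hs.map_nhds_eq (hF.der _ (h1 w hw))
    rw [h2 w hw] at hm
    have hB := Metric.isOpen_ball.mem_nhds hw
    refine HasDerivAt.of_local_left_inverse ?_ hs.hasDerivAt (hF.der _ (h1 w hw)) ?_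
    · intro V hV
      have h3 : F '' (V ∩ U) ∈ 𝓝 w := by
        rw [← hm]
        exact image_mem_map (inter_mem hV (hU.mem_nhds (h1 w hw)))
      rw [mem_map]
      filter_upwards [h3, hB] with w' hw' hwB
      obtain ⟨z, ⟨hzV, hzU⟩, rfl⟩ := hw'
      rwa [mem_preimage, hF.inj (h1 _ hwB) hzU (h2 _ hwB)]
    · filter_upwards [hB] with w' hw' using h2 w' hw'
  have hφi : InjOn φ (Metric.ball 0 1) := fun x hx y hy h => by
    rw [← h2 x hx, h, h2 y hy]
  have hpD : ∀ w ∈ Metric.ball (0:ℂ) 1, HasDerivAt (fun w => ψ (φ w))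
      (deriv ψ (φ w) * (deriv F (φ w))⁻¹) w := fun w hw =>
    (hd.differentiableAt (hU.mem_nhds (h1 w hw))).hasDerivAt.comp w (hD w hw)
  exact ⟨φ, fun w => ψ (φ w), a, b, ε,
    { diff := fun w hw => (hD w hw).differentiableAt.differentiableWithinAt
      inj := hφi
      img := by
        refine Subset.antisymm (image_subset_iff.2 h1) fun z hz => ?_
        have hz' : F z ∈ Metric.ball (0:ℂ) 1 := hFU ▸ mem_image_of_mem F hz
        exact ⟨F z, hz', hF.inj (h1 _ hz') hz (h2 _ hz')⟩
      der := fun w hw => by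
        rw [(hD w hw).deriv]
        exact inv_ne_zero (hF.der _ (h1 w hw))
      pdiff := fun w hw => (hpD w hw).differentiableAt.differentiableWithinAt
      pinj := fun x hx y hy h => hφi hx hy (hi (h1 x hx) (h1 y hy) h)
      pder := fun w hw => by
        rw [(hpD w hw).deriv]
        exact mul_ne_zero (hder _ (h1 w hw)) (inv_ne_zero (hF.der _ (h1 w hw)))
      plt := fun w hw => hlt _ (h1 w hw)
      pne := fun w hw => hn _ (h1 w hw)
      ne := h0
      rel := fun w hw => hrel _ (h1 w hw) }⟩

end

section
open MeasureTheory

theorem ConfDisc.map_nhds {U : Set ℂ} {φ ψ : ℂ → ℂ} {a b ε : ℂ} (h : ConfDisc U φ ψ a b ε)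
    {z : ℂ} (hz : z ∈ Metric.ball (0:ℂ) 1) : map φ (𝓝 z) = 𝓝 (φ z) := by
  have hs : HasStrictDerivAt φ (deriv φ z) z :=
    (h.diff.analyticAt (Metric.isOpen_ball.mem_nhds hz)).hasStrictDerivAt
  exact hs.map_nhds_eq (h.der z hz)

theorem ConfDisc.eq_add {U : Set ℂ} {φ ψ : ℂ → ℂ} {a b ε : ℂ} (h : ConfDisc U φ ψ a b ε)
    {z : ℂ} (hz : z ∈ Metric.ball (0:ℂ) 1) : φ z = a + (b + ε * (ψ z)⁻¹) ^ 2 := by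
  have h1 := h.rel z hz
  have h2 := h.pne z hz
  field_simp
  linear_combination h1

theorem ConfDisc.isEnd {U : Set ℂ} {φ ψ : ℂ → ℂ} {a b ε : ℂ} (h : ConfDisc U φ ψ a b ε)
    {F : Filter ℂ} [F.NeBot] (hF : Metric.ball (0:ℂ) 1 ∈ F)
    (hn : Tendsto (fun z : ℂ => ‖z‖) F (𝓝 1)) {u : ℂ} (hu : Tendsto ψ F (𝓝 u)) :
    ∃ l, IsEnd U l ∧ Tendsto φ F l ∧ (u ≠ 0 → l = 𝓝 (a + (b + ε * u⁻¹) ^ 2)) := by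
  have heq : φ =ᶠ[F] fun z => a + (b + ε * (ψ z)⁻¹) ^ 2 := by
    filter_upwards [hF] with z hz using h.eq_add hz
  by_cases h0 : u = 0
  · subst h0
    refine ⟨cocompact ℂ, Or.inr rfl, ?_, fun h => (h rfl).elim⟩
    have h1 : Tendsto ψ F (𝓝[≠] 0) := tendsto_nhdsWithin_iff.2
      ⟨hu, by filter_upwards [hF] with z hz using h.pne z hz⟩
    have h2 := tendsto_inv₀_nhdsNE_zero.comp h1
    have h3 := (tendsto_mul_left_cobounded h.ne).comp h2
    have h4 := (tendsto_const_add_cobounded b).comp h3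
    have h5 := (tendsto_pow_cobounded_cobounded (α := ℂ) two_ne_zero).comp h4
    have h6 := (tendsto_const_add_cobounded a).comp h5
    rw [← Metric.cobounded_eq_cocompact]
    exact Tendsto.congr' heq.symm h6
  · have hT : Tendsto φ F (𝓝 (a + (b + ε * u⁻¹) ^ 2)) :=
      Tendsto.congr' heq.symm (((hu.inv₀ h0).const_mul ε |>.const_add b).pow 2 |>.const_add a)
    refine ⟨_, Or.inl ⟨_, fun hU => ?_, rfl⟩, hT, fun _ => rfl⟩
    rw [← h.img] at hU
    obtain ⟨z, hz, hz'⟩ := hU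
    rw [← hz', ← h.map_nhds hz] at hT
    have hz1 : ‖z‖ < 1 := by simpa using hz
    have h1 : Metric.ball z ((1 - ‖z‖) / 2) ∩ Metric.ball 0 1 ∈ 𝓝 z :=
      inter_mem (Metric.ball_mem_nhds z (by linarith)) (Metric.isOpen_ball.mem_nhds hz)
    have h2 : φ ⁻¹' _ ∈ F := hT (image_mem_map h1)
    have h3 : (fun z : ℂ => ‖z‖) ⁻¹' _ ∈ F := hn (Ioi_mem_nhds (show (1 + ‖z‖) / 2 < 1 by linarith))
    obtain ⟨w, ⟨⟨w', ⟨hw', hwB'⟩, hww⟩, hwB⟩, hw⟩ :=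
      Filter.nonempty_of_mem (inter_mem (inter_mem h2 hF) h3)
    rw [h.inj hwB' hwB hww] at hw'
    have h4 : (1 + ‖z‖) / 2 < ‖w‖ := hw
    have h5 : dist w z < (1 - ‖z‖) / 2 := hw'
    rw [dist_eq_norm] at h5
    have := norm_sub_norm_le w z
    linarith

theorem mul_circ_mem_ball_iff {r u : ℝ} (hr0 : 0 < r) :
    (r : ℂ) * circ u ∈ Metric.ball (1:ℂ) 1 ↔ r / 2 < Real.cos u := by
  have h1 : ‖(r : ℂ) * circ u - 1‖ ^ 2 = 1 - 2 * r * Real.cos u + r ^ 2 := by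
    have hc : circ u = ⟨Real.cos u, Real.sin u⟩ := by
      apply Complex.ext <;> simp [circ, Complex.exp_re, Complex.exp_im]
    rw [← Complex.normSq_eq_norm_sq, Complex.normSq_apply, hc]
    simp
    linear_combination r ^ 2 * Real.sin_sq_add_cos_sq u
  rw [Metric.mem_ball, dist_eq_norm, ← sq_lt_one_iff₀ (norm_nonneg _), h1]
  constructor
  · intro h; nlinarith
  · intro h; nlinarith

/-- Points of a circular cross-cut of the disc in polar coordinates around its centre. -/
theorem exists_angle (x : ℝ) {r : ℝ} (hr0 : 0 < r) {z : ℂ}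
    (hz : z ∈ Metric.sphere (circ x) r ∩ Metric.ball 0 1) :
    ∃ u : ℝ, |u| < Real.pi / 2 ∧ r / 2 < Real.cos u ∧ z = circ x * (1 - r * circ u) := by
  set ζ := circ x with hζ
  have hζ1 : ‖ζ‖ = 1 := norm_circ x
  have hζ0 : ζ ≠ 0 := by rw [← norm_pos_iff, hζ1]; exact one_pos
  obtain ⟨hz, hz1⟩ := hz
  set w : ℂ := 1 - z / ζ with hw
  have hzw : z = ζ * (1 - w) := by rw [hw]; field_simp; ring
  have hwr : ‖w‖ = r := by
    have : w = (ζ - z) / ζ := by rw [hw]; field_simp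
    rw [this, norm_div, hζ1, div_one, ← dist_eq_norm, dist_comm]
    exact hz
  have hwc : w = r * circ w.arg := by
    rw [← hwr]; exact (Complex.norm_mul_exp_arg_mul_I w).symm
  have hwB : (r : ℂ) * circ w.arg ∈ Metric.ball (1:ℂ) 1 := by
    rw [← hwc, Metric.mem_ball, dist_comm, dist_eq_norm]
    have : ‖z‖ = ‖ζ‖ * ‖1 - w‖ := by rw [hzw, norm_mul]
    rw [hζ1, one_mul] at this
    rw [← this]
    simpa using hz1
  have hcos := (mul_circ_mem_ball_iff hr0).1 hwB
  refine ⟨w.arg, ?_, hcos, by rw [← hwc]; exact hzw⟩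
  rw [Complex.abs_arg_lt_pi_div_two_iff]
  left
  have h2 : w.re = r * Real.cos w.arg := by
    rw [← hwr, Complex.norm_mul_cos_arg]
  rw [h2]
  exact mul_pos hr0 (by linarith)

theorem circ_mul_one_sub_mem {x r u : ℝ} (hr0 : 0 < r) (hu : r / 2 < Real.cos u) :
    circ x * (1 - r * circ u) ∈ Metric.sphere (circ x) r ∩ Metric.ball 0 1 := by
  constructor
  · rw [mem_sphere_iff_norm, show circ x * (1 - r * circ u) - circ x = -(circ x * (r * circ u)) by
      ring, norm_neg, norm_mul, norm_mul, norm_circ, norm_circ, Complex.norm_real,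
      Real.norm_of_nonneg hr0.le]
    ring
  · have := (mul_circ_mem_ball_iff hr0).2 hu
    rw [mem_ball_zero_iff, norm_mul, norm_circ, one_mul, ← dist_eq_norm, dist_comm]
    exact this

theorem isPreconnected_crosscut (x : ℝ) {r : ℝ} (hr0 : 0 < r) :
    IsPreconnected (Metric.sphere (circ x) r ∩ Metric.ball 0 1) := by
  have hset : Metric.sphere (circ x) r ∩ Metric.ball 0 1 =
      (fun u : ℝ => circ x * (1 - r * circ u)) ''
        {u : ℝ | u ∈ Ioo (-(Real.pi / 2)) (Real.pi / 2) ∧ r / 2 < Real.cos u} := by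
    ext z
    constructor
    · intro hz
      obtain ⟨u, hu, hc, rfl⟩ := exists_angle x hr0 hz
      exact ⟨u, ⟨abs_lt.1 hu, hc⟩, rfl⟩
    · rintro ⟨u, ⟨-, hc⟩, rfl⟩
      exact circ_mul_one_sub_mem hr0 hc
  rw [hset]
  refine IsPreconnected.image ?_ _ (by unfold circ; fun_prop)
  refine OrdConnected.isPreconnected ⟨fun s hs t ht u hu => ⟨⟨?_, ?_⟩, ?_⟩⟩
  · exact hs.1.1.trans_le hu.1
  · exact hu.2.trans_lt ht.1.2
  · exact (lt_min hs.2 ht.2).trans_le (strictConcaveOn_cos_Icc.concaveOn.min_le_of_mem_Icc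
      ⟨hs.1.1.le, hs.1.2.le⟩ ⟨ht.1.1.le, ht.1.2.le⟩ hu)

theorem ConfDisc.short_crosscut {U : Set ℂ} {φ ψ : ℂ → ℂ} {a b ε : ℂ} (h : ConfDisc U φ ψ a b ε)
    (x : ℝ) {δ η : ℝ} (hδ : 0 < δ) (hη : 0 < η) : ∃ r, 0 < r ∧ r < δ ∧
      ∀ z ∈ Metric.sphere (circ x) r ∩ Metric.ball 0 1,
        ∀ z' ∈ Metric.sphere (circ x) r ∩ Metric.ball 0 1, dist (ψ z) (ψ z') ≤ η := by
  set ζ := circ x with hζ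
  have hζ1 : ‖ζ‖ = 1 := norm_circ x
  have hζ0 : ζ ≠ 0 := by rw [← norm_pos_iff, hζ1]; exact one_pos
  have hmap : ∀ w ∈ Metric.ball (1:ℂ) 1, ζ * (1 - w) ∈ Metric.ball (0:ℂ) 1 := by
    intro w hw
    rw [mem_ball_zero_iff, norm_mul, hζ1, one_mul, ← dist_eq_norm, dist_comm]
    exact hw
  obtain ⟨r, hr0, hrδ, hr⟩ := exists_short_arc (W := Metric.ball (1:ℂ) 1) Metric.isOpen_ball
    (χ := fun w => ψ (ζ * (1 - w)))
    (h.pdiff.comp (by fun_prop) hmap)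
    (fun w hw w' hw' he => by
      have := h.pinj (hmap w hw) (hmap w' hw') he
      have := mul_left_cancel₀ hζ0 this
      linear_combination -this)
    (fun w hw => h.plt _ (hmap w hw)) hδ hη
  refine ⟨r, hr0, hrδ, ?_⟩
  have key := fun u => mul_circ_mem_ball_iff (u := u) hr0
  have hpt := fun z hz => exists_angle x hr0 (z := z) hz
  have main : ∀ s t : ℝ, |s| < Real.pi / 2 → |t| < Real.pi / 2 → r / 2 < Real.cos s →
      r / 2 < Real.cos t → s ≤ t →
      dist (ψ (ζ * (1 - r * circ t))) (ψ (ζ * (1 - r * circ s))) ≤ η := by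
    intro s t hs ht hcs hct hst
    rw [abs_lt] at hs ht
    have := Real.pi_pos
    refine hr s t (by linarith) hst (by linarith) fun u hu => (key u).2 ?_
    exact (lt_min hcs hct).trans_le (strictConcaveOn_cos_Icc.concaveOn.min_le_of_mem_Icc
      ⟨hs.1.le, hs.2.le⟩ ⟨ht.1.le, ht.2.le⟩ hu)
  intro z hz z' hz'
  obtain ⟨s, hs, hcs, rfl⟩ := hpt z hz
  obtain ⟨t, ht, hct, rfl⟩ := hpt z' hz'
  rcases le_total s t with hst | hst
  · rw [dist_comm]; exact main s t hs ht hcs hct hst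
  · exact main t s ht hs hct hcs hst

theorem ConfDisc.wolff {U : Set ℂ} {φ ψ : ℂ → ℂ} {a b ε : ℂ} (h : ConfDisc U φ ψ a b ε)
    (x : ℝ) : ∃ r : ℕ → ℝ, (∀ k, 0 < r k) ∧ Tendsto r atTop (𝓝 0) ∧ ∃ l, IsEnd U l ∧
    Tendsto φ (evFilter fun k => Metric.sphere (circ x) (r k) ∩ Metric.ball 0 1) l := by
  have hpos : ∀ k : ℕ, (0:ℝ) < 1 / (k + 1) := fun k => by positivity
  choose r hr0 hrδ hr using fun k : ℕ => h.short_crosscut x (hpos k) (hpos k)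
  have hδ : Tendsto (fun k : ℕ => (1:ℝ) / (k + 1)) atTop (𝓝 0) :=
    tendsto_one_div_add_atTop_nhds_zero_nat
  have hr1 : ∀ k, r k < 1 := fun k => (hrδ k).trans_le (by
    rw [div_le_one (by positivity)]; linarith [show (0:ℝ) ≤ k from k.cast_nonneg])
  have hrt : Tendsto r atTop (𝓝 0) :=
    squeeze_zero (fun k => (hr0 k).le) (fun k => (hrδ k).le) hδ
  set σ : ℕ → Set ℂ := fun k => Metric.sphere (circ x) (r k) ∩ Metric.ball 0 1 with hσ
  set z : ℕ → ℂ := fun k => ((1 - r k : ℝ) : ℂ) * circ x with hz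
  have hzm : ∀ k, z k ∈ σ k := by
    intro k
    constructor
    · rw [mem_sphere_iff_norm]
      have : z k - circ x = ((-r k : ℝ) : ℂ) * circ x := by simp only [hz]; push_cast; ring
      rw [this, norm_mul, norm_circ, Complex.norm_real, norm_neg, Real.norm_of_nonneg (hr0 k).le,
        mul_one]
    · rw [mem_ball_zero_iff]
      simp only [hz]
      rw [norm_mul, norm_circ, Complex.norm_real, Real.norm_of_nonneg (by linarith [hr1 k])]
      linarith [hr0 k]
  obtain ⟨u, -, j, hj, hu⟩ := (isCompact_closedBall (0:ℂ) 1).tendsto_subseq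
    (x := fun k => ψ (z k)) (fun k => by simpa using (h.plt _ (hzm k).2).le)
  have hjt := hj.tendsto_atTop
  refine ⟨fun k => r (j k), fun k => hr0 _, hrt.comp hjt, ?_⟩
  have : (evFilter fun k => σ (j k)).NeBot := evFilter_neBot fun k => ⟨_, hzm (j k)⟩
  have hn : Tendsto (fun z : ℂ => ‖z‖) (evFilter fun k => σ (j k)) (𝓝 1) := by
    rw [Metric.tendsto_nhds]
    intro e he
    refine mem_evFilter.2 ?_
    filter_upwards [(hrt.comp hjt) (Iio_mem_nhds he)] with k hk w hw
    have h1 : dist w (circ x) = r (j k) := hw.1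
    have h2 : dist (‖w‖) ‖circ x‖ ≤ dist w (circ x) := dist_norm_norm_le _ _ |>.trans_eq
      (dist_eq_norm _ _).symm
    rw [norm_circ, h1] at h2
    exact h2.trans_lt hk
  have hψ : Tendsto ψ (evFilter fun k => σ (j k)) (𝓝 u) := by
    rw [Metric.tendsto_nhds]
    intro e he
    refine mem_evFilter.2 ?_
    filter_upwards [(hδ.comp hjt) (Iio_mem_nhds (half_pos he)),
      hu (Metric.ball_mem_nhds u (half_pos he))] with k hk hk' w hw
    have h1 := hr (j k) w hw _ (hzm (j k))
    have h2 : (1:ℝ) / ((j k : ℕ) + 1) < e / 2 := hk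
    have h3 : dist (ψ (z (j k))) u < e / 2 := hk'
    have := dist_triangle (ψ w) (ψ (z (j k))) u
    show dist (ψ w) u < e
    linarith
  obtain ⟨l, hl, hlt, -⟩ := h.isEnd (F := evFilter fun k => σ (j k))
    (mem_evFilter.2 (.of_forall fun k => inter_subset_right)) hn hψ
  exact ⟨l, hl, hlt⟩

theorem ConfDisc.radial {U : Set ℂ} {φ ψ : ℂ → ℂ} {a b ε : ℂ} (h : ConfDisc U φ ψ a b ε)
    (α β : ℝ) (hαβ : α < β) (S : Set ℂ) (hS : S.Finite) : ∃ θ ∈ Ioo α β, ∃ y, y ∉ U ∧ y ∉ S ∧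
      Tendsto (fun r : ℝ => φ (r * circ θ)) (𝓝[<] 1) (𝓝 y) := by
  have hπ := Real.pi_pos
  obtain ⟨n, hn, -⟩ := existsUnique_add_zsmul_mem_Ico (show 0 < 2 * Real.pi by positivity) α
    (-Real.pi)
  set α' : ℝ := α + n • (2 * Real.pi) with hα'
  set β' : ℝ := min (β + n • (2 * Real.pi)) Real.pi with hβ'
  have hαβ' : α' < β' := lt_min (by simp only [hα']; linarith) (by linarith [hn.2])
  have hsub : Ioo α' β' ⊆ Ioo (-Real.pi) Real.pi := Ioo_subset_Ioo hn.1 (min_le_right _ _)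
  set B : Set ℂ := {0} ∪ ⋃ y ∈ S, {u : ℂ | a + (b + ε * u⁻¹) ^ 2 = y} with hB
  have hBf : B.Finite := by
    refine (finite_singleton _).union (hS.biUnion fun y _ => ?_)
    obtain ⟨s, hs⟩ := IsAlgClosed.exists_pow_nat_eq (y - a) two_pos
    refine (toFinite {((s - b) / ε)⁻¹, ((-s - b) / ε)⁻¹}).subset fun u hu => ?_
    have h1 : (b + ε * u⁻¹) ^ 2 = s ^ 2 := by
      rw [hs]; exact eq_sub_of_add_eq' hu
    have h0 := h.ne
    rcases sq_eq_sq_iff_eq_or_eq_neg.1 h1 with h2 | h2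
    · left
      rw [← inv_eq_iff_eq_inv, eq_div_iff h0]
      linear_combination h2
    · right
      rw [mem_singleton_iff, ← inv_eq_iff_eq_inv, eq_div_iff h0]
      linear_combination h2
  have h1 := ae_exists_radial_limit h.pdiff h.pinj h.plt
  have h2 := (ae_ball_iff hBf.countable).2 fun u (_ : u ∈ B) =>
    measure_radial_fibre h.pdiff h.pinj h.pder h.plt u
  have h3 := ae_restrict_of_ae_restrict_of_subset hsub (h1.and h2)
  have hne : (ae (volume.restrict (Ioo α' β'))).NeBot := by
    rw [ae_neBot, Ne, Measure.restrict_eq_zero, Real.volume_Ioo, ENNReal.ofReal_eq_zero]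
    linarith
  obtain ⟨t, ⟨⟨u, hu⟩, hbad⟩, ht⟩ :=
    (h3.and (ae_restrict_mem (measurableSet_Ioo : MeasurableSet (Ioo α' β')))).exists
  have hcirc : circ (t - n • (2 * Real.pi)) = circ t := circ_eq_circ.2
    ⟨-n, by push_cast; rw [zsmul_eq_mul]; ring⟩
  refine ⟨t - n • (2 * Real.pi), ⟨by linarith [ht.1], by
    linarith [ht.2, min_le_left (β + n • (2 * Real.pi)) Real.pi]⟩, ?_⟩
  simp only [hcirc]
  have huB : u ∉ B := fun hb => hbad u hb hu
  have hu0 : u ≠ 0 := fun h0 => huB (Or.inl h0)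
  set F : Filter ℂ := map (fun r : ℝ => (r : ℂ) * circ t) (𝓝[<] 1) with hF
  have hFB : Metric.ball (0:ℂ) 1 ∈ F := by
    rw [hF, mem_map]
    filter_upwards [Ioo_mem_nhdsLT (zero_lt_one' ℝ)] with r hr
    rw [mem_preimage, mem_ball_zero_iff, norm_mul, norm_circ, Complex.norm_real,
      Real.norm_of_nonneg hr.1.le]
    linarith [hr.2]
  have hFn : Tendsto (fun z : ℂ => ‖z‖) F (𝓝 1) := by
    rw [hF, tendsto_map'_iff]
    have : Continuous fun r : ℝ => ‖(r : ℂ) * circ t‖ := by fun_prop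
    have h5 := (this.tendsto 1).mono_left (nhdsWithin_le_nhds (s := Iio 1))
    simpa [norm_circ, Function.comp_def] using h5
  obtain ⟨l, hl, hlt, hle⟩ := h.isEnd hFB hFn (u := u) hu
  rw [hle hu0] at hl hlt
  have hyU : a + (b + ε * u⁻¹) ^ 2 ∉ U := fun hyU => by
    have h6 := hl.disjoint_nhds hyU
    rw [disjoint_self] at h6
    exact (inferInstance : (𝓝 (a + (b + ε * u⁻¹) ^ 2)).NeBot).ne h6
  exact ⟨_, hyU, fun hyS => huB (Or.inr (mem_biUnion hyS rfl)), hlt⟩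

theorem ConfDisc.discModel {U : Set ℂ} {φ ψ : ℂ → ℂ} {a b ε : ℂ} (h : ConfDisc U φ ψ a b ε) :
    DiscModel U φ where
  inj := h.inj
  img := h.img
  nhds := fun _ hz => h.map_nhds hz
  wolff := h.wolff
  radial := h.radial

end

section

/-- Open circular sectors based at the origin, of infinite radius. -/
def sector (s t : ℝ) : Set ℂ := Complex.exp '' {z | s < z.im ∧ z.im < t}

theorem isOpen_sector (s t : ℝ) : IsOpen (sector s t) := by
  have : IsOpenMap Complex.exp := IsOpenMap.of_nhds_le fun z =>
    ((Complex.hasStrictDerivAt_exp z).map_nhds_eq (Complex.exp_ne_zero z)).ge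
  exact this _ ((isOpen_lt continuous_const Complex.continuous_im).inter
    (isOpen_lt Complex.continuous_im continuous_const))

theorem mem_sector {s t : ℝ} {z : ℂ} :
    z ∈ sector s t ↔ ∃ r θ : ℝ, 0 < r ∧ s < θ ∧ θ < t ∧ z = r * circ θ := by
  constructor
  · rintro ⟨w, hw, rfl⟩
    refine ⟨Real.exp w.re, w.im, Real.exp_pos _, hw.1, hw.2, ?_⟩
    conv_lhs => rw [← Complex.re_add_im w]
    rw [Complex.exp_add, Complex.ofReal_exp, circ]
  · rintro ⟨r, θ, hr, h1, h2, rfl⟩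
    refine ⟨(Real.log r : ℂ) + θ * Complex.I, by simpa using ⟨h1, h2⟩, ?_⟩
    rw [Complex.exp_add, ← Complex.ofReal_exp, Real.exp_log hr, circ]

theorem eq_of_mul_circ_eq {r r' s t : ℝ} (hr : 0 < r) (hr' : 0 < r')
    (h : (r : ℂ) * circ s = r' * circ t) : r = r' ∧ circ s = circ t := by
  have h1 := congrArg norm h
  simp only [norm_mul, norm_circ, Complex.norm_real, mul_one, Real.norm_of_nonneg hr.le,
    Real.norm_of_nonneg hr'.le] at h1
  subst h1
  exact ⟨rfl, mul_left_cancel₀ (by exact_mod_cast hr.ne') h⟩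

theorem disjoint_sector {s t u : ℝ} (h : u ≤ s + 2 * Real.pi) :
    Disjoint (sector s t) (sector t u) := by
  rw [Set.disjoint_left]
  intro z hz hz'
  obtain ⟨r, θ, hr, h1, h2, rfl⟩ := mem_sector.1 hz
  obtain ⟨r', θ', hr', h1', h2', he⟩ := mem_sector.1 hz'
  exact circ_ne (h2.trans h1') (by linarith) (eq_of_mul_circ_eq hr hr' he).2.symm

theorem exists_polar (s : ℝ) {z : ℂ} (hz : z ≠ 0) :
    ∃ r θ : ℝ, 0 < r ∧ s ≤ θ ∧ θ < s + 2 * Real.pi ∧ z = r * circ θ := by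
  obtain ⟨n, hn, -⟩ := existsUnique_add_zsmul_mem_Ico (show 0 < 2 * Real.pi by positivity) z.arg s
  refine ⟨‖z‖, z.arg + n • (2 * Real.pi), norm_pos_iff.2 hz, hn.1, hn.2, ?_⟩
  rw [circ_eq_circ.2 ⟨n, by rw [zsmul_eq_mul]⟩]
  exact (Complex.norm_mul_exp_arg_mul_I z).symm

theorem sector_cover {s t : ℝ} {z : ℂ} (hz : z ≠ 0)
    (hs : ∀ r : ℝ, 0 < r → z ≠ r * circ s) (ht : ∀ r : ℝ, 0 < r → z ≠ r * circ t) :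
    z ∈ sector s t ∪ sector t (s + 2 * Real.pi) := by
  obtain ⟨r, θ, hr, h1, h2, rfl⟩ := exists_polar s hz
  have h1' : s < θ := lt_of_le_of_ne h1 fun h => hs r hr (h ▸ rfl)
  rcases lt_trichotomy θ t with h | h | h
  · exact Or.inl (mem_sector.2 ⟨r, θ, hr, h1', h, rfl⟩)
  · exact (ht r hr (h ▸ rfl)).elim
  · exact Or.inr (mem_sector.2 ⟨r, θ, hr, h, h2, rfl⟩)

/-- A connected set meeting two complementary sectors meets the origin or the separating rays. -/
theorem meets_rays {s t : ℝ} {σ : Set ℂ} (hσ : IsPreconnected σ) (h0 : (0:ℂ) ∉ σ)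
    (h1 : (σ ∩ sector s t).Nonempty) (h2 : (σ ∩ sector t (s + 2 * Real.pi)).Nonempty) :
    ∃ r : ℝ, 0 < r ∧ ((r : ℂ) * circ s ∈ σ ∨ (r : ℂ) * circ t ∈ σ) := by
  by_contra! hcon
  obtain ⟨z, -, hz, hz'⟩ := hσ _ _ (isOpen_sector s t) (isOpen_sector t (s + 2 * Real.pi))
    (fun z hz => sector_cover (fun h => h0 (h ▸ hz)) (fun r hr h => (hcon r hr).1 (h ▸ hz))
      fun r hr h => (hcon r hr).2 (h ▸ hz)) h1 h2
  exact Set.disjoint_left.1 (disjoint_sector le_rfl) hz hz'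

theorem circ_mem_sector {s t θ : ℝ} (h1 : s < θ) (h2 : θ < t) : circ θ ∈ sector s t :=
  mem_sector.2 ⟨1, θ, one_pos, h1, h2, by simp⟩

section
variable {X : Type*} [TopologicalSpace X] {U : Set X} {χ : ℂ → X}

namespace DiscModel

theorem continuousAt (h : DiscModel U χ) {z : ℂ} (hz : z ∈ Metric.ball (0:ℂ) 1) :
    ContinuousAt χ z := (h.nhds z hz).le

theorem continuousOn (h : DiscModel U χ) : ContinuousOn χ (Metric.ball 0 1) := fun _ hz =>
  (h.continuousAt hz).continuousWithinAt

theorem mem (h : DiscModel U χ) {z : ℂ} (hz : z ∈ Metric.ball (0:ℂ) 1) : χ z ∈ U :=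
  h.img ▸ mem_image_of_mem χ hz

end DiscModel

variable [T2Space X]

theorem IsEnd.compl_mem {U : Set X} {l : Filter X} (h : IsEnd U l) {K : Set X} (hK : IsCompact K)
    (hKU : K ⊆ U) : Kᶜ ∈ l := by
  rcases h with ⟨y, hy, rfl⟩ | rfl
  · exact hK.isClosed.isOpen_compl.mem_nhds fun h => hy (hKU h)
  · exact hK.compl_mem_cocompact

variable [LocallyCompactSpace X]

namespace DiscModel

/-- A filter escaping to an end leaves the compact subsets of the disc. -/
theorem norm_tendsto (h : DiscModel U χ) {l : Filter X} (hl : IsEnd U l) {F : Filter ℂ}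
    (ht : Tendsto χ F l) {ρ : ℝ} (hρ : ρ < 1) :
    ∀ᶠ z in F, ρ < ‖z‖ := by
  have hsub : Metric.closedBall (0:ℂ) ρ ⊆ Metric.ball 0 1 := Metric.closedBall_subset_ball hρ
  have hK : IsCompact (χ '' Metric.closedBall 0 ρ) :=
    (isCompact_closedBall _ _).image_of_continuousOn (h.continuousOn.mono hsub)
  filter_upwards [ht (hl.compl_mem hK (image_subset_iff.2 fun z hz => h.mem (hsub hz)))] with z hz
  by_contra hn
  exact hz ⟨z, by simpa using hn, rfl⟩

/-- Connected sets whose images shrink to an end subconverge to a point of the circle. -/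
theorem exists_subseq (h : DiscModel U χ) {σ : ℕ → Set ℂ} (hσB : ∀ k, σ k ⊆ Metric.ball 0 1)
    (hp : ∀ k, IsPreconnected (σ k)) (hne : ∀ k, (σ k).Nonempty) {l : Filter X} (hl : IsEnd U l)
    (ht : Tendsto χ (evFilter σ) l) :
    ∃ j : ℕ → ℕ, StrictMono j ∧ ∃ x : ℝ, evFilter (fun k => σ (j k)) ≤ 𝓝 (circ x) := by
  have hlim : ∀ {j : ℕ → ℕ}, Tendsto j atTop atTop → ∀ {z : ℕ → ℂ}, (∀ k, z k ∈ σ (j k)) →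
      ∀ {w : ℂ}, Tendsto z atTop (𝓝 w) → ∃ x, w = circ x := by
    intro j hj z hz w hw
    have h1 : Tendsto z atTop (evFilter σ) :=
      (tendsto_evFilter (σ := fun k => σ (j k)) hz).mono_right (evFilter_comp_le σ hj)
    have hw1 : ‖w‖ = 1 := by
      refine le_antisymm (le_of_tendsto hw.norm (.of_forall fun k => ?_)) ?_
      · have := hσB _ (hz k)
        rw [mem_ball_zero_iff] at this
        exact this.le
      · refine le_of_forall_lt fun ρ hρ => ?_
        obtain ⟨ρ', h2, h3⟩ := exists_between hρ
        exact h2.trans_le (ge_of_tendsto hw.norm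
          ((h1.eventually (h.norm_tendsto hl ht h3)).mono fun k hk => hk.le))
    refine ⟨w.arg, ?_⟩
    have := Complex.norm_mul_exp_arg_mul_I w
    rw [hw1, Complex.ofReal_one, one_mul] at this
    exact this.symm
  choose z hz using hne
  obtain ⟨w, -, j, hj, hw⟩ := (isCompact_closedBall (0:ℂ) 1).tendsto_subseq
    (x := z) (fun k => Metric.ball_subset_closedBall (hσB _ (hz k)))
  obtain ⟨x, rfl⟩ := hlim hj.tendsto_atTop (fun k => hz (j k)) hw
  refine ⟨j, hj, x, ?_⟩
  by_contra hcon
  obtain ⟨V, hV, hV'⟩ := Filter.not_le.1 hcon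
  have hfr : ∃ᶠ k in atTop, ∃ z' ∈ σ (j k), z' ∉ V := fun h => hV' <| mem_evFilter.2 <|
    h.mono fun k hk z' hz' => by_contra fun hzV => hk ⟨z', hz', hzV⟩
  obtain ⟨i, hi, hi'⟩ := extraction_of_frequently_atTop hfr
  choose z' hz' hzV using hi'
  obtain ⟨w', -, i', hi', hw'⟩ := (isCompact_closedBall (0:ℂ) 1).tendsto_subseq
    (x := z') (fun k => Metric.ball_subset_closedBall (hσB _ (hz' k)))
  set m : ℕ → ℕ := fun k => j (i (i' k)) with hm
  have hmt : Tendsto m atTop atTop :=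
    hj.tendsto_atTop.comp (hi.tendsto_atTop.comp hi'.tendsto_atTop)
  obtain ⟨x', rfl⟩ := hlim hmt (fun k => hz' (i' k)) hw'
  have hw2 : Tendsto (fun k => z (m k)) atTop (𝓝 (circ x)) :=
    hw.comp (hi.tendsto_atTop.comp hi'.tendsto_atTop)
  have hne' : circ x' ≠ circ x := by
    intro e
    rw [e] at hw'
    obtain ⟨k, hk⟩ := (hw'.eventually_mem hV).exists
    exact hzV _ hk
  obtain ⟨n, hn, -⟩ := existsUnique_add_zsmul_mem_Ico (show 0 < 2 * Real.pi by positivity) x' x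
  set x'' : ℝ := x' + n • (2 * Real.pi) with hx''
  have hcx : circ x'' = circ x' := circ_eq_circ.2 ⟨n, by rw [hx'', zsmul_eq_mul]⟩
  have hxx : x < x'' := lt_of_le_of_ne hn.1 fun e => hne' (by rw [← hcx, ← e])
  have hxx' : x'' < x + 2 * Real.pi := hn.2
  obtain ⟨S, hS, hSl⟩ : ∃ S : Set X, S.Finite ∧ ∀ y, y ∉ S → 𝓝 y ≠ l := by
    rcases hl with ⟨y, -, rfl⟩ | rfl
    · exact ⟨{y}, finite_singleton _, fun y' hy' e => hy' (nhds_injective e)⟩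
    · refine ⟨∅, finite_empty, fun y _ e => ?_⟩
      have := disjoint_nhds_cocompact y
      rw [e, disjoint_self, ← e] at this
      exact (inferInstance : (𝓝 y).NeBot).ne this
  have hray : ∀ α β : ℝ, α < β → ∃ θ ∈ Ioo α β, ∀ᶠ k in atTop, ∀ r : ℝ, 0 < r →
      (r : ℂ) * circ θ ∉ σ k := by
    intro α β hαβ
    obtain ⟨θ, hθ, y, hy, hyS, hyt⟩ := h.radial α β hαβ S hS
    refine ⟨θ, hθ, ?_⟩
    have hd : Disjoint (𝓝 y) l :=
      ((show IsEnd U (𝓝 y) from Or.inl ⟨y, hy, rfl⟩).eq_or_disjoint hl).resolve_left (hSl y hyS)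
    obtain ⟨A, hA, B, hB', hAB⟩ := Filter.disjoint_iff.1 hd
    obtain ⟨ρ, hρ, hρ'⟩ := mem_nhdsLT_iff_exists_Ioo_subset.1 (hyt hA)
    filter_upwards [mem_evFilter.1 (ht hB'), mem_evFilter.1 (h.norm_tendsto hl ht hρ)]
      with k hk hk' r hr hmem
    have h1 := hσB k hmem
    have h2 : ρ < ‖(r : ℂ) * circ θ‖ := hk' hmem
    rw [norm_mul, norm_circ, Complex.norm_real, Real.norm_of_nonneg hr.le, mul_one] at h2
    rw [mem_ball_zero_iff, norm_mul, norm_circ, Complex.norm_real, Real.norm_of_nonneg hr.le,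
      mul_one] at h1
    exact Set.disjoint_left.1 hAB (hρ' ⟨h2, h1⟩) (hk hmem)
  obtain ⟨θ, hθ, hr1⟩ := hray x x'' hxx
  obtain ⟨θ', hθ', hr2⟩ := hray x'' (x + 2 * Real.pi) hxx'
  have hm1 := hmt.eventually hr1
  have hm2 := hmt.eventually hr2
  have hm3 := hmt.eventually (mem_evFilter.1 (h.norm_tendsto hl ht zero_lt_one))
  have hs1 : circ x' ∈ sector θ θ' := hcx ▸ circ_mem_sector hθ.2 hθ'.1
  have hs2 : circ x ∈ sector θ' (θ + 2 * Real.pi) := by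
    rw [← circ_add_two_pi]
    exact circ_mem_sector hθ'.2 (by linarith [hθ.1])
  obtain ⟨k, h1, h2, h3, h4, h5⟩ := (hm1.and (hm2.and (hm3.and
    ((hw'.eventually_mem ((isOpen_sector _ _).mem_nhds hs1)).and
      (hw2.eventually_mem ((isOpen_sector _ _).mem_nhds hs2)))))).exists
  obtain ⟨r, hr, h6 | h6⟩ := meets_rays (hp (m k))
    (fun h0 => by have h7 : (0:ℝ) < ‖(0:ℂ)‖ := h3 h0
                  simp at h7) ⟨_, hz' _, h4⟩ ⟨_, hz _, h5⟩
  · exact h1 r hr h6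
  · exact h2 r hr h6

/-- Curves in the disc whose images land at an end land at a point of the circle. -/
theorem exists_landing (h : DiscModel U χ) {c : ℝ → ℂ} (hc : ContinuousOn c (Ico 0 1))
    (hcB : MapsTo c (Ico 0 1) (Metric.ball 0 1)) {l : Filter X} (hl : IsEnd U l)
    (ht : Tendsto (fun t => χ (c t)) (𝓝[<] 1) l) : ∃ x, Tendsto c (𝓝[<] 1) (𝓝 (circ x)) := by
  set s : ℕ → ℝ := fun k => 1 - 1 / (k + 1) with hs
  have hs0 : ∀ k, 0 ≤ s k := fun k => by
    simp only [hs, sub_nonneg]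
    rw [div_le_one (by positivity)]
    linarith [show (0:ℝ) ≤ k from k.cast_nonneg]
  have hs1 : ∀ k, s k < 1 := fun k => by
    have : (0:ℝ) < 1 / (k + 1) := by positivity
    simp only [hs]; linarith
  have hst : Tendsto s atTop (𝓝 1) := by
    have := (tendsto_const_nhds (x := (1:ℝ))).sub (tendsto_one_div_add_atTop_nhds_zero_nat (𝕜 := ℝ))
    rwa [sub_zero] at this
  have hsub : ∀ k, Ico (s k) 1 ⊆ Ico 0 1 := fun k => Ico_subset_Ico_left (hs0 k)
  have hmem : ∀ {V : Set ℂ}, c ⁻¹' V ∈ 𝓝[<] 1 → ∀ᶠ k in atTop, c '' Ico (s k) 1 ⊆ V := by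
    intro V hV
    obtain ⟨ρ, hρ, hρ'⟩ := mem_nhdsLT_iff_exists_Ioo_subset.1 hV
    filter_upwards [hst (Ioi_mem_nhds hρ)] with k hk
    exact image_subset_iff.2 fun t ht => hρ' ⟨lt_of_lt_of_le hk ht.1, ht.2⟩
  obtain ⟨j, hj, x, hx⟩ := h.exists_subseq (σ := fun k => c '' Ico (s k) 1)
    (fun k => image_subset_iff.2 fun t ht => hcB (hsub k ht))
    (fun k => isPreconnected_Ico.image _ (hc.mono (hsub k)))
    (fun k => (nonempty_Ico.2 (hs1 k)).image _) hl
    (fun V hV => mem_evFilter.2 (hmem (ht hV)))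
  refine ⟨x, fun V hV => ?_⟩
  obtain ⟨k, hk⟩ := (mem_evFilter.1 (hx hV)).exists
  rw [mem_map]
  filter_upwards [Ioo_mem_nhdsLT (hs1 (j k))] with t ht
  exact hk (mem_image_of_mem _ ⟨ht.1.le, ht.2⟩)

theorem eventually_crossing {c : ℝ → ℂ} (hc : ContinuousOn c (Ico 0 1))
    (hcB : MapsTo c (Ico 0 1) (Metric.ball 0 1)) {x : ℝ} (hx : Tendsto c (𝓝[<] 1) (𝓝 (circ x)))
    {r : ℕ → ℝ} (hr0 : ∀ k, 0 < r k) (hr : Tendsto r atTop (𝓝 0)) {T : ℝ} (hT : T ∈ Ico (0:ℝ) 1) :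
    ∀ᶠ k in atTop, ∃ t ∈ Ioo T 1, dist (c t) (circ x) = r k := by
  have hdc : ContinuousOn (fun t => dist (c t) (circ x)) (Ico 0 1) :=
    (continuous_id.dist continuous_const).comp_continuousOn hc
  filter_upwards [hr (Iio_mem_nhds (dist_circ_pos x ⟨c T, hcB hT⟩))] with k hk
  obtain ⟨ρ, hρ, hρ'⟩ := mem_nhdsLT_iff_exists_Ioo_subset.1 (hx (Metric.ball_mem_nhds _ (hr0 k)))
  obtain ⟨t₁, h1, h2⟩ := exists_between (max_lt hT.2 hρ : max T ρ < 1)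
  have h3 : dist (c t₁) (circ x) < r k := hρ' ⟨(le_max_right _ _).trans_lt h1, h2⟩
  have hTt : T ≤ t₁ := ((le_max_left _ _).trans_lt h1).le
  obtain ⟨t, ht, he⟩ := intermediate_value_Icc' hTt
    (hdc.mono fun t ht => ⟨hT.1.trans ht.1, ht.2.trans_lt h2⟩) ⟨h3.le, le_of_lt hk⟩
  refine ⟨t, ⟨lt_of_le_of_ne ht.1 fun e => ?_, ht.2.trans_lt h2⟩, he⟩
  rw [← e] at he
  exact (ne_of_lt hk) he.symm

/-- The limit along small circles is the limit along any curve landing at their centre. -/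
theorem eq_of_crosscut {c : ℝ → ℂ} (hc : ContinuousOn c (Ico 0 1))
    (hcB : MapsTo c (Ico 0 1) (Metric.ball 0 1)) {l l₀ : Filter X} (hl : IsEnd U l)
    (hl₀ : IsEnd U l₀) (ht : Tendsto (fun t => χ (c t)) (𝓝[<] 1) l) {x : ℝ}
    (hx : Tendsto c (𝓝[<] 1) (𝓝 (circ x))) {r : ℕ → ℝ} (hr0 : ∀ k, 0 < r k)
    (hr : Tendsto r atTop (𝓝 0)) (hr' : Tendsto χ
      (evFilter fun k => Metric.sphere (circ x) (r k) ∩ Metric.ball 0 1) l₀) : l = l₀ := by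
  rcases hl.eq_or_disjoint hl₀ with e | d
  · exact e
  obtain ⟨A, hA, B, hB, hAB⟩ := Filter.disjoint_iff.1 d
  obtain ⟨ρ, hρ, hρ'⟩ := mem_nhdsLT_iff_exists_Ioo_subset.1 (ht hA)
  obtain ⟨k, ⟨t, ht, he⟩, hk⟩ := ((eventually_crossing hc hcB hx hr0 hr
    (T := max ρ 0) ⟨le_max_right _ _, max_lt hρ one_pos⟩).and (mem_evFilter.1 (hr' hB))).exists
  have ht0 : t ∈ Ico (0:ℝ) 1 := ⟨((le_max_right _ _).trans_lt ht.1).le, ht.2⟩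
  exact (Set.disjoint_left.1 hAB (hρ' ⟨(le_max_left _ _).trans_lt ht.1, ht.2⟩)
    (hk ⟨he, hcB ht0⟩)).elim

/-- Curves landing at the same point of the circle have the same end. -/
theorem landing_unique (h : DiscModel U χ) {c c' : ℝ → ℂ} (hc : ContinuousOn c (Ico 0 1))
    (hcB : MapsTo c (Ico 0 1) (Metric.ball 0 1)) (hc' : ContinuousOn c' (Ico 0 1))
    (hcB' : MapsTo c' (Ico 0 1) (Metric.ball 0 1)) {l l' : Filter X} (hl : IsEnd U l)
    (hl' : IsEnd U l') (ht : Tendsto (fun t => χ (c t)) (𝓝[<] 1) l)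
    (ht' : Tendsto (fun t => χ (c' t)) (𝓝[<] 1) l') {x : ℝ}
    (hx : Tendsto c (𝓝[<] 1) (𝓝 (circ x))) (hx' : Tendsto c' (𝓝[<] 1) (𝓝 (circ x))) : l = l' := by
  obtain ⟨r, hr0, hr, l₀, hl₀, hr'⟩ := h.wolff x
  exact (eq_of_crosscut hc hcB hl hl₀ ht hx hr0 hr hr').trans
    (eq_of_crosscut hc' hcB' hl' hl₀ ht' hx' hr0 hr hr').symm

end DiscModel
end

end

section

/-- A homeomorphism of the disc extending continuously to the circle. -/
def BdExt (g : Dsk ≃ₜ Dsk) : Prop :=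
  ∀ x : ℝ, ∃ y : ℝ, ∀ r > 0, ∃ r' > 0, g '' Nb x r' ⊆ Nb y r

theorem circ_eq_of_Nb {x y : ℝ} (h : ∀ r > 0, ∃ r' > 0, Nb x r' ⊆ Nb y r) : circ x = circ y := by
  by_contra hne
  have hd : 0 < dist (circ x) (circ y) := dist_pos.2 hne
  obtain ⟨r', hr', hsub⟩ := h _ (half_pos hd)
  obtain ⟨z, hz⟩ := Nb_nonempty x (lt_min hr' (half_pos hd))
  have h1 := hsub (Nb_mono (min_le_left _ _) hz)
  have h2 := Nb_mono (min_le_right _ _) hz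
  have h1' : dist (z:ℂ) (circ y) < _ := h1
  have h2' : dist (z:ℂ) (circ x) < _ := h2
  have := dist_triangle_left (circ x) (circ y) z
  linarith

theorem Nb_congr {x y : ℝ} (h : circ x = circ y) (r : ℝ) : Nb x r = Nb y r := by
  simp only [Nb, h]

theorem arg_pos_add {w : ℂ} (hw : w ∈ Complex.slitPlane) :
    -Real.pi < w.arg ∧ w.arg < Real.pi :=
  ⟨Complex.neg_pi_lt_arg w, lt_of_le_of_ne (Complex.arg_le_pi w)
    (Complex.mem_slitPlane_iff_arg.1 hw).1⟩

theorem bdLimit_unique {g : Dsk ≃ₜ Dsk} {x y z : ℝ} (hy : ∀ r > 0, ∃ r' > 0, g '' Nb x r' ⊆ Nb y r)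
    (hz : ∀ r > 0, ∃ r' > 0, g '' Nb x r' ⊆ Nb z r) : circ y = circ z := by
  by_contra hne
  have hd : 0 < dist (circ y) (circ z) := dist_pos.2 hne
  obtain ⟨r, hr, h1⟩ := hy _ (half_pos hd)
  obtain ⟨r', hr', h2⟩ := hz _ (half_pos hd)
  obtain ⟨w, hw⟩ := Nb_nonempty x (lt_min hr hr')
  have h1' : dist ((g w : Dsk):ℂ) (circ y) < _ := h1 (mem_image_of_mem g (Nb_mono (min_le_left _ _) hw))
  have h2' : dist ((g w : Dsk):ℂ) (circ z) < _ := h2 (mem_image_of_mem g (Nb_mono (min_le_right _ _) hw))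
  have := dist_triangle_left (circ y) (circ z) (g w : Dsk)
  linarith

/-- The lift of the boundary extension, when it has no fixed points. -/
theorem exists_lift {g : Dsk ≃ₜ Dsk} (hg : BdExt g) (hg' : BdExt g⁻¹)
    (hnf : ∀ x : ℝ, ¬ ∀ r > 0, ∃ r' > 0, g '' Nb x r' ⊆ Nb x r) :
    ∃ h : ℝ ≃o ℝ, (∀ x, h (x + 2 * Real.pi) = h x + 2 * Real.pi) ∧
      (∀ x, x < h x ∧ h x < x + 2 * Real.pi) ∧
      (∀ x, ∀ r > 0, ∃ r' > 0, g '' Nb x r' ⊆ Nb (h x) r) ∧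
      (∀ x, ∀ r > 0, ∃ r' > 0, (g⁻¹ : Dsk ≃ₜ Dsk) '' Nb x r' ⊆ Nb ((h⁻¹ : ℝ ≃o ℝ) x) r) := by
  have hπ := Real.pi_pos
  choose G hG using hg
  choose G' hG' using hg'
  have hGc : Continuous fun x => circ (G x) := by
    rw [continuous_iff_continuousAt]
    intro x
    refine Metric.tendsto_nhds.2 fun e he => ?_
    obtain ⟨r, hr, hsub⟩ := hG x (e / 2) (half_pos he)
    have hc : Continuous circ := by unfold circ; fun_prop
    filter_upwards [hc.continuousAt.eventually (Metric.ball_mem_nhds _ hr)] with y hy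
    have hy' : dist (circ y) (circ x) < r := hy
    obtain ⟨r', hr', hsub'⟩ := hG y (e / 2) (half_pos he)
    obtain ⟨z, hz⟩ := Nb_nonempty y (lt_min hr' (sub_pos.2 hy'))
    have h1 := hsub' (mem_image_of_mem g (Nb_mono (min_le_left _ _) hz))
    have h2 : dist (z:ℂ) (circ y) < r - dist (circ y) (circ x) := Nb_mono (min_le_right _ _) hz
    have h3 := hsub (mem_image_of_mem g (show z ∈ Nb x r from by
      have := dist_triangle (z:ℂ) (circ y) (circ x)
      show dist (z:ℂ) (circ x) < r
      linarith))
    have h1' : dist ((g z : Dsk):ℂ) (circ (G y)) < e / 2 := h1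
    have h3' : dist ((g z : Dsk):ℂ) (circ (G x)) < e / 2 := h3
    have := dist_triangle_left (circ (G y)) (circ (G x)) (g z : Dsk)
    linarith
  have hGne : ∀ x, circ (G x) ≠ circ x := fun x he =>
    hnf x fun r hr => by
      obtain ⟨r', hr', hs⟩ := hG x r hr
      exact ⟨r', hr', by rwa [← Nb_congr he r]⟩
  have hper0 : ∀ x, circ (G (x + 2 * Real.pi)) = circ (G x) := fun x =>
    bdLimit_unique (hG _) (by simpa only [Nb_congr (circ_add_two_pi x)] using hG x)
  have hG'G : ∀ x, circ (G' (G x)) = circ x := by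
    intro x
    refine (circ_eq_of_Nb fun r hr => ?_).symm
    obtain ⟨s, hs, hsub⟩ := hG' (G x) r hr
    obtain ⟨s', hs', hsub'⟩ := hG x s hs
    refine ⟨s', hs', ?_⟩
    rw [← image_inv_image g (Nb x s')]
    exact (image_mono hsub').trans hsub
  set q : ℝ → ℂ := fun x => circ (G x - x) with hq
  have hqs : ∀ x, -q x ∈ Complex.slitPlane := by
    intro x
    by_contra hcon
    rw [Complex.mem_slitPlane_iff] at hcon
    push Not at hcon
    obtain ⟨h1, h2⟩ := hcon
    have h0 : q x = 1 := by
      have h3 : Complex.normSq (q x) = 1 := by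
        rw [Complex.normSq_eq_norm_sq, hq, norm_circ, one_pow]
      rw [Complex.normSq_apply] at h3
      simp only [Complex.neg_re, Complex.neg_im, neg_eq_zero] at h1 h2
      rw [h2] at h3
      apply Complex.ext
      · rw [Complex.one_re]; nlinarith
      · rw [Complex.one_im, h2]
    refine hGne x ?_
    have h3 : circ (G x) = circ (G x - x) * circ x := by
      simp only [circ, ← Complex.exp_add]; congr 1; push_cast; ring
    rw [h3]
    change (q x) * circ x = circ x
    rw [h0, one_mul]
  set h₀ : ℝ → ℝ := fun x => x + Real.pi + (-q x).arg with hh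
  have hbd : ∀ x, x < h₀ x ∧ h₀ x < x + 2 * Real.pi := fun x => by
    have := arg_pos_add (hqs x)
    constructor <;> simp only [hh] <;> linarith
  have hqe : ∀ x, q x = circ (G x) * (starRingEnd ℂ) (circ x) := fun x =>
    (circ_mul_conj _ _).symm
  have hcirc : ∀ x, circ (h₀ x) = circ (G x) := by
    intro x
    have h1 : circ (h₀ x) = circ x * circ Real.pi * circ (-q x).arg := by
      simp only [hh, circ, ← Complex.exp_add]; congr 1; push_cast; ring
    have h2 : circ Real.pi = -1 := by rw [circ, Complex.exp_pi_mul_I]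
    have h3 : circ (-q x).arg = -q x := by
      have := Complex.norm_mul_exp_arg_mul_I (-q x)
      rwa [norm_neg, hq, norm_circ, Complex.ofReal_one, one_mul] at this
    have h4 : circ (G x) = circ (G x - x) * circ x := by
      simp only [circ, ← Complex.exp_add]; congr 1; push_cast; ring
    rw [h1, h2, h3, h4]
    ring
  have hqc : Continuous q := by
    have : q = fun x => circ (G x) * (starRingEnd ℂ) (circ x) := funext hqe
    rw [this]
    refine hGc.mul (Complex.continuous_conj.comp ?_)
    unfold circ; fun_prop
  have hcont : Continuous h₀ := by
    refine (continuous_id.add continuous_const).add ?_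
    rw [continuous_iff_continuousAt]
    intro x
    exact (Complex.continuousAt_arg (hqs x)).comp (f := fun x => -q x) hqc.neg.continuousAt
  have hper : ∀ x, h₀ (x + 2 * Real.pi) = h₀ x + 2 * Real.pi := by
    intro x
    have : q (x + 2 * Real.pi) = q x := by rw [hqe, hqe, hper0, circ_add_two_pi]
    simp only [hh, this]; ring
  have hinj : Function.Injective h₀ := by
    intro x y hxy
    have h1 : circ (G x) = circ (G y) := by rw [← hcirc, ← hcirc, hxy]
    have h2 : circ x = circ y := by
      rw [← hG'G x, ← hG'G y]
      refine bdLimit_unique (hG' _) ?_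
      simpa only [Nb_congr h1] using hG' (G y)
    obtain ⟨n, hn⟩ := circ_eq_circ.1 h2
    rw [hn, map_add_int_mul hper] at hxy
    have h3 : (n:ℝ) * (2 * Real.pi) = 0 := by linarith
    rw [hn, h3, add_zero]
  have hmono : StrictMono h₀ := by
    rcases hcont.strictMono_of_inj hinj with hm | hm
    · exact hm
    · have := hm (show (0:ℝ) < 0 + 2 * Real.pi by linarith)
      rw [hper] at this
      linarith
  have hsurj : Function.Surjective h₀ := by
    refine hcont.surjective ?_ ?_
    · exact tendsto_atTop_mono (fun x => (hbd x).1.le) tendsto_id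
    · exact tendsto_atBot_mono (fun x => (hbd x).2.le)
        (tendsto_atBot_add_const_right _ _ tendsto_id)
  set h : ℝ ≃o ℝ := hmono.orderIsoOfSurjective h₀ hsurj with hh'
  have hex : ∀ x, ∀ r > 0, ∃ r' > 0, g '' Nb x r' ⊆ Nb (h₀ x) r := fun x r hr => by
    obtain ⟨r', hr', hs⟩ := hG x r hr
    exact ⟨r', hr', by rwa [Nb_congr (hcirc x)]⟩
  refine ⟨h, hper, hbd, hex, fun x r hr => ?_⟩
  obtain ⟨y, rfl⟩ := h.surjective x
  have e1 : (h⁻¹ : ℝ ≃o ℝ) (h y) = y := h.symm_apply_apply y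
  rw [e1]
  obtain ⟨r', hr', hs⟩ := hG' (G y) r hr
  have e2 : circ (h y) = circ (G y) := hcirc y
  exact ⟨r', hr', by rwa [Nb_congr e2, ← Nb_congr (hG'G y) r]⟩

end

section
variable {X : Type*} [TopologicalSpace X] {U : Set X} {χ : ℂ → X}

namespace DiscModel

/-- The parametrisation, as a homeomorphism onto the domain. -/
noncomputable def chart (m : DiscModel U χ) : Dsk ≃ₜ U :=
  (Equiv.ofBijective (fun z : Dsk => (⟨χ z, m.mem z.2⟩ : U))
    ⟨fun z w h => Subtype.ext (m.inj z.2 w.2 (congrArg Subtype.val h)), fun y => by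
      obtain ⟨z, hz, hy⟩ : (y:X) ∈ χ '' Metric.ball 0 1 := by rw [m.img]; exact y.2
      exact ⟨⟨z, hz⟩, Subtype.ext hy⟩⟩).toHomeomorphOfContinuousOpen
    (Continuous.subtype_mk (m.continuousOn.comp_continuous continuous_subtype_val fun z => z.2) _)
    (by
      refine IsOpenMap.of_nhds_le fun z => ?_
      rw [nhds_subtype_eq_comap]
      intro s hs
      obtain ⟨t, ht, hts⟩ : ∃ t ∈ 𝓝 (z:ℂ), (Subtype.val ⁻¹' t : Set Dsk) ⊆ {z | _ } :=
        mem_nhds_subtype _ _ _ |>.1 hs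
      refine mem_comap.2 ⟨χ '' (t ∩ Metric.ball 0 1), ?_, ?_⟩
      · change _ ∈ 𝓝 (χ z)
        rw [← m.nhds z z.2]
        exact image_mem_map (inter_mem ht (Metric.isOpen_ball.mem_nhds z.2))
      · rintro ⟨y, hy⟩ ⟨w, ⟨hw, hwB⟩, rfl⟩
        exact hts (a := ⟨w, hwB⟩) hw)

theorem chart_apply (m : DiscModel U χ) (z : Dsk) : (m.chart z : X) = χ z := rfl

/-- The homeomorphism of the disc induced by a homeomorphism preserving the domain. -/
noncomputable def conj (m : DiscModel U χ) (f : X ≃ₜ X) (hf : f '' U = U) : Dsk ≃ₜ Dsk :=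
  (m.chart.trans ((f.image U).trans (Homeomorph.setCongr hf))).trans m.chart.symm

theorem conj_apply (m : DiscModel U χ) (f : X ≃ₜ X) (hf : f '' U = U) (z : Dsk) :
    χ (m.conj f hf z) = f (χ z) := by
  rw [← m.chart_apply, conj]
  simp only [Homeomorph.trans_apply, Homeomorph.apply_symm_apply]
  rfl

theorem eq_of_apply (m : DiscModel U χ) {z w : Dsk} (h : χ z = χ w) : z = w :=
  Subtype.ext (m.inj z.2 w.2 h)

theorem conj_symm_apply (m : DiscModel U χ) (f : X ≃ₜ X) (hf : f '' U = U) (z : Dsk) :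
    χ ((m.conj f hf)⁻¹ z : Dsk) = (f⁻¹ : X ≃ₜ X) (χ z) := by
  apply f.injective
  rw [← m.conj_apply f hf]
  change χ ((m.conj f hf) ((m.conj f hf).symm z)) = f (f.symm (χ z))
  rw [Homeomorph.apply_symm_apply, Homeomorph.apply_symm_apply]

theorem conj_zpow_apply (m : DiscModel U χ) (f : X ≃ₜ X) (hf : f '' U = U) (k : ℤ) (z : Dsk) :
    χ ((m.conj f hf ^ k : Dsk ≃ₜ Dsk) z) = (f ^ k : X ≃ₜ X) (χ z) := by
  induction k using Int.induction_on generalizing z with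
  | zero => rfl
  | succ k ih =>
    rw [zpow_add_one, zpow_add_one, Homeomorph.mul_apply, Homeomorph.mul_apply, ih, m.conj_apply]
  | pred k ih =>
    rw [zpow_sub_one, zpow_sub_one, Homeomorph.mul_apply, Homeomorph.mul_apply, ih,
      m.conj_symm_apply]

theorem inv_image (f : X ≃ₜ X) (hf : f '' U = U) : (f⁻¹ : X ≃ₜ X) '' U = U := by
  conv_lhs => rw [← hf]
  rw [image_image]
  convert image_id U
  exact f.symm_apply_apply _

theorem conj_inv (m : DiscModel U χ) (f : X ≃ₜ X) (hf : f '' U = U) :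
    m.conj f⁻¹ (inv_image f hf) = (m.conj f hf)⁻¹ := by
  ext1 z
  apply m.eq_of_apply
  rw [m.conj_apply, m.conj_symm_apply]

variable [T2Space X] [LocallyCompactSpace X]

theorem bdExt (m : DiscModel U χ) (f : X ≃ₜ X) (hf : f '' U = U) : BdExt (m.conj f hf) := by
  intro x
  set g := m.conj f hf with hg
  obtain ⟨r, hr0, hr, l, hl, hrl⟩ := m.wolff x
  -- arcs that are too large are discarded
  obtain ⟨N, hN⟩ := eventually_atTop.1 (hr.eventually (Iio_mem_nhds one_pos))
  set r' : ℕ → ℝ := fun k => r (k + N) with hr'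
  have hr'0 : ∀ k, 0 < r' k := fun k => hr0 _
  have hr'1 : ∀ k, r' k < 1 := fun k => hN _ (Nat.le_add_left _ _)
  have hr't : Tendsto r' atTop (𝓝 0) := (tendsto_add_atTop_iff_nat N).2 hr
  have hval : ∀ k, (Subtype.val '' Cb x (r' k) : Set ℂ) =
      Metric.sphere (circ x) (r' k) ∩ Metric.ball 0 1 := fun k => by
    ext z
    constructor
    · rintro ⟨w, hw, rfl⟩
      exact ⟨hw, w.2⟩
    · rintro ⟨hz, hzB⟩
      exact ⟨⟨z, hzB⟩, hz, rfl⟩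
  have hpre : ∀ k, IsPreconnected (Cb x (r' k)) := fun k => by
    rw [← Topology.IsInducing.subtypeVal.isPreconnected_image, hval]
    exact isPreconnected_crosscut x (hr'0 k)
  have hne : ∀ k, (Cb x (r' k)).Nonempty := fun k =>
    ⟨⟨_, radial_mem (hr'0 k) (hr'1 k).le⟩, radial_dist (hr'0 k).le⟩
  set σ : ℕ → Set ℂ := fun k => Subtype.val '' (g '' Cb x (r' k)) with hσ
  have hmap : Tendsto χ (evFilter σ) (map f l) := by
    intro V hV
    rw [mem_map, mem_evFilter]
    filter_upwards [(tendsto_add_atTop_iff_nat N).2 tendsto_id |>.eventually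
      (mem_evFilter.1 (hrl (mem_map.1 hV)))] with k hk
    rintro _ ⟨_, ⟨z, hz, rfl⟩, rfl⟩
    change χ (g z) ∈ V
    rw [hg, m.conj_apply]
    exact hk ⟨hz, z.2⟩
  have hl' : IsEnd U (map f l) := by
    have := hl.map f
    rwa [hf] at this
  obtain ⟨j, hj, y, hy⟩ := m.exists_subseq (σ := σ)
    (fun k => by rintro _ ⟨w, -, rfl⟩; exact w.2)
    (fun k => ((hpre k).image g g.continuous.continuousOn).image _
      continuous_subtype_val.continuousOn)
    (fun k => ((hne k).image g).image _) hl' hmap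
  refine ⟨y, fun R hR => ?_⟩
  set z₀ : Dsk := ⟨0, by simp⟩ with hz₀
  have hg0 : ‖((g z₀ : Dsk) : ℂ)‖ < 1 := mem_ball_zero_iff.1 (g z₀).2
  set e : ℝ := min (R ^ 2 / 2) (1 - ‖((g z₀ : Dsk) : ℂ)‖) with he
  have he0 : 0 < e := lt_min (by positivity) (by linarith)
  set φ : ℂ → ℝ := fun z => (z * (starRingEnd ℂ) (circ y)).re with hφ
  have hφc : Continuous φ := by fun_prop
  have hφy : φ (circ y) = 1 := by
    simp only [hφ, circ_mul_conj]
    simp [circ]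
  have hφle : ∀ z, φ z ≤ ‖z‖ := fun z => by
    refine (Complex.re_le_norm _).trans ?_
    rw [norm_mul, RCLike.norm_conj, norm_circ, mul_one]
  have hopen : {z : ℂ | 1 - e < φ z} ∈ 𝓝 (circ y) :=
    (isOpen_lt continuous_const hφc).mem_nhds (by change 1 - e < φ (circ y); rw [hφy]; linarith)
  obtain ⟨k, hk⟩ := (mem_evFilter.1 (hy hopen)).exists
  refine ⟨r' (j k), hr'0 _, ?_⟩
  set L : Set Dsk := {z | φ z ≤ 1 - e} with hL
  have hLp : IsPreconnected L := by
    rw [← Topology.IsInducing.subtypeVal.isPreconnected_image]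
    have : (Subtype.val '' L : Set ℂ) = Metric.ball 0 1 ∩ {z | φ z ≤ 1 - e} := by
      ext z
      constructor
      · rintro ⟨w, hw, rfl⟩
        exact ⟨w.2, hw⟩
      · rintro ⟨hz, hz'⟩
        exact ⟨⟨z, hz⟩, hz', rfl⟩
    rw [this]
    refine ((convex_ball _ _).inter (convex_halfSpace_le ?_ _)).isPreconnected
    refine ⟨fun z w => ?_, fun c z => ?_⟩
    · simp only [hφ, add_mul, Complex.add_re]
    · simp only [hφ, smul_mul_assoc, Complex.smul_re]
  have hL0 : g z₀ ∈ L := by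
    have := hφle (g z₀)
    have := min_le_right (R ^ 2 / 2) (1 - ‖((g z₀ : Dsk) : ℂ)‖)
    change φ (g z₀) ≤ 1 - e
    linarith
  have hLd : Disjoint (g ⁻¹' L) (Cb x (r' (j k))) := by
    rw [Set.disjoint_left]
    intro z hz hz'
    have h1 : 1 - e < φ (g z) := hk ⟨_, ⟨z, hz', rfl⟩, rfl⟩
    exact absurd h1 (not_lt.2 hz)
  have hLp' : IsPreconnected (g ⁻¹' L) := by
    rw [← g.image_symm]
    exact hLp.image _ g.symm.continuous.continuousOn
  have hz0N : z₀ ∉ Nb x (r' (j k)) := by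
    intro h
    have h1 : dist (0:ℂ) (circ x) < r' (j k) := h
    rw [dist_zero_left, norm_circ] at h1
    linarith [hr'1 (j k)]
  rcases subset_Nb_or_disjoint hLp' hLd with h | h
  · exact (hz0N (h hL0)).elim
  · rintro _ ⟨z, hz, rfl⟩
    have h1 : ¬ φ (g z) ≤ 1 - e := fun h1 => Set.disjoint_left.1 h h1 hz
    change dist ((g z : Dsk) : ℂ) (circ y) < R
    have h2 : ‖((g z : Dsk) : ℂ)‖ < 1 := mem_ball_zero_iff.1 (g z).2
    have h3 : dist ((g z : Dsk) : ℂ) (circ y) ^ 2 =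
        ‖((g z : Dsk) : ℂ)‖ ^ 2 + 1 - 2 * φ (g z) := by
      have h4 := norm_circ y
      have h5 : Complex.normSq (circ y) = 1 := by rw [Complex.normSq_eq_norm_sq, h4, one_pow]
      rw [dist_eq_norm, ← Complex.normSq_eq_norm_sq, Complex.normSq_sub, h5,
        Complex.normSq_eq_norm_sq]
    have h6 := min_le_left (R ^ 2 / 2) (1 - ‖((g z₀ : Dsk) : ℂ)‖)
    refine lt_of_pow_lt_pow_left₀ 2 hR.le ?_
    have h7 : ‖((g z : Dsk) : ℂ)‖ ^ 2 < 1 := by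
      nlinarith [norm_nonneg ((g z : Dsk) : ℂ)]
    rw [h3]
    linarith

theorem bdExt_inv (m : DiscModel U χ) (f : X ≃ₜ X) (hf : f '' U = U) : BdExt (m.conj f hf)⁻¹ := by
  rw [← conj_inv]
  exact m.bdExt _ _

end DiscModel
end

section

/-- An open truncated sector of the unit disc. -/
def boxSector (ρ s t : ℝ) : Set ℂ := Complex.exp '' {z | (Real.log ρ < z.re ∧ z.re < 0) ∧ s < z.im ∧ z.im < t}

/-- The complementary side of a truncated sector of the unit disc. -/
def boxOutside (ρ s t : ℝ) : Set ℂ :=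
  Metric.ball 0 ρ ∪ Metric.ball 0 1 ∩ sector t (s + 2 * Real.pi)

theorem mem_boxSector {ρ s t : ℝ} (hρ : 0 < ρ) {z : ℂ} : z ∈ boxSector ρ s t ↔
    ∃ r θ : ℝ, ρ < r ∧ r < 1 ∧ s < θ ∧ θ < t ∧ z = r * circ θ := by
  constructor
  · rintro ⟨w, ⟨⟨h1, h2⟩, h3, h4⟩, rfl⟩
    refine ⟨Real.exp w.re, w.im, (Real.log_lt_iff_lt_exp hρ).1 h1, by simpa using h2, h3, h4, ?_⟩
    conv_lhs => rw [← Complex.re_add_im w]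
    rw [Complex.exp_add, Complex.ofReal_exp, circ]
  · rintro ⟨r, θ, h1, h2, h3, h4, rfl⟩
    have hr : 0 < r := hρ.trans h1
    refine ⟨(Real.log r : ℂ) + θ * Complex.I, ⟨⟨?_, ?_⟩, ?_, ?_⟩, ?_⟩
    · simpa using Real.log_lt_log hρ h1
    · simpa using Real.log_neg hr h2
    · simpa using h3
    · simpa using h4
    · rw [Complex.exp_add, ← Complex.ofReal_exp, Real.exp_log hr, circ]

theorem norm_mul_circ {r : ℝ} (hr : 0 ≤ r) (θ : ℝ) : ‖(r : ℂ) * circ θ‖ = r := by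
  rw [norm_mul, norm_circ, mul_one, Complex.norm_real, Real.norm_of_nonneg hr]

theorem boxSector_eq {ρ s t : ℝ} (hρ : 0 < ρ) :
    boxSector ρ s t = {z | ρ < ‖z‖ ∧ ‖z‖ < 1} ∩ sector s t := by
  ext z
  rw [mem_boxSector hρ]
  constructor
  · rintro ⟨r, θ, h1, h2, h3, h4, rfl⟩
    have hr : 0 < r := hρ.trans h1
    refine ⟨?_, mem_sector.2 ⟨r, θ, hr, h3, h4, rfl⟩⟩
    simp only [Set.mem_ofPred_eq, norm_mul_circ hr.le]
    exact ⟨h1, h2⟩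
  · rintro ⟨⟨h1, h2⟩, h⟩
    obtain ⟨r, θ, hr, h3, h4, rfl⟩ := mem_sector.1 h
    rw [norm_mul_circ hr.le] at h1 h2
    exact ⟨r, θ, h1, h2, h3, h4, rfl⟩

theorem isOpen_boxSector {ρ s t : ℝ} (hρ : 0 < ρ) : IsOpen (boxSector ρ s t) := by
  rw [boxSector_eq hρ]
  exact ((isOpen_lt continuous_const continuous_norm).inter
    (isOpen_lt continuous_norm continuous_const)).inter (isOpen_sector s t)

theorem isPreconnected_boxSector (ρ s t : ℝ) : IsPreconnected (boxSector ρ s t) := by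
  refine IsPreconnected.image ?_ _ Complex.continuous_exp.continuousOn
  refine Convex.isPreconnected ?_
  exact ((convex_halfSpace_re_gt _).inter (convex_halfSpace_re_lt _)).inter
    ((convex_halfSpace_im_gt _).inter (convex_halfSpace_im_lt _))

theorem isOpen_boxOutside (ρ s t : ℝ) : IsOpen (boxOutside ρ s t) :=
  Metric.isOpen_ball.union (Metric.isOpen_ball.inter (isOpen_sector _ _))

theorem isPreconnected_boxOutside {ρ s t : ℝ} (hρ : 0 < ρ) (hρ1 : ρ < 1)
    (ht : t < s + 2 * Real.pi) : IsPreconnected (boxOutside ρ s t) := by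
  have h1 : Metric.ball (0:ℂ) 1 ∩ sector t (s + 2 * Real.pi) =
      Complex.exp '' {z | z.re < 0 ∧ t < z.im ∧ z.im < s + 2 * Real.pi} := by
    ext z
    constructor
    · rintro ⟨hz, w, hw, rfl⟩
      refine ⟨w, ⟨?_, hw⟩, rfl⟩
      simpa [Complex.norm_exp] using hz
    · rintro ⟨w, ⟨hw, hw'⟩, rfl⟩
      exact ⟨by simpa [Complex.norm_exp] using hw, w, hw', rfl⟩
  obtain ⟨θ, h2, h3⟩ := exists_between ht
  have hp : ‖((ρ / 2 : ℝ) : ℂ) * circ θ‖ = ρ / 2 := norm_mul_circ (by positivity) θ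
  refine IsPreconnected.union (((ρ / 2 : ℝ) : ℂ) * circ θ) ?_ ⟨?_, ?_⟩
    (convex_ball _ _).isPreconnected ?_
  · rw [mem_ball_zero_iff, hp]
    linarith
  · rw [mem_ball_zero_iff, hp]
    linarith
  · exact mem_sector.2 ⟨_, θ, by positivity, h2, h3, rfl⟩
  · rw [h1]
    refine IsPreconnected.image ?_ _ Complex.continuous_exp.continuousOn
    exact Convex.isPreconnected ((convex_halfSpace_re_lt _).inter
      ((convex_halfSpace_im_gt _).inter (convex_halfSpace_im_lt _)))

theorem disjoint_boxSector_boxOutside {ρ s t : ℝ} (hρ : 0 < ρ) :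
    Disjoint (boxSector ρ s t) (boxOutside ρ s t) := by
  rw [boxSector_eq hρ, Set.disjoint_left]
  rintro z ⟨⟨h1, h2⟩, h3⟩ (h4 | ⟨-, h4⟩)
  · rw [mem_ball_zero_iff] at h4
    exact h1.not_gt h4
  · exact Set.disjoint_left.1 (disjoint_sector le_rfl) h3 h4

/-- The three-piece arc cutting off a truncated sector. -/
noncomputable def boxArc (ρ s t u : ℝ) : ℂ :=
  ((max ρ (max (1 - 3 * (1 - ρ) * u) (1 - 3 * (1 - ρ) * (1 - u))) : ℝ) : ℂ) *
    circ (s + (t - s) * max 0 (min 1 (3 * u - 1)))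

theorem continuous_boxArc (ρ s t : ℝ) : Continuous (boxArc ρ s t) := by
  unfold boxArc circ
  fun_prop

theorem boxArc_cases {ρ s t u : ℝ} (hρ : 0 < ρ) (hρ1 : ρ < 1) (hst : s < t) (hu : u ∈ Ioo (0:ℝ) 1) :
    (∃ r, ρ < r ∧ r < 1 ∧ r = 1 - 3 * (1 - ρ) * u ∧ boxArc ρ s t u = r * circ s) ∨
    (∃ θ, s ≤ θ ∧ θ ≤ t ∧ θ = s + (t - s) * (3 * u - 1) ∧ boxArc ρ s t u = ρ * circ θ) ∨
    (∃ r, ρ < r ∧ r < 1 ∧ r = 1 - 3 * (1 - ρ) * (1 - u) ∧ boxArc ρ s t u = r * circ t) := by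
  obtain ⟨h0, h1⟩ := hu
  have hd : 0 < 1 - ρ := by linarith
  rcases lt_or_ge u (1 / 3) with h | h
  · left
    refine ⟨_, ?_, ?_, rfl, ?_⟩
    · nlinarith
    · nlinarith
    · rw [boxArc, max_eq_right, max_eq_left, min_eq_right, max_eq_left, mul_zero, add_zero]
      · linarith
      · linarith
      · nlinarith
      · exact le_max_of_le_left (by nlinarith)
  · rcases le_or_gt u (2 / 3) with h' | h'
    · right; left
      refine ⟨_, ?_, ?_, rfl, ?_⟩
      · nlinarith
      · nlinarith
      · rw [boxArc, max_eq_left, min_eq_right, max_eq_right]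
        · linarith
        · linarith
        · exact max_le (by nlinarith) (by nlinarith)
    · right; right
      refine ⟨_, ?_, ?_, rfl, ?_⟩
      · nlinarith
      · nlinarith
      · rw [boxArc, max_eq_right, max_eq_right, min_eq_left, max_eq_right, mul_one,
          add_sub_cancel]
        · exact zero_le_one
        · linarith
        · nlinarith
        · exact le_max_of_le_right (by nlinarith)

theorem injOn_boxArc {ρ s t : ℝ} (hρ : 0 < ρ) (hρ1 : ρ < 1) (hst : s < t)
    (ht : t < s + 2 * Real.pi) : InjOn (boxArc ρ s t) (Ioo 0 1) := by
  have key : ∀ {r r' θ θ' : ℝ}, 0 < r → 0 < r' → s ≤ θ → θ ≤ t → s ≤ θ' → θ' ≤ t →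
      (r : ℂ) * circ θ = r' * circ θ' → r = r' ∧ θ = θ' := by
    intro r r' θ θ' hr hr' h1 h2 h3 h4 h
    obtain ⟨rfl, hc⟩ := eq_of_mul_circ_eq hr hr' h
    refine ⟨rfl, ?_⟩
    rcases lt_trichotomy θ θ' with h5 | h5 | h5
    · exact (circ_ne h5 (by linarith) hc.symm).elim
    · exact h5
    · exact (circ_ne h5 (by linarith) hc).elim
  have hd : 0 < 1 - ρ := by linarith
  have hd' : 0 < t - s := by linarith
  intro u hu v hv he
  rcases boxArc_cases hρ hρ1 hst hu with ⟨r, h1, h2, h3, h4⟩ | ⟨r, h1, h2, h3, h4⟩ |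
      ⟨r, h1, h2, h3, h4⟩ <;>
    rcases boxArc_cases hρ hρ1 hst hv with ⟨r', h1', h2', h3', h4'⟩ | ⟨r', h1', h2', h3', h4'⟩ |
      ⟨r', h1', h2', h3', h4'⟩ <;> rw [h4, h4'] at he <;>
    obtain ⟨e1, e2⟩ := key (by linarith) (by linarith) (by linarith) (by linarith) (by linarith)
      (by linarith) he
  · rw [h3, h3'] at e1
    nlinarith
  · linarith
  · linarith
  · linarith
  · rw [h3, h3'] at e2
    nlinarith
  · linarith
  · linarith
  · linarith
  · rw [h3, h3'] at e1
    nlinarith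

theorem image_boxArc {ρ s t : ℝ} (hρ : 0 < ρ) (hρ1 : ρ < 1) (hst : s < t)
    (ht : t < s + 2 * Real.pi) : boxArc ρ s t '' Ioo 0 1 =
      Metric.ball 0 1 \ (boxSector ρ s t ∪ boxOutside ρ s t) := by
  have hd : 0 < 1 - ρ := by linarith
  have hd' : 0 < t - s := by linarith
  have key : ∀ {r θ : ℝ}, ρ ≤ r → r < 1 → s ≤ θ → θ ≤ t → (r = ρ ∨ θ = s ∨ θ = t) →
      (r : ℂ) * circ θ ∈ Metric.ball 0 1 \ (boxSector ρ s t ∪ boxOutside ρ s t) := by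
    intro r θ h1 h2 h3 h4 h5
    have hr : 0 < r := by linarith
    refine ⟨by rw [mem_ball_zero_iff, norm_mul_circ hr.le]; exact h2, ?_⟩
    rintro (h | h | ⟨-, h⟩)
    · obtain ⟨r', θ', k1, k2, k3, k4, k5⟩ := (mem_boxSector hρ).1 h
      obtain ⟨e1, e2⟩ := eq_of_mul_circ_eq hr (hρ.trans k1) k5
      rcases h5 with h5 | h5 | h5
      · linarith
      · subst h5
        exact circ_ne k3 (by linarith) e2.symm
      · subst h5
        exact circ_ne k4 (by linarith) e2
    · rw [mem_ball_zero_iff, norm_mul_circ hr.le] at h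
      linarith
    · obtain ⟨r', θ', k1, k2, k3, k4⟩ := mem_sector.1 h
      obtain ⟨e1, e2⟩ := eq_of_mul_circ_eq hr k1 k4
      exact circ_ne (h4.trans_lt k2) (by linarith) e2.symm
  apply Subset.antisymm
  · rintro _ ⟨u, hu, rfl⟩
    rcases boxArc_cases hρ hρ1 hst hu with ⟨r, h1, h2, h3, h4⟩ | ⟨r, h1, h2, h3, h4⟩ |
      ⟨r, h1, h2, h3, h4⟩ <;> rw [h4]
    · exact key h1.le h2 le_rfl hst.le (by simp)
    · exact key le_rfl hρ1 h1 h2 (by simp)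
    · exact key h1.le h2 hst.le le_rfl (by simp)
  · rintro z ⟨hz, hz'⟩
    rw [mem_ball_zero_iff] at hz
    simp only [mem_union, not_or, boxOutside] at hz'
    obtain ⟨h1, h2, h3⟩ := hz'
    rw [mem_ball_zero_iff, not_lt] at h2
    have hz0 : z ≠ 0 := by
      rintro rfl
      rw [norm_zero] at h2
      linarith
    obtain ⟨r, θ, hr, h4, h5, rfl⟩ := exists_polar s hz0
    rw [norm_mul_circ hr.le] at hz h2
    have h6 : θ ≤ t := by
      by_contra! h6
      exact h3 ⟨by rwa [mem_ball_zero_iff, norm_mul_circ hr.le],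
        mem_sector.2 ⟨r, θ, hr, h6, h5, rfl⟩⟩
    have h7 : r = ρ ∨ (ρ < r ∧ (θ = s ∨ θ = t)) := by
      by_contra! h7
      have h8 : ρ < r := lt_of_le_of_ne h2 (Ne.symm h7.1)
      obtain ⟨h9, h10⟩ := h7.2 h8
      exact h1 ((mem_boxSector hρ).2 ⟨r, θ, h8, hz, lt_of_le_of_ne h4 (Ne.symm h9),
        lt_of_le_of_ne h6 h10, rfl⟩)
    rcases h7 with rfl | ⟨h7, rfl | rfl⟩
    · have hq0 : 0 ≤ (θ - s) / (t - s) := div_nonneg (by linarith) hd'.le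
      have hq1 : (θ - s) / (t - s) ≤ 1 := (div_le_one hd').2 (by linarith)
      have hq : (t - s) * ((θ - s) / (t - s)) = θ - s := by field_simp
      refine ⟨(1 + (θ - s) / (t - s)) / 3, ⟨by positivity, by linarith⟩, ?_⟩
      rw [boxArc, max_eq_left, min_eq_right, max_eq_right]
      · congr 2
        linear_combination hq
      · linarith
      · linarith
      · exact max_le (by nlinarith) (by nlinarith)
    · have hq0 : 0 < (1 - r) / (1 - ρ) := div_pos (by linarith) hd
      have hq1 : (1 - r) / (1 - ρ) < 1 := (div_lt_one hd).2 (by linarith)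
      have hq : (1 - ρ) * ((1 - r) / (1 - ρ)) = 1 - r := by field_simp
      refine ⟨(1 - r) / (1 - ρ) / 3, ⟨by positivity, by linarith⟩, ?_⟩
      rw [boxArc, max_eq_right, max_eq_left, min_eq_right, max_eq_left, mul_zero, add_zero]
      · congr 2
        linear_combination -hq
      · linarith
      · linarith
      · nlinarith
      · exact le_max_of_le_left (by nlinarith)
    · have hq0 : 0 < (1 - r) / (1 - ρ) := div_pos (by linarith) hd
      have hq1 : (1 - r) / (1 - ρ) < 1 := (div_lt_one hd).2 (by linarith)
      have hq : (1 - ρ) * ((1 - r) / (1 - ρ)) = 1 - r := by field_simp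
      refine ⟨1 - (1 - r) / (1 - ρ) / 3, ⟨by linarith, by linarith⟩, ?_⟩
      rw [boxArc, max_eq_right, max_eq_right, min_eq_left, max_eq_right, mul_one,
          add_sub_cancel]
      · congr 2
        linear_combination -hq
      · exact zero_le_one
      · linarith
      · nlinarith
      · exact le_max_of_le_right (by nlinarith)

end

section

theorem connectedComponentIn_of_split {X : Type*} [TopologicalSpace X] {A W V : Set X}
    (hA : A = W ∪ V) (hW : IsOpen W) (hV : IsOpen V) (hd : Disjoint W V) (hWp : IsPreconnected W)
    {x : X} (hx : x ∈ W) : connectedComponentIn A x = W := by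
  have hxA : x ∈ A := hA ▸ Or.inl hx
  apply Subset.antisymm
  · exact (isPreconnected_connectedComponentIn (x := x) (F := A)).subset_left_of_subset_union
      hW hV hd (hA ▸ connectedComponentIn_subset A x) ⟨x, mem_connectedComponentIn hxA, hx⟩
  · exact hWp.subset_connectedComponentIn hx (hA ▸ subset_union_left)

section
variable {X : Type*} [TopologicalSpace X] {U : Set X} {χ : ℂ → X}

theorem DiscModel.isOpen_image (m : DiscModel U χ) {V : Set ℂ} (hV : IsOpen V)
    (hVB : V ⊆ Metric.ball 0 1) : IsOpen (χ '' V) := by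
  rw [isOpen_iff_mem_nhds]
  rintro _ ⟨z, hz, rfl⟩
  rw [← m.nhds z (hVB hz)]
  exact image_mem_map (hV.mem_nhds hz)

/-- A truncated sector whose two sides land at points off `U`. -/
structure GoodBox (U : Set X) (χ : ℂ → X) (ρ s t : ℝ) (y y' : X) : Prop where
  pos : 0 < ρ
  lt_one : ρ < 1
  lt : s < t
  lt' : t < s + 2 * Real.pi
  not_mem : y ∉ U
  not_mem' : y' ∉ U
  lim : Tendsto (fun r : ℝ => χ (r * circ s)) (𝓝[<] 1) (𝓝 y)
  lim' : Tendsto (fun r : ℝ => χ (r * circ t)) (𝓝[<] 1) (𝓝 y')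

variable {ρ s t : ℝ} {y y' : X}

theorem boxSector_subset_ball (hρ : 0 < ρ) : boxSector ρ s t ⊆ Metric.ball 0 1 := by
  rw [boxSector_eq hρ]
  rintro z ⟨⟨-, hz⟩, -⟩
  exact mem_ball_zero_iff.2 hz

theorem boxOutside_subset_ball (hρ : ρ < 1) : boxOutside ρ s t ⊆ Metric.ball 0 1 :=
  union_subset (Metric.ball_subset_ball hρ.le) inter_subset_left

theorem boxArc_mem (hρ : 0 < ρ) (hρ1 : ρ < 1) (hst : s < t)
    (ht : t < s + 2 * Real.pi) {u : ℝ} (hu : u ∈ Ioo (0:ℝ) 1) :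
    boxArc ρ s t u ∈ Metric.ball (0:ℂ) 1 := by
  have := mem_image_of_mem (boxArc ρ s t) hu
  rw [image_boxArc hρ hρ1 hst ht] at this
  exact this.1

theorem tendsto_boxArc_left {l : Filter X} (hρ : 0 < ρ) (hρ1 : ρ < 1) (hst : s < t)
    (hl : Tendsto (fun r : ℝ => χ (r * circ s)) (𝓝[<] 1) l) :
    Tendsto (fun u => χ (boxArc ρ s t u)) (𝓝[>] 0) l := by
  have h1 : Tendsto (fun u : ℝ => 1 - 3 * (1 - ρ) * u) (𝓝[>] 0) (𝓝[<] 1) := by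
    refine tendsto_nhdsWithin_iff.2 ⟨?_, ?_⟩
    · have : Tendsto (fun u : ℝ => 1 - 3 * (1 - ρ) * u) (𝓝 0) (𝓝 (1 - 3 * (1 - ρ) * 0)) :=
        (by fun_prop : Continuous fun u : ℝ => 1 - 3 * (1 - ρ) * u).tendsto 0
      rw [mul_zero, sub_zero] at this
      exact this.mono_left nhdsWithin_le_nhds
    · filter_upwards [self_mem_nhdsWithin] with u hu
      have hu' : (0:ℝ) < u := hu
      simp only [mem_Iio]
      nlinarith
  refine (hl.comp h1).congr' ?_
  filter_upwards [Ioo_mem_nhdsGT (show (0:ℝ) < 1 / 3 by norm_num)] with u hu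
  rcases boxArc_cases hρ hρ1 hst (u := u) ⟨hu.1, hu.2.trans (by norm_num)⟩ with
    ⟨r, h1, h2, h3, h4⟩ | ⟨r, h1, h2, h3, h4⟩ | ⟨r, h1, h2, h3, h4⟩
  · simp only [Function.comp_apply, h4, h3]
  · nlinarith [hu.2]
  · nlinarith [hu.2]

theorem tendsto_boxArc_right {l : Filter X} (hρ : 0 < ρ) (hρ1 : ρ < 1) (hst : s < t)
    (hl : Tendsto (fun r : ℝ => χ (r * circ t)) (𝓝[<] 1) l) :
    Tendsto (fun u => χ (boxArc ρ s t u)) (𝓝[<] 1) l := by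
  have h1 : Tendsto (fun u : ℝ => 1 - 3 * (1 - ρ) * (1 - u)) (𝓝[<] 1) (𝓝[<] 1) := by
    refine tendsto_nhdsWithin_iff.2 ⟨?_, ?_⟩
    · have : Tendsto (fun u : ℝ => 1 - 3 * (1 - ρ) * (1 - u)) (𝓝 1)
          (𝓝 (1 - 3 * (1 - ρ) * (1 - 1))) :=
        (by fun_prop : Continuous fun u : ℝ => 1 - 3 * (1 - ρ) * (1 - u)).tendsto 1
      rw [sub_self, mul_zero, sub_zero] at this
      exact this.mono_left nhdsWithin_le_nhds
    · filter_upwards [self_mem_nhdsWithin] with u hu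
      have hu' : u < 1 := hu
      simp only [mem_Iio]
      nlinarith
  refine (hl.comp h1).congr' ?_
  filter_upwards [Ioo_mem_nhdsLT (show (2 / 3 : ℝ) < 1 by norm_num)] with u hu
  rcases boxArc_cases hρ hρ1 hst (u := u) ⟨lt_trans (by norm_num) hu.1, hu.2⟩ with
    ⟨r, h1, h2, h3, h4⟩ | ⟨r, h1, h2, h3, h4⟩ | ⟨r, h1, h2, h3, h4⟩
  · nlinarith [hu.1]
  · nlinarith [hu.1]
  · simp only [Function.comp_apply, h4, h3]

theorem radial_mem_ball (θ : ℝ) : ∀ᶠ r : ℝ in 𝓝[<] 1, (r : ℂ) * circ θ ∈ Metric.ball (0:ℂ) 1 := by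
  filter_upwards [Ioo_mem_nhdsLT (show (0:ℝ) < 1 by norm_num)] with r hr
  rw [mem_ball_zero_iff, norm_mul_circ hr.1.le]
  exact hr.2

theorem DiscModel.mem_frontier_of_tendsto (m : DiscModel U χ) {V : Set ℂ}
    (hVB : V ⊆ Metric.ball 0 1) {θ : ℝ} (hθ : ∀ᶠ r : ℝ in 𝓝[<] 1, (r : ℂ) * circ θ ∈ V) {y : X}
    (hy : y ∉ U) (hl : Tendsto (fun r : ℝ => χ (r * circ θ)) (𝓝[<] 1) (𝓝 y)) :
    y ∈ frontier (χ '' V) := by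
  refine ⟨mem_closure_of_tendsto hl (hθ.mono fun r hr => mem_image_of_mem _ hr), fun h => ?_⟩
  obtain ⟨z, hz, rfl⟩ := interior_subset h
  exact hy (m.mem (hVB hz))

theorem DiscModel.mem_frontier (m : DiscModel U χ) {θ : ℝ} {y : X}
    (hy : y ∉ U) (hl : Tendsto (fun r : ℝ => χ (r * circ θ)) (𝓝[<] 1) (𝓝 y)) :
    y ∈ frontier U := by
  have := m.mem_frontier_of_tendsto Subset.rfl (radial_mem_ball θ) hy hl
  rwa [m.img] at this

theorem boxSector_radial (hρ : 0 < ρ) (hρ1 : ρ < 1) {θ : ℝ} (h1 : s < θ) (h2 : θ < t) :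
    ∀ᶠ r : ℝ in 𝓝[<] 1, (r : ℂ) * circ θ ∈ boxSector ρ s t := by
  filter_upwards [Ioo_mem_nhdsLT hρ1] with r hr
  exact (mem_boxSector hρ).2 ⟨r, θ, hr.1, hr.2, h1, h2, rfl⟩

theorem boxOutside_radial {θ : ℝ} (h1 : t < θ) (h2 : θ < s + 2 * Real.pi) :
    ∀ᶠ r : ℝ in 𝓝[<] 1, (r : ℂ) * circ θ ∈ boxOutside ρ s t := by
  filter_upwards [Ioo_mem_nhdsLT (show (0:ℝ) < 1 by norm_num), radial_mem_ball θ] with r hr hr'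
  exact Or.inr ⟨hr', mem_sector.2 ⟨r, θ, hr.1, h1, h2, rfl⟩⟩

theorem boxSector_nonempty (hρ : 0 < ρ) (hρ1 : ρ < 1) (hst : s < t) :
    (boxSector ρ s t).Nonempty := by
  obtain ⟨θ, h1, h2⟩ := exists_between hst
  obtain ⟨r, hr⟩ := (boxSector_radial hρ hρ1 h1 h2).exists
  exact ⟨_, hr⟩

variable [T2Space X] [LocallyCompactSpace X]

/-- The arc bounding a good truncated sector, completed with its endpoints. -/
noncomputable def boxCut (χ : ℂ → X) (ρ s t : ℝ) : ℝ → X :=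
  extendFrom (Ioo 0 1) fun u => χ (boxArc ρ s t u)

namespace GoodBox

theorem continuousOn (h : GoodBox U χ ρ s t y y') (m : DiscModel U χ) :
    ContinuousOn (boxCut χ ρ s t) (Icc 0 1) :=
  continuousOn_Icc_extendFrom_Ioo
    (m.continuousOn.comp (continuous_boxArc ρ s t).continuousOn fun _ hu =>
      boxArc_mem h.pos h.lt_one h.lt h.lt' hu)
    (tendsto_boxArc_left h.pos h.lt_one h.lt h.lim)
    (tendsto_boxArc_right h.pos h.lt_one h.lt h.lim')

theorem cut_zero (h : GoodBox U χ ρ s t y y') : boxCut χ ρ s t 0 = y :=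
  eq_lim_at_left_extendFrom_Ioo zero_lt_one (tendsto_boxArc_left h.pos h.lt_one h.lt h.lim)

theorem cut_one (h : GoodBox U χ ρ s t y y') : boxCut χ ρ s t 1 = y' :=
  eq_lim_at_right_extendFrom_Ioo zero_lt_one (tendsto_boxArc_right h.pos h.lt_one h.lt h.lim')

theorem cut_eq (h : GoodBox U χ ρ s t y y') (m : DiscModel U χ) {u : ℝ} (hu : u ∈ Ioo (0:ℝ) 1) :
    boxCut χ ρ s t u = χ (boxArc ρ s t u) := by
  refine extendFrom_eq (by rw [closure_Ioo zero_ne_one]; exact Ioo_subset_Icc_self hu) ?_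
  have h1 := boxArc_mem h.pos h.lt_one h.lt h.lt' hu
  exact ((m.continuousAt h1).comp (continuous_boxArc ρ s t).continuousAt).tendsto.mono_left
    nhdsWithin_le_nhds

theorem image_Ioo (h : GoodBox U χ ρ s t y y') (m : DiscModel U χ) :
    boxCut χ ρ s t '' Ioo 0 1 =
      χ '' (Metric.ball 0 1 \ (boxSector ρ s t ∪ boxOutside ρ s t)) := by
  rw [← image_boxArc h.pos h.lt_one h.lt h.lt', image_image]
  exact image_congr fun u hu => h.cut_eq m hu

theorem image_Icc (h : GoodBox U χ ρ s t y y') (m : DiscModel U χ) :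
    boxCut χ ρ s t '' Icc 0 1 =
      χ '' (Metric.ball 0 1 \ (boxSector ρ s t ∪ boxOutside ρ s t)) ∪ {y, y'} := by
  rw [← h.image_Ioo m, ← Ioo_union_both zero_le_one, image_union, image_pair, h.cut_zero,
    h.cut_one]

theorem diff_cut (h : GoodBox U χ ρ s t y y') (m : DiscModel U χ) :
    U \ (boxCut χ ρ s t '' Ioo 0 1) = χ '' boxSector ρ s t ∪ χ '' boxOutside ρ s t := by
  have h1 := boxSector_subset_ball (s := s) (t := t) h.pos
  have h2 := boxOutside_subset_ball (s := s) (t := t) h.lt_one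
  rw [h.image_Ioo m, ← image_union]
  conv_lhs => rw [← m.img]
  rw [← m.inj.image_sdiff_subset sdiff_subset, sdiff_sdiff_right_self]
  congr 1
  exact inter_eq_right.2 (union_subset h1 h2)

theorem disjoint_image (h : GoodBox U χ ρ s t y y') (m : DiscModel U χ) :
    Disjoint (χ '' boxSector ρ s t) (χ '' boxOutside ρ s t) :=
  (disjoint_boxSector_boxOutside h.pos).image m.inj (boxSector_subset_ball h.pos)
    (boxOutside_subset_ball h.lt_one)

theorem isOpen_sect (h : GoodBox U χ ρ s t y y') (m : DiscModel U χ) :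
    IsOpen (χ '' boxSector ρ s t) :=
  m.isOpen_image (isOpen_boxSector h.pos) (boxSector_subset_ball h.pos)

theorem isOpen_out (h : GoodBox U χ ρ s t y y') (m : DiscModel U χ) :
    IsOpen (χ '' boxOutside ρ s t) :=
  m.isOpen_image (isOpen_boxOutside ρ s t) (boxOutside_subset_ball h.lt_one)

theorem isPreconnected_sect (h : GoodBox U χ ρ s t y y') (m : DiscModel U χ) :
    IsPreconnected (χ '' boxSector ρ s t) :=
  (isPreconnected_boxSector ρ s t).image _
    (m.continuousOn.mono (boxSector_subset_ball h.pos))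

theorem isPreconnected_out (h : GoodBox U χ ρ s t y y') (m : DiscModel U χ) :
    IsPreconnected (χ '' boxOutside ρ s t) :=
  (isPreconnected_boxOutside h.pos h.lt_one h.lt').image _
    (m.continuousOn.mono (boxOutside_subset_ball h.lt_one))

theorem isCrossSection (h : GoodBox U χ ρ s t y y') (m : DiscModel U χ) :
    IsCrossSection U (χ '' boxSector ρ s t) := by
  have hS := boxSector_subset_ball (s := s) (t := t) h.pos
  have hO := boxOutside_subset_ball (s := s) (t := t) h.lt_one
  have hSne : (χ '' boxSector ρ s t).Nonempty :=
    (boxSector_nonempty h.pos h.lt_one h.lt).image _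
  have hOne : (χ '' boxOutside ρ s t).Nonempty :=
    Set.Nonempty.image _ ⟨0, Or.inl (by simpa using h.pos)⟩
  have h1 : ∀ x ∈ χ '' boxSector ρ s t, connectedComponentIn (U \ (boxCut χ ρ s t '' Ioo 0 1)) x =
      χ '' boxSector ρ s t := fun x hx =>
    connectedComponentIn_of_split (h.diff_cut m) (h.isOpen_sect m) (h.isOpen_out m)
      (h.disjoint_image m) (h.isPreconnected_sect m) hx
  have h2 : ∀ x ∈ χ '' boxOutside ρ s t, connectedComponentIn (U \ (boxCut χ ρ s t '' Ioo 0 1)) x =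
      χ '' boxOutside ρ s t := fun x hx =>
    connectedComponentIn_of_split ((h.diff_cut m).trans (union_comm _ _)) (h.isOpen_out m)
      (h.isOpen_sect m) (h.disjoint_image m).symm (h.isPreconnected_out m) hx
  have hcS : IsCompOf (U \ (boxCut χ ρ s t '' Ioo 0 1)) (χ '' boxSector ρ s t) := by
    obtain ⟨x, hx⟩ := hSne
    exact ⟨x, h.diff_cut m ▸ Or.inl hx, (h1 x hx).symm⟩
  have hcO : IsCompOf (U \ (boxCut χ ρ s t '' Ioo 0 1)) (χ '' boxOutside ρ s t) := by
    obtain ⟨x, hx⟩ := hOne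
    exact ⟨x, h.diff_cut m ▸ Or.inr hx, (h2 x hx).symm⟩
  have hIcc : ∀ z, z ∉ U → z ∉ ({y, y'} : Set X) → z ∉ boxCut χ ρ s t '' Icc 0 1 := by
    intro z hz hz' hz''
    rw [h.image_Icc m] at hz''
    rcases hz'' with ⟨w, hw, rfl⟩ | hz''
    · exact hz (m.mem hw.1)
    · exact hz' hz''
  have hfin : ({y, y'} : Set X).Finite := by simp
  refine ⟨boxCut χ ρ s t '' Ioo 0 1, ⟨boxCut χ ρ s t, h.continuousOn m, ?_, ?_, ?_, ?_, rfl,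
    _, _, ⟨hcS, hcO, ?_, ?_⟩, ?_, ?_⟩, hcS⟩
  · intro u hu v hv huv
    rw [h.cut_eq m hu, h.cut_eq m hv] at huv
    exact injOn_boxArc h.pos h.lt_one h.lt h.lt' hu hv
      (m.inj (boxArc_mem h.pos h.lt_one h.lt h.lt' hu) (boxArc_mem h.pos h.lt_one h.lt h.lt' hv)
        huv)
  · intro u hu
    rw [h.cut_eq m hu]
    exact m.mem (boxArc_mem h.pos h.lt_one h.lt h.lt' hu)
  · rw [h.cut_zero]
    exact m.mem_frontier h.not_mem h.lim
  · rw [h.cut_one]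
    exact m.mem_frontier h.not_mem' h.lim'
  · exact fun he => (h.disjoint_image m).ne hSne.ne_empty he
  · intro x hx
    rw [h.diff_cut m] at hx
    exact hx.imp (h1 x) (h2 x)
  · obtain ⟨θ, hθ, z, hz, hz', hzl⟩ := m.radial s t h.lt _ hfin
    exact ⟨z, m.mem_frontier_of_tendsto hS (boxSector_radial h.pos h.lt_one hθ.1 hθ.2) hz hzl,
      m.mem_frontier hz hzl, hIcc z hz hz'⟩
  · obtain ⟨θ, hθ, z, hz, hz', hzl⟩ := m.radial t (s + 2 * Real.pi) h.lt' _ hfin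
    exact ⟨z, m.mem_frontier_of_tendsto hO (boxOutside_radial hθ.1 hθ.2) hz hzl,
      m.mem_frontier hz hzl, hIcc z hz hz'⟩

theorem closure_bdIn_subset (h : GoodBox U χ ρ s t y y') (m : DiscModel U χ) :
    closure (bdIn U (χ '' boxSector ρ s t)) ⊆
      χ '' (Metric.ball 0 1 \ (boxSector ρ s t ∪ boxOutside ρ s t)) ∪ {y, y'} := by
  rw [← h.image_Icc m]
  refine closure_minimal ?_ (isCompact_Icc.image_of_continuousOn (h.continuousOn m)).isClosed
  rintro z ⟨⟨hz, hzS⟩, hzU⟩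
  refine image_mono Ioo_subset_Icc_self ?_
  by_contra hcon
  have h1 : z ∈ U \ (boxCut χ ρ s t '' Ioo 0 1) := ⟨hzU, hcon⟩
  rw [h.diff_cut m] at h1
  rcases h1 with h1 | h1
  · exact hzS h1
  · exact Set.disjoint_left.1 ((h.disjoint_image m).symm.closure_right (h.isOpen_out m)) h1 hz

end GoodBox
end

end

section

theorem dist_circ_le (s t : ℝ) : dist (circ s) (circ t) ≤ |s - t| := by
  have h1 : circ s = circ t * Complex.exp (Complex.I * ((s - t : ℝ) : ℂ)) := by
    rw [circ, circ, ← Complex.exp_add]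
    congr 1
    push_cast
    ring
  rw [dist_eq_norm, h1]
  calc ‖circ t * Complex.exp (Complex.I * ((s - t : ℝ) : ℂ)) - circ t‖
      = ‖circ t * (Complex.exp (Complex.I * ((s - t : ℝ) : ℂ)) - 1)‖ := by rw [mul_sub, mul_one]
    _ = ‖Complex.exp (Complex.I * ((s - t : ℝ) : ℂ)) - 1‖ := by rw [norm_mul, norm_circ, one_mul]
    _ ≤ ‖s - t‖ := Real.norm_exp_I_mul_ofReal_sub_one_le
    _ = |s - t| := Real.norm_eq_abs _

theorem dist_mul_circ_le {r : ℝ} (hr : r ≤ 1) (s t : ℝ) :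
    dist ((r : ℂ) * circ s) (circ t) ≤ 1 - r + |s - t| := by
  refine (dist_triangle _ (circ s) _).trans (add_le_add ?_ (dist_circ_le s t))
  rw [dist_eq_norm, ← sub_one_mul, norm_mul, norm_circ, mul_one,
    show (r : ℂ) - 1 = ((r - 1 : ℝ) : ℂ) by push_cast; rfl, Complex.norm_real, Real.norm_eq_abs,
    abs_of_nonpos (by linarith)]
  linarith

section
variable {X : Type*} [TopologicalSpace X] {U : Set X} {χ : ℂ → X}
variable [T2Space X] [LocallyCompactSpace X]

/-- Truncated sectors shrinking to a boundary point form a chain. -/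
theorem DiscModel.exists_chain (m : DiscModel U χ) (x : ℝ) :
    ∃ T : ℕ → Set ℂ, IsPEChain U (fun n => χ '' T n) ∧ (∀ n, T n ⊆ Metric.ball 0 1) ∧
      (∀ n, IsPreconnected (T n)) ∧ (∀ n, (T n).Nonempty) ∧
      (∀ n, ∃ r > 0, Metric.ball (circ x) r ∩ Metric.ball 0 1 ⊆ T n) ∧
      ∀ r > 0, ∃ n, T n ⊆ Metric.ball (circ x) r := by
  classical
  let α := ℝ × ℝ × ℝ × X × X
  let P : α → Prop := fun p => p.1 < 1 / 2 ∧ x - p.1 < p.2.1 ∧ p.2.1 < x ∧ x < p.2.2.1 ∧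
    p.2.2.1 < x + p.1 ∧ GoodBox U χ (1 - p.1) p.2.1 p.2.2.1 p.2.2.2.1 p.2.2.2.2
  let R : α → α → Prop := fun p q => q.1 ≤ p.1 / 2 ∧ p.2.1 < q.2.1 ∧ q.2.2.1 < p.2.2.1 ∧
    q.2.2.2.1 ∉ ({p.2.2.2.1, p.2.2.2.2} : Set X) ∧ q.2.2.2.2 ∉ ({p.2.2.2.1, p.2.2.2.2} : Set X)
  have hpi : (3 : ℝ) < Real.pi := Real.pi_gt_three
  obtain ⟨F, hF, hR⟩ := exists_seq_of_forall_finset_exists P R (by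
    intro S hS
    have hfin : (⋃ p ∈ S, ({p.2.2.2.1, p.2.2.2.2} : Set X)).Finite :=
      S.finite_toSet.biUnion fun p _ => by simp
    obtain ⟨δ, hδ0, hδ1, hδ⟩ : ∃ δ : ℝ, 0 < δ ∧ δ < 1 / 2 ∧ ∀ p ∈ S, δ ≤ p.1 / 2 ∧
        p.2.1 < x - δ ∧ x + δ < p.2.2.1 := by
      have h1 : ∀ᶠ δ : ℝ in 𝓝[>] 0, ∀ p ∈ S, δ ≤ p.1 / 2 ∧ p.2.1 < x - δ ∧ x + δ < p.2.2.1 := by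
        rw [Filter.eventually_all_finset]
        intro p hp
        obtain ⟨h1, h2, h3, h4, h5, h6⟩ := hS p hp
        have h7 : 0 < min (p.1 / 2) (min (x - p.2.1) (p.2.2.1 - x)) := by
          refine lt_min ?_ (lt_min ?_ ?_) <;> linarith
        filter_upwards [Ioo_mem_nhdsGT h7] with δ hδ
        have h8 := hδ.2
        rw [lt_min_iff, lt_min_iff] at h8
        exact ⟨h8.1.le, by linarith [h8.2.1], by linarith [h8.2.2]⟩
      obtain ⟨δ, hδ, hδ'⟩ := (h1.and (Ioo_mem_nhdsGT (show (0:ℝ) < 1 / 2 by norm_num))).exists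
      exact ⟨δ, hδ'.1, hδ'.2, hδ⟩
    obtain ⟨s, hs, y, hy, hyS, hyl⟩ := m.radial (x - δ) x (by linarith) _ hfin
    obtain ⟨t, ht, y', hy', hyS', hyl'⟩ := m.radial x (x + δ) (by linarith) _ hfin
    refine ⟨(δ, s, t, y, y'), ⟨hδ1, hs.1, hs.2, ht.1, ht.2, ⟨?_, ?_, ?_, ?_, hy, hy', hyl, hyl'⟩⟩,
      fun p hp => ⟨(hδ p hp).1, (hδ p hp).2.1.trans hs.1, ht.2.trans (hδ p hp).2.2,
        fun h => hyS (mem_biUnion hp h), fun h => hyS' (mem_biUnion hp h)⟩⟩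
    · change 0 < 1 - δ
      linarith
    · change 1 - δ < 1
      linarith
    · exact hs.2.trans ht.1
    · have := hs.1
      have := ht.2
      change t < s + 2 * Real.pi
      linarith)
  have hpos : ∀ n, 0 < (F n).1 := fun n => by
    obtain ⟨-, h2, h3, -⟩ := hF n
    linarith
  have hG : ∀ n, GoodBox U χ (1 - (F n).1) (F n).2.1 (F n).2.2.1 (F n).2.2.2.1 (F n).2.2.2.2 :=
    fun n => (hF n).2.2.2.2.2
  set T : ℕ → Set ℂ := fun n => boxSector (1 - (F n).1) (F n).2.1 (F n).2.2.1 with hT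
  set A : ℕ → Set ℂ := fun n => Metric.ball 0 1 \ (boxSector (1 - (F n).1) (F n).2.1 (F n).2.2.1 ∪
    boxOutside (1 - (F n).1) (F n).2.1 (F n).2.2.1) with hA
  have hsub : ∀ n k, n < k → T k ∪ A k ⊆ T n := by
    intro n k hnk z hz
    obtain ⟨h1, h2, h3, -, -⟩ := hR n k hnk
    have hn := hpos n
    have hk := (hG k).pos
    have hk' := (hG k).lt
    rw [hT]
    simp only
    rw [mem_boxSector (hG n).pos]
    rcases hz with hz | hz
    · obtain ⟨r, θ, k1, k2, k3, k4, rfl⟩ := (mem_boxSector hk).1 hz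
      exact ⟨r, θ, by linarith, k2, by linarith, by linarith, rfl⟩
    · rw [hA] at hz
      simp only at hz
      rw [← image_boxArc hk (hG k).lt_one hk' (hG k).lt'] at hz
      obtain ⟨u, hu, rfl⟩ := hz
      rcases boxArc_cases hk (hG k).lt_one hk' hu with ⟨r, k1, k2, k3, k4⟩ | ⟨r, k1, k2, k3, k4⟩ |
        ⟨r, k1, k2, k3, k4⟩
      · exact ⟨r, _, by linarith, k2, h2, by linarith, k4⟩
      · exact ⟨_, r, by linarith, (hG k).lt_one, by linarith, by linarith, k4⟩
      · exact ⟨r, _, by linarith, k2, by linarith, h3, k4⟩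
  have hball : ∀ n, T n ⊆ Metric.ball 0 1 := fun n => boxSector_subset_ball (hG n).pos
  have hmono : ∀ i j : ℕ, j ≤ i → T i ⊆ T j := fun i j hij => by
    rcases hij.lt_or_eq with h | rfl
    · exact subset_union_left.trans (hsub j i h)
    · exact Subset.rfl
  have hdis : ∀ i j : ℕ, i < j →
      closure (bdIn U (χ '' T i)) ∩ closure (bdIn U (χ '' T j)) = ∅ := by
    intro i j hij
    rw [← disjoint_iff_inter_eq_empty]
    refine Disjoint.mono ((hG i).closure_bdIn_subset m) ((hG j).closure_bdIn_subset m) ?_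
    rw [Set.disjoint_left]
    obtain ⟨-, -, -, h1, h2⟩ := hR i j hij
    rintro _ (⟨z, hz, rfl⟩ | hz) (⟨w, hw, hzw⟩ | hw)
    · have := m.inj hw.1 hz.1 hzw
      subst this
      exact hz.2 (Or.inl (hsub i j hij (Or.inr hw)))
    · rcases hw with hw | hw
      · exact (hG j).not_mem (hw ▸ m.mem hz.1)
      · exact (hG j).not_mem' (hw ▸ m.mem hz.1)
    · rcases hz with hz | hz
      · exact (hG i).not_mem (by rw [← hz, ← hzw]; exact m.mem hw.1)
      · exact (hG i).not_mem' (by rw [← hz, ← hzw]; exact m.mem hw.1)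
    · rcases hw with hw | hw
      · exact h1 (hw ▸ hz)
      · exact h2 (hw ▸ hz)
  refine ⟨T, ⟨fun i => (hG i).isCrossSection m, fun i j hij => image_mono (hmono i j hij),
    fun i j hij => ?_⟩, hball, fun n => isPreconnected_boxSector _ _ _,
    fun n => boxSector_nonempty (hG n).pos (hG n).lt_one (hG n).lt, fun n => ?_, fun r hr => ?_⟩
  · rcases lt_or_gt_of_ne hij with h | h
    · exact hdis i j h
    · rw [inter_comm]
      exact hdis j i h
  · obtain ⟨h1, h2, h3, h4, h5, h6⟩ := hF n
    have hop : IsOpen ({z : ℂ | 1 - (F n).1 < ‖z‖} ∩ sector (F n).2.1 (F n).2.2.1) :=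
      (isOpen_lt continuous_const continuous_norm).inter (isOpen_sector _ _)
    obtain ⟨r, hr, hr'⟩ := Metric.isOpen_iff.1 hop (circ x)
      ⟨by simp only [Set.mem_ofPred_eq, norm_circ]; exact h6.lt_one, circ_mem_sector h3 h4⟩
    refine ⟨r, hr, fun z hz => ?_⟩
    have hz' := hr' hz.1
    change z ∈ boxSector (1 - (F n).1) (F n).2.1 (F n).2.2.1
    rw [boxSector_eq h6.pos]
    exact ⟨⟨hz'.1, mem_ball_zero_iff.1 hz.2⟩, hz'.2⟩
  · have hpow : ∀ n, (F n).1 ≤ (1 / 2) ^ n := by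
      intro n
      induction n with
      | zero => linarith [(hF 0).1]
      | succ n ih =>
        have := (hR n (n + 1) n.lt_succ_self).1
        rw [pow_succ]
        linarith
    obtain ⟨n, hn⟩ := exists_pow_lt_of_lt_one (show 0 < r / 2 by positivity)
      (show (1 / 2 : ℝ) < 1 by norm_num)
    refine ⟨n, fun z hz => ?_⟩
    obtain ⟨ρ, θ, h1, h2, h3, h4, rfl⟩ := (mem_boxSector (hG n).pos).1 hz
    obtain ⟨-, k2, k3, k4, k5, -⟩ := hF n
    have h5 : |θ - x| < (F n).1 := abs_lt.2 ⟨by linarith, by linarith⟩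
    have := dist_mul_circ_le h2.le θ x
    have := hpow n
    rw [Metric.mem_ball]
    linarith

end

end

section
variable {X : Type*} [TopologicalSpace X] {U : Set X} {χ : ℂ → X}

theorem DiscModel.exists_inverse (m : DiscModel U χ) :
    ∃ η : X → ℂ, (∀ z ∈ Metric.ball (0:ℂ) 1, η (χ z) = z) ∧ ContinuousOn η U ∧
      ∀ p ∈ U, η p ∈ Metric.ball (0:ℂ) 1 ∧ χ (η p) = p := by
  have h1 : ∀ z ∈ Metric.ball (0:ℂ) 1, Function.invFunOn χ (Metric.ball 0 1) (χ z) = z :=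
    fun z hz => m.inj.leftInvOn_invFunOn hz
  refine ⟨Function.invFunOn χ (Metric.ball 0 1), h1, ?_, fun p hp => ?_⟩
  · rw [← m.img]
    rintro _ ⟨z, hz, rfl⟩
    refine ContinuousAt.continuousWithinAt ?_
    rw [ContinuousAt, h1 z hz, ← m.nhds z hz, tendsto_map'_iff]
    refine tendsto_id.congr' ?_
    filter_upwards [Metric.isOpen_ball.mem_nhds hz] with w hw
    exact (h1 w hw).symm
  · rw [← m.img] at hp
    obtain ⟨z, hz, rfl⟩ := hp
    rw [h1 z hz]
    exact ⟨hz, rfl⟩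

theorem IsCrossSection.isOpen [T2Space X] [LocallyConnectedSpace X] (hU : IsOpen U) {E : Set X}
    (hE : IsCrossSection U E) : IsOpen E ∧ E.Nonempty ∧ ∃ g : ℝ → X, ContinuousOn g (Icc 0 1) ∧
      (∀ t ∈ Ioo (0:ℝ) 1, g t ∈ U) ∧ g 0 ∉ U ∧ g 1 ∉ U ∧ bdIn U E ⊆ g '' Ioo 0 1 := by
  obtain ⟨γ, ⟨g, hg, -, hgU, h0, h1, rfl, -⟩, p, hp, rfl⟩ := hE
  have h0U : g 0 ∉ U := fun h => h0.2 (hU.interior_eq.symm ▸ h)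
  have h1U : g 1 ∉ U := fun h => h1.2 (hU.interior_eq.symm ▸ h)
  have hop : IsOpen (U \ (g '' Ioo 0 1)) := by
    have : U \ (g '' Ioo 0 1) = U \ (g '' Icc 0 1) := by
      refine Subset.antisymm (fun q hq => ⟨hq.1, ?_⟩)
        (sdiff_subset_sdiff_right (image_mono Ioo_subset_Icc_self))
      rw [← Ioo_union_both zero_le_one, image_union, image_pair]
      rintro (h | h | h)
      · exact hq.2 h
      · exact h0U (h ▸ hq.1)
      · exact h1U (h ▸ hq.1)
    rw [this]
    exact hU.sdiff (isCompact_Icc.image_of_continuousOn hg).isClosed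
  refine ⟨hop.connectedComponentIn, ⟨p, mem_connectedComponentIn hp⟩, g, hg, hgU, h0U, h1U, ?_⟩
  rintro q ⟨⟨hq, hq'⟩, hqU⟩
  by_contra hcon
  have hqA : q ∈ U \ (g '' Ioo 0 1) := ⟨hqU, hcon⟩
  obtain ⟨w, hw, hw'⟩ := mem_closure_iff.1 hq _ (hop.connectedComponentIn (x := q))
    (mem_connectedComponentIn hqA)
  exact hq' (connectedComponentIn_eq hw' ▸ connectedComponentIn_eq hw ▸
    mem_connectedComponentIn hqA)

variable [T2Space X] [LocallyCompactSpace X]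

theorem DiscModel.landing_of_arc (m : DiscModel U χ) {g : ℝ → X} (hg : ContinuousOn g (Icc 0 1))
    (hgU : ∀ t ∈ Ioo (0:ℝ) 1, g t ∈ U) (h1 : g 1 ∉ U) {u : ℕ → ℝ} (hu : ∀ k, u k ∈ Ioo (0:ℝ) 1)
    (hut : Tendsto u atTop (𝓝 1)) {z : ℕ → ℂ} (hz : ∀ k, z k ∈ Metric.ball (0:ℂ) 1)
    (hzg : ∀ k, χ (z k) = g (u k)) {x : ℝ} (hzx : Tendsto z atTop (𝓝 (circ x))) :
    ∃ c : ℝ → ℂ, ContinuousOn c (Ico 0 1) ∧ MapsTo c (Ico 0 1) (Metric.ball 0 1) ∧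
      Tendsto (fun t => χ (c t)) (𝓝[<] 1) (𝓝 (g 1)) ∧ Tendsto c (𝓝[<] 1) (𝓝 (circ x)) := by
  obtain ⟨η, hη, hηc, hη'⟩ := m.exists_inverse
  have hmem : ∀ t ∈ Ico (0:ℝ) 1, (1 + t) / 2 ∈ Ioo (0:ℝ) 1 := fun t ht =>
    ⟨by linarith [ht.1], by linarith [ht.2]⟩
  have hc : ContinuousOn (fun t : ℝ => η (g ((1 + t) / 2))) (Ico 0 1) := by
    refine hηc.comp ((hg.mono Ioo_subset_Icc_self).comp
      (by fun_prop : Continuous fun t : ℝ => (1 + t) / 2).continuousOn hmem) ?_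
    exact fun t ht => hgU _ (hmem t ht)
  have hcB : MapsTo (fun t : ℝ => η (g ((1 + t) / 2))) (Ico 0 1) (Metric.ball 0 1) :=
    fun t ht => (hη' _ (hgU _ (hmem t ht))).1
  have hIoo : ∀ᶠ t : ℝ in 𝓝[<] 1, t ∈ Ico (0:ℝ) 1 := by
    filter_upwards [Ioo_mem_nhdsLT (show (0:ℝ) < 1 by norm_num)] with t ht
    exact ⟨ht.1.le, ht.2⟩
  have hlim : Tendsto (fun t : ℝ => χ (η (g ((1 + t) / 2)))) (𝓝[<] 1) (𝓝 (g 1)) := by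
    have h2 : Tendsto (fun t : ℝ => (1 + t) / 2) (𝓝[<] 1) (𝓝[Icc 0 1] 1) := by
      refine tendsto_nhdsWithin_iff.2 ⟨?_, hIoo.mono fun t ht => Ioo_subset_Icc_self (hmem t ht)⟩
      have : Tendsto (fun t : ℝ => (1 + t) / 2) (𝓝 1) (𝓝 ((1 + 1) / 2)) :=
        (by fun_prop : Continuous fun t : ℝ => (1 + t) / 2).tendsto 1
      rw [show ((1:ℝ) + 1) / 2 = 1 by norm_num] at this
      exact this.mono_left nhdsWithin_le_nhds
    refine ((hg 1 ⟨zero_le_one, le_rfl⟩).tendsto.comp h2).congr' ?_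
    filter_upwards [hIoo] with t ht
    exact ((hη' _ (hgU _ (hmem t ht))).2).symm
  refine ⟨_, hc, hcB, hlim, ?_⟩
  obtain ⟨x', hx'⟩ := m.exists_landing hc hcB (Or.inl ⟨_, h1, rfl⟩) hlim
  have h3 : Tendsto (fun k => 2 * u k - 1) atTop (𝓝[<] 1) := by
    refine tendsto_nhdsWithin_iff.2 ⟨?_, Eventually.of_forall fun k => ?_⟩
    · have := (hut.const_mul 2).sub_const 1
      rwa [show (2:ℝ) * 1 - 1 = 1 by norm_num] at this
    · have := (hu k).2
      simp only [mem_Iio]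
      linarith
  have h4 : Tendsto z atTop (𝓝 (circ x')) := by
    refine (hx'.comp h3).congr fun k => ?_
    simp only [Function.comp_apply]
    rw [show (1 + (2 * u k - 1)) / 2 = u k by ring, ← hzg, hη _ (hz k)]
  rwa [tendsto_nhds_unique hzx h4]

theorem DiscModel.landing_of_crossSection [LocallyConnectedSpace X] (m : DiscModel U χ)
    (hU : IsOpen U) {E : Set X} (hE : IsCrossSection U E) {z : ℕ → ℂ}
    (hz : ∀ k, z k ∈ Metric.ball (0:ℂ) 1) (hzE : ∀ k, χ (z k) ∈ bdIn U E) {x : ℝ}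
    (hzx : Tendsto z atTop (𝓝 (circ x))) :
    ∃ y, y ∉ U ∧ y ∈ closure (bdIn U E) ∧ ∃ c : ℝ → ℂ, ContinuousOn c (Ico 0 1) ∧
      MapsTo c (Ico 0 1) (Metric.ball 0 1) ∧
      Tendsto (fun t => χ (c t)) (𝓝[<] 1) (𝓝 y) ∧ Tendsto c (𝓝[<] 1) (𝓝 (circ x)) := by
  obtain ⟨-, -, g, hg, hgU, h0, h1, hsub⟩ := hE.isOpen hU
  choose u hu hgu using fun k => hsub (hzE k)
  obtain ⟨v, hv, j, hj, hjv⟩ := isCompact_Icc.tendsto_subseq fun k => Ioo_subset_Icc_self (hu k)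
  have hzj : Tendsto (fun k => z (j k)) atTop (𝓝 (circ x)) := hzx.comp hj.tendsto_atTop
  have hlim : Tendsto (fun k => χ (z (j k))) atTop (𝓝 (g v)) := by
    refine ((hg v hv).tendsto.comp (tendsto_nhdsWithin_iff.2 ⟨hjv, Eventually.of_forall
      fun k => Ioo_subset_Icc_self (hu (j k))⟩)).congr fun k => hgu (j k)
  have hcl : g v ∈ closure (bdIn U E) :=
    mem_closure_of_tendsto hlim (Eventually.of_forall fun k => hzE (j k))
  have hvU : v ∉ Ioo (0:ℝ) 1 := by
    intro hv'
    obtain ⟨η, hη, hηc, hη'⟩ := m.exists_inverse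
    have h2 : Tendsto (fun k => η (χ (z (j k)))) atTop (𝓝 (η (g v))) :=
      ((hηc.continuousAt (hU.mem_nhds (hgU v hv'))).tendsto.comp hlim)
    have h3 : circ x = η (g v) := by
      refine tendsto_nhds_unique hzj (h2.congr fun k => hη _ (hz _))
    have h4 := (hη' _ (hgU v hv')).1
    rw [← h3, mem_ball_zero_iff, norm_circ] at h4
    exact lt_irrefl _ h4
  rw [← Ioo_union_both zero_le_one] at hv
  rcases hv with hv | rfl | rfl
  · exact (hvU hv).elim
  · refine ⟨g 0, h0, hcl, ?_⟩
    have hmem : ∀ {t : ℝ}, t ∈ Icc (0:ℝ) 1 → 1 - t ∈ Icc (0:ℝ) 1 := fun ht =>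
      ⟨by linarith [ht.2], by linarith [ht.1]⟩
    have := m.landing_of_arc (g := fun t => g (1 - t))
      (hg.comp (by fun_prop : Continuous fun t : ℝ => 1 - t).continuousOn fun t ht => hmem ht)
      (fun t ht => hgU _ ⟨by linarith [ht.2], by linarith [ht.1]⟩) (by simpa using h0)
      (u := fun k => 1 - u (j k)) (fun k => ⟨by linarith [(hu (j k)).2], by linarith [(hu (j k)).1]⟩)
      (by simpa using hjv.const_sub 1) (fun k => hz (j k))
      (fun k => by simp only [sub_sub_cancel]; exact (hgu (j k)).symm) hzj
    simpa using this
  · exact ⟨g 1, h1, hcl, m.landing_of_arc hg hgU h1 (fun k => hu (j k)) hjv (fun k => hz (j k))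
      (fun k => (hgu (j k)).symm) hzj⟩

/-- Every boundary point of the disc carries a prime chain. -/
theorem DiscModel.exists_primeChain [LocallyConnectedSpace X] (m : DiscModel U χ) (hU : IsOpen U)
    (x : ℝ) : ∃ T : ℕ → Set ℂ, IsPrimeChain U (fun n => χ '' T n) ∧
      (∀ n, T n ⊆ Metric.ball 0 1) ∧
      (∀ n, ∃ r > 0, Metric.ball (circ x) r ∩ Metric.ball 0 1 ⊆ T n) ∧
      ∀ r > 0, ∃ n, T n ⊆ Metric.ball (circ x) r := by
  obtain ⟨T, hT, hTB, hTp, hTne, hTn, hTr⟩ := m.exists_chain x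
  refine ⟨T, ⟨hT, fun E hE hdiv n => ?_⟩, hTB, hTn, hTr⟩
  by_contra! hcon
  have hmonoT : ∀ {i j : ℕ}, j ≤ i → T i ⊆ T j := fun {i j} hij z hz => by
    obtain ⟨w, hw, hwz⟩ := hT.2.1 i j hij ⟨z, hz, rfl⟩
    rwa [← m.inj (hTB _ hw) (hTB _ hz) hwz]
  have key : ∀ N, n ≤ N → ∃ y, y ∉ U ∧ y ∈ closure (bdIn U (E N)) ∧ ∃ c : ℝ → ℂ,
      ContinuousOn c (Ico 0 1) ∧ MapsTo c (Ico 0 1) (Metric.ball 0 1) ∧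
      Tendsto (fun t => χ (c t)) (𝓝[<] 1) (𝓝 y) ∧ Tendsto c (𝓝[<] 1) (𝓝 (circ x)) := by
    intro N hN
    obtain ⟨hEo, hEne, -⟩ := (hE.1 N).isOpen hU
    have h1 : ∀ k, ∃ z ∈ T k, χ z ∈ bdIn U (E N) := by
      intro k
      by_contra! h2
      obtain ⟨i, hi⟩ := hdiv k
      obtain ⟨p, hp⟩ := ((hE.1 (max i N)).isOpen hU).2.1
      have hp1 : p ∈ χ '' T k := hi (hE.2.1 _ _ (le_max_left _ _) hp)
      have hp2 : p ∈ E N := hE.2.1 _ _ (le_max_right _ _) hp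
      have h3 : IsPreconnected (χ '' T k) := (hTp k).image _ (m.continuousOn.mono (hTB k))
      have h4 : χ '' T k ⊆ E N := by
        refine h3.subset_left_of_subset_union hEo isClosed_closure.isOpen_compl
          (Set.disjoint_left.2 fun q hq hq' => hq' (subset_closure hq)) ?_ ⟨p, hp1, hp2⟩
        rintro _ ⟨z, hz, rfl⟩
        by_cases hq : χ z ∈ E N
        · exact Or.inl hq
        · exact Or.inr fun hq' => h2 z hz ⟨⟨hq', hq⟩, m.mem (hTB k hz)⟩
      exact hcon k (h4.trans (hE.2.1 _ _ hN))
    choose z hz hzE using h1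
    refine m.landing_of_crossSection hU (hE.1 N) (fun k => hTB k (hz k)) hzE
      (Metric.tendsto_atTop.2 fun r hr => ?_)
    obtain ⟨k, hk⟩ := hTr r hr
    exact ⟨k, fun i hi => hk (hmonoT hi (hz i))⟩
  obtain ⟨y, hy, hycl, c, hc, hcB, hcy, hcx⟩ := key n le_rfl
  obtain ⟨y', hy', hycl', c', hc', hcB', hcy', hcx'⟩ := key (n + 1) n.le_succ
  have h5 := m.landing_unique hc hcB hc' hcB' (Or.inl ⟨y, hy, rfl⟩) (Or.inl ⟨y', hy', rfl⟩)
    hcy hcy' hcx hcx'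
  have h6 : y = y' := by
    refine eq_of_nhds_neBot ?_
    rw [h5, inf_idem]
    infer_instance
  subst h6
  have h7 := hE.2.2 n (n + 1) n.lt_succ_self.ne
  exact (h7 ▸ ⟨hycl, hycl'⟩ : y ∈ (∅ : Set X))

end

section
variable {X : Type*} [TopologicalSpace X] {U : Set X} {χ : ℂ → X}

theorem ChainDivides.trans {C C' C'' : ℕ → Set X} (h : ChainDivides C C')
    (h' : ChainDivides C' C'') : ChainDivides C C'' := fun n => by
  obtain ⟨m, hm⟩ := h' n
  obtain ⟨k, hk⟩ := h m
  exact ⟨k, hk.trans hm⟩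

theorem ChainDivides.refl (C : ℕ → Set X) : ChainDivides C C := fun n => ⟨n, Subset.rfl⟩

theorem PrimeChain.divides_of_mk_eq {C C' : PrimeChain U}
    (h : (Quot.mk _ C : PrimeEnd U) = Quot.mk _ C') :
    ChainDivides C.1 C'.1 ∧ ChainDivides C'.1 C.1 := by
  have h1 := Quot.eqvGen_exact h
  have he : Equivalence
      (fun C C' : PrimeChain U => ChainDivides C.1 C'.1 ∧ ChainDivides C'.1 C.1) :=
    ⟨fun C => ⟨ChainDivides.refl _, ChainDivides.refl _⟩, fun h => ⟨h.2, h.1⟩,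
      fun h h' => ⟨h.1.trans h'.1, h'.2.trans h.2⟩⟩
  exact he.eqvGen_iff.1 h1

theorem PrimeChain.eventually_mem (C : PrimeChain U) {O : Set (PrimeEndComp U)} (hO : IsOpen O)
    (hp : peEnd U (Quot.mk _ C) ∈ O) :
    ∃ i, ∀ j, i ≤ j → ∀ (q : X) (hq : q ∈ U), q ∈ C.1 j → pePt U ⟨q, hq⟩ ∈ O := by
  induction hO with
  | basic s hs =>
    rcases hs with ⟨V, -, -, rfl⟩ | ⟨E, -, rfl⟩
    · obtain ⟨w, hw, -⟩ := hp
      exact (Sum.inr_ne_inl hw).elim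
    · rcases hp with ⟨w, hw, -⟩ | ⟨p, hp, C', hC', N, hN⟩
      · exact (Sum.inr_ne_inl hw).elim
      · have h1 : Quot.mk _ C = p := Sum.inr_injective hp
        obtain ⟨i, hi⟩ := (PrimeChain.divides_of_mk_eq (h1.trans hC'.symm)).1 N
        exact ⟨i, fun j hj q hq hqC =>
          Or.inl ⟨⟨q, hq⟩, rfl, hN N le_rfl (hi (C.2.1.2.1 j i hj hqC))⟩⟩
  | univ => exact ⟨0, fun _ _ _ _ _ => trivial⟩
  | inter s t _ _ ihs iht =>
    obtain ⟨i, hi⟩ := ihs hp.1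
    obtain ⟨j, hj⟩ := iht hp.2
    exact ⟨max i j, fun k hk q hq hqC => ⟨hi k ((le_max_left _ _).trans hk) q hq hqC,
      hj k ((le_max_right _ _).trans hk) q hq hqC⟩⟩
  | sUnion S _ ih =>
    obtain ⟨s, hs, hps⟩ := hp
    obtain ⟨i, hi⟩ := ih s hs hps
    exact ⟨i, fun j hj q hq hqC => ⟨s, hs, hi j hj q hq hqC⟩⟩

/-- A prime end is fixed as soon as one of its chains is divided by its image. -/
theorem PrimeChain.fixed_of_divides {f : X ≃ₜ X} (hf : f '' U = U) {F : PrimeEndComp U ≃ₜ PrimeEndComp U}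
    (hF : IsPEExtension f U F) (C : PrimeChain U) (hCU : ∀ i, C.1 i ⊆ U)
    (hC : ∀ i, ∃ j, C.1 j ⊆ f '' C.1 i) :
    F (peEnd U (Quot.mk _ C)) = peEnd U (Quot.mk _ C) := by
  have hmem : ∀ q ∈ U, f q ∈ U := fun q hq => hf ▸ mem_image_of_mem f hq
  rcases hFp : F (peEnd U (Quot.mk _ C)) with u | q
  · obtain ⟨w, hw, hwu⟩ : (u : X) ∈ f '' U := hf.symm ▸ u.2
    have h1 := hF w hw (hmem w hw)
    have h2 : F (pePt U ⟨w, hw⟩) = F (peEnd U (Quot.mk _ C)) := by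
      rw [h1, hFp]
      exact congrArg Sum.inl (Subtype.ext hwu)
    exact (Sum.inl_ne_inr (F.injective h2)).elim
  · obtain ⟨E, rfl⟩ := Quot.exists_rep q
    have h3 : ChainDivides C.1 E.1 := by
      intro n
      have hop : IsOpen (peSection U (E.1 n)) :=
        TopologicalSpace.isOpen_generateFrom_of_mem (Or.inr ⟨_, E.2.1.1 n, rfl⟩)
      have hmemE : F (peEnd U (Quot.mk _ C)) ∈ peSection U (E.1 n) := by
        rw [hFp]
        exact Or.inr ⟨_, rfl, E, rfl, n, fun i hi => E.2.1.2.1 i n hi⟩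
      obtain ⟨i, hi⟩ := C.eventually_mem (hop.preimage F.continuous) hmemE
      obtain ⟨j, hj⟩ := hC i
      refine ⟨j, hj.trans ?_⟩
      rintro _ ⟨q, hq, rfl⟩
      have h4 : F (pePt U ⟨q, hCU i hq⟩) ∈ peSection U (E.1 n) := hi i le_rfl q (hCU i hq) hq
      rw [hF q (hCU i hq) (hmem q (hCU i hq))] at h4
      rcases h4 with ⟨w, hw, hwE⟩ | ⟨p, hp, -⟩
      · have := Sum.inl_injective hw
        rw [← this] at hwE
        exact hwE
      · exact (Sum.inl_ne_inr hp).elim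
    have h5 := E.2.2 C.1 C.2.1 h3
    exact congrArg (peEnd U) (Quot.sound ⟨h5, h3⟩)

theorem IsPEExtension.symm {f : X ≃ₜ X} {F : PrimeEndComp U ≃ₜ PrimeEndComp U}
    (hF : IsPEExtension f U F) : IsPEExtension f⁻¹ U F.symm := by
  intro x hx hfx
  rw [Homeomorph.symm_apply_eq]
  have h1 : f ((f⁻¹ : X ≃ₜ X) x) = x := f.apply_symm_apply x
  rw [hF _ hfx (h1.symm ▸ hx)]
  exact congrArg (pePt U) (Subtype.ext h1.symm)

variable [T2Space X] [LocallyCompactSpace X] [LocallyConnectedSpace X]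

theorem DiscModel.exists_fixed_of_inv (m : DiscModel U χ) (hU : IsOpen U) (f : X ≃ₜ X)
    (hf : f '' U = U) {F : PrimeEndComp U ≃ₜ PrimeEndComp U} (hF : IsPEExtension f U F) {x : ℝ}
    (hx : ∀ r > 0, ∃ r' > 0, ((m.conj f hf)⁻¹ : Dsk ≃ₜ Dsk) '' Nb x r' ⊆ Nb x r) :
    ∃ p, F (peEnd U p) = peEnd U p := by
  obtain ⟨T, hT, hTB, hTn, hTr⟩ := m.exists_primeChain hU x
  refine ⟨_, PrimeChain.fixed_of_divides hf hF ⟨_, hT⟩ ?_ fun i => ?_⟩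
  · rintro i _ ⟨z, hz, rfl⟩
    exact m.mem (hTB i hz)
  · obtain ⟨r, hr, hrT⟩ := hTn i
    obtain ⟨r', hr', hrr⟩ := hx r hr
    obtain ⟨j, hj⟩ := hTr r' hr'
    refine ⟨j, ?_⟩
    rintro _ ⟨z, hz, rfl⟩
    have h1 : (m.conj f hf)⁻¹ ⟨z, hTB j hz⟩ ∈ Nb x r := hrr ⟨_, hj hz, rfl⟩
    refine ⟨_, ⟨_, hrT ⟨h1, ((m.conj f hf)⁻¹ ⟨z, hTB j hz⟩).2⟩, rfl⟩, ?_⟩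
    rw [m.conj_symm_apply f hf]
    exact f.apply_symm_apply _

theorem DiscModel.not_fixed (m : DiscModel U χ) (hU : IsOpen U) (f : X ≃ₜ X)
    (hf : f '' U = U) {F : PrimeEndComp U ≃ₜ PrimeEndComp U} (hF : IsPEExtension f U F)
    (hFn : ∀ p, F (peEnd U p) ≠ peEnd U p) (x : ℝ) :
    ¬ ∀ r > 0, ∃ r' > 0, m.conj f hf '' Nb x r' ⊆ Nb x r := by
  intro h
  rw [← inv_inv (m.conj f hf), ← m.conj_inv f hf] at h
  obtain ⟨p, hp⟩ := m.exists_fixed_of_inv hU f⁻¹ (inv_image f hf) hF.symm h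
  rw [Homeomorph.symm_apply_eq] at hp
  exact hFn p hp.symm

theorem iterZ_eq (f : X ≃ₜ X) (k : ℤ) (A : Set X) : iterZ f k A = (f ^ k : X ≃ₜ X) '' A := by
  have : ∀ x, (f.toEquiv ^ k) x = (f ^ k : X ≃ₜ X) x := by
    induction k using Int.induction_on with
    | zero => exact fun x => rfl
    | succ k ih =>
      intro x
      rw [zpow_add_one, zpow_add_one, Homeomorph.mul_apply, Equiv.Perm.mul_apply, ih]
      rfl
    | pred k ih =>
      intro x
      rw [zpow_sub_one, zpow_sub_one, Homeomorph.mul_apply, Equiv.Perm.mul_apply, ih]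
      rfl
  exact image_congr fun x _ => this x

/-- The nonwandering condition, transported to the disc. -/
theorem DiscModel.nonwandering (m : DiscModel U χ) (hU : IsOpen U) (f : X ≃ₜ X)
    (hf : f '' U = U) (hbn : BdNonwandering f U) {n : ℕ} (hn : 1 ≤ n) :
    ∃ K : Set Dsk, IsCompact K ∧ ∀ (x r : ℝ), 0 < r →
      (∀ k : ℤ, k ≠ 0 → Disjoint ((m.conj f hf ^ ((n : ℤ) * k) : Dsk ≃ₜ Dsk) '' Nb x r) (Nb x r)) →
      (∃ k : ℤ, 0 < k ∧ ((m.conj f hf ^ ((n : ℤ) * k) : Dsk ≃ₜ Dsk) '' Nb x r ∩ K).Nonempty) ∧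
      (∃ k : ℤ, k < 0 ∧ ((m.conj f hf ^ ((n : ℤ) * k) : Dsk ≃ₜ Dsk) '' Nb x r ∩ K).Nonempty) := by
  obtain ⟨K, hK, hKU, hKw⟩ := hbn n hn
  refine ⟨{z | χ z ∈ K}, ?_, fun x r hr hw => ?_⟩
  · have h1 : IsCompact ((Subtype.val : U → X) ⁻¹' K) :=
      Topology.IsInducing.subtypeVal.isCompact_preimage_iff (by rwa [Subtype.range_coe]) |>.2 hK
    have h2 := h1.image m.chart.symm.continuous
    convert h2 using 1
    rw [m.chart.image_symm]
    rfl
  · obtain ⟨T, hT, hTB, hTn, hTr⟩ := m.exists_primeChain hU x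
    obtain ⟨i, hi⟩ := hTr r hr
    have hlift : ∀ k : ℤ, ∀ p ∈ iterZ f ((n : ℤ) * k) (χ '' T i), ∃ z : Dsk, χ z = p ∧
        z ∈ (m.conj f hf ^ ((n : ℤ) * k) : Dsk ≃ₜ Dsk) '' Nb x r := by
      intro k p hp
      rw [iterZ_eq] at hp
      obtain ⟨_, ⟨z, hz, rfl⟩, rfl⟩ := hp
      exact ⟨_, m.conj_zpow_apply f hf _ ⟨z, hTB i hz⟩, ⟨z, hTB i hz⟩, hi hz, rfl⟩
    have hsec : IsWanderingSection f U n (χ '' T i) := by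
      refine ⟨hT.1.1 i, fun k hk => ?_⟩
      rw [← disjoint_iff_inter_eq_empty, Set.disjoint_left]
      rintro p hp ⟨w, hwT, rfl⟩
      obtain ⟨z, hzp, hz⟩ := hlift k _ hp
      have h3 : (z : ℂ) = w := m.inj z.2 (hTB i hwT) hzp
      refine Set.disjoint_left.1 (hw k hk) hz ?_
      change dist (z : ℂ) (circ x) < r
      rw [h3]
      exact hi hwT
    obtain ⟨⟨k, hk, p, hp, hpK⟩, ⟨k', hk', p', hp', hpK'⟩⟩ := hKw _ hsec
    refine ⟨⟨k, hk, ?_⟩, ⟨k', hk', ?_⟩⟩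
    · obtain ⟨z, rfl, hz⟩ := hlift k p hp
      exact ⟨z, hz, hpK⟩
    · obtain ⟨z, rfl, hz⟩ := hlift k' p' hp'
      exact ⟨z, hz, hpK'⟩

end

section
variable {X : Type*} [TopologicalSpace X] {U : Set X} {χ : ℂ → X}

/-- There is a curve in the disc starting at `w`, landing at the boundary point of angle `x`,
mapped into `O` and converging to `y` there. -/
def EndCurve (χ : ℂ → X) (O : Set X) (w : Dsk) (x : ℝ) (y : X) : Prop :=
  ∃ c : ℝ → Dsk, ContinuousOn c (Ico 0 1) ∧ c 0 = w ∧ (∀ t ∈ Ico (0:ℝ) 1, χ (c t) ∈ O) ∧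
    Tendsto (fun t => (c t : ℂ)) (𝓝[<] 1) (𝓝 (circ x)) ∧
    Tendsto (fun t => χ (c t)) (𝓝[<] 1) (𝓝 y)

/-- The boundary point of angle `x` can be accessed from `v` inside `O`, with limit `y`. -/
def Accesses (χ : ℂ → X) (O : Set X) (v : Dsk) (x : ℝ) (y : X) : Prop :=
  ∃ w, JoinedIn {z : Dsk | χ z ∈ O} v w ∧ EndCurve χ O w x y

theorem EndCurve.accesses {O : Set X} {w : Dsk} {x : ℝ} {y : X} (h : EndCurve χ O w x y) :
    Accesses χ O w x y := by
  obtain ⟨c, h1, rfl, h2, h3⟩ := h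
  exact ⟨c 0, JoinedIn.refl (h2 0 (by simp)), c, h1, rfl, h2, h3⟩

theorem Accesses.mono {O O' : Set X} {v : Dsk} {x : ℝ} {y : X} (h : Accesses χ O v x y)
    (hO : O ⊆ O') : Accesses χ O' v x y := by
  obtain ⟨w, hw, c, h1, h2, h3, h4⟩ := h
  exact ⟨w, hw.mono fun z hz => hO hz, c, h1, h2, fun t ht => hO (h3 t ht), h4⟩

theorem JoinedIn.accesses {O : Set X} {v w : Dsk} {x : ℝ} {y : X}
    (hv : JoinedIn {z : Dsk | χ z ∈ O} v w) (h : Accesses χ O w x y) : Accesses χ O v x y := by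
  obtain ⟨w', hw, h⟩ := h
  exact ⟨w', hv.trans hw, h⟩

/-- Accesses are transported by a homeomorphism. -/
theorem Accesses.map {O : Set X} {v : Dsk} {x x' : ℝ} {y : X} (h : Accesses χ O v x y)
    {f : X ≃ₜ X} {F : Dsk ≃ₜ Dsk} (hF : ∀ z : Dsk, χ (F z) = f (χ z))
    (hx : ∀ r > 0, ∃ r' > 0, F '' Nb x r' ⊆ Nb x' r) :
    Accesses χ (f '' O) (F v) x' (f y) := by
  obtain ⟨w, ⟨p, hp⟩, c, h1, rfl, h2, h3, h4⟩ := h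
  refine ⟨F (c 0), ⟨p.map F.continuous, fun t => ?_⟩, fun t => F (c t),
    F.continuous.comp_continuousOn h1, rfl, fun t ht => ?_, ?_, ?_⟩
  · exact ⟨_, hp t, (hF _).symm⟩
  · exact ⟨_, h2 t ht, (hF _).symm⟩
  · rw [Metric.tendsto_nhds]
    intro r hr
    obtain ⟨r', hr', hrr⟩ := hx r hr
    filter_upwards [h3 (Metric.ball_mem_nhds _ hr')] with t ht
    exact hrr ⟨_, ht, rfl⟩
  · simp only [hF]
    exact (f.continuous.tendsto y).comp h4

variable [T2Space X] [LocallyCompactSpace X]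

theorem Accesses.unique (m : DiscModel U χ) {O O' : Set X} {v v' : Dsk} {x x' : ℝ} {y y' : X}
    (h : Accesses χ O v x y) (h' : Accesses χ O' v' x' y') (hy : y ∉ U) (hy' : y' ∉ U)
    (hx : circ x = circ x') : y = y' := by
  obtain ⟨-, -, c, h1, -, -, h3, h4⟩ := h
  obtain ⟨-, -, c', h1', -, -, h3', h4'⟩ := h'
  have := m.landing_unique (continuous_subtype_val.comp_continuousOn h1) (fun t _ => (c t).2)
    (continuous_subtype_val.comp_continuousOn h1') (fun t _ => (c' t).2)
    (Or.inl ⟨y, hy, rfl⟩) (Or.inl ⟨y', hy', rfl⟩) h4 h4' h3 (hx ▸ h3')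
  exact nhds_injective this

/-- A path leaving the domain accesses its boundary. -/
theorem DiscModel.exists_endCurve (m : DiscModel U χ) (hU : IsOpen U) {A : Set X}
    {w : Dsk} {z : X} (h : JoinedIn A (χ w) z) (hz : z ∉ U) :
    ∃ x y, y ∈ A ∧ y ∉ U ∧ EndCurve χ A w x y := by
  obtain ⟨p, hp⟩ := h
  have hpA : ∀ t, p.extend t ∈ A := fun t => hp _
  have hpc := p.continuous_extend
  set q := p.extend with hq
  have hq0 : q 0 = χ w := by simp [hq]
  have hq1 : q 1 = z := by simp [hq]
  set S := Icc (0:ℝ) 1 ∩ q ⁻¹' Uᶜ with hS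
  have hSc : IsCompact S := isCompact_Icc.inter_right (hU.isClosed_compl.preimage hpc)
  obtain ⟨T, hT⟩ := hSc.exists_isLeast ⟨1, by simp, by simpa [hq1] using hz⟩
  have hlt : ∀ t, 0 ≤ t → t < T → q t ∈ U := by
    intro t ht0 htT
    by_contra hn
    exact absurd (hT.2 ⟨⟨ht0, htT.le.trans hT.1.1.2⟩, hn⟩) (not_le.2 htT)
  have hT0 : 0 < T := by
    refine lt_of_le_of_ne hT.1.1.1 fun e => hT.1.2 ?_
    rw [← e, hq0]
    exact m.mem w.2
  have hmem : ∀ t ∈ Ico (0:ℝ) 1, q (T * t) ∈ U := fun t ht =>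
    hlt _ (mul_nonneg hT0.le ht.1) (by nlinarith [ht.2])
  classical
  set c : ℝ → Dsk := fun t => if h : q (T * t) ∈ U then m.chart.symm ⟨_, h⟩ else w with hc
  have hcU : ∀ t ∈ Ico (0:ℝ) 1, χ (c t) = q (T * t) := by
    intro t ht
    simp only [hc, dif_pos (hmem t ht)]
    rw [← m.chart_apply, Homeomorph.apply_symm_apply]
  have hcc : ContinuousOn c (Ico 0 1) := by
    rw [continuousOn_iff_continuous_domRestrict]
    have : (Ico (0:ℝ) 1).domRestrict c =
        fun t : Ico (0:ℝ) 1 => m.chart.symm ⟨q (T * (t:ℝ)), hmem t t.2⟩ := by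
      funext t
      simp only [Set.domRestrict_apply, hc, dif_pos (hmem t t.2)]
    rw [this]
    refine m.chart.symm.continuous.comp (Continuous.subtype_mk ?_ _)
    exact hpc.comp (continuous_const.mul continuous_subtype_val)
  have hlim : Tendsto (fun t => χ (c t)) (𝓝[<] 1) (𝓝 (q T)) := by
    have h1 : Tendsto (fun t => q (T * t)) (𝓝[<] 1) (𝓝 (q T)) := by
      have : Continuous fun t => q (T * t) := by fun_prop
      simpa using (this.tendsto 1).mono_left nhdsWithin_le_nhds
    refine h1.congr' ?_
    filter_upwards [Ioo_mem_nhdsLT one_pos] with t ht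
    exact (hcU t ⟨ht.1.le, ht.2⟩).symm
  obtain ⟨x, hx⟩ := m.exists_landing (continuous_subtype_val.comp_continuousOn hcc)
    (fun t _ => (c t).2) (Or.inl ⟨q T, hT.1.2, rfl⟩) hlim
  refine ⟨x, q T, hpA T, hT.1.2, c, hcc, ?_, fun t ht => ?_, hx, hlim⟩
  · refine m.eq_of_apply ?_
    rw [hcU 0 (by simp), mul_zero, hq0]
  · rw [hcU t ht]
    exact hpA _

/-- An accessed boundary point is encircled by crosscuts connected to the start of the access. -/
theorem EndCurve.exists_crosscut (m : DiscModel U χ) {O W : Set X} {v : Dsk} {x : ℝ} {y : X}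
    (h : EndCurve χ O v x y) (hy : y ∉ U) (hW : W ∈ 𝓝 y) {R : ℝ} (hR : 0 < R) :
    ∃ r, 0 < r ∧ r < R ∧ ∃ S : Set Dsk, IsPreconnected S ∧ (∀ z ∈ S, χ z ∈ O ∪ W) ∧ v ∈ S ∧
      Cb x r ⊆ S := by
  obtain ⟨c, h1, rfl, h2, h3, h4⟩ := h
  obtain ⟨r, hr0, hr, l₀, hl₀, hr'⟩ := m.wolff x
  have h1' : ContinuousOn (fun t => (c t : ℂ)) (Ico 0 1) :=
    continuous_subtype_val.comp_continuousOn h1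
  have hl := DiscModel.eq_of_crosscut h1' (fun t _ => (c t).2) (Or.inl ⟨y, hy, rfl⟩) hl₀ h4 h3
    hr0 hr hr'
  rw [← hl] at hr'
  obtain ⟨k, ⟨⟨t, ht, he⟩, hk⟩, hkR⟩ := (((DiscModel.eventually_crossing h1' (fun t _ => (c t).2)
    h3 hr0 hr (T := 0) (by simp)).and (mem_evFilter.1 (hr' hW))).and
    (hr (Iio_mem_nhds hR))).exists
  have hsub : Icc 0 t ⊆ Ico (0:ℝ) 1 := fun s hs => ⟨hs.1, hs.2.trans_lt ht.2⟩
  refine ⟨r k, hr0 k, hkR, c '' Icc 0 t ∪ Cb x (r k), ?_, ?_, Or.inl ⟨0, by simp [ht.1.le], rfl⟩,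
    subset_union_right⟩
  · refine IsPreconnected.union (c t) ⟨t, by simp [ht.1.le], rfl⟩ he
      (isPreconnected_Icc.image _ (h1.mono hsub)) ?_
    rw [← Topology.IsInducing.subtypeVal.isPreconnected_image]
    have : (Subtype.val '' Cb x (r k) : Set ℂ) = Metric.sphere (circ x) (r k) ∩ Metric.ball 0 1 := by
      ext z
      exact ⟨by rintro ⟨z, hz, rfl⟩; exact ⟨hz, z.2⟩, fun hz => ⟨⟨z, hz.2⟩, hz.1, rfl⟩⟩
    rw [this]
    exact isPreconnected_crosscut x (hr0 k)
  · rintro z (⟨s, hs, rfl⟩ | hz)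
    · exact Or.inl (h2 s (hsub hs))
    · exact Or.inr (hk ⟨hz, z.2⟩)

end

section
variable {φ : ℂ → ℂ}

/-- The part over the disc of the graph of `φ`, off a set `Q` of values. -/
def offGraph (φ : ℂ → ℂ) (Q : Set ℂ) : Set (ℂ × ℂ) :=
  {w | w.1 ∈ Metric.ball (0:ℂ) 1 ∧ w.2 = φ w.1 ∧ w.2 ∉ Q}

theorem JoinedIn.offGraph (hφ : ContinuousOn φ (Metric.ball 0 1)) {O Q : Set ℂ}
    (hd : Disjoint O Q) {v w : Dsk} (h : JoinedIn {z : Dsk | φ z ∈ O} v w) :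
    JoinedIn (offGraph φ Q) ((v : ℂ), φ v) ((w : ℂ), φ w) := by
  obtain ⟨p, hp⟩ := h
  have hc : Continuous fun z : Dsk => ((z : ℂ), φ z) :=
    continuous_subtype_val.prodMk (continuousOn_iff_continuous_domRestrict.1 hφ)
  exact ⟨p.map hc, fun t => ⟨(p t).2, rfl, Set.disjoint_left.1 hd (hp t)⟩⟩

theorem EndCurve.joinedIn (hφ : ContinuousOn φ (Metric.ball 0 1)) {O Q : Set ℂ}
    (hd : Disjoint O Q) {w : Dsk} {x : ℝ} {y : ℂ} (h : EndCurve φ O w x y) :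
    JoinedIn (offGraph φ Q ∪ {(circ x, y)}) ((w : ℂ), φ w) (circ x, y) := by
  obtain ⟨c, h1, rfl, h2, h3, h4⟩ := h
  have hI : Icc (0:ℝ) 1 \ {1} = Ico 0 1 := Icc_sdiff_right
  refine JoinedIn.ofLine (f := Function.update (fun t => ((c t : ℂ), φ (c t))) 1 (circ x, y))
    ?_ (by simp) (by simp) ?_
  · change ContinuousOn _ (Icc 0 1)
    rw [continuousOn_update_iff, hI]
    have h1' : ContinuousOn (fun t => (c t : ℂ)) (Ico 0 1) :=
      continuous_subtype_val.comp_continuousOn h1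
    refine ⟨h1'.prodMk (hφ.comp h1' fun t _ => (c t).2), fun _ => ?_⟩
    rw [nhdsWithin_Ico_eq_nhdsLT one_pos]
    exact h3.prodMk_nhds h4
  · rintro _ ⟨t, ht, rfl⟩
    by_cases ht1 : t = 1
    · subst ht1; simp
    · rw [Function.update_of_ne ht1]
      exact Or.inl ⟨(c t).2, rfl, Set.disjoint_left.1 hd (h2 t ⟨ht.1, lt_of_le_of_ne ht.2 ht1⟩)⟩

theorem Accesses.joinedIn (hφ : ContinuousOn φ (Metric.ball 0 1)) {O Q : Set ℂ}
    (hd : Disjoint O Q) {v : Dsk} {x : ℝ} {y : ℂ} (h : Accesses φ O v x y) :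
    JoinedIn (offGraph φ Q ∪ {(circ x, y)}) ((v : ℂ), φ v) (circ x, y) := by
  obtain ⟨w, hw, hc⟩ := h
  exact ((hw.offGraph hφ hd).mono subset_union_left).trans (hc.joinedIn hφ hd)

theorem joinedIn_endGraph (hφ : ContinuousOn φ (Metric.ball 0 1)) {O₁ O₂ O₃ Q : Set ℂ}
    {v v' : Dsk} {x x' : ℝ} {y y' : ℂ} (h₁ : Accesses φ O₁ v x y)
    (h₂ : JoinedIn {z : Dsk | φ z ∈ O₂} v v') (h₃ : Accesses φ O₃ v' x' y')
    (hd₁ : Disjoint O₁ Q) (hd₂ : Disjoint O₂ Q) (hd₃ : Disjoint O₃ Q) :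
    JoinedIn (endGraph φ Q (circ x) y (circ x') y') (circ x, y) (circ x', y') := by
  refine ((h₁.joinedIn hφ hd₁).symm.mono ?_).trans (((h₂.offGraph hφ hd₂).mono ?_).trans
    ((h₃.joinedIn hφ hd₃).mono ?_))
  · rintro w (hw | hw)
    · exact Or.inl hw
    · exact Or.inr (Or.inl hw)
  · exact fun w hw => Or.inl hw
  · rintro w (hw | hw)
    · exact Or.inl hw
    · exact Or.inr (Or.inr hw)

theorem endGraph_comm (φ : ℂ → ℂ) (Q : Set ℂ) (a ya c yc : ℂ) :
    endGraph φ Q a ya c yc = endGraph φ Q c yc a ya := by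
  ext w
  simp only [endGraph, mem_ofPred_eq]
  tauto

end

section
variable {G : ℝ ≃o ℝ}

theorem exists_displacement_bound (hper : ∀ x, G (x + 2 * Real.pi) = G x + 2 * Real.pi)
    (hG : ∀ x, x < G x ∧ G x < x + 2 * Real.pi) :
    ∃ c > 0, ∀ x, x + c ≤ G x ∧ G x ≤ x + 2 * Real.pi - c := by
  have hc : Continuous fun x => min (G x - x) (x + 2 * Real.pi - G x) := by
    have := G.continuous
    fun_prop
  obtain ⟨p, -, hp⟩ := isCompact_Icc.exists_isMinOn
    (nonempty_Icc.2 (show (0:ℝ) ≤ 2 * Real.pi by positivity)) hc.continuousOn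
  refine ⟨_, lt_min (sub_pos.2 (hG p).1) (sub_pos.2 (hG p).2), fun x => ?_⟩
  obtain ⟨n, hn, -⟩ := existsUnique_add_zsmul_mem_Ico (show 0 < 2 * Real.pi by positivity) x 0
  have h1 := hp (show x + n • (2 * Real.pi) ∈ Icc 0 (2 * Real.pi) from
    ⟨hn.1, by simpa using hn.2.le⟩)
  rw [zsmul_eq_mul] at h1
  simp only [mem_ofPred_eq, map_add_int_mul hper] at h1
  have h2 := h1.trans (min_le_left _ _)
  have h3 := h1.trans (min_le_right _ _)
  constructor <;> linarith

theorem pow_displacement {c : ℝ} (hc : ∀ x, x + c ≤ G x ∧ G x ≤ x + 2 * Real.pi - c) (k : ℕ)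
    (x : ℝ) : x + k * c ≤ (G ^ k) x ∧ (G ^ k) x ≤ x + k * (2 * Real.pi - c) := by
  induction k with
  | zero => simp
  | succ k ih =>
    rw [pow_succ', RelIso.mul_apply]
    push_cast
    have := hc ((G ^ k) x)
    constructor <;> linarith [ih.1, ih.2]

/-- Some iterate of every fundamental interval is linked with it, up to equality of endpoints. -/
theorem exists_linked (hper : ∀ x, G (x + 2 * Real.pi) = G x + 2 * Real.pi)
    (hG : ∀ x, x < G x ∧ G x < x + 2 * Real.pi) :
    ∃ M : ℕ, ∀ x, ∃ k : ℕ, 4 ≤ k ∧ k ≤ M ∧ ∃ j : ℤ,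
      (x ≤ (G ^ k) x + j * (2 * Real.pi) ∧ (G ^ k) x + j * (2 * Real.pi) < G x ∧
        G x ≤ (G ^ (k + 1)) x + j * (2 * Real.pi) ∧
        (G ^ (k + 1)) x + j * (2 * Real.pi) < x + 2 * Real.pi) ∨
      (G x - 2 * Real.pi < (G ^ k) x + j * (2 * Real.pi) ∧ (G ^ k) x + j * (2 * Real.pi) ≤ x ∧
        x < (G ^ (k + 1)) x + j * (2 * Real.pi) ∧
        (G ^ (k + 1)) x + j * (2 * Real.pi) ≤ G x) := by
  have hπ := Real.pi_pos
  obtain ⟨c, hc0, hc⟩ := exists_displacement_bound hper hG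
  set M := ⌈8 * Real.pi / c⌉₊ with hM
  have hMc : 8 * Real.pi ≤ M * c := by
    rw [← div_le_iff₀ hc0]
    exact Nat.le_ceil _
  have hs : ∀ k x, (G ^ (k + 1)) x = G ((G ^ k) x) := fun k x => by
    rw [pow_succ', RelIso.mul_apply]
  have hlt : ∀ {a b : ℝ} (j : ℤ), a < b + j * (2 * Real.pi) → G a < G b + j * (2 * Real.pi) :=
    fun {a b} j h => by rw [← map_add_int_mul hper]; exact G.strictMono h
  have hgt : ∀ {a b : ℝ} (j : ℤ), b + j * (2 * Real.pi) < a → G b + j * (2 * Real.pi) < G a :=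
    fun {a b} j h => by rw [← map_add_int_mul hper]; exact G.strictMono h
  have hge : ∀ {a b : ℝ} (j : ℤ), b + j * (2 * Real.pi) ≤ a → G b + j * (2 * Real.pi) ≤ G a :=
    fun {a b} j h => by rw [← map_add_int_mul hper]; exact G.monotone h
  have hle : ∀ {a b : ℝ} (j : ℤ), a ≤ b + j * (2 * Real.pi) → G a ≤ G b + j * (2 * Real.pi) :=
    fun {a b} j h => by rw [← map_add_int_mul hper]; exact G.monotone h
  classical
  refine ⟨M, fun x => ?_⟩
  rcases le_or_gt (G (G x)) (x + 2 * Real.pi) with h2 | h2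
  · have hex : ∃ k : ℕ, x + (4:ℤ) * (2 * Real.pi) ≤ (G ^ k) x :=
      ⟨M, by push_cast; linarith [(pow_displacement hc M x).1]⟩
    obtain ⟨k, hk, hmin, hkM⟩ : ∃ k : ℕ, x + (4:ℤ) * (2 * Real.pi) ≤ (G ^ k) x ∧
        (∀ l < k, ¬ x + (4:ℤ) * (2 * Real.pi) ≤ (G ^ l) x) ∧ k ≤ M :=
      ⟨Nat.find hex, Nat.find_spec hex, fun l hl => Nat.find_min hex hl,
        Nat.find_min' hex (by push_cast; linarith [(pow_displacement hc M x).1])⟩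
    have hk4 : 4 ≤ k := by
      have h3 := (pow_displacement hc k x).2
      by_contra! h4
      have h5 : (k:ℝ) ≤ 3 := by exact_mod_cast Nat.le_of_lt_succ h4
      have h6 : (0:ℝ) ≤ k := k.cast_nonneg
      push_cast at hk
      nlinarith
    obtain ⟨l, rfl⟩ : ∃ l, k = l + 1 := ⟨k - 1, by omega⟩
    have h3 := hlt 4 (not_le.1 (hmin l (by omega)))
    have h4 := hlt 4 h3
    have h5 := hge 4 hk
    rw [← hs] at h3 h4 h5
    rw [← hs] at h4
    refine ⟨l + 1, hk4, hkM, -4, Or.inl ⟨?_, ?_, ?_, ?_⟩⟩ <;> push_cast at * <;> linarith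
  · have hex : (G ^ M) x ≤ x + ((M - 4 : ℤ)) * (2 * Real.pi) := by
      push_cast; linarith [(pow_displacement hc M x).2]
    have hex' : ∃ k : ℕ, (G ^ k) x ≤ x + ((k - 4 : ℤ)) * (2 * Real.pi) := ⟨M, hex⟩
    obtain ⟨k, hk, hmin, hkM⟩ : ∃ k : ℕ, (G ^ k) x ≤ x + ((k - 4 : ℤ)) * (2 * Real.pi) ∧
        (∀ l < k, ¬ (G ^ l) x ≤ x + ((l - 4 : ℤ)) * (2 * Real.pi)) ∧ k ≤ M :=
      ⟨Nat.find hex', Nat.find_spec hex', fun l hl => Nat.find_min hex' hl,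
        Nat.find_min' hex' hex⟩
    have hk4 : 4 ≤ k := by
      have h3 := (pow_displacement hc k x).1
      by_contra! h4
      have h5 : (k:ℝ) ≤ 3 := by exact_mod_cast Nat.le_of_lt_succ h4
      have h6 : (0:ℝ) ≤ k := k.cast_nonneg
      push_cast at hk
      nlinarith
    obtain ⟨l, rfl⟩ : ∃ l, k = l + 1 := ⟨k - 1, by omega⟩
    have h3 := hgt _ (not_le.1 (hmin l (by omega)))
    have h4 := hgt _ h3
    have h5 := hle _ hk
    rw [← hs] at h3 h4 h5
    rw [← hs] at h4
    refine ⟨l + 1, hk4, hkM, 4 - (l + 1), Or.inr ⟨?_, ?_, ?_, ?_⟩⟩ <;> push_cast at * <;> linarith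

end

section
variable {X : Type*} [TopologicalSpace X]

theorem image_zpow_add (f : X ≃ₜ X) (i j : ℤ) (S : Set X) :
    (f ^ (i + j) : X ≃ₜ X) '' S = (f ^ i : X ≃ₜ X) '' ((f ^ j : X ≃ₜ X) '' S) := by
  rw [zpow_add, image_image]
  rfl

theorem image_zpow_zero (f : X ≃ₜ X) (S : Set X) : (f ^ (0:ℤ) : X ≃ₜ X) '' S = S := by
  rw [zpow_zero]
  exact image_id S

theorem disjoint_image_zpow (f : X ≃ₜ X) (i j : ℤ) (S T : Set X) :
    Disjoint ((f ^ i : X ≃ₜ X) '' S) ((f ^ j : X ≃ₜ X) '' T) ↔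
      Disjoint S ((f ^ (j - i) : X ≃ₜ X) '' T) := by
  rw [show j = i + (j - i) by ring, image_zpow_add, Set.disjoint_image_iff (f ^ i).injective]
  simp

theorem zpow_image_eq {U : Set X} {f : X ≃ₜ X} (hf : f '' U = U) (k : ℤ) :
    (f ^ k : X ≃ₜ X) '' U = U := by
  have h1 : (f ^ (1:ℤ) : X ≃ₜ X) '' U = U := by rwa [zpow_one]
  have h2 : (f ^ (-1:ℤ) : X ≃ₜ X) '' U = U := by
    conv_lhs => rw [← h1]
    rw [← image_zpow_add]
    exact image_zpow_zero f U
  induction k using Int.induction_on with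
  | zero => exact image_zpow_zero f U
  | succ k ih => rw [image_zpow_add, h1, ih]
  | pred k ih => rw [sub_eq_add_neg, image_zpow_add, h2, ih]

theorem zpow_mem_iff {U : Set X} {f : X ≃ₜ X} (hf : f '' U = U) (k : ℤ) {y : X} :
    (f ^ k : X ≃ₜ X) y ∈ U ↔ y ∈ U := by
  conv_lhs => rw [← zpow_image_eq hf k]
  exact (f ^ k).injective.mem_set_image

theorem ext_pow {F : Dsk ≃ₜ Dsk} {G : ℝ ≃o ℝ}
    (hext : ∀ x, ∀ r > 0, ∃ r' > 0, F '' Nb x r' ⊆ Nb (G x) r) (k : ℕ) (x : ℝ) :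
    ∀ r > 0, ∃ r' > 0, (F ^ k : Dsk ≃ₜ Dsk) '' Nb x r' ⊆ Nb ((G ^ k : ℝ ≃o ℝ) x) r := by
  induction k with
  | zero => exact fun r hr => ⟨r, hr, by rw [pow_zero, pow_zero]; exact (image_id _).subset⟩
  | succ k ih =>
    intro r hr
    obtain ⟨r₁, hr₁, h₁⟩ := hext ((G ^ k : ℝ ≃o ℝ) x) r hr
    obtain ⟨r₂, hr₂, h₂⟩ := ih r₁ hr₁
    refine ⟨r₂, hr₂, ?_⟩
    rw [pow_succ', pow_succ', RelIso.mul_apply, image_homeo_mul]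
    exact (image_mono h₂).trans h₁

theorem JoinedIn.union_image {f : X ≃ₜ X} {A : Set X} (hA : IsPathConnected A)
    (hf : (f '' A ∩ A).Nonempty) {y : X} (hy : y ∈ A) : JoinedIn (A ∪ f '' A) y (f y) := by
  obtain ⟨q, hq, hq'⟩ := hf
  exact ((hA.joinedIn y hy q hq').mono subset_union_left).trans
    (((hA.image f.continuous).joinedIn q hq _ ⟨y, hy, rfl⟩).mono subset_union_right)
end

section
variable {U : Set ℂ} {φ : ℂ → ℂ}

/-- The complement of the iterates of `A` of index between `2` and `L` in absolute value. -/
def tubeSet (f : ℂ ≃ₜ ℂ) (A : Set ℂ) (L : ℤ) : Set ℂ :=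
  {p | ∀ l : ℤ, 2 ≤ |l| → |l| ≤ L → p ∉ (f ^ l : ℂ ≃ₜ ℂ) '' A}

theorem disjoint_tubeSet {f : ℂ ≃ₜ ℂ} {A : Set ℂ} {L l : ℤ} (h : 2 ≤ |l|) (h' : |l| ≤ L) :
    Disjoint (tubeSet f A L) ((f ^ l : ℂ ≃ₜ ℂ) '' A) :=
  Set.disjoint_left.2 fun _ hp => hp l h h'

set_option maxHeartbeats 1000000 in
/-- A curve from an orbit segment to a point of a tube of translation arcs cannot leave the domain
while avoiding the other tubes. -/
theorem not_accesses (m : DiscModel U φ) (hφ : DifferentiableOn ℂ φ (Metric.ball 0 1))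
    (hder : ∀ z ∈ Metric.ball (0:ℂ) 1, deriv φ z ≠ 0) {f : ℂ ≃ₜ ℂ} (hf : f '' U = U)
    {G : ℝ ≃o ℝ} (hper : ∀ x, G (x + 2 * Real.pi) = G x + 2 * Real.pi)
    (hext : ∀ x, ∀ r > 0, ∃ r' > 0, m.conj f hf '' Nb x r' ⊆ Nb (G x) r) {M : ℕ} {x : ℝ}
    (hM : ∃ k : ℕ, 4 ≤ k ∧ k ≤ M ∧ ∃ j : ℤ,
      (x ≤ (G ^ k) x + j * (2 * Real.pi) ∧ (G ^ k) x + j * (2 * Real.pi) < G x ∧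
        G x ≤ (G ^ (k + 1)) x + j * (2 * Real.pi) ∧
        (G ^ (k + 1)) x + j * (2 * Real.pi) < x + 2 * Real.pi) ∨
      (G x - 2 * Real.pi < (G ^ k) x + j * (2 * Real.pi) ∧ (G ^ k) x + j * (2 * Real.pi) ≤ x ∧
        x < (G ^ (k + 1)) x + j * (2 * Real.pi) ∧
        (G ^ (k + 1)) x + j * (2 * Real.pi) ≤ G x))
    {A : Set ℂ} (hA : IsPathConnected A) (hAf : (f '' A ∩ A).Nonempty)
    (hdis : ∀ l : ℤ, 2 ≤ |l| → |l| ≤ (M:ℤ) + 2 → Disjoint A ((f ^ l : ℂ ≃ₜ ℂ) '' A))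
    {B : Set ℂ} {v : Dsk} (hB : JoinedIn {z : Dsk | φ z ∈ B} v (m.conj f hf v))
    (hB' : ∀ l : ℤ, |l| ≤ (M:ℤ) + 2 → Disjoint B ((f ^ l : ℂ ≃ₜ ℂ) '' A)) {y : ℂ}
    (h : Accesses φ (tubeSet f A (M + 2)) v x y) (hy : y ∈ A) (hyU : y ∉ U) : False := by
  obtain ⟨k, hk4, hkM, j, hj⟩ := hM
  set F := m.conj f hf with hF
  set O := tubeSet f A (M + 2) with hO
  have hφc := hφ.continuousOn
  have hFk : ∀ (k : ℕ) (z : Dsk), φ ((F ^ k : Dsk ≃ₜ Dsk) z) = (f ^ k : ℂ ≃ₜ ℂ) (φ z) := fun k z => by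
    have := m.conj_zpow_apply f hf k z
    rwa [zpow_natCast, zpow_natCast] at this
  have hacc : ∀ i : ℕ, Accesses φ ((f ^ i : ℂ ≃ₜ ℂ) '' O) ((F ^ i : Dsk ≃ₜ Dsk) v)
      ((G ^ i : ℝ ≃o ℝ) x) ((f ^ i : ℂ ≃ₜ ℂ) y) := fun i =>
    h.map (hFk i) (ext_pow hext i x)
  have hyU' : ∀ i : ℕ, (f ^ i : ℂ ≃ₜ ℂ) y ∉ U := fun i => by
    have := zpow_mem_iff hf i (y := y)
    rw [zpow_natCast] at this
    rwa [this]
  have hs : ∀ i x, (G ^ (i + 1)) x = G ((G ^ i) x) := fun k x => by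
    rw [pow_succ', RelIso.mul_apply]
  have hsf : (f ^ (k + 1) : ℂ ≃ₜ ℂ) y = (f ^ k : ℂ ≃ₜ ℂ) (f y) := by
    rw [pow_succ, Homeomorph.mul_apply]
  -- disjointness of the two chains of tubes
  have hdisO : ∀ i l : ℤ, 2 ≤ |l - i| → |l - i| ≤ (M:ℤ) + 2 →
      Disjoint ((f ^ i : ℂ ≃ₜ ℂ) '' O) ((f ^ l : ℂ ≃ₜ ℂ) '' A) := fun i l h1 h2 => by
    rw [disjoint_image_zpow]
    exact disjoint_tubeSet h1 h2
  have hdisB : ∀ i l : ℤ, |l - i| ≤ (M:ℤ) + 2 →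
      Disjoint ((f ^ i : ℂ ≃ₜ ℂ) '' B) ((f ^ l : ℂ ≃ₜ ℂ) '' A) := fun i l h2 => by
    rw [disjoint_image_zpow]
    exact hB' _ h2
  have hdisA : ∀ i l : ℤ, 2 ≤ |l - i| → |l - i| ≤ (M:ℤ) + 2 →
      Disjoint ((f ^ i : ℂ ≃ₜ ℂ) '' A) ((f ^ l : ℂ ≃ₜ ℂ) '' A) := fun i l h1 h2 => by
    rw [disjoint_image_zpow]
    exact hdis _ h1 h2
  set T : Set ℂ := A ∪ f '' A with hT
  have hT' : T = (f ^ (0:ℤ) : ℂ ≃ₜ ℂ) '' A ∪ (f ^ (1:ℤ) : ℂ ≃ₜ ℂ) '' A := by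
    rw [image_zpow_zero, zpow_one]
  set Q : Set ℂ := (f ^ k : ℂ ≃ₜ ℂ) '' T with hQ
  have hQ' : Q = (f ^ (k:ℤ) : ℂ ≃ₜ ℂ) '' A ∪ (f ^ ((k:ℤ) + 1) : ℂ ≃ₜ ℂ) '' A := by
    rw [hQ, hT, image_union, image_zpow_add, zpow_one, zpow_natCast]
  have key : ∀ a b : ℤ, (2 ≤ a ∨ 2 ≤ -a) → a ≤ b → -a ≤ b → 2 ≤ |a| ∧ |a| ≤ b :=
    fun a b h1 h2 h3 => ⟨le_abs.2 h1, abs_le'.2 ⟨h2, h3⟩⟩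
  have hTQ : Disjoint T Q := by
    rw [hT', hQ']
    refine Disjoint.union_left (Disjoint.union_right ?_ ?_) (Disjoint.union_right ?_ ?_) <;>
    · refine hdisA _ _ ?_ ?_
      · exact (key _ (M + 2) (by omega) (by omega) (by omega)).1
      · exact (key _ (M + 2) (by omega) (by omega) (by omega)).2
  have hOQ : ∀ i : ℤ, 0 ≤ i → i ≤ 1 → Disjoint ((f ^ i : ℂ ≃ₜ ℂ) '' O) Q := fun i h0 h1 => by
    rw [hQ']
    refine Disjoint.union_right ?_ ?_ <;>
    · refine hdisO _ _ ?_ ?_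
      · exact (key _ (M + 2) (by omega) (by omega) (by omega)).1
      · exact (key _ (M + 2) (by omega) (by omega) (by omega)).2
  have hOT : ∀ i : ℤ, k ≤ i → i ≤ k + 1 → Disjoint ((f ^ i : ℂ ≃ₜ ℂ) '' O) T := fun i h0 h1 => by
    rw [hT']
    refine Disjoint.union_right ?_ ?_ <;>
    · refine hdisO _ _ ?_ ?_
      · exact (key _ (M + 2) (by omega) (by omega) (by omega)).1
      · exact (key _ (M + 2) (by omega) (by omega) (by omega)).2
  have hBQ : Disjoint B Q := by
    rw [← image_zpow_zero f B, hQ']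
    refine Disjoint.union_right ?_ ?_ <;>
    · refine hdisB _ _ ?_
      exact abs_le.2 ⟨by omega, by omega⟩
  have hBT : Disjoint ((f ^ k : ℂ ≃ₜ ℂ) '' B) T := by
    rw [← zpow_natCast, hT']
    refine Disjoint.union_right ?_ ?_ <;>
    · refine hdisB _ _ ?_
      exact abs_le.2 ⟨by omega, by omega⟩
  -- the two end graphs
  have hp : JoinedIn (endGraph φ Q (circ x) y (circ (G x)) (f y)) (circ x, y)
      (circ (G x), f y) := by
    have h0 := hOQ 0 le_rfl zero_le_one
    have h1 := hOQ 1 zero_le_one le_rfl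
    rw [image_zpow_zero] at h0
    rw [zpow_one] at h1
    have h2 := hacc 1
    rw [pow_one, pow_one, pow_one] at h2
    exact joinedIn_endGraph hφc h hB h2 h0 hBQ h1
  have hq : JoinedIn (endGraph φ T (circ ((G ^ k) x)) ((f ^ k : ℂ ≃ₜ ℂ) y)
      (circ ((G ^ (k + 1)) x)) ((f ^ (k + 1) : ℂ ≃ₜ ℂ) y))
      (circ ((G ^ k) x), (f ^ k : ℂ ≃ₜ ℂ) y)
      (circ ((G ^ (k + 1)) x), (f ^ (k + 1) : ℂ ≃ₜ ℂ) y) := by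
    have h0 := hOT k le_rfl (by omega)
    have h1 := hOT (k + 1 : ℕ) (by push_cast; lia) (by push_cast; lia)
    rw [zpow_natCast] at h0 h1
    refine joinedIn_endGraph hφc (hacc k) (O₂ := (f ^ k : ℂ ≃ₜ ℂ) '' B) ?_ (hacc (k + 1)) h0 hBT h1
    obtain ⟨p, hp⟩ := hB
    refine ⟨(p.map (F ^ k).continuous).cast rfl (by rw [pow_succ, Homeomorph.mul_apply]),
      fun t => ?_⟩
    exact ⟨_, hp t, (hFk k _).symm⟩
  have hP : JoinedIn T y (f y) := JoinedIn.union_image hA hAf hy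
  have hQj : JoinedIn Q ((f ^ k : ℂ ≃ₜ ℂ) y) ((f ^ (k + 1) : ℂ ≃ₜ ℂ) y) := by
    obtain ⟨p, hp⟩ := hP
    exact ⟨(p.map (f ^ k).continuous).cast rfl hsf, fun t => ⟨_, hp t, rfl⟩⟩
  -- the endpoints are distinct
  have hne : (G ^ k) x + j * (2 * Real.pi) ≠ x := fun he => by
    have hc : circ ((G ^ k) x) = circ x :=
      circ_eq_circ.2 ⟨-j, by push_cast; linarith⟩
    have := (hacc k).unique m h (hyU' k) hyU hc
    have hd := hdis k (key _ (M + 2) (by omega) (by omega) (by omega)).1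
      (key _ (M + 2) (by omega) (by omega) (by omega)).2
    rw [zpow_natCast] at hd
    exact Set.disjoint_left.1 hd hy ⟨y, hy, this⟩
  have hne' : (G ^ (k + 1)) x + j * (2 * Real.pi) ≠ G x := fun he => by
    rw [hs, ← map_add_int_mul hper] at he
    exact hne (G.injective he)
  have hcj : ∀ t, circ (t + j * (2 * Real.pi)) = circ t := fun t =>
    circ_eq_circ.2 ⟨j, rfl⟩
  have hcm : circ (G x - 2 * Real.pi) = circ (G x) := circ_eq_circ.2 ⟨-1, by push_cast; ring⟩
  have hfyU : f y ∉ U := by simpa using hyU' 1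
  rw [← m.img] at hyU hfyU hyU'
  rw [← hcj ((G ^ k) x), ← hcj ((G ^ (k + 1)) x)] at hq
  rcases hj with ⟨h1, h2, h3, h4⟩ | ⟨h1, h2, h3, h4⟩
  · exact reciprocity_joined hφ m.inj hder (lt_of_le_of_ne h1 hne.symm) h2
      (lt_of_le_of_ne h3 hne'.symm) h4 hyU (hyU' k) hfyU (hyU' (k + 1)) hTQ hP hQj hp hq
  · rw [endGraph_comm, ← hcm] at hp
    exact reciprocity_joined hφ m.inj hder h1 (lt_of_le_of_ne h2 hne) h3
      (by linarith [lt_of_le_of_ne h4 hne']) hfyU (hyU' k) hyU (hyU' (k + 1)) hTQ hP.symm hQj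
      hp.symm hq

end

section
variable {X : Type*} [TopologicalSpace X] {U : Set X} {χ : ℂ → X}

/-- The trace on the disc of a set of the target. -/
def discTrace (χ : ℂ → X) (S : Set X) : Set Dsk := {z | χ z ∈ S}

theorem DiscModel.image_discTrace (m : DiscModel U χ) (f : X ≃ₜ X) (hf : f '' U = U) (k : ℤ)
    (S : Set X) : (m.conj f hf ^ k : Dsk ≃ₜ Dsk) '' discTrace χ S =
      discTrace χ ((f ^ k : X ≃ₜ X) '' S) := by
  ext z
  constructor
  · rintro ⟨w, hw, rfl⟩
    exact ⟨_, hw, (m.conj_zpow_apply f hf k w).symm⟩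
  · rintro ⟨y, hy, hyz⟩
    refine ⟨(m.conj f hf ^ (-k) : Dsk ≃ₜ Dsk) z, ?_, ?_⟩
    · change χ _ ∈ S
      rw [m.conj_zpow_apply, ← hyz, ← Homeomorph.mul_apply, ← zpow_add, neg_add_cancel, zpow_zero]
      exact hy
    · rw [← Homeomorph.mul_apply, ← zpow_add, add_neg_cancel, zpow_zero]
      rfl

theorem DiscModel.isClosed_discTrace (m : DiscModel U χ) {S : Set X} (hS : IsClosed S) :
    IsClosed (discTrace χ S) :=
  hS.preimage (m.continuousOn.comp_continuous continuous_subtype_val fun z => z.2)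

/-- A compact path connected tube, meeting its image, leaving the domain, disjoint from its other
iterates up to order `N` and from the iterates of `C` up to order `N`. -/
structure IsTube (f : X ≃ₜ X) (U A C : Set X) (N : ℤ) : Prop where
  cpt : IsCompact A
  path : IsPathConnected A
  meet : (f '' A ∩ A).Nonempty
  dis : ∀ l : ℤ, 2 ≤ |l| → |l| ≤ N → Disjoint A ((f ^ l : X ≃ₜ X) '' A)
  disC : ∀ l : ℤ, |l| ≤ N → Disjoint C ((f ^ l : X ≃ₜ X) '' A)
  out : ∃ z ∈ A, z ∉ U

/-- The union of the first iterates of a set. -/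
def orbitSeg (f : X ≃ₜ X) (A : Set X) (L : ℕ) : Set X :=
  ⋃ i ∈ Icc (0:ℤ) L, (f ^ i : X ≃ₜ X) '' A

theorem mem_orbitSeg {f : X ≃ₜ X} {A : Set X} {L : ℕ} {k : ℤ} {y : X} :
    y ∈ (f ^ k : X ≃ₜ X) '' orbitSeg f A L ↔
      ∃ i : ℤ, k ≤ i ∧ i ≤ k + L ∧ y ∈ (f ^ i : X ≃ₜ X) '' A := by
  simp only [orbitSeg, image_iUnion, mem_iUnion, ← image_zpow_add]
  constructor
  · rintro ⟨i, hi, hy⟩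
    exact ⟨k + i, by linarith [hi.1], by linarith [hi.2], hy⟩
  · rintro ⟨i, h1, h2, hy⟩
    exact ⟨i - k, ⟨by linarith, by linarith⟩, by simpa using hy⟩

theorem IsTube.disjoint {f : X ≃ₜ X} {A C : Set X} {N : ℤ} (h : IsTube f U A C N) {i j : ℤ}
    (h1 : i + 2 ≤ j) (h2 : j ≤ i + N) {y : X} (hi : y ∈ (f ^ i : X ≃ₜ X) '' A)
    (hj : y ∈ (f ^ j : X ≃ₜ X) '' A) : False := by
  refine Set.disjoint_left.1 ((disjoint_image_zpow f i j A A).2 (h.dis _ ?_ ?_)) hi hj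
  · exact le_abs.2 (Or.inl (by lia))
  · exact abs_le.2 ⟨by lia, by lia⟩

theorem isClosed_orbitSeg [T2Space X] {f : X ≃ₜ X} {A : Set X} (hA : IsCompact A) (L : ℕ) :
    IsClosed (orbitSeg f A L) :=
  (finite_Icc _ _).isClosed_biUnion fun i _ => (hA.image (f ^ i).continuous).isClosed

end

section
variable {U : Set ℂ} {φ : ℂ → ℂ}

theorem IsTube.star (m : DiscModel U φ) (hU : IsOpen U)
    (hφ : DifferentiableOn ℂ φ (Metric.ball 0 1))
    (hder : ∀ z ∈ Metric.ball (0:ℂ) 1, deriv φ z ≠ 0) {f : ℂ ≃ₜ ℂ} (hf : f '' U = U)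
    {G : ℝ ≃o ℝ} (hper : ∀ x, G (x + 2 * Real.pi) = G x + 2 * Real.pi)
    (hext : ∀ x, ∀ r > 0, ∃ r' > 0, m.conj f hf '' Nb x r' ⊆ Nb (G x) r) {M : ℕ}
    (hM : ∀ x, ∃ k : ℕ, 4 ≤ k ∧ k ≤ M ∧ ∃ j : ℤ,
      (x ≤ (G ^ k) x + j * (2 * Real.pi) ∧ (G ^ k) x + j * (2 * Real.pi) < G x ∧
        G x ≤ (G ^ (k + 1)) x + j * (2 * Real.pi) ∧
        (G ^ (k + 1)) x + j * (2 * Real.pi) < x + 2 * Real.pi) ∨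
      (G x - 2 * Real.pi < (G ^ k) x + j * (2 * Real.pi) ∧ (G ^ k) x + j * (2 * Real.pi) ≤ x ∧
        x < (G ^ (k + 1)) x + j * (2 * Real.pi) ∧
        (G ^ (k + 1)) x + j * (2 * Real.pi) ≤ G x))
    {A C : Set ℂ} {N : ℤ} (h : IsTube f U A C N) {n : ℕ} (hn : M + 4 ≤ n)
    (hN : 2 * (n:ℤ) + M + 2 ≤ N) {b : Dsk}
    (hb : JoinedIn (discTrace φ C) b (m.conj f hf b)) :
    discTrace φ (orbitSeg f A (M + 2)) ⊆
      hideSet b ((m.conj f hf ^ (n:ℤ) : Dsk ≃ₜ Dsk) '' discTrace φ (orbitSeg f A (M + 2))) ∪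
      hideSet b ((m.conj f hf ^ (-(n:ℤ)) : Dsk ≃ₜ Dsk) '' discTrace φ (orbitSeg f A (M + 2))) := by
  intro y hy
  by_contra hcon
  rw [mem_union, not_or] at hcon
  set F := m.conj f hf with hF
  set P := discTrace φ (orbitSeg f A (M + 2)) with hP
  have hcl : IsClosed P := m.isClosed_discTrace (isClosed_orbitSeg h.cpt _)
  have hmem : ∀ (k : ℤ) (z : Dsk), z ∈ (F ^ k : Dsk ≃ₜ Dsk) '' P ↔
      ∃ i : ℤ, k ≤ i ∧ i ≤ k + (M + 2) ∧ φ z ∈ (f ^ i : ℂ ≃ₜ ℂ) '' A := fun k z => by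
    rw [hP, hF, m.image_discTrace]
    exact mem_orbitSeg.trans (by push_cast; rfl)
  have hy' := not_mem_hideSet_union ((F ^ (n:ℤ)).isClosedMap _ hcl)
    ((F ^ (-(n:ℤ))).isClosedMap _ hcl) (Set.disjoint_left.2 fun z h1 h2 => by
      obtain ⟨i, hi1, hi2, hi⟩ := (hmem _ _).1 h1
      obtain ⟨j, hj1, hj2, hj⟩ := (hmem _ _).1 h2
      exact h.disjoint (by lia) (by lia) hj hi) hcon.1 hcon.2
  set Z : Set Dsk := ((F ^ (n:ℤ) : Dsk ≃ₜ Dsk) '' P ∪ (F ^ (-(n:ℤ)) : Dsk ≃ₜ Dsk) '' P)ᶜ with hZ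
  have hZo : IsOpen Z := (((F ^ (n:ℤ)).isClosedMap _ hcl).union
    ((F ^ (-(n:ℤ))).isClosedMap _ hcl)).isOpen_compl
  rw [hideSet, notMem_compl_iff] at hy'
  have hbZ : b ∈ Z := by
    by_contra hbZ
    rw [connectedComponentIn_eq_empty hbZ] at hy'
    exact hy'
  have hco : IsConnected (connectedComponentIn Z b) :=
    ⟨⟨y, hy'⟩, isPreconnected_connectedComponentIn⟩
  obtain ⟨p, hp⟩ := ((hZo.connectedComponentIn.isConnected_iff_isPathConnected.1 hco).joinedIn b
    (mem_connectedComponentIn hbZ) y hy').mono (connectedComponentIn_subset _ _)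
  have hpc := p.continuous_extend
  have hpZ : ∀ t, p.extend t ∈ Z := fun t => hp _
  -- the first hit of a middle tube
  set R : Set Dsk := discTrace φ (⋃ i ∈ Ioo (-(n:ℤ) + (M + 2)) n, (f ^ i : ℂ ≃ₜ ℂ) '' A) with hR
  have hRc : IsClosed R := m.isClosed_discTrace
    ((finite_Ioo _ _).isClosed_biUnion fun i _ => (h.cpt.image (f ^ i).continuous).isClosed)
  have hmemR : ∀ z, z ∈ R ↔ ∃ i : ℤ, -(n:ℤ) + (M + 2) < i ∧ i < n ∧
      φ z ∈ (f ^ i : ℂ ≃ₜ ℂ) '' A := fun z => by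
    simp only [hR, discTrace, mem_iUnion, mem_Ioo, exists_prop, mem_ofPred_eq, and_assoc]
  have hyR : y ∈ R := by
    rw [hmemR]
    have : y ∈ (F ^ (0:ℤ) : Dsk ≃ₜ Dsk) '' P := by rw [image_zpow_zero]; exact hy
    obtain ⟨i, h1, h2, h3⟩ := (hmem 0 y).1 this
    exact ⟨i, by lia, by lia, h3⟩
  obtain ⟨t₀, ⟨ht₀, ht₀R⟩, hleast⟩ : ∃ t₀, IsLeast (Icc (0:ℝ) 1 ∩ p.extend ⁻¹' R) t₀ :=
    (isCompact_Icc.inter_right (hRc.preimage hpc)).exists_isLeast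
      ⟨1, ⟨zero_le_one, le_rfl⟩, by simpa using hyR⟩
  obtain ⟨i, hi1, hi2, hi⟩ := (hmemR _).1 ht₀R
  set Fi : Dsk ≃ₜ Dsk := F ^ (-i) with hFi
  have hφFi : ∀ z, φ (Fi z) = (f ^ (-i) : ℂ ≃ₜ ℂ) (φ z) := fun z => m.conj_zpow_apply f hf _ z
  have htr : ∀ z (l : ℤ), φ (Fi z) ∈ (f ^ l : ℂ ≃ₜ ℂ) '' A ↔ φ z ∈ (f ^ (i + l) : ℂ ≃ₜ ℂ) '' A :=
    fun z l => by
      rw [hφFi, ← (f ^ i).injective.mem_set_image, ← image_zpow_add, ← Homeomorph.mul_apply,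
        ← zpow_add, add_neg_cancel, zpow_zero]
      rfl
  have hjoin : JoinedIn {z : Dsk | φ z ∈ tubeSet f A (M + 2)} (Fi b) (Fi (p.extend t₀)) := by
    refine JoinedIn.ofLine (f := fun t => Fi (p.extend (t * t₀)))
      (Fi.continuous.comp (hpc.comp (by fun_prop))).continuousOn (by simp) (by simp) ?_
    rintro _ ⟨t, ht, rfl⟩ l hl1 hl2
    rw [htr]
    intro hmeml
    have hl2' := abs_le.1 hl2
    rcases eq_or_ne t 1 with rfl | ht1
    · rw [one_mul] at hmeml
      rcases le_abs.1 hl1 with hl | hl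
      · exact h.disjoint (by lia) (by lia) hi hmeml
      · exact h.disjoint (by lia) (by lia) hmeml hi
    · have hz := hpZ (t * t₀)
      rw [hZ, compl_union] at hz
      have hz1 : ¬ ((n:ℤ) ≤ i + l ∧ i + l ≤ n + (M + 2)) :=
        fun hh => hz.1 ((hmem _ _).2 ⟨i + l, hh.1, hh.2, hmeml⟩)
      have hz2 : ¬ (-(n:ℤ) ≤ i + l ∧ i + l ≤ -n + (M + 2)) :=
        fun hh => hz.2 ((hmem _ _).2 ⟨i + l, hh.1, hh.2, hmeml⟩)
      have hin : p.extend (t * t₀) ∈ R := (hmemR _).2 ⟨i + l, by lia, by lia, hmeml⟩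
      have hle := hleast ⟨⟨mul_nonneg ht.1 ht₀.1, mul_le_one₀ ht.2 ht₀.1 ht₀.2⟩, hin⟩
      rcases ht₀.1.eq_or_lt with h0 | h0
      · rw [← h0, mul_zero] at hmeml
        rw [← h0] at hi
        rcases le_abs.1 hl1 with hl | hl
        · exact h.disjoint (by lia) (by lia) hi hmeml
        · exact h.disjoint (by lia) (by lia) hmeml hi
      · have : t < 1 := lt_of_le_of_ne ht.2 ht1
        nlinarith
  obtain ⟨z, hzA, hzU⟩ := h.out
  have hwA : φ (Fi (p.extend t₀)) ∈ A := by
    have := (htr (p.extend t₀) 0).2 (by rwa [add_zero])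
    rwa [image_zpow_zero] at this
  obtain ⟨x, y', hy'A, hy'U, hend⟩ :=
    m.exists_endCurve hU (h.path.joinedIn _ hwA z hzA) hzU
  have hAO : A ⊆ tubeSet f A (M + 2) := fun q hq l h1 h2 hq' =>
    Set.disjoint_left.1 (h.dis l h1 (by lia)) hq hq'
  refine not_accesses m hφ hder hf hper hext (hM x) h.path h.meet
    (fun l h1 h2 => h.dis l h1 (by lia)) (B := (f ^ (-i) : ℂ ≃ₜ ℂ) '' C) (v := Fi b) ?_ ?_
    (hjoin.accesses (hend.accesses.mono hAO)) hy'A hy'U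
  · obtain ⟨q, hq⟩ := hb
    refine ⟨(q.map Fi.continuous).cast rfl ?_, fun t => ⟨_, hq t, (hφFi _).symm⟩⟩
    rw [← hF, hFi, ← Homeomorph.mul_apply, ← Homeomorph.mul_apply, ← zpow_add_one,
      ← zpow_one_add, add_comm]
  · intro l hl
    have := abs_le.1 hl
    conv_rhs => rw [show l = 0 + l by ring]
    rw [show (0:ℤ) + l = l by ring, disjoint_image_zpow]
    exact h.disC _ (abs_le.2 ⟨by lia, by lia⟩)

end

section
variable {X : Type*} [TopologicalSpace X] {U : Set X} {χ : ℂ → X}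

theorem orbitSeg_joinedIn {f : X ≃ₜ X} {A : Set X} (hA : IsPathConnected A)
    (hf : (f '' A ∩ A).Nonempty) {L : ℕ} {z : X} (hz : z ∈ A) {y : X} (hy : y ∈ orbitSeg f A L) :
    JoinedIn (orbitSeg f A L) y z := by
  have hsub : ∀ i : ℕ, i ≤ L → (f ^ (i:ℤ) : X ≃ₜ X) '' A ⊆ orbitSeg f A L := fun i hi =>
    subset_biUnion_of_mem (u := fun i : ℤ => (f ^ i : X ≃ₜ X) '' A)
      (show (i:ℤ) ∈ Icc (0:ℤ) L from ⟨by lia, by lia⟩)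
  have hpc : ∀ i : ℕ, IsPathConnected ((f ^ (i:ℤ) : X ≃ₜ X) '' A) := fun i =>
    hA.image (f ^ (i:ℤ)).continuous
  have key : ∀ i : ℕ, i ≤ L → ∀ y ∈ (f ^ (i:ℤ) : X ≃ₜ X) '' A, JoinedIn (orbitSeg f A L) y z := by
    intro i
    induction i with
    | zero =>
      intro h0 y hy
      refine ((hpc 0).joinedIn y hy z ?_).mono (hsub 0 h0)
      rw [Nat.cast_zero, image_zpow_zero]
      exact hz
    | succ i ih =>
      intro hi y hy
      obtain ⟨q, hq, hq'⟩ := hf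
      have h1 : (f ^ (i:ℤ) : X ≃ₜ X) q ∈ (f ^ ((i + 1 : ℕ):ℤ) : X ≃ₜ X) '' A := by
        rw [Nat.cast_succ, image_zpow_add, zpow_one]
        exact ⟨q, hq, rfl⟩
      exact (((hpc (i + 1)).joinedIn y hy _ h1).mono (hsub _ hi)).trans
        (ih (by lia) _ ⟨q, hq', rfl⟩)
  obtain ⟨i, ⟨h0, h1⟩, hi⟩ : ∃ i ∈ Icc (0:ℤ) L, y ∈ (f ^ i : X ≃ₜ X) '' A := by
    simpa [orbitSeg] using hy
  lift i to ℕ using h0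
  exact key i (by lia) y hi

theorem DiscModel.reach [T2Space X] [LocallyCompactSpace X] (m : DiscModel U χ) (hU : IsOpen U)
    {f : X ≃ₜ X} {A : Set X} (hA : IsPathConnected A)
    (hf : (f '' A ∩ A).Nonempty) {L : ℕ} {z : X} (hz : z ∈ A) (hzU : z ∉ U) {y : Dsk}
    (hy : y ∈ discTrace χ (orbitSeg f A L)) :
    ∃ x, ∀ Q : Set X, IsClosed Q → Disjoint (orbitSeg f A L) Q → ∀ R > 0, ∃ r, 0 < r ∧ r < R ∧
      ∃ S : Set Dsk, IsPreconnected S ∧ Disjoint S (discTrace χ Q) ∧ y ∈ S ∧ Cb x r ⊆ S := by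
  obtain ⟨x, y', hy', hyU, h⟩ := m.exists_endCurve hU
    (orbitSeg_joinedIn hA hf hz hy) hzU
  refine ⟨x, fun Q hQ hd R hR => ?_⟩
  obtain ⟨r, hr0, hrR, S, hS, hSQ, hyS, hCS⟩ :=
    h.exists_crosscut m hyU (hQ.isOpen_compl.mem_nhds (Set.disjoint_left.1 hd hy')) hR
  refine ⟨r, hr0, hrR, S, hS, Set.disjoint_left.2 fun w hw hwQ => ?_, hyS, hCS⟩
  rcases hSQ w hw with h | h
  · exact Set.disjoint_left.1 hd h hwQ
  · exact h hwQ

theorem exists_rot_pow {G : ℝ ≃o ℝ} (hper : ∀ x, G (x + 2 * Real.pi) = G x + 2 * Real.pi)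
    (n₀ : ℕ) : ∃ n, n₀ ≤ n ∧ 1 ≤ n ∧ ((∃ x, ∃ m : ℤ, (G ^ n) x = x + m * (2 * Real.pi)) ∨
      (∀ i : ℤ, i ≠ 0 → ∀ x, ∀ m : ℤ, ((G ^ n) ^ i : ℝ ≃o ℝ) x ≠ x + m * (2 * Real.pi))) := by
  by_cases h : ∃ p : ℕ, 1 ≤ p ∧ ∃ x, ∃ q : ℤ, (G ^ p) x = x + q * (2 * Real.pi)
  · obtain ⟨p, hp, x, q, hq⟩ := h
    refine ⟨p * (n₀ + 1), by nlinarith, by nlinarith, Or.inl ⟨x, (n₀ + 1 : ℕ) * q, ?_⟩⟩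
    have : ∀ j : ℕ, ((G ^ p) ^ j) x = x + (j * q : ℤ) * (2 * Real.pi) := fun j => by
      induction j with
      | zero => simp
      | succ j ih =>
        rw [pow_succ', RelIso.mul_apply, ih, map_add_int_mul (pow_periodic hper p), hq]
        push_cast
        ring
    rw [pow_mul, this]
  · push Not at h
    refine ⟨n₀ + 1, by lia, by lia, Or.inr fun i hi x m hm => ?_⟩
    rcases lt_or_gt_of_ne hi with hi | hi
    · obtain ⟨k, rfl⟩ := Int.exists_eq_neg_ofNat hi.le
      refine h ((n₀ + 1) * k) (Nat.mul_pos (by lia) (by lia)) x (-m) ?_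
      have h1 : ((G ^ (n₀ + 1)) ^ k) (((G ^ (n₀ + 1)) ^ (-(k:ℤ)) : ℝ ≃o ℝ) x) = x := by
        rw [← zpow_natCast, ← RelIso.mul_apply, ← zpow_add, add_neg_cancel, zpow_zero]
        rfl
      rw [hm, map_add_int_mul (pow_periodic (pow_periodic hper _) _)] at h1
      rw [pow_mul]
      push_cast
      linarith
    · lift i to ℕ using hi.le
      refine h ((n₀ + 1) * i) (Nat.mul_pos (by lia) (by lia)) x m ?_
      rw [pow_mul, ← hm, zpow_natCast]

end

section
variable {U : Set ℂ} {φ : ℂ → ℂ}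

theorem IsTube.false (m : DiscModel U φ) (hU : IsOpen U)
    (hφ : DifferentiableOn ℂ φ (Metric.ball 0 1))
    (hder : ∀ z ∈ Metric.ball (0:ℂ) 1, deriv φ z ≠ 0) {f : ℂ ≃ₜ ℂ} (hf : f '' U = U)
    {G : ℝ ≃o ℝ} (hper : ∀ x, G (x + 2 * Real.pi) = G x + 2 * Real.pi)
    (hext : ∀ x, ∀ r > 0, ∃ r' > 0, m.conj f hf '' Nb x r' ⊆ Nb (G x) r)
    (hext' : ∀ x, ∀ r > 0, ∃ r' > 0,
      ((m.conj f hf)⁻¹ : Dsk ≃ₜ Dsk) '' Nb x r' ⊆ Nb ((G⁻¹ : ℝ ≃o ℝ) x) r) {M : ℕ}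
    (hM : ∀ x, ∃ k : ℕ, 4 ≤ k ∧ k ≤ M ∧ ∃ j : ℤ,
      (x ≤ (G ^ k) x + j * (2 * Real.pi) ∧ (G ^ k) x + j * (2 * Real.pi) < G x ∧
        G x ≤ (G ^ (k + 1)) x + j * (2 * Real.pi) ∧
        (G ^ (k + 1)) x + j * (2 * Real.pi) < x + 2 * Real.pi) ∨
      (G x - 2 * Real.pi < (G ^ k) x + j * (2 * Real.pi) ∧ (G ^ k) x + j * (2 * Real.pi) ≤ x ∧
        x < (G ^ (k + 1)) x + j * (2 * Real.pi) ∧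
        (G ^ (k + 1)) x + j * (2 * Real.pi) ≤ G x))
    {A : Set ℂ} {N : ℤ} {n : ℕ} (hn : M + 4 ≤ n) (hN : 2 * (n:ℤ) + M + 2 ≤ N)
    {K : Set Dsk} {b : Dsk} (hK : IsPathConnected K) (hb : b ∈ K) (hFb : m.conj f hf b ∈ K)
    (hgb : (m.conj f hf ^ (n:ℤ) : Dsk ≃ₜ Dsk) b ∈ K)
    (hgb' : (m.conj f hf ^ (-(n:ℤ)) : Dsk ≃ₜ Dsk) b ∈ K)
    (hNW1 : ∀ x r : ℝ, 0 < r →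
      (∀ k : ℤ, k ≠ 0 → Disjoint ((m.conj f hf ^ ((n : ℤ) * k) : Dsk ≃ₜ Dsk) '' Nb x r) (Nb x r)) →
      (∃ k : ℤ, 0 < k ∧ ((m.conj f hf ^ ((n : ℤ) * k) : Dsk ≃ₜ Dsk) '' Nb x r ∩ K).Nonempty) ∧
      (∃ k : ℤ, k < 0 ∧ ((m.conj f hf ^ ((n : ℤ) * k) : Dsk ≃ₜ Dsk) '' Nb x r ∩ K).Nonempty))
    (hNW2 : ∀ x r : ℝ, 0 < r →
      (∀ k : ℤ, k ≠ 0 →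
        Disjoint ((m.conj f hf ^ ((2 * n : ℕ) * k : ℤ) : Dsk ≃ₜ Dsk) '' Nb x r) (Nb x r)) →
      (∃ k : ℤ, 0 < k ∧
        ((m.conj f hf ^ ((2 * n : ℕ) * k : ℤ) : Dsk ≃ₜ Dsk) '' Nb x r ∩ K).Nonempty) ∧
      (∃ k : ℤ, k < 0 ∧
        ((m.conj f hf ^ ((2 * n : ℕ) * k : ℤ) : Dsk ≃ₜ Dsk) '' Nb x r ∩ K).Nonempty))
    (hrot : (∃ x, ∃ m : ℤ, (G ^ n) x = x + m * (2 * Real.pi)) ∨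
      (∀ i : ℤ, i ≠ 0 → ∀ x, ∀ m : ℤ, ((G ^ n) ^ i : ℝ ≃o ℝ) x ≠ x + m * (2 * Real.pi)))
    (h : IsTube f U A ((fun z : Dsk => φ z) '' K) N) (hAU : (A ∩ U).Nonempty) : False := by
  have htK : discTrace φ ((fun z : Dsk => φ z) '' K) = K := by
    ext z
    exact ⟨fun ⟨w, hw, hwz⟩ => m.eq_of_apply hwz ▸ hw, fun hz => ⟨z, hz, rfl⟩⟩
  have hstar := h.star m hU hφ hder hf hper hext hM hn hN (b := b)
    (by rw [htK]; exact hK.joinedIn _ hb _ hFb)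
  obtain ⟨z, hzA, hzU⟩ := h.out
  have hreach := fun y => m.reach hU h.path h.meet (L := M + 2) hzA hzU (y := y)
  have hcl : IsClosed (orbitSeg f A (M + 2)) := isClosed_orbitSeg h.cpt _
  set F := m.conj f hf with hF
  set P := discTrace φ (orbitSeg f A (M + 2)) with hP
  have him : ∀ k : ℤ, (F ^ k : Dsk ≃ₜ Dsk) '' P =
      discTrace φ ((f ^ k : ℂ ≃ₜ ℂ) '' orbitSeg f A (M + 2)) := fun k => m.image_discTrace f hf k _
  have hKP : ∀ k : ℤ, |k| ≤ n → Disjoint K ((F ^ k : Dsk ≃ₜ Dsk) '' P) := fun k hk => by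
    have hk' := abs_le.1 hk
    rw [him]
    refine Set.disjoint_left.2 fun w hw hw' => ?_
    obtain ⟨i, h1, h2, hi⟩ := mem_orbitSeg.1 hw'
    push_cast at h2
    exact Set.disjoint_left.1 (h.disC i (abs_le.2 ⟨by lia, by lia⟩)) ⟨w, hw, rfl⟩ hi
  have hPP : ∀ k : ℤ, |k| = n → Disjoint (orbitSeg f A (M + 2))
      ((f ^ k : ℂ ≃ₜ ℂ) '' orbitSeg f A (M + 2)) := fun k hk => by
    refine Set.disjoint_left.2 fun w hw hw' => ?_
    rw [← image_zpow_zero f (orbitSeg f A (M + 2))] at hw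
    obtain ⟨i, h1, h2, hi⟩ := mem_orbitSeg.1 hw
    obtain ⟨j, h3, h4, hj⟩ := mem_orbitSeg.1 hw'
    push_cast at h2 h4
    rcases (abs_eq (by lia)).1 hk with rfl | rfl
    · exact h.disjoint (by lia) (by lia) hi hj
    · exact h.disjoint (by lia) (by lia) hj hi
  have hclk : ∀ k : ℤ, IsClosed ((f ^ k : ℂ ≃ₜ ℂ) '' orbitSeg f A (M + 2)) := fun k =>
    (f ^ k).isClosedMap _ hcl
  have hg : (F ^ n)⁻¹ = F ^ (-(n:ℤ)) := by rw [zpow_neg, zpow_natCast]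
  have hg' : F ^ n = F ^ (n:ℤ) := by rw [zpow_natCast]
  have hn' : |(n:ℤ)| = n := abs_of_nonneg (by lia)
  have hn'' : |-(n:ℤ)| = n := by rw [abs_neg, hn']
  have d : DiscData (F ^ n) (G ^ n) P K b := by
    refine ⟨pow_periodic hper n, ext_pow hext n, ?_, m.isClosed_discTrace hcl, ?_,
      hK.isConnected.isPreconnected, hb, ?_, ?_, ?_, ?_, ?_, fun x r hr hw => ?_, fun x r hr hw => ?_,
      fun y hy => ?_, ?_, hrot⟩
    · rw [← inv_pow, ← inv_pow]
      exact ext_pow hext' n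
    · rw [hg', him]
      exact (Disjoint.preimage (fun z : Dsk => φ z) (hPP n hn')).symm
    · rwa [hg']
    · rwa [hg]
    · have := hKP 0 (by simp)
      rwa [image_zpow_zero] at this
    · rw [hg']; exact hKP n hn'.le
    · rw [hg]; exact hKP _ hn''.le
    · simp only [hg', ← zpow_mul] at hw ⊢
      exact hNW1 x r hr hw
    · simp only [hg', ← zpow_mul, show ∀ k : ℤ, (n:ℤ) * (2 * k) = (2 * n : ℕ) * k from
        fun k => by push_cast; ring] at hw ⊢
      exact hNW2 x r hr hw
    · obtain ⟨x, hx⟩ := hreach y hy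
      rw [hg, hg', him, him]
      exact ⟨x, hx _ (hclk _) (hPP n hn'), hx _ (hclk _) (hPP _ hn'')⟩
    · rwa [hg, hg']
  obtain ⟨y, hyA, hyU⟩ := hAU
  rw [← m.img] at hyU
  obtain ⟨w, hw, rfl⟩ := hyU
  have hwP : (⟨w, hw⟩ : Dsk) ∈ P := by
    refine mem_biUnion (show (0:ℤ) ∈ Icc (0:ℤ) ((M + 2 : ℕ):ℤ) from ⟨le_rfl, by lia⟩) ?_
    rw [image_zpow_zero]
    exact hyA
  rw [d.eq_empty] at hwP
  exact hwP

end

section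
theorem isPathConnected_closedDisc {ρ : ℝ} (h0 : 0 ≤ ρ) (h1 : ρ < 1) :
    IsPathConnected {z : Dsk | ‖(z:ℂ)‖ ≤ ρ} ∧ IsCompact {z : Dsk | ‖(z:ℂ)‖ ≤ ρ} := by
  have him : (Subtype.val : Dsk → ℂ) '' {z : Dsk | ‖(z:ℂ)‖ ≤ ρ} = Metric.closedBall 0 ρ := by
    ext z
    rw [mem_closedBall_zero_iff]
    exact ⟨fun ⟨w, hw, hwz⟩ => hwz ▸ hw, fun hz =>
      ⟨⟨z, mem_ball_zero_iff.2 (hz.trans_lt h1)⟩, hz, rfl⟩⟩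
  rw [Topology.IsInducing.subtypeVal.isCompact_iff,
    Topology.IsInducing.subtypeVal.isPathConnected_iff, him]
  exact ⟨(convex_closedBall _ _).isPathConnected (Metric.nonempty_closedBall.2 h0),
    isCompact_closedBall _ _⟩

theorem exists_closedDisc {K : Set Dsk} (hK : IsCompact K) :
    ∃ ρ : ℝ, 0 ≤ ρ ∧ ρ < 1 ∧ K ⊆ {z : Dsk | ‖(z:ℂ)‖ ≤ ρ} := by
  rcases K.eq_empty_or_nonempty with rfl | hne
  · exact ⟨0, le_rfl, one_pos, empty_subset _⟩
  · obtain ⟨p, -, hp⟩ := hK.exists_isMaxOn hne (f := fun z : Dsk => ‖(z:ℂ)‖) (by fun_prop)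
    exact ⟨_, norm_nonneg _, mem_ball_zero_iff.1 p.2, fun z hz => hp hz⟩

/-- A connected set disjoint from its iterates can be thickened at one of its points to a tube. -/
theorem exists_isTube {U C γ : Set ℂ} {f : ℂ ≃ₜ ℂ} {N : ℤ} (hU : IsOpen U) (hC : IsCompact C)
    (hγ : IsCompact γ) (hγp : IsPathConnected γ) (hf : (f '' γ ∩ γ).Nonempty)
    (hd : ∀ k : ℤ, 2 ≤ |k| → Disjoint γ ((f ^ k : ℂ ≃ₜ ℂ) '' γ))
    (hdC : ∀ k : ℤ, |k| ≤ N → Disjoint C ((f ^ k : ℂ ≃ₜ ℂ) '' γ)) {z : ℂ} (hz : z ∈ γ)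
    (hzU : z ∈ frontier U) : ∃ A, IsTube f U A C N ∧ (A ∩ U).Nonempty := by
  have hV : ∀ l : ℤ, ∃ V ∈ 𝓝ˢ γ, (2 ≤ |l| → Disjoint V ((f ^ l : ℂ ≃ₜ ℂ) '' V)) ∧
      (|l| ≤ N → Disjoint C ((f ^ l : ℂ ≃ₜ ℂ) '' V)) := by
    intro l
    have h1 : ∃ V ∈ 𝓝ˢ γ, (2 ≤ |l| → Disjoint V ((f ^ l : ℂ ≃ₜ ℂ) '' V)) := by
      by_cases hl : 2 ≤ |l|
      · obtain ⟨V₁, V₂, ho₁, ho₂, hs₁, hs₂, hdis⟩ :=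
          SeparatedNhds.of_isCompact_isCompact hγ (hγ.image (f ^ l).continuous) (hd l hl)
        refine ⟨V₁ ∩ (f ^ l : ℂ ≃ₜ ℂ) ⁻¹' V₂, (ho₁.inter (ho₂.preimage (f ^ l).continuous)).mem_nhdsSet.2
          (subset_inter hs₁ (image_subset_iff.1 hs₂)), fun _ => ?_⟩
        exact hdis.mono inter_subset_left
          ((image_mono inter_subset_right).trans (image_preimage_subset _ _))
      · exact ⟨univ, univ_mem, fun h => absurd h hl⟩
    have h2 : ∃ V ∈ 𝓝ˢ γ, (|l| ≤ N → Disjoint C ((f ^ l : ℂ ≃ₜ ℂ) '' V)) := by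
      by_cases hl : |l| ≤ N
      · refine ⟨((f ^ l : ℂ ≃ₜ ℂ) ⁻¹' C)ᶜ,
          (hC.isClosed.preimage (f ^ l).continuous).isOpen_compl.mem_nhdsSet.2 fun y hy hyC =>
            Set.disjoint_left.1 (hdC l hl) hyC ⟨y, hy, rfl⟩, fun _ => ?_⟩
        refine Set.disjoint_left.2 ?_
        rintro _ hy ⟨y, hyC, rfl⟩
        exact hyC hy
      · exact ⟨univ, univ_mem, fun h => absurd h hl⟩
    obtain ⟨V, hV, h1⟩ := h1
    obtain ⟨W, hW, h2⟩ := h2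
    exact ⟨V ∩ W, inter_mem hV hW, fun h => (h1 h).mono inter_subset_left
      (image_mono inter_subset_left), fun h => (h2 h).mono_right (image_mono inter_subset_right)⟩
  choose V hV h1 h2 using hV
  have hW : (⋂ l ∈ Icc (-N) N, V l) ∈ 𝓝ˢ γ := (biInter_mem (finite_Icc _ _)).2 fun l _ => hV l
  obtain ⟨ε, hε, hεV⟩ := Metric.nhds_basis_closedBall.mem_iff.1 (mem_nhdsSet_iff_forall.1 hW z hz)
  set A := γ ∪ Metric.closedBall z ε with hA
  have hAV : ∀ l : ℤ, |l| ≤ N → A ⊆ V l := fun l hl =>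
    (union_subset (subset_of_mem_nhdsSet hW) hεV).trans (biInter_subset_of_mem (abs_le.1 hl))
  have hzA : z ∈ A := Or.inl hz
  refine ⟨A, ⟨hγ.union (isCompact_closedBall _ _), ?_, ?_, fun l hl hlN => ?_, fun l hl => ?_,
    z, hzA, ?_⟩, ?_⟩
  · exact hγp.union ((convex_closedBall _ _).isPathConnected ⟨z, Metric.mem_closedBall_self hε.le⟩)
      ⟨z, hz, Metric.mem_closedBall_self hε.le⟩
  · exact hf.mono (inter_subset_inter (image_mono subset_union_left) subset_union_left)
  · exact (h1 l hl).mono (hAV l hlN) (image_mono (hAV l hlN))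
  · exact (h2 l hl).mono_right (image_mono (hAV l hl))
  · rw [hU.frontier_eq] at hzU
    exact hzU.2
  · exact (mem_closure_iff_nhds.1 hzU.1 _ (Metric.closedBall_mem_nhds z hε)).mono
      (inter_subset_inter_left _ subset_union_right)

theorem exists_isCompact_disjoint_frontier {U : Set ℂ} {φ : ℂ → ℂ} (m : DiscModel U φ)
    (hU : IsOpen U) (hφ : DifferentiableOn ℂ φ (Metric.ball 0 1))
    (hder : ∀ z ∈ Metric.ball (0:ℂ) 1, deriv φ z ≠ 0) {f : ℂ ≃ₜ ℂ} (hf : f '' U = U)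
    (hnf : ∀ x : ℝ, ¬ ∀ r > 0, ∃ r' > 0, m.conj f hf '' Nb x r' ⊆ Nb x r)
    (hNW : ∀ n : ℕ, 1 ≤ n → ∃ K : Set Dsk, IsCompact K ∧ ∀ (x r : ℝ), 0 < r →
      (∀ k : ℤ, k ≠ 0 → Disjoint ((m.conj f hf ^ ((n : ℤ) * k) : Dsk ≃ₜ Dsk) '' Nb x r) (Nb x r)) →
      (∃ k : ℤ, 0 < k ∧ ((m.conj f hf ^ ((n : ℤ) * k) : Dsk ≃ₜ Dsk) '' Nb x r ∩ K).Nonempty) ∧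
      (∃ k : ℤ, k < 0 ∧ ((m.conj f hf ^ ((n : ℤ) * k) : Dsk ≃ₜ Dsk) '' Nb x r ∩ K).Nonempty)) :
    ∃ K : Set ℂ, IsCompact K ∧ K ⊆ U ∧ ∀ γ : Set ℂ, IsCompact γ → IsPathConnected γ →
      (f '' γ ∩ γ).Nonempty → (∀ k : ℤ, 2 ≤ |k| → Disjoint γ ((f ^ k : ℂ ≃ₜ ℂ) '' γ)) →
      γ ⊆ Kᶜ → Disjoint γ (frontier U) := by
  obtain ⟨G, hper, hG, hext, hext'⟩ := exists_lift (m.bdExt f hf) (m.bdExt_inv f hf) hnf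
  obtain ⟨M, hM⟩ := exists_linked hper hG
  obtain ⟨n, hn, hn1, hrot⟩ := exists_rot_pow hper (M + 4)
  obtain ⟨K₁, hK₁, hw₁⟩ := hNW n hn1
  obtain ⟨K₂, hK₂, hw₂⟩ := hNW (2 * n) (by lia)
  let b : Dsk := ⟨0, by simp⟩
  set F := m.conj f hf with hF
  obtain ⟨ρ, hρ0, hρ1, hρ⟩ := exists_closedDisc ((hK₁.union hK₂).union
    (toFinite {b, F b, (F ^ (n:ℤ) : Dsk ≃ₜ Dsk) b, (F ^ (-(n:ℤ)) : Dsk ≃ₜ Dsk) b}).isCompact)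
  obtain ⟨hKp, hKc⟩ := isPathConnected_closedDisc hρ0 hρ1
  set K := {z : Dsk | ‖(z:ℂ)‖ ≤ ρ} with hKdef
  have hK1 : K₁ ⊆ K := subset_union_left.trans (subset_union_left.trans hρ)
  have hK2 : K₂ ⊆ K := subset_union_right.trans (subset_union_left.trans hρ)
  have hpt := subset_union_right.trans hρ
  set N : ℤ := 2 * (n:ℤ) + M + 2 with hN
  set C : Set ℂ := (fun z : Dsk => φ z) '' K with hC
  have hCc : IsCompact C := hKc.image
    (m.continuousOn.comp_continuous continuous_subtype_val fun z => z.2)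
  have hCU : C ⊆ U := by
    rintro _ ⟨z, -, rfl⟩
    exact m.mem z.2
  refine ⟨⋃ i ∈ Icc (-N) N, (f ^ i : ℂ ≃ₜ ℂ) '' C,
    (finite_Icc _ _).isCompact_biUnion fun i _ => hCc.image (f ^ i).continuous,
    iUnion₂_subset fun i _ => (image_mono hCU).trans (zpow_image_eq hf i).subset,
    fun γ hγ hγp hγf hγd hγK => Set.disjoint_left.2 fun z hz hzU => ?_⟩
  obtain ⟨A, hA, hAU⟩ := exists_isTube hU hCc hγ hγp hγf hγd (N := N) (fun k hk => by
    rw [disjoint_comm, ← image_zpow_zero f C, disjoint_image_zpow]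
    refine Set.disjoint_left.2 fun y hy hyC => hγK hy (mem_biUnion (x := 0 - k) ?_ hyC)
    rw [zero_sub, mem_Icc]
    exact abs_le.1 (by rwa [abs_neg])) hz hzU
  exact hA.false m hU hφ hder hf hper hext hext' hM hn le_rfl hKp (b := b) (hpt (by simp))
    (hpt (by simp [hF])) (hpt (by simp [hF])) (hpt (by simp [hF]))
    (fun x r hr hw => ⟨(hw₁ x r hr hw).1.imp fun k hk => ⟨hk.1, hk.2.mono (inter_subset_inter_right _ hK1)⟩,
      (hw₁ x r hr hw).2.imp fun k hk => ⟨hk.1, hk.2.mono (inter_subset_inter_right _ hK1)⟩⟩)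
    (fun x r hr hw => ⟨(hw₂ x r hr hw).1.imp fun k hk => ⟨hk.1, hk.2.mono (inter_subset_inter_right _ hK2)⟩,
      (hw₂ x r hr hw).2.imp fun k hk => ⟨hk.1, hk.2.mono (inter_subset_inter_right _ hK2)⟩⟩)
    hrot hAU

end

section

theorem IsInfTranslationArc.disjoint {X : Type*} [TopologicalSpace X] {f : X ≃ₜ X} {γ : Set X} {x : X}
    (h : IsInfTranslationArc f γ x) {k : ℤ} (hk : 2 ≤ |k|) : Disjoint γ ((f ^ k : X ≃ₜ X) '' γ) := by
  have hnat : ∀ n : ℕ, 2 ≤ n → Disjoint γ ((f ^ (n : ℤ) : X ≃ₜ X) '' γ) := by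
    intro n hn
    have h1 := ((h (n + 1) (by omega)).2 (by omega)).1 n hn (by omega)
    have h2 : ∀ n : ℕ, ⇑(f ^ n : X ≃ₜ X) = (⇑f)^[n] := fun n => by
      induction n with
      | zero => rfl
      | succ n ih =>
        rw [pow_succ, Function.iterate_succ, ← ih]
        rfl
    rw [disjoint_comm, Set.disjoint_iff_inter_eq_empty, zpow_natCast, h2, h1]
  rcases le_or_gt 0 k with hk0 | hk0
  · lift k to ℕ using hk0
    exact hnat k (by simpa using hk)
  · obtain ⟨n, rfl⟩ : ∃ n : ℕ, k = -n := ⟨k.natAbs, by omega⟩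
    have h1 := hnat n (by simpa using hk)
    rw [disjoint_comm, ← image_zpow_zero f γ, disjoint_image_zpow, image_zpow_zero]
    simpa using h1

theorem IsInfTranslationArc.isCompact {X : Type*} [TopologicalSpace X] {f : X ≃ₜ X} {γ : Set X}
    {x : X} (h : IsInfTranslationArc f γ x) :
    IsCompact γ ∧ IsPathConnected γ ∧ (f '' γ ∩ γ).Nonempty := by
  obtain ⟨-, g, hg, -, -, -, rfl, h2⟩ := (h 1 le_rfl).1
  refine ⟨isCompact_Icc.image_of_continuousOn hg,
    ((convex_Icc (0:ℝ) 1).isPathConnected ⟨0, by simp⟩).image' hg, ?_⟩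
  rcases h2 with h2 | ⟨h2, -⟩ <;> rw [h2]
  exacts [singleton_nonempty _, insert_nonempty _ _]

theorem conj_symm_image {X Y : Type*} [TopologicalSpace X] [TopologicalSpace Y] (e : X ≃ₜ Y)
    (f : Y ≃ₜ Y) (k : ℤ) (y : Y) :
    ((e.trans (f.trans e.symm)) ^ k : X ≃ₜ X) (e.symm y) = e.symm ((f ^ k : Y ≃ₜ Y) y) := by
  induction k using Int.induction_on generalizing y with
  | zero => rfl
  | succ k ih =>
    rw [zpow_add_one, zpow_add_one, Homeomorph.mul_apply, Homeomorph.mul_apply, ← ih]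
    simp
  | pred k ih =>
    rw [zpow_sub_one, zpow_sub_one, Homeomorph.mul_apply, Homeomorph.mul_apply, ← ih]
    congr 1
    exact congrArg e.symm (congrArg f.symm (e.apply_symm_apply y))

end

/-- Plane case of the ∞-translation-arc corollary: if `f` is
∂-nonwandering in the invariant open disk `U` and `ρ(f,U) ≠ 0`, then there is a compact
`K ⊆ U` such that every ∞-translation arc contained in `ℝ² ∖ K` is disjoint from `∂U`. -/
theorem inf_translation_arc_corollary_plane
    (f : (ℝ × ℝ) ≃ₜ (ℝ × ℝ)) (hor : IsOrientationPreserving f)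
    (U : Set (ℝ × ℝ)) (hUopen : IsOpen U) (hUinv : ⇑f '' U = U)
    (hUplane : Nonempty (↥U ≃ₜ (ℝ × ℝ))) (hUcompl : Set.Nontrivial Uᶜ)
    (hbnw : BdNonwandering f U)
    (hrot : ∃ F : PrimeEndComp U ≃ₜ PrimeEndComp U, IsPEExtension f U F ∧
      ∀ p : PrimeEnd U, F (peEnd U p) ≠ peEnd U p) :
    ∃ K : Set (ℝ × ℝ), IsCompact K ∧ K ⊆ U ∧
      ∀ (γ : Set (ℝ × ℝ)) (x : ℝ × ℝ),
        IsInfTranslationArc f γ x → γ ⊆ Kᶜ → Disjoint γ (frontier U) := by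
  obtain ⟨F, hF, hFn⟩ := hrot
  let e : ℂ ≃ₜ ℝ × ℝ := Complex.equivRealProdCLM.toHomeomorph
  obtain ⟨V, rfl⟩ : ∃ V : Set ℂ, U = e '' V := ⟨e.symm '' U, by rw [image_image]; simp⟩
  have hVo : IsOpen V := e.isOpen_image.1 hUopen
  have hVc : IsSimplyConnected V := by
    obtain ⟨h⟩ := hUplane
    exact ((e.image V).trans h).toHomotopyEquiv.simplyConnectedSpace
  obtain ⟨φ, ψ, a, b, ε, h⟩ := exists_confDisc hVo hVc (by
    rintro rfl
    obtain ⟨y, hy⟩ := hUcompl.nonempty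
    exact hy ⟨e.symm y, mem_univ _, e.apply_symm_apply y⟩)
  have m := h.discModel
  let g : ℂ ≃ₜ ℂ := e.trans (f.trans e.symm)
  have hg : g '' V = V := by
    apply e.injective.image_injective
    rw [← hUinv, image_image, image_image]
    simp [g]
  have hgf : (m.comp_homeo e).conj f hUinv = m.conj g hg := by
    ext1 z
    apply m.eq_of_apply
    apply e.injective
    rw [m.conj_apply, (m.comp_homeo e).conj_apply f hUinv z]
    simp [g]
  obtain ⟨K, hK, hKV, hKγ⟩ := exists_isCompact_disjoint_frontier m hVo h.diff h.der hg
    (fun x => hgf ▸ (m.comp_homeo e).not_fixed hUopen f hUinv hF hFn x)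
    (fun n hn => hgf ▸ (m.comp_homeo e).nonwandering hUopen f hUinv hbnw hn)
  refine ⟨e '' K, hK.image e.continuous, image_mono hKV, fun γ x hγ hγK => ?_⟩
  obtain ⟨h1, h2, h3⟩ := hγ.isCompact
  have him : ∀ k : ℤ, (g ^ k : ℂ ≃ₜ ℂ) '' (e.symm '' γ) = e.symm '' ((f ^ k : _ ≃ₜ _) '' γ) := by
    intro k
    rw [image_image, image_image]
    exact image_congr fun y _ => conj_symm_image e f k y
  have h4 := hKγ (e.symm '' γ) (h1.image e.symm.continuous) (h2.image e.symm.continuous) ?_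
    (fun k hk => ?_) ?_
  · rw [← e.image_frontier, ← Set.disjoint_image_iff e.symm.injective, image_image _ e]
    simpa using h4
  · have := him 1
    rw [zpow_one, zpow_one] at this
    rw [this, ← image_inter e.symm.injective]
    exact h3.image _
  · rw [him k, Set.disjoint_image_iff e.symm.injective]
    exact hγ.disjoint hk
  · rintro _ ⟨y, hy, rfl⟩ hyK
    exact hγK hy ⟨_, hyK, e.apply_symm_apply y⟩

end
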